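/- For each partition μ with at most n rows, define the q-immanant S_μ = S_U(0) for a standard μ-tableau U (this is independent of the choice of U). As μ ranges over all partitions with at most n rows (with S_∅ = 1 for the empty partition), the q-immanants S_μ form a basis of the center of the subalgebra U°_q(gl_n). More generally, for each fixed z ∈ ℂ, the elements S_μ(z) with μ ranging over all partitions with at most n rows form a basis of the center of U°_q(gl_n). -/

import Mathlib

open scoped Classical

noncomputable section

namespace QImm

/-- `q` is not a root of unity. -/
def NotRootOfUnity (q : ℂ) : Prop := ∀ k : ℕ, 0 < k → q ^ k ≠ 1

/-! ### The R-matrices -/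

/-- The R-matrix `R = q ∑ eᵢᵢ⊗eᵢᵢ + ∑_{i≠j} eᵢᵢ⊗eⱼⱼ + (q-q⁻¹) ∑_{i<j} eᵢⱼ⊗eⱼᵢ`. -/
def Rmat (q : ℂ) (n : ℕ) : Matrix (Fin n × Fin n) (Fin n × Fin n) ℂ := fun p r =>
  if p.1 = r.1 ∧ p.2 = r.2 then (if p.1 = p.2 then q else 1)
  else if p.2 = r.1 ∧ p.1 = r.2 ∧ p.1 < r.1 then q - q⁻¹ else 0

/-- The permutation operator `P = ∑ eᵢⱼ⊗eⱼᵢ`. -/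
def Pmat (n : ℕ) : Matrix (Fin n × Fin n) (Fin n × Fin n) ℂ := fun p r =>
  if p.1 = r.2 ∧ p.2 = r.1 then 1 else 0

/-- `Ř = P R`. -/
def Rcheck (q : ℂ) (n : ℕ) : Matrix (Fin n × Fin n) (Fin n × Fin n) ℂ :=
  Pmat n * Rmat q n

/-! ### Embeddings into tensor legs: `(End ℂⁿ)^{⊗m} ⊗ A ≅ Matrix (Fin m → Fin n) (Fin m → Fin n) A` -/

/-- An `n×n` matrix over `A` placed in the `a`-th tensor leg (0-indexed) of
`(End ℂⁿ)^{⊗m} ⊗ A`. -/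
def leg1 {A : Type} [Ring A] (n m : ℕ) (X : Matrix (Fin n) (Fin n) A) (a : ℕ) :
    Matrix (Fin m → Fin n) (Fin m → Fin n) A := fun i j =>
  if h : a < m then
    if ∀ c : Fin m, (c : ℕ) ≠ a → i c = j c then X (i ⟨a, h⟩) (j ⟨a, h⟩) else 0
  else 0

/-- A scalar element of `End ℂⁿ ⊗ End ℂⁿ` placed in the `a`-th and `b`-th tensor legs
(0-indexed) of `(End ℂⁿ)^{⊗m} ⊗ A`. -/
def leg2 (A : Type) [Ring A] [Algebra ℂ A] (n m : ℕ)
    (C : Matrix (Fin n × Fin n) (Fin n × Fin n) ℂ) (a b : ℕ) :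
    Matrix (Fin m → Fin n) (Fin m → Fin n) A := fun i j =>
  if h : a < m ∧ b < m then
    if ∀ c : Fin m, (c : ℕ) ≠ a → (c : ℕ) ≠ b → i c = j c then
      algebraMap ℂ A (C (i ⟨a, h.1⟩, i ⟨b, h.2⟩) (j ⟨a, h.1⟩, j ⟨b, h.2⟩))
    else 0
  else 0

/-- `Ř_{k+1}` (paper numbering), acting in the tensor legs `k`, `k+1` (0-indexed). -/
def RcLeg (A : Type) [Ring A] [Algebra ℂ A] (q : ℂ) (n m : ℕ) (k : ℕ) :
    Matrix (Fin m → Fin n) (Fin m → Fin n) A :=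
  leg2 A n m (Rcheck q n) k (k + 1)

/-- `Ř⁻¹_{k+1}` (paper numbering), acting in the tensor legs `k`, `k+1` (0-indexed). -/
def RcLegInv (A : Type) [Ring A] [Algebra ℂ A] (q : ℂ) (n m : ℕ) (k : ℕ) :
    Matrix (Fin m → Fin n) (Fin m → Fin n) A :=
  leg2 A n m (Rcheck q n)⁻¹ k (k + 1)

/-- `legBar q n m X k` is `X_{\overline{k+1}}` (paper numbering), so `legBar q n m X 0 = X₁`
and `X_{\overline{k+1}} = Ř_k X_{\overline{k}} Ř_k⁻¹`. -/
def legBar {A : Type} [Ring A] [Algebra ℂ A] (q : ℂ) (n m : ℕ)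
    (X : Matrix (Fin n) (Fin n) A) : ℕ → Matrix (Fin m → Fin n) (Fin m → Fin n) A
  | 0 => leg1 n m X 0
  | k + 1 => RcLeg A q n m k * legBar q n m X k * RcLegInv A q n m k

/-! ### q-traces -/

/-- The q-trace over all `m` tensor legs: `tr_{q(1,…,m)} Y = tr D₁⋯D_m Y` with
`D = diag(1, q⁻², …, q^{-2n+2})`. -/
def qTr {A : Type} [Ring A] [Algebra ℂ A] (q : ℂ) (n m : ℕ)
    (Y : Matrix (Fin m → Fin n) (Fin m → Fin n) A) : A :=
  ∑ i : Fin m → Fin n,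
    algebraMap ℂ A (∏ a : Fin m, q ^ (-2 * ((i a : ℕ) : ℤ))) * Y i i

/-- The q-trace of a single `n×n` matrix: `tr_q X = tr D X`. -/
def qTr1 {A : Type} [Ring A] [Algebra ℂ A] (q : ℂ) (n : ℕ)
    (X : Matrix (Fin n) (Fin n) A) : A :=
  ∑ j : Fin n, algebraMap ℂ A (q ^ (-2 * ((j : ℕ) : ℤ))) * X j j

/-! ### The Hecke algebra -/

/-- The defining relations of the Hecke algebra `H_m` on generators `T_1, …, T_{m-1}`
(the generator `i : Fin (m-1)` is `T_{i+1}` in 1-indexed paper notation). -/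
inductive HeckeRel (q : ℂ) (m : ℕ) :
    FreeAlgebra ℂ (Fin (m - 1)) → FreeAlgebra ℂ (Fin (m - 1)) → Prop
  | quad (i : Fin (m - 1)) :
      HeckeRel q m
        ((FreeAlgebra.ι ℂ i - algebraMap ℂ (FreeAlgebra ℂ (Fin (m - 1))) q) *
          (FreeAlgebra.ι ℂ i + algebraMap ℂ (FreeAlgebra ℂ (Fin (m - 1))) q⁻¹)) 0
  | braid (i j : Fin (m - 1)) (h : (j : ℕ) = (i : ℕ) + 1) :
      HeckeRel q m (FreeAlgebra.ι ℂ i * FreeAlgebra.ι ℂ j * FreeAlgebra.ι ℂ i)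
        (FreeAlgebra.ι ℂ j * FreeAlgebra.ι ℂ i * FreeAlgebra.ι ℂ j)
  | commute (i j : Fin (m - 1)) (h : (i : ℕ) + 1 < (j : ℕ)) :
      HeckeRel q m (FreeAlgebra.ι ℂ i * FreeAlgebra.ι ℂ j)
        (FreeAlgebra.ι ℂ j * FreeAlgebra.ι ℂ i)

/-- The Hecke algebra `H_m`. -/
abbrev Hecke (q : ℂ) (m : ℕ) := RingQuot (HeckeRel q m)

/-- The generator `T_{i+1}` (paper 1-indexed) of `H_m`. -/
def Tgen (q : ℂ) (m : ℕ) (i : Fin (m - 1)) : Hecke q m :=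
  RingQuot.mkAlgHom ℂ (HeckeRel q m) (FreeAlgebra.ι ℂ i)

/-- `T_{k+1}` (paper 1-indexed), i.e. the 0-indexed `k`-th generator; junk value `1`
out of range. -/
def Tn (q : ℂ) (m : ℕ) (k : ℕ) : Hecke q m :=
  if h : k < m - 1 then Tgen q m ⟨k, h⟩ else 1

/-- The paper's 1-indexed generator `T_a`, `a = 1, …, m-1`. -/
def Tp (q : ℂ) (m : ℕ) (a : ℕ) : Hecke q m := Tn q m (a - 1)

/-- The Jucys–Murphy elements, 1-indexed: `y_1 = 1`, `y_{k+1} = T_k ⋯ T_2 T_1² T_2 ⋯ T_k`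
(the value at `0` is a junk value `1`). -/
def yJM (q : ℂ) (m : ℕ) : ℕ → Hecke q m
  | 0 => 1
  | 1 => 1
  | k + 2 => Tp q m (k + 1) * yJM q m (k + 1) * Tp q m (k + 1)

/-- The element `T_{(i,j)} = T_i T_{i+1} ⋯ T_{j-2} T_{j-1} T_{j-2} ⋯ T_{i+1} T_i` of `H_m`
associated with the transposition `(i,j)`, `1 ≤ i < j` (paper 1-indexed). -/
def Ttrans (q : ℂ) (m : ℕ) (i j : ℕ) : Hecke q m :=
  ((List.range' i (j - i)).map (Tp q m)).prod *
    (((List.range' i (j - 1 - i)).map (Tp q m)).reverse).prod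

/-- The condition that `φ : H_m → End((ℂⁿ)^{⊗m})` is the algebra homomorphism sending
`T_k ↦ Ř_k`. -/
def IsHeckeRep (q : ℂ) (n m : ℕ)
    (φ : Hecke q m →ₐ[ℂ] Matrix (Fin m → Fin n) (Fin m → Fin n) ℂ) : Prop :=
  ∀ k : ℕ, k < m - 1 → φ (Tn q m k) = RcLeg ℂ q n m k

/-! ### Young diagrams and standard tableaux -/

/-- The content `c(α) = j - i` of a box `α = (i, j)` (row `i`, column `j`, 0-indexed). -/
def ctn (α : ℕ × ℕ) : ℤ := (α.2 : ℤ) - (α.1 : ℤ)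

/-- A standard tableau of shape `μ` with `m` boxes, recorded via the position `pos k` of
each entry `k ∈ {1, …, m}`; entries strictly increase along rows and down columns. -/
structure StdTab (μ : YoungDiagram) (m : ℕ) where
  pos : ℕ → ℕ × ℕ
  bij : Set.BijOn pos (Set.Icc 1 m) (μ.cells : Set (ℕ × ℕ))
  row_lt : ∀ k ∈ Set.Icc 1 m, ∀ l ∈ Set.Icc 1 m,
    (pos k).1 = (pos l).1 → (pos k).2 < (pos l).2 → k < l
  col_lt : ∀ k ∈ Set.Icc 1 m, ∀ l ∈ Set.Icc 1 m,
    (pos k).2 = (pos l).2 → (pos k).1 < (pos l).1 → k < l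

/-- `c_k(U)`, the content of the box of `U` occupied by `k`. -/
def ctnAt {μ : YoungDiagram} {m : ℕ} (U : StdTab μ m) (k : ℕ) : ℤ := ctn (U.pos k)

/-- The condition singling out the primitive idempotent `e_U` of `H_m` associated with a
standard tableau `U`: a nonzero idempotent with `y_k e_U = e_U y_k = q^{2c_k(U)} e_U`. -/
def IsJMIdem (q : ℂ) (m : ℕ) {μ : YoungDiagram} (U : StdTab μ m) (e : Hecke q m) : Prop :=
  e ≠ 0 ∧ e * e = e ∧ ∀ k : ℕ, 1 ≤ k → k ≤ m →
    yJM q m k * e = (q ^ (2 * ctnAt U k) : ℂ) • e ∧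
    e * yJM q m k = (q ^ (2 * ctnAt U k) : ℂ) • e

/-! ### The quantized enveloping algebra `U_q(gl_n)` -/

/-- Generators: `inl (i,j) ↦ l⁺_{ij}`, `inr (i,j) ↦ l⁻_{ij}`. -/
abbrev UqGen (n : ℕ) := (Fin n × Fin n) ⊕ (Fin n × Fin n)

def lpF (n : ℕ) (i j : Fin n) : FreeAlgebra ℂ (UqGen n) := FreeAlgebra.ι ℂ (Sum.inl (i, j))
def lmF (n : ℕ) (i j : Fin n) : FreeAlgebra ℂ (UqGen n) := FreeAlgebra.ι ℂ (Sum.inr (i, j))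

/-- A matrix `X` over `F` placed in the first of two matrix legs of
`End ℂⁿ ⊗ End ℂⁿ ⊗ F`. -/
def M1 {F : Type} [Ring F] {n : ℕ} (X : Fin n → Fin n → F) :
    Matrix (Fin n × Fin n) (Fin n × Fin n) F := fun p r => if p.2 = r.2 then X p.1 r.1 else 0

/-- A matrix `X` over `F` placed in the second of two matrix legs of
`End ℂⁿ ⊗ End ℂⁿ ⊗ F`. -/
def M2 {F : Type} [Ring F] {n : ℕ} (X : Fin n → Fin n → F) :
    Matrix (Fin n × Fin n) (Fin n × Fin n) F := fun p r => if p.1 = r.1 then X p.2 r.2 else 0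

/-- The R-matrix, viewed over the free algebra on the generators of `U_q(gl_n)`. -/
def RmatU (q : ℂ) (n : ℕ) : Matrix (Fin n × Fin n) (Fin n × Fin n) (FreeAlgebra ℂ (UqGen n)) :=
  (Rmat q n).map (algebraMap ℂ (FreeAlgebra ℂ (UqGen n)))

/-- The defining relations of `U_q(gl_n)`. -/
inductive UqRel (q : ℂ) (n : ℕ) :
    FreeAlgebra ℂ (UqGen n) → FreeAlgebra ℂ (UqGen n) → Prop
  | upperZero (i j : Fin n) (h : j < i) : UqRel q n (lpF n i j) 0
  | lowerZero (i j : Fin n) (h : i < j) : UqRel q n (lmF n i j) 0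
  | diagPM (i : Fin n) : UqRel q n (lpF n i i * lmF n i i) 1
  | diagMP (i : Fin n) : UqRel q n (lmF n i i * lpF n i i) 1
  | rllPP (x y : Fin n × Fin n) :
      UqRel q n ((RmatU q n * M1 (lpF n) * M2 (lpF n)) x y)
        ((M2 (lpF n) * M1 (lpF n) * RmatU q n) x y)
  | rllMM (x y : Fin n × Fin n) :
      UqRel q n ((RmatU q n * M1 (lmF n) * M2 (lmF n)) x y)
        ((M2 (lmF n) * M1 (lmF n) * RmatU q n) x y)
  | rllPM (x y : Fin n × Fin n) :
      UqRel q n ((RmatU q n * M1 (lpF n) * M2 (lmF n)) x y)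
        ((M2 (lmF n) * M1 (lpF n) * RmatU q n) x y)

/-- The quantized enveloping algebra `U_q(gl_n)`. -/
abbrev Uq (q : ℂ) (n : ℕ) := RingQuot (UqRel q n)

def lp (q : ℂ) (n : ℕ) (i j : Fin n) : Uq q n := RingQuot.mkAlgHom ℂ (UqRel q n) (lpF n i j)
def lm (q : ℂ) (n : ℕ) (i j : Fin n) : Uq q n := RingQuot.mkAlgHom ℂ (UqRel q n) (lmF n i j)

/-- The matrix `L⁺`. -/
def Lp (q : ℂ) (n : ℕ) : Matrix (Fin n) (Fin n) (Uq q n) := Matrix.of fun i j => lp q n i j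
/-- The matrix `L⁻`. -/
def Lm (q : ℂ) (n : ℕ) : Matrix (Fin n) (Fin n) (Uq q n) := Matrix.of fun i j => lm q n i j

/-- `L = L⁺ (L⁻)⁻¹`, where `K` is the (two-sided) inverse of `L⁻`. -/
def Lmat (q : ℂ) (n : ℕ) (K : Matrix (Fin n) (Fin n) (Uq q n)) :
    Matrix (Fin n) (Fin n) (Uq q n) := Lp q n * K

/-! ### The braided Weyl algebra -/

/-- Generators: `inl (i,j) ↦ m_{ij}`, `inr (i,j) ↦ ∂_{ij}`. -/
abbrev WGen (n : ℕ) := (Fin n × Fin n) ⊕ (Fin n × Fin n)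

def mgF (n : ℕ) (i j : Fin n) : FreeAlgebra ℂ (WGen n) := FreeAlgebra.ι ℂ (Sum.inl (i, j))
def dgF (n : ℕ) (i j : Fin n) : FreeAlgebra ℂ (WGen n) := FreeAlgebra.ι ℂ (Sum.inr (i, j))

def RcW (q : ℂ) (n : ℕ) : Matrix (Fin n × Fin n) (Fin n × Fin n) (FreeAlgebra ℂ (WGen n)) :=
  (Rcheck q n).map (algebraMap ℂ (FreeAlgebra ℂ (WGen n)))

def RcWInv (q : ℂ) (n : ℕ) : Matrix (Fin n × Fin n) (Fin n × Fin n) (FreeAlgebra ℂ (WGen n)) :=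
  ((Rcheck q n)⁻¹).map (algebraMap ℂ (FreeAlgebra ℂ (WGen n)))

/-- The defining relations of the braided Weyl algebra `W_n`. -/
inductive WRel (q : ℂ) (n : ℕ) :
    FreeAlgebra ℂ (WGen n) → FreeAlgebra ℂ (WGen n) → Prop
  | mm (x y : Fin n × Fin n) :
      WRel q n ((RcW q n * M1 (mgF n) * RcW q n * M1 (mgF n)) x y)
        ((M1 (mgF n) * RcW q n * M1 (mgF n) * RcW q n) x y)
  | dd (x y : Fin n × Fin n) :
      WRel q n ((RcWInv q n * M1 (dgF n) * RcWInv q n * M1 (dgF n)) x y)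
        ((M1 (dgF n) * RcWInv q n * M1 (dgF n) * RcWInv q n) x y)
  | dm (x y : Fin n × Fin n) :
      WRel q n ((M1 (dgF n) * RcW q n * M1 (mgF n)) x y)
        ((RcW q n * M1 (mgF n) * RcWInv q n * M1 (dgF n) * RcWInv q n + 1) x y)

/-- The braided Weyl algebra `W_n`. -/
abbrev Weyl (q : ℂ) (n : ℕ) := RingQuot (WRel q n)

def mW (q : ℂ) (n : ℕ) (i j : Fin n) : Weyl q n := RingQuot.mkAlgHom ℂ (WRel q n) (mgF n i j)
def dW (q : ℂ) (n : ℕ) (i j : Fin n) : Weyl q n := RingQuot.mkAlgHom ℂ (WRel q n) (dgF n i j)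

/-- The matrix `M = [m_{ij}]` over `W_n`. -/
def Mmat (q : ℂ) (n : ℕ) : Matrix (Fin n) (Fin n) (Weyl q n) := Matrix.of fun i j => mW q n i j
/-- The matrix `𝒟 = [∂_{ij}]` over `W_n`. -/
def Dmat (q : ℂ) (n : ℕ) : Matrix (Fin n) (Fin n) (Weyl q n) := Matrix.of fun i j => dW q n i j

/-- The image `L = M𝒟 - (q - q⁻¹)⁻¹·1` of `L` in the braided Weyl algebra. -/
def LW (q : ℂ) (n : ℕ) : Matrix (Fin n) (Fin n) (Weyl q n) :=
  Mmat q n * Dmat q n - ((q - q⁻¹)⁻¹ : ℂ) • 1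

/-! ### The q-immanant polynomials -/

/-- The matrix `(L_{1̄} + z q^{-2c₁(U)}) ⋯ (L_{m̄} + z q^{-2c_m(U)}) E_U`, where `E` is the
image `E_U` of the primitive idempotent `e_U`. -/
def prodU {A : Type} [Ring A] [Algebra ℂ A] (q : ℂ) (n m : ℕ) {μ : YoungDiagram}
    (U : StdTab μ m) (E : Matrix (Fin m → Fin n) (Fin m → Fin n) ℂ)
    (X : Matrix (Fin n) (Fin n) A) (z : ℂ) :
    Matrix (Fin m → Fin n) (Fin m → Fin n) A :=
  (((List.range m).map fun k =>
      legBar q n m X k + ((z * q ^ (-2 * ctnAt U (k + 1))) : ℂ) • 1)).prod *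
    E.map (algebraMap ℂ A)

/-- The q-immanant polynomial
`S_U(z) = tr_{q(1,…,m)} (L_{1̄} + z q^{-2c₁(U)}) ⋯ (L_{m̄} + z q^{-2c_m(U)}) E_U`. -/
def SUpoly {A : Type} [Ring A] [Algebra ℂ A] (q : ℂ) (n m : ℕ) {μ : YoungDiagram}
    (U : StdTab μ m) (E : Matrix (Fin m → Fin n) (Fin m → Fin n) ℂ)
    (X : Matrix (Fin n) (Fin n) A) (z : ℂ) : A :=
  qTr q n m (prodU q n m U E X z)

/-- The coefficient `a_μ = ∏_{α ∈ μ} q^{-2c(α)}`. -/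
def aCoeff (q : ℂ) (μ : YoungDiagram) : ℂ := ∏ α ∈ μ.cells, q ^ (-2 * ctn α)

/-- `tr_{q(1,…,m)} L_{1̄} ⋯ L_{m̄} E_{(1^m)}`, where `Em` is the image of the primitive
idempotent associated with the column diagram `(1^m)`. -/
def colElem (q : ℂ) (n k : ℕ) (K : Matrix (Fin n) (Fin n) (Uq q n))
    (φk : Hecke q k →ₐ[ℂ] Matrix (Fin k → Fin n) (Fin k → Fin n) ℂ)
    (ek : Hecke q k) : Uq q n :=
  qTr q n k (((List.range k).map fun j => legBar q n k (Lmat q n K) j).prod *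
    (φk ek).map (algebraMap ℂ (Uq q n)))

/-- The semistandardness condition on a filling of the boxes of `μ` with entries in
`{1, …, n}` (encoded as `Fin n`): weakly increasing along rows, strictly increasing
down columns. -/
def SSYTCond {n : ℕ} (μ : YoungDiagram) (f : {x // x ∈ μ.cells} → Fin n) : Prop :=
  (∀ a b : {x // x ∈ μ.cells}, (a : ℕ × ℕ).1 = (b : ℕ × ℕ).1 →
    (a : ℕ × ℕ).2 ≤ (b : ℕ × ℕ).2 → f a ≤ f b) ∧
  (∀ a b : {x // x ∈ μ.cells}, (a : ℕ × ℕ).2 = (b : ℕ × ℕ).2 →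
    (a : ℕ × ℕ).1 < (b : ℕ × ℕ).1 → f a < f b)

/-- The factorial Schur polynomial `s_μ(x₁,…,x_n | a)` evaluated at `x_i = q^{2ℓ_i}`,
`ℓ_i = λ_i - i + 1` (1-indexed), with parameter sequence `a_j = z q^{1-2j}`. -/
def factSchur {n : ℕ} (q z : ℂ) (lam : Fin n → ℤ) (μ : YoungDiagram) : ℂ :=
  ∑ f : {x // x ∈ μ.cells} → Fin n,
    if SSYTCond μ f then
      ∏ α : {x // x ∈ μ.cells},
        (q ^ (2 * (lam (f α) - ((f α : ℕ) : ℤ))) +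
          z * q ^ (1 - 2 * (((f α : ℕ) : ℤ) + 1 + ctn (α : ℕ × ℕ))))
    else 0

/-- The Young diagrams with at most `n` rows. -/
def ParIdx (n : ℕ) := {μ : YoungDiagram // ∀ c ∈ μ.cells, c.1 < n}

/-! ### Tensor legs -/

/-- A tensor leg with index type `Ω` of a space whose basis is indexed by `W`: the coordinate
`p`, together with the operation `u` replacing this coordinate. -/
structure Leg (W Ω : Type) where
  p : W → Ω
  u : W → Ω → W
  pu : ∀ I x, p (u I x) = x
  uu : ∀ I x y, u (u I x) y = u I y
  up : ∀ I, u I (p I) = I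

attribute [simp] Leg.pu Leg.uu Leg.up

section Legs

set_option linter.unusedSectionVars false

variable {W Ω Ω' : Type} [Fintype W] [Fintype Ω] [Fintype Ω'] [DecidableEq W] [DecidableEq Ω]
  [DecidableEq Ω']
  {B : Type} [Ring B]

/-- The matrix `X` acting in the leg `l`. -/
def embFun (l : Leg W Ω) (X : Matrix Ω Ω B) : Matrix W W B := fun I J =>
  if J = l.u I (l.p J) then X (l.p I) (l.p J) else 0

theorem sum_embFun (l : Leg W Ω) (X : Matrix Ω Ω B) (I : W) (f : W → B) :
    ∑ J, embFun l X I J * f J = ∑ x, X (l.p I) x * f (l.u I x) := by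
  symm
  refine Finset.sum_of_injOn (fun x => l.u I x) ?_ (by simp) ?_ ?_
  · intro x _ y _ h
    have := congrArg l.p h
    simpa using this
  · intro J _ hJ
    have : J ≠ l.u I (l.p J) := fun h => hJ ⟨l.p J, by simp, h.symm⟩
    simp [embFun, this]
  · intro x _
    simp [embFun]

/-- The matrices acting in the leg `l`, as a ring homomorphism. -/
def emb (l : Leg W Ω) : Matrix Ω Ω B →+* Matrix W W B where
  toFun := embFun l
  map_one' := by
    ext I J
    by_cases h : I = J
    · subst h; simp [embFun]
    · have : J = l.u I (l.p J) → l.p I ≠ l.p J := by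
        intro h1 h2
        rw [← h2, l.up] at h1
        exact h h1.symm
      by_cases h1 : J = l.u I (l.p J)
      · simp only [embFun, if_pos h1, Matrix.one_apply, if_neg h, if_neg (this h1)]
      · simp only [embFun, if_neg h1, Matrix.one_apply, if_neg h]
  map_zero' := by ext I J; simp [embFun]
  map_mul' X Y := by
    ext I J
    rw [Matrix.mul_apply, sum_embFun]
    simp only [embFun, Leg.pu, Leg.uu, Matrix.mul_apply]
    split_ifs <;> simp
  map_add' X Y := by
    ext I J
    simp only [embFun, Matrix.add_apply]
    split_ifs <;> simp

theorem emb_apply (l : Leg W Ω) (X : Matrix Ω Ω B) (I J : W) :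
    emb l X I J = if J = l.u I (l.p J) then X (l.p I) (l.p J) else 0 := rfl

theorem emb_mul_apply (l : Leg W Ω) (X : Matrix Ω Ω B) (Z : Matrix W W B) (I J : W) :
    (emb l X * Z) I J = ∑ x, X (l.p I) x * Z (l.u I x) J := by
  rw [Matrix.mul_apply]
  exact sum_embFun l X I fun K => Z K J

theorem mul_emb_apply (l : Leg W Ω) (X : Matrix Ω Ω B) (Z : Matrix W W B) (I J : W) :
    (Z * emb l X) I J = ∑ x, Z I (l.u J x) * X x (l.p J) := by
  rw [Matrix.mul_apply]
  symm
  refine Finset.sum_of_injOn (fun x => l.u J x) ?_ (by simp) ?_ ?_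
  · intro x _ y _ h
    have := congrArg l.p h
    simpa using this
  · intro K _ hK
    have : J ≠ l.u K (l.p J) := by
      intro h
      refine hK ⟨l.p K, by simp, ?_⟩
      change l.u J (l.p K) = K
      rw [h]; simp
    simp [emb_apply, this]
  · intro x _
    simp [emb_apply]

theorem emb_map {B' : Type} [Ring B'] (l : Leg W Ω) (X : Matrix Ω Ω B)
    (f : B →+* B') : (emb l X).map f = emb l (X.map f) := by
  ext I J
  simp only [Matrix.map_apply, emb_apply]
  split_ifs <;> simp

theorem emb_smul [Algebra ℂ B] (l : Leg W Ω) (c : ℂ) (X : Matrix Ω Ω B) : emb l (c • X) = c • emb l X := by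
  ext I J
  simp only [Matrix.smul_apply, emb_apply]
  split_ifs <;> simp

/-- Two legs are disjoint if they change and read independent coordinates. -/
structure Leg.Disj (l : Leg W Ω) (l' : Leg W Ω') : Prop where
  left : ∀ I y, l.p (l'.u I y) = l.p I
  right : ∀ I x, l'.p (l.u I x) = l'.p I
  comm : ∀ I x y, l'.u (l.u I x) y = l.u (l'.u I y) x

theorem Leg.Disj.symm {l : Leg W Ω} {l' : Leg W Ω'} (h : l.Disj l') : l'.Disj l :=
  ⟨h.right, h.left, fun I x y => (h.comm I y x).symm⟩

theorem emb_commute {l : Leg W Ω} {l' : Leg W Ω'} (h : l.Disj l') (X : Matrix Ω Ω B)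
    (Y : Matrix Ω' Ω' B) (hc : ∀ a b c d, Commute (X a b) (Y c d)) :
    Commute (emb l X) (emb l' Y) := by
  change _ = _
  rw [← mul_one (emb l X * emb l' Y), ← mul_one (emb l' Y * emb l X), mul_assoc, mul_assoc]
  generalize (1 : Matrix W W B) = Z
  ext I J
  simp only [emb_mul_apply, h.left, h.right, h.comm, Finset.mul_sum]
  rw [Finset.sum_comm]
  refine Finset.sum_congr rfl fun y _ => Finset.sum_congr rfl fun x _ => ?_
  rw [← mul_assoc, ← mul_assoc, (hc _ _ _ _).eq]

/-- The union of two disjoint legs. -/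
def Leg.prod (l : Leg W Ω) (l' : Leg W Ω') (h : l.Disj l') : Leg W (Ω × Ω') where
  p I := (l.p I, l'.p I)
  u I x := l'.u (l.u I x.1) x.2
  pu I x := by simp [h.left]
  uu I x y := by simp [h.comm]
  up I := by simp

end Legs

/-! ### The R-matrix -/

section RAction

variable {n : ℕ} (q : ℂ)

/-- Diagonal coefficient of the R-matrix. -/
def al (a b : Fin n) : ℂ := if a = b then q else 1
/-- Off-diagonal coefficient of the R-matrix. -/
def be (a b : Fin n) : ℂ := if a < b then q - q⁻¹ else 0

theorem Rmat_apply (p r : Fin n × Fin n) :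
    Rmat q n p r = (if r = p then al q p.1 p.2 else 0) +
      (if r = p.swap then be q p.1 p.2 else 0) := by
  obtain ⟨a, b⟩ := p
  obtain ⟨c, d⟩ := r
  simp only [Rmat, al, be, Prod.mk.injEq, Prod.swap]
  by_cases h1 : c = a <;> by_cases h2 : d = b <;> by_cases h3 : c = b <;>
    by_cases h4 : d = a <;> by_cases h5 : a = b <;> simp_all [eq_comm] 

theorem Rmat_apply' (p r : Fin n × Fin n) :
    Rmat q n p r = (if p = r then al q r.1 r.2 else 0) +
      (if p = r.swap then be q r.2 r.1 else 0) := by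
  rw [Rmat_apply]
  have h : r = p.swap ↔ p = r.swap := by
    constructor <;> (rintro rfl; simp)
  congr 1
  · by_cases h' : r = p
    · subst h'; simp
    · simp [h', Ne.symm h']
  · by_cases h' : r = p.swap
    · subst h'; simp
    · rw [if_neg h', if_neg fun x => h' (h.2 x)]

theorem sum_Rmat_row {M : Type*} [AddCommGroup M] [Module ℂ M] (p : Fin n × Fin n)
    (f : Fin n × Fin n → M) :
    ∑ r, Rmat q n p r • f r = al q p.1 p.2 • f p + be q p.1 p.2 • f p.swap := by
  simp [Rmat_apply, add_smul, Finset.sum_add_distrib, ite_smul]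

theorem sum_Rmat_col {M : Type*} [AddCommGroup M] [Module ℂ M] (r : Fin n × Fin n)
    (f : Fin n × Fin n → M) :
    ∑ p, Rmat q n p r • f p = al q r.1 r.2 • f r + be q r.2 r.1 • f r.swap := by
  simp [Rmat_apply', add_smul, Finset.sum_add_distrib, ite_smul]

variable (B : Type) [Ring B] [Algebra ℂ B]

/-- The R-matrix over the algebra `B`. -/
def RB (n : ℕ) : Matrix (Fin n × Fin n) (Fin n × Fin n) B := (Rmat q n).map (algebraMap ℂ B)

variable {B}

theorem al_symm (a b : Fin n) : al q a b = al q b a := by simp [al, eq_comm]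

theorem emb_RB_mul {W : Type} [Fintype W] [DecidableEq W] (l : Leg W (Fin n × Fin n)) (Z : Matrix W W B)
    (I J : W) : (emb l (RB q B n) * Z) I J =
      al q (l.p I).1 (l.p I).2 • Z I J + be q (l.p I).1 (l.p I).2 • Z (l.u I (l.p I).swap) J := by
  rw [emb_mul_apply]
  simp only [RB, Matrix.map_apply, ← Algebra.smul_def]
  rw [sum_Rmat_row, l.up]

theorem RB_mul (Z : Matrix (Fin n × Fin n) (Fin n × Fin n) B) (p r : Fin n × Fin n) :
    (RB q B n * Z) p r = al q p.1 p.2 • Z p r + be q p.1 p.2 • Z p.swap r := by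
  rw [Matrix.mul_apply]
  simp only [RB, Matrix.map_apply, ← Algebra.smul_def]
  rw [sum_Rmat_row]

theorem al_inv (a b : Fin n) : al q⁻¹ a b = (al q a b)⁻¹ := by simp only [al]; split_ifs <;> simp

theorem be_inv (a b : Fin n) : be q⁻¹ a b = - be q a b := by simp only [be]; split_ifs <;> simp

theorem RB_mul_inv {q : ℂ} (hq : q ≠ 0) : RB q B n * RB q⁻¹ B n = 1 := by
  suffices ∀ Z, RB q B n * (RB q⁻¹ B n * Z) = Z by simpa using this 1
  intro Z
  ext ⟨a, b⟩ r
  simp only [RB_mul, al_inv, be_inv, Prod.swap, al_symm q b a]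
  simp only [al, be]
  rcases lt_trichotomy a b with h | h | h
  · simp only [h, h.ne, h.not_gt, if_true, if_false]
    module
  · subst h; simp [hq]
  · simp [h, h.ne', h.not_gt]

theorem RB_inv_mul {q : ℂ} (hq : q ≠ 0) : RB q⁻¹ B n * RB q B n = 1 := by
  have := RB_mul_inv (B := B) (n := n) (inv_ne_zero hq)
  rwa [inv_inv] at this

/-- The Yang-Baxter equation for three pairwise disjoint legs. -/
theorem yang_baxter {W : Type} [Fintype W] [DecidableEq W] {l₁ l₂ l₃ : Leg W (Fin n)} (hq : q ≠ 0)
    (h₁₂ : l₁.Disj l₂) (h₁₃ : l₁.Disj l₃) (h₂₃ : l₂.Disj l₃) :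
    emb (l₁.prod l₂ h₁₂) (RB q B n) * emb (l₁.prod l₃ h₁₃) (RB q B n) *
        emb (l₂.prod l₃ h₂₃) (RB q B n) =
      emb (l₂.prod l₃ h₂₃) (RB q B n) * emb (l₁.prod l₃ h₁₃) (RB q B n) *
        emb (l₁.prod l₂ h₁₂) (RB q B n) := by
  rw [← mul_one (_ * emb (l₂.prod l₃ h₂₃) (RB q B n)),
    ← mul_one (_ * emb (l₁.prod l₂ h₁₂) (RB q B n))]
  generalize (1 : Matrix W W B) = Z
  simp only [mul_assoc]
  ext I J
  suffices H : ∀ I a b c, (emb (l₁.prod l₂ h₁₂) (RB q B n) * (emb (l₁.prod l₃ h₁₃) (RB q B n) *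
      (emb (l₂.prod l₃ h₂₃) (RB q B n) * Z))) (l₃.u (l₂.u (l₁.u I a) b) c) J =
    (emb (l₂.prod l₃ h₂₃) (RB q B n) * (emb (l₁.prod l₃ h₁₃) (RB q B n) *
      (emb (l₁.prod l₂ h₁₂) (RB q B n) * Z))) (l₃.u (l₂.u (l₁.u I a) b) c) J by
    simpa using H I (l₁.p I) (l₂.p I) (l₃.p I)
  clear I
  intro I a b c
  simp only [emb_RB_mul, Leg.prod, h₁₂.right, h₁₃.right, h₂₃.right,
    Leg.pu, Leg.uu, Prod.swap, h₁₂.comm, h₁₃.comm, h₂₃.comm]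
  simp only [al, be]
  rcases lt_trichotomy a b with h | h | h <;> rcases lt_trichotomy b c with h' | h' | h' <;>
    rcases lt_trichotomy a c with h'' | h'' | h''
  all_goals subst_vars
  all_goals first
    | (exfalso; order)
    | (simp only [*, ne_of_lt, ne_of_gt, not_lt_of_gt, lt_irrefl, if_true, if_false]
       try match_scalars
       all_goals try field_simp
       all_goals try ring)

end RAction

section RLLSection

set_option linter.unusedSectionVars false

variable {n : ℕ} {q : ℂ} {B : Type} [Ring B] [Algebra ℂ B]

/-- The first factor of a product, as a leg. -/
def fstL (Ω Ω' : Type) : Leg (Ω × Ω') Ω where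
  p := Prod.fst
  u I x := (x, I.2)
  pu _ _ := rfl
  uu _ _ _ := rfl
  up _ := rfl

/-- The second factor of a product, as a leg. -/
def sndL (Ω Ω' : Type) : Leg (Ω × Ω') Ω' where
  p := Prod.snd
  u I x := (I.1, x)
  pu _ _ := rfl
  uu _ _ _ := rfl
  up _ := rfl

theorem fst_disj_snd (Ω Ω' : Type) : (fstL Ω Ω').Disj (sndL Ω Ω') :=
  ⟨fun _ _ => rfl, fun _ _ => rfl, fun _ _ _ => rfl⟩

theorem M1_eq_emb (X : Matrix (Fin n) (Fin n) B) : M1 X = emb (fstL (Fin n) (Fin n)) X := by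
  ext ⟨a, b⟩ ⟨c, d⟩
  simp [M1, emb_apply, fstL, eq_comm]

theorem M2_eq_emb (X : Matrix (Fin n) (Fin n) B) : M2 X = emb (sndL (Fin n) (Fin n)) X := by
  ext ⟨a, b⟩ ⟨c, d⟩
  simp [M2, emb_apply, sndL, eq_comm]

variable (q) in
/-- The relation `R X₁ Y₂ = Y₂ X₁ R`. -/
def RTT (X Y : Matrix (Fin n) (Fin n) B) : Prop :=
  RB q B n * M1 X * M2 Y = M2 Y * M1 X * RB q B n

theorem M1_mul (X Y : Matrix (Fin n) (Fin n) B) : M1 (X * Y) = M1 X * M1 Y := by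
  simp only [M1_eq_emb, map_mul]

theorem M2_mul (X Y : Matrix (Fin n) (Fin n) B) : M2 (X * Y) = M2 X * M2 Y := by
  simp only [M2_eq_emb, map_mul]

theorem M1_one : M1 (1 : Matrix (Fin n) (Fin n) B) = 1 := by
  rw [M1_eq_emb, map_one]

theorem M2_one : M2 (1 : Matrix (Fin n) (Fin n) B) = 1 := by
  rw [M2_eq_emb, map_one]

theorem M1_M2_commute (X Y : Matrix (Fin n) (Fin n) B)
    (h : ∀ a b c d, Commute (X a b) (Y c d)) : Commute (M1 X) (M2 Y) := by
  rw [M1_eq_emb, M2_eq_emb]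
  exact emb_commute (fst_disj_snd _ _) X Y h

theorem RTT.mul {X Y X' Y' : Matrix (Fin n) (Fin n) B} (h : RTT q X Y) (h' : RTT q X' Y')
    (h₁ : ∀ a b c d, Commute (X a b) (Y' c d)) (h₂ : ∀ a b c d, Commute (X' a b) (Y c d)) :
    RTT q (X * X') (Y * Y') := by
  unfold RTT at *
  have c₁ := (M1_M2_commute X Y' h₁).eq
  have c₂ := (M1_M2_commute X' Y h₂).eq
  rw [M1_mul, M2_mul]
  calc RB q B n * (M1 X * M1 X') * (M2 Y * M2 Y')
      = RB q B n * M1 X * (M1 X' * M2 Y) * M2 Y' := by simp only [mul_assoc]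
    _ = (RB q B n * M1 X * M2 Y) * M1 X' * M2 Y' := by rw [c₂]; simp only [mul_assoc]
    _ = M2 Y * M1 X * (RB q B n * M1 X' * M2 Y') := by rw [h]; simp only [mul_assoc]
    _ = M2 Y * (M1 X * M2 Y') * M1 X' * RB q B n := by rw [h']; simp only [mul_assoc]
    _ = _ := by rw [c₁]; simp only [mul_assoc]

theorem RTT.map {B' : Type} [Ring B'] [Algebra ℂ B'] {X Y : Matrix (Fin n) (Fin n) B}
    (h : RTT q X Y) (f : B →ₐ[ℂ] B') : RTT q (X.map f) (Y.map f) := by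
  unfold RTT at *
  have h1 : ∀ X : Matrix (Fin n) (Fin n) B, M1 (X.map f) = (M1 X).map f := fun X => by
    ext p r; simp only [M1, Matrix.map_apply]; split_ifs <;> simp
  have h2 : ∀ X : Matrix (Fin n) (Fin n) B, M2 (X.map f) = (M2 X).map f := fun X => by
    ext p r; simp only [M2, Matrix.map_apply]; split_ifs <;> simp
  have h3 : RB q B' n = (RB q B n).map f := by
    ext p r; simp [RB]
  rw [h1, h2, h3, ← Matrix.map_mul, ← Matrix.map_mul, ← Matrix.map_mul, ← Matrix.map_mul, h]

variable (q) in
/-- Matrices satisfying the defining relations of the generator matrices `L⁺`, `L⁻`. -/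
structure RLL (X Y : Matrix (Fin n) (Fin n) B) : Prop where
  upper : ∀ i j, j < i → X i j = 0
  lower : ∀ i j, i < j → Y i j = 0
  diag : ∀ i, X i i * Y i i = 1
  diag' : ∀ i, Y i i * X i i = 1
  pp : RTT q X X
  mm : RTT q Y Y
  pm : RTT q X Y

theorem upper_mul_diag {X X' : Matrix (Fin n) (Fin n) B} (h : ∀ i j, j < i → X i j = 0)
    (h' : ∀ i j, j < i → X' i j = 0) (i : Fin n) : (X * X') i i = X i i * X' i i := by
  rw [Matrix.mul_apply]
  refine Finset.sum_eq_single i (fun k _ hk => ?_) (by simp)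
  rcases lt_or_gt_of_ne hk with hk | hk
  · rw [h _ _ hk, zero_mul]
  · rw [h' _ _ hk, mul_zero]

theorem upper_mul {X X' : Matrix (Fin n) (Fin n) B} (h : ∀ i j, j < i → X i j = 0)
    (h' : ∀ i j, j < i → X' i j = 0) (i j : Fin n) (hij : j < i) : (X * X') i j = 0 := by
  rw [Matrix.mul_apply]
  refine Finset.sum_eq_zero fun k _ => ?_
  rcases lt_or_ge k i with hk | hk
  · rw [h _ _ hk, zero_mul]
  · rw [h' _ _ (hij.trans_le hk), mul_zero]

theorem lower_mul_diag {X X' : Matrix (Fin n) (Fin n) B} (h : ∀ i j, i < j → X i j = 0)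
    (h' : ∀ i j, i < j → X' i j = 0) (i : Fin n) : (X * X') i i = X i i * X' i i := by
  rw [Matrix.mul_apply]
  refine Finset.sum_eq_single i (fun k _ hk => ?_) (by simp)
  rcases lt_or_gt_of_ne hk with hk | hk
  · rw [h' _ _ hk, mul_zero]
  · rw [h _ _ hk, zero_mul]

theorem lower_mul {X X' : Matrix (Fin n) (Fin n) B} (h : ∀ i j, i < j → X i j = 0)
    (h' : ∀ i j, i < j → X' i j = 0) (i j : Fin n) (hij : i < j) : (X * X') i j = 0 := by
  rw [Matrix.mul_apply]
  refine Finset.sum_eq_zero fun k _ => ?_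
  rcases lt_or_ge i k with hk | hk
  · rw [h _ _ hk, zero_mul]
  · rw [h' _ _ (hk.trans_lt hij), mul_zero]

theorem RLL.mul {X Y X' Y' : Matrix (Fin n) (Fin n) B} (h : RLL q X Y) (h' : RLL q X' Y')
    (hXX : ∀ a b c d, Commute (X a b) (X' c d)) (hXY : ∀ a b c d, Commute (X a b) (Y' c d))
    (hYX : ∀ a b c d, Commute (Y a b) (X' c d)) (hYY : ∀ a b c d, Commute (Y a b) (Y' c d)) :
    RLL q (X * X') (Y * Y') where
  upper := upper_mul h.upper h'.upper
  lower := lower_mul h.lower h'.lower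
  diag i := by
    rw [upper_mul_diag h.upper h'.upper, lower_mul_diag h.lower h'.lower, mul_assoc,
      ← mul_assoc (X' i i), ← (hYX i i i i).eq, mul_assoc, h'.diag, mul_one, h.diag]
  diag' i := by
    rw [upper_mul_diag h.upper h'.upper, lower_mul_diag h.lower h'.lower, mul_assoc,
      ← mul_assoc (Y' i i), ← (hXY i i i i).eq, mul_assoc, h'.diag', mul_one, h.diag']
  pp := h.pp.mul h'.pp hXX fun a b c d => (hXX c d a b).symm
  mm := h.mm.mul h'.mm hYY fun a b c d => (hYY c d a b).symm
  pm := h.pm.mul h'.pm hXY fun a b c d => (hYX c d a b).symm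

theorem RLL.map {B' : Type} [Ring B'] [Algebra ℂ B'] {X Y : Matrix (Fin n) (Fin n) B}
    (h : RLL q X Y) (f : B →ₐ[ℂ] B') : RLL q (X.map f) (Y.map f) where
  upper i j hij := by simp [h.upper i j hij]
  lower i j hij := by simp [h.lower i j hij]
  diag i := by simp [← map_mul, h.diag i]
  diag' i := by simp [← map_mul, h.diag' i]
  pp := h.pp.map f
  mm := h.mm.map f
  pm := h.pm.map f

theorem RLL.one : RLL q (1 : Matrix (Fin n) (Fin n) B) 1 where
  upper i j h := Matrix.one_apply_ne h.ne'
  lower i j h := Matrix.one_apply_ne h.ne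
  diag i := by simp
  diag' i := by simp
  pp := by unfold RTT; rw [M1_one, M2_one]; simp
  mm := by unfold RTT; rw [M1_one, M2_one]; simp
  pm := by unfold RTT; rw [M1_one, M2_one]; simp

theorem RTT.smul {X Y : Matrix (Fin n) (Fin n) B} (h : RTT q X Y) (c d : ℂ) :
    RTT q (c • X) (d • Y) := by
  unfold RTT at *
  have h1 : M1 (c • X) = c • M1 X := by rw [M1_eq_emb, M1_eq_emb, ← emb_smul]
  have h2 : M2 (d • Y) = d • M2 Y := by rw [M2_eq_emb, M2_eq_emb, ← emb_smul]
  rw [h1, h2]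
  simp only [smul_mul_assoc, mul_smul_comm, h, smul_comm c d]

theorem RLL.smul {X Y : Matrix (Fin n) (Fin n) B} (h : RLL q X Y) {c : ℂ} (hc : c ≠ 0) :
    RLL q (c • X) (c⁻¹ • Y) where
  upper i j hij := by simp [h.upper i j hij]
  lower i j hij := by simp [h.lower i j hij]
  diag i := by simp [h.diag, smul_smul, hc]
  diag' i := by simp [h.diag', smul_smul, hc]
  pp := h.pp.smul _ _
  mm := h.mm.smul _ _
  pm := h.pm.smul _ _

theorem RLL_U (q : ℂ) (n : ℕ) : RLL q (Lp q n) (Lm q n) := by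
  have e : ∀ (X : Fin n → Fin n → FreeAlgebra ℂ (UqGen n)) (Y : Matrix (Fin n) (Fin n) (Uq q n)),
      (∀ i j, RingQuot.mkAlgHom ℂ (UqRel q n) (X i j) = Y i j) →
      M1 Y = (M1 X).map (RingQuot.mkAlgHom ℂ (UqRel q n)) ∧
      M2 Y = (M2 X).map (RingQuot.mkAlgHom ℂ (UqRel q n)) := by
    intro X Y h
    constructor <;> ext p r <;> simp only [M1, M2, Matrix.map_apply] <;> split_ifs <;> simp [h]
  have eR : RB q (Uq q n) n = (RmatU q n).map (RingQuot.mkAlgHom ℂ (UqRel q n)) := by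
    ext p r; simp [RB, RmatU]
  obtain ⟨p1, p2⟩ := e (lpF n) (Lp q n) fun _ _ => rfl
  obtain ⟨m1, m2⟩ := e (lmF n) (Lm q n) fun _ _ => rfl
  refine ⟨?_, ?_, ?_, ?_, ?_, ?_, ?_⟩
  · intro i j h
    exact (RingQuot.mkAlgHom_rel ℂ (UqRel.upperZero i j h)).trans (map_zero _)
  · intro i j h
    exact (RingQuot.mkAlgHom_rel ℂ (UqRel.lowerZero i j h)).trans (map_zero _)
  · intro i
    exact ((map_mul _ _ _).symm.trans (RingQuot.mkAlgHom_rel ℂ (UqRel.diagPM i))).trans (map_one _)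
  · intro i
    exact ((map_mul _ _ _).symm.trans (RingQuot.mkAlgHom_rel ℂ (UqRel.diagMP i))).trans (map_one _)
  · unfold RTT
    rw [p1, p2, eR, ← Matrix.map_mul, ← Matrix.map_mul, ← Matrix.map_mul, ← Matrix.map_mul]
    ext x y
    exact RingQuot.mkAlgHom_rel ℂ (UqRel.rllPP x y)
  · unfold RTT
    rw [m1, m2, eR, ← Matrix.map_mul, ← Matrix.map_mul, ← Matrix.map_mul, ← Matrix.map_mul]
    ext x y
    exact RingQuot.mkAlgHom_rel ℂ (UqRel.rllMM x y)
  · unfold RTT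
    rw [p1, m2, eR, ← Matrix.map_mul, ← Matrix.map_mul, ← Matrix.map_mul, ← Matrix.map_mul]
    ext x y
    exact RingQuot.mkAlgHom_rel ℂ (UqRel.rllPM x y)

theorem exists_lift {X Y : Matrix (Fin n) (Fin n) B} (h : RLL q X Y) :
    ∃ f : Uq q n →ₐ[ℂ] B, (∀ i j, f (lp q n i j) = X i j) ∧ ∀ i j, f (lm q n i j) = Y i j := by
  let g : FreeAlgebra ℂ (UqGen n) →ₐ[ℂ] B :=
    FreeAlgebra.lift ℂ (Sum.elim (fun p => X p.1 p.2) fun p => Y p.1 p.2)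
  have gp : ∀ i j, g (lpF n i j) = X i j := fun i j => by simp [g, lpF]
  have gm : ∀ i j, g (lmF n i j) = Y i j := fun i j => by simp [g, lmF]
  have e1 : ∀ (Z : Fin n → Fin n → FreeAlgebra ℂ (UqGen n)) (Z' : Matrix (Fin n) (Fin n) B),
      (∀ i j, g (Z i j) = Z' i j) → (M1 Z).map g = M1 Z' ∧ (M2 Z).map g = M2 Z' := by
    intro Z Z' h
    constructor <;> ext p r <;> simp only [M1, M2, Matrix.map_apply] <;> split_ifs <;> simp [h]
  have eR : (RmatU q n).map g = RB q B n := by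
    ext p r; simp [RB, RmatU]
  have ent : ∀ (Z : Matrix (Fin n × Fin n) (Fin n × Fin n) (FreeAlgebra ℂ (UqGen n))) x y,
    g (Z x y) = (Z.map g) x y := fun _ _ _ => rfl
  obtain ⟨p1, p2⟩ := e1 (lpF n) X gp
  obtain ⟨m1, m2⟩ := e1 (lmF n) Y gm
  refine ⟨RingQuot.liftAlgHom ℂ ⟨g, ?_⟩, ?_, ?_⟩
  · intro x y r
    induction r with
    | upperZero i j hij => rw [gp, h.upper i j hij, map_zero]
    | lowerZero i j hij => rw [gm, h.lower i j hij, map_zero]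
    | diagPM i => rw [map_mul, gp, gm, h.diag, map_one]
    | diagMP i => rw [map_mul, gp, gm, h.diag', map_one]
    | rllPP x y =>
      rw [ent, ent]
      simp only [Matrix.map_mul, p1, p2, eR]
      rw [h.pp]
    | rllMM x y =>
      rw [ent, ent]
      simp only [Matrix.map_mul, m1, m2, eR]
      rw [h.mm]
    | rllPM x y =>
      rw [ent, ent]
      simp only [Matrix.map_mul, p1, m2, eR]
      rw [h.pm]
  · intro i j
    rw [lp, RingQuot.liftAlgHom_mkAlgHom_apply, gp]
  · intro i j
    rw [lm, RingQuot.liftAlgHom_mkAlgHom_apply, gm]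

end RLLSection

section Inverse

set_option linter.unusedSectionVars false

variable {n : ℕ} {q : ℂ} {B : Type} [Ring B] [Algebra ℂ B]

variable (q) in
/-- Matrices satisfying the relations of `L⁺`, `L⁻` and the inverse of `L⁻`. -/
structure RLLK (X Y K : Matrix (Fin n) (Fin n) B) : Prop extends RLL q X Y where
  inv : Y * K = 1
  inv' : K * Y = 1

theorem RLLK.map {B' : Type} [Ring B'] [Algebra ℂ B'] {X Y K : Matrix (Fin n) (Fin n) B}
    (h : RLLK q X Y K) (f : B →ₐ[ℂ] B') : RLLK q (X.map f) (Y.map f) (K.map f) where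
  toRLL := h.toRLL.map f
  inv := by rw [← Matrix.map_mul, h.inv, Matrix.map_one _ (map_zero f) (map_one f)]
  inv' := by rw [← Matrix.map_mul, h.inv', Matrix.map_one _ (map_zero f) (map_one f)]

theorem RLLK.one : RLLK q (1 : Matrix (Fin n) (Fin n) B) 1 1 :=
  ⟨RLL.one, one_mul 1, one_mul 1⟩

theorem RLLK.smul {X Y K : Matrix (Fin n) (Fin n) B} (h : RLLK q X Y K) {c : ℂ} (hc : c ≠ 0) :
    RLLK q (c • X) (c⁻¹ • Y) (c • K) where
  toRLL := h.toRLL.smul hc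
  inv := by simp [h.inv, smul_smul, hc]
  inv' := by simp [h.inv', smul_smul, hc]

theorem lower_inverse {Y K : Matrix (Fin n) (Fin n) B} (hl : ∀ i j, i < j → Y i j = 0)
    {D : Fin n → B} (hD : ∀ i, D i * Y i i = 1) (hi : Y * K = 1) :
    (∀ i j, i < j → K i j = 0) ∧ ∀ i, K i i = D i := by
  have key : ∀ i, (∀ i' < i, ∀ j, i' < j → K i' j = 0) → ∀ j, i ≤ j → Y i i * K i j =
      (1 : Matrix (Fin n) (Fin n) B) i j := by
    intro i ih j hij
    rw [← hi, Matrix.mul_apply]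
    symm
    refine Finset.sum_eq_single i (fun k _ hk => ?_) (by simp)
    rcases lt_or_gt_of_ne hk with hk | hk
    · rw [ih k hk j (hk.trans_le hij), mul_zero]
    · rw [hl _ _ hk, zero_mul]
  have low : ∀ i, ∀ j, i < j → K i j = 0 := by
    intro i
    induction i using WellFoundedLT.induction with
    | _ i ih =>
      intro j hij
      have := key i ih j hij.le
      rw [Matrix.one_apply_ne hij.ne] at this
      rw [← one_mul (K i j), ← hD i, mul_assoc, this, mul_zero]
  refine ⟨low, fun i => ?_⟩
  have := key i (fun i' _ => low i') i le_rfl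
  rw [Matrix.one_apply_eq] at this
  rw [← one_mul (K i i), ← hD i, mul_assoc, this, mul_one]

theorem RLLK.lowerK {X Y K : Matrix (Fin n) (Fin n) B} (h : RLLK q X Y K) (i j : Fin n)
    (hij : i < j) : K i j = 0 := (lower_inverse h.lower h.diag h.inv).1 i j hij

theorem RLLK.diagK {X Y K : Matrix (Fin n) (Fin n) B} (h : RLLK q X Y K) (i : Fin n) :
    K i i = X i i := (lower_inverse h.lower h.diag h.inv).2 i

theorem RLLK.mul {X Y K X' Y' K' : Matrix (Fin n) (Fin n) B} (h : RLLK q X Y K)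
    (h' : RLLK q X' Y' K')
    (hXX : ∀ a b c d, Commute (X a b) (X' c d)) (hXY : ∀ a b c d, Commute (X a b) (Y' c d))
    (hYX : ∀ a b c d, Commute (Y a b) (X' c d)) (hYY : ∀ a b c d, Commute (Y a b) (Y' c d)) :
    RLLK q (X * X') (Y * Y') (K' * K) where
  toRLL := h.toRLL.mul h'.toRLL hXX hXY hYX hYY
  inv := by rw [mul_assoc, ← mul_assoc Y', h'.inv, one_mul, h.inv]
  inv' := by rw [mul_assoc, ← mul_assoc K, h.inv', one_mul, h'.inv']

theorem RLLK.kk {X Y K : Matrix (Fin n) (Fin n) B} (h : RLLK q X Y K) :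
    RB q B n * M2 K * M1 K = M1 K * M2 K * RB q B n := by
  have h1 : M1 Y * M1 K = 1 := by rw [← M1_mul, h.inv, M1_one]
  have h1' : M1 K * M1 Y = 1 := by rw [← M1_mul, h.inv', M1_one]
  have h2 : M2 Y * M2 K = 1 := by rw [← M2_mul, h.inv, M2_one]
  have h2' : M2 K * M2 Y = 1 := by rw [← M2_mul, h.inv', M2_one]
  have := h.mm
  unfold RTT at this
  calc RB q B n * M2 K * M1 K
      = M1 K * (M2 K * M2 Y) * M1 Y * RB q B n * M2 K * M1 K := by
        rw [h2', mul_one, h1', one_mul]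
    _ = M1 K * M2 K * (M2 Y * M1 Y * RB q B n) * M2 K * M1 K := by simp only [mul_assoc]
    _ = M1 K * M2 K * RB q B n * (M1 Y * (M2 Y * M2 K) * M1 K) := by
        rw [← this]; simp only [mul_assoc]
    _ = _ := by rw [h2, mul_one, h1, mul_one]

theorem RLLK.kx {X Y K : Matrix (Fin n) (Fin n) B} (h : RLLK q X Y K) :
    M2 K * RB q B n * M1 X = M1 X * RB q B n * M2 K := by
  have h2 : M2 Y * M2 K = 1 := by rw [← M2_mul, h.inv, M2_one]
  have h2' : M2 K * M2 Y = 1 := by rw [← M2_mul, h.inv', M2_one]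
  have := h.pm
  unfold RTT at this
  calc M2 K * RB q B n * M1 X = M2 K * (RB q B n * M1 X * M2 Y) * M2 K := by
        simp only [mul_assoc, h2, mul_one]
    _ = (M2 K * M2 Y) * M1 X * RB q B n * M2 K := by rw [this]; simp only [mul_assoc]
    _ = _ := by rw [h2', one_mul]

/-- The permutation operator over `B`. -/
def PB (B : Type) [Ring B] [Algebra ℂ B] (n : ℕ) :
    Matrix (Fin n × Fin n) (Fin n × Fin n) B := (Pmat n).map (algebraMap ℂ B)

/-- The braiding over `B`. -/
def TB (q : ℂ) (B : Type) [Ring B] [Algebra ℂ B] (n : ℕ) :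
    Matrix (Fin n × Fin n) (Fin n × Fin n) B := (Rcheck q n).map (algebraMap ℂ B)

theorem PB_apply (p r : Fin n × Fin n) : PB B n p r = if r = p.swap then 1 else 0 := by
  simp only [PB, Pmat, Matrix.map_apply, Prod.ext_iff, Prod.swap, eq_comm, and_comm]
  split_ifs <;> simp

theorem emb_PB_mul {W : Type} [Fintype W] [DecidableEq W] (l : Leg W (Fin n × Fin n))
    (Z : Matrix W W B) (I J : W) : (emb l (PB B n) * Z) I J = Z (l.u I (l.p I).swap) J := by
  rw [emb_mul_apply]
  simp [PB_apply]

theorem TB_eq : TB q B n = PB B n * RB q B n := by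
  simp only [TB, Rcheck, PB, RB, Matrix.map_mul]

theorem PB_mul_self : PB B n * PB B n = 1 := by
  rw [PB, ← Matrix.map_mul, ← Matrix.map_one (algebraMap ℂ B) (map_zero _) (map_one _)]
  congr 1
  ext p r
  rw [Matrix.mul_apply]
  simp only [Pmat, Matrix.one_apply, Prod.ext_iff, ite_and, Fintype.sum_prod_type]
  simp [eq_comm]

theorem TB_mul_inv (hq : q ≠ 0) : TB q B n * (RB q⁻¹ B n * PB B n) = 1 := by
  rw [TB_eq, mul_assoc, ← mul_assoc (RB q B n), RB_mul_inv hq, one_mul, PB_mul_self]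

theorem TBinv_eq (hq : q ≠ 0) : ((Rcheck q n)⁻¹).map (algebraMap ℂ B) = RB q⁻¹ B n * PB B n := by
  have h : (Rcheck q n)⁻¹ = RB q⁻¹ ℂ n * PB ℂ n := by
    refine Matrix.inv_eq_right_inv ?_
    have := TB_mul_inv (B := ℂ) (n := n) hq
    simpa [TB] using this
  rw [h, Matrix.map_mul]
  simp [RB, PB]

theorem TB_mul_inv' (hq : q ≠ 0) : TB q B n * ((Rcheck q n)⁻¹).map (algebraMap ℂ B) = 1 := by
  rw [TBinv_eq hq, TB_mul_inv hq]

theorem TB_inv_mul (hq : q ≠ 0) : ((Rcheck q n)⁻¹).map (algebraMap ℂ B) * TB q B n = 1 := by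
  rw [TBinv_eq hq, TB_eq, mul_assoc, ← mul_assoc (PB B n), PB_mul_self, one_mul, RB_inv_mul hq]

theorem PB_conj {W : Type} [Fintype W] [DecidableEq W] {Ω : Type} [Fintype Ω] [DecidableEq Ω]
    {l l' : Leg W (Fin n)}
    (h : l.Disj l') {l₀ : Leg W Ω} (h₀ : l₀.Disj l) (h₀' : l₀.Disj l')
    (C : Matrix (Ω × Fin n) (Ω × Fin n) B) :
    emb (l.prod l' h) (PB B n) * emb (l₀.prod l h₀) C =
      emb (l₀.prod l' h₀') C * emb (l.prod l' h) (PB B n) := by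
  suffices ∀ Z, emb (l.prod l' h) (PB B n) * (emb (l₀.prod l h₀) C * Z) =
      emb (l₀.prod l' h₀') C * (emb (l.prod l' h) (PB B n) * Z) by simpa using this 1
  intro Z
  ext I J
  rw [emb_PB_mul, emb_mul_apply, emb_mul_apply]
  simp only [emb_PB_mul]
  simp only [Leg.prod, Prod.swap, h₀.symm.right, h₀'.symm.right, h.left,
    h₀.comm, h₀'.comm, Leg.uu, Leg.pu, h₀.right, h₀'.right, h.comm]

theorem PB_conj_pair {W : Type} [Fintype W] [DecidableEq W] {Ω : Type} [Fintype Ω] [DecidableEq Ω]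
    {l l' : Leg W (Fin n)}
    (h : l.Disj l') {l₀ : Leg W Ω} (h₀ : l.Disj l₀) (h₀' : l'.Disj l₀)
    (C : Matrix (Fin n × Ω) (Fin n × Ω) B) :
    emb (l.prod l' h) (PB B n) * emb (l.prod l₀ h₀) C =
      emb (l'.prod l₀ h₀') C * emb (l.prod l' h) (PB B n) := by
  suffices ∀ Z, emb (l.prod l' h) (PB B n) * (emb (l.prod l₀ h₀) C * Z) =
      emb (l'.prod l₀ h₀') C * (emb (l.prod l' h) (PB B n) * Z) by simpa using this 1
  intro Z
  ext I J
  rw [emb_PB_mul, emb_mul_apply, emb_mul_apply]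
  simp only [emb_PB_mul]
  simp only [Leg.prod, Prod.swap, h₀.right, h₀'.right, h₀.left, h.left,
    h₀.comm, h₀'.comm, Leg.uu, Leg.pu, h.comm]

theorem PB_M1 (X : Matrix (Fin n) (Fin n) B) : PB B n * M1 X = M2 X * PB B n := by
  ext p r
  simp only [Matrix.mul_apply, PB_apply, M1, M2, Fintype.sum_prod_type]
  simp [Prod.ext_iff, ite_and, eq_comm]

theorem PB_M2 (X : Matrix (Fin n) (Fin n) B) : PB B n * M2 X = M1 X * PB B n := by
  ext p r
  simp only [Matrix.mul_apply, PB_apply, M1, M2, Fintype.sum_prod_type]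
  simp [Prod.ext_iff, ite_and, eq_comm]

theorem RLLK.tpp {X Y K : Matrix (Fin n) (Fin n) B} (h : RLLK q X Y K) :
    TB q B n * (M1 X * M2 X) = M1 X * M2 X * TB q B n := by
  have := h.pp
  unfold RTT at this
  rw [TB_eq, mul_assoc, ← mul_assoc (RB q B n), this, ← mul_assoc, ← mul_assoc, ← mul_assoc, PB_M2,
    mul_assoc (M1 X), PB_M1, ← mul_assoc]

theorem RLLK.tkk {X Y K : Matrix (Fin n) (Fin n) B} (h : RLLK q X Y K) :
    TB q B n * (M2 K * M1 K) = M2 K * M1 K * TB q B n := by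
  rw [TB_eq, mul_assoc, ← mul_assoc (RB q B n), h.kk, ← mul_assoc, ← mul_assoc, ← mul_assoc, PB_M1,
    mul_assoc (M2 K), PB_M2, ← mul_assoc]

theorem RLLK.tkx {X Y K : Matrix (Fin n) (Fin n) B} (h : RLLK q X Y K) :
    M1 K * TB q B n * M1 X = M2 X * TB q B n * M2 K := by
  rw [TB_eq, ← mul_assoc, ← PB_M2, mul_assoc, mul_assoc, ← mul_assoc (M2 K), h.kx, ← mul_assoc,
    ← mul_assoc, PB_M1, ← mul_assoc]

end Inverse

/-! ### Ordered products -/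

section AscDesc

variable {R : Type} [Ring R]

/-- The product `x 0 * ⋯ * x (k - 1)`. -/
def asc (x : ℕ → R) : ℕ → R
  | 0 => 1
  | k + 1 => asc x k * x k

/-- The product `x (k - 1) * ⋯ * x 0`. -/
def desc (x : ℕ → R) : ℕ → R
  | 0 => 1
  | k + 1 => x k * desc x k

theorem commute_asc {x : ℕ → R} {t : R} {k : ℕ} (h : ∀ i < k, Commute t (x i)) :
    Commute t (asc x k) := by
  induction k with
  | zero => exact Commute.one_right t
  | succ k ih => exact (ih fun i hi => h i (by omega)).mul_right (h k (by omega))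

theorem commute_desc {x : ℕ → R} {t : R} {k : ℕ} (h : ∀ i < k, Commute t (x i)) :
    Commute t (desc x k) := by
  induction k with
  | zero => exact Commute.one_right t
  | succ k ih => exact (h k (by omega)).mul_right (ih fun i hi => h i (by omega))

theorem commute_asc_of_adjacent {x : ℕ → R} {t : R} {k m : ℕ} (hk : k + 1 < m)
    (h : ∀ i < m, i ≠ k → i ≠ k + 1 → Commute t (x i)) (h' : Commute t (x k * x (k + 1))) :
    Commute t (asc x m) := by
  induction m with
  | zero => omega
  | succ m ih =>
    by_cases hm : m = k + 1
    · subst hm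
      change Commute t (asc x k * x k * x (k + 1))
      rw [mul_assoc]
      exact (commute_asc fun i hi => h i (by omega) (by omega) (by omega)).mul_right h'
    · exact (ih (by omega) fun i hi => h i (by omega)).mul_right
        (h m (by omega) (by omega) (by omega))

theorem commute_desc_of_adjacent {x : ℕ → R} {t : R} {k m : ℕ} (hk : k + 1 < m)
    (h : ∀ i < m, i ≠ k → i ≠ k + 1 → Commute t (x i)) (h' : Commute t (x (k + 1) * x k)) :
    Commute t (desc x m) := by
  induction m with
  | zero => omega
  | succ m ih =>
    by_cases hm : m = k + 1
    · subst hm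
      change Commute t (x (k + 1) * (x k * desc x k))
      rw [← mul_assoc]
      exact h'.mul_right (commute_desc fun i hi => h i (by omega) (by omega) (by omega))
    · exact (h m (by omega) (by omega) (by omega)).mul_right
        (ih (by omega) fun i hi => h i (by omega))

theorem asc_mul_asc {x y : ℕ → R} {m : ℕ} (h : ∀ i < m, ∀ j < i, Commute (y j) (x i)) :
    asc (fun i => x i * y i) m = asc x m * asc y m := by
  induction m with
  | zero => simp [asc]
  | succ m ih =>
    have : Commute (x m) (asc y m) := commute_asc fun j hj => (h m (by omega) j hj).symm
    simp only [asc]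
    rw [ih fun i hi => h i (by omega), mul_assoc, ← mul_assoc (asc y m), ← this.eq]
    simp only [mul_assoc]

theorem desc_mul_desc {x y : ℕ → R} {m : ℕ} (h : ∀ i < m, ∀ j < i, Commute (y i) (x j)) :
    desc (fun i => x i * y i) m = desc x m * desc y m := by
  induction m with
  | zero => simp [desc]
  | succ m ih =>
    have : Commute (y m) (desc x m) := commute_desc fun j hj => h m (by omega) j hj
    simp only [desc]
    rw [ih fun i hi => h i (by omega), mul_assoc, ← mul_assoc (y m), this.eq]
    simp only [mul_assoc]

theorem asc_congr {x y : ℕ → R} {m : ℕ} (h : ∀ i < m, x i = y i) : asc x m = asc y m := by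
  induction m with
  | zero => rfl
  | succ m ih => rw [asc, asc, ih fun i hi => h i (by omega), h m (by omega)]

theorem desc_congr {x y : ℕ → R} {m : ℕ} (h : ∀ i < m, x i = y i) : desc x m = desc y m := by
  induction m with
  | zero => rfl
  | succ m ih => rw [desc, desc, ih fun i hi => h i (by omega), h m (by omega)]

theorem map_asc {R' : Type} [Ring R'] (f : R →+* R') (x : ℕ → R) (m : ℕ) :
    f (asc x m) = asc (fun i => f (x i)) m := by
  induction m with
  | zero => exact map_one f
  | succ m ih => rw [asc, map_mul, ih]; rfl

theorem map_desc {R' : Type} [Ring R'] (f : R →+* R') (x : ℕ → R) (m : ℕ) :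
    f (desc x m) = desc (fun i => f (x i)) m := by
  induction m with
  | zero => exact map_one f
  | succ m ih => rw [desc, map_mul, ih]; rfl

theorem prod_map_range (x : ℕ → R) (m : ℕ) : ((List.range m).map x).prod = asc x m := by
  induction m with
  | zero => rfl
  | succ m ih => rw [List.range_succ, List.map_append, List.prod_append, ih]; simp [asc]

/-- Passing from the braided copies of a product to ordered products of its factors. -/
theorem asc_braided {T T' l κ bar : ℕ → R} {m : ℕ} (hT : ∀ k, k + 1 < m → T k * T' k = 1)
    (h0 : 0 < m → bar 0 = l 0 * κ 0) (hbar : ∀ k, k + 1 < m → bar (k + 1) = T k * bar k * T' k)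
    (hTκ : ∀ k i, k + 1 < m → i < k → Commute (T k) (κ i))
    (hTκ' : ∀ k i, k + 1 < m → i < k → Commute (T' k) (κ i))
    (h2 : ∀ k, k + 1 < m → T k * (κ (k + 1) * κ k) = κ (k + 1) * κ k * T k)
    (h3 : ∀ k, k + 1 < m → κ k * T k * l k = l (k + 1) * T k * κ (k + 1)) :
    asc bar m = asc l m * desc κ m := by
  have key : ∀ k < m, desc κ k * bar k = l k * κ k * desc κ k := by
    intro k
    induction k with
    | zero => intro hk; simp [desc, h0 hk]
    | succ k ih =>
      intro hk
      have ih := ih (by omega)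
      have c1 : Commute (T k) (desc κ k) := commute_desc fun i hi => hTκ k i hk hi
      have c2 : Commute (T' k) (desc κ k) := commute_desc fun i hi => hTκ' k i hk hi
      calc κ k * desc κ k * bar (k + 1)
          = κ k * (desc κ k * T k) * bar k * T' k := by rw [hbar k hk]; simp only [mul_assoc]
        _ = κ k * T k * (desc κ k * bar k) * T' k := by rw [← c1.eq]; simp only [mul_assoc]
        _ = (κ k * T k * l k) * κ k * (desc κ k * T' k) := by rw [ih]; simp only [mul_assoc]
        _ = l (k + 1) * (T k * (κ (k + 1) * κ k)) * T' k * desc κ k := by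
          rw [h3 k hk, ← c2.eq]; simp only [mul_assoc]
        _ = l (k + 1) * κ (k + 1) * κ k * (T k * T' k) * desc κ k := by
          rw [h2 k hk]; simp only [mul_assoc]
        _ = l (k + 1) * κ (k + 1) * (κ k * desc κ k) := by
          rw [hT k hk, mul_one]; simp only [mul_assoc]
  suffices ∀ k ≤ m, asc bar k = asc l k * desc κ k from this m le_rfl
  intro k
  induction k with
  | zero => intro _; simp [asc, desc]
  | succ k ih =>
    intro hk
    change asc bar k * bar k = asc l k * l k * (κ k * desc κ k)
    rw [ih (by omega), mul_assoc, key k (by omega)]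
    simp only [mul_assoc]

end AscDesc

/-! ### Tensor legs of words -/

section Words

set_option linter.unusedSectionVars false

variable {n m : ℕ} {q : ℂ} {B : Type} [Ring B] [Algebra ℂ B]

/-- The `k`-th letter of a word. -/
def legL (n : ℕ) {m : ℕ} (k : Fin m) : Leg (Fin m → Fin n) (Fin n) where
  p I := I k
  u I x := Function.update I k x
  pu I x := by simp
  uu I x y := by simp
  up I := by simp

theorem legL_disj {k l : Fin m} (h : k ≠ l) : (legL n k).Disj (legL n l) where
  left I y := by simp [legL, h]
  right I x := by simp [legL, h.symm]
  comm I x y := by simp only [legL]; rw [Function.update_comm h.symm]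

/-- The matrix `X` acting on the letter with index `k` of words of length `m`. -/
def w1 (m : ℕ) (X : Matrix (Fin n) (Fin n) B) (k : ℕ) : Matrix (Fin m → Fin n) (Fin m → Fin n) B :=
  if h : k < m then emb (legL n ⟨k, h⟩) X else 1

/-- The matrix `C` acting on the letters with indices `a` and `b` of words of length `m`. -/
def w2 (m : ℕ) (C : Matrix (Fin n × Fin n) (Fin n × Fin n) B) (a b : ℕ) :
    Matrix (Fin m → Fin n) (Fin m → Fin n) B :=
  if h : (a < m ∧ b < m) ∧ a ≠ b then
    emb ((legL n ⟨a, h.1.1⟩).prod (legL n ⟨b, h.1.2⟩) (legL_disj (by simpa using h.2))) C else 1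

theorem w1_mul (X Y : Matrix (Fin n) (Fin n) B) (k : ℕ) : w1 m (X * Y) k = w1 m X k * w1 m Y k := by
  unfold w1; split_ifs <;> simp

theorem w2_mul (X Y : Matrix (Fin n × Fin n) (Fin n × Fin n) B) (a b : ℕ) :
    w2 m (X * Y) a b = w2 m X a b * w2 m Y a b := by
  unfold w2; split_ifs <;> simp

theorem w1_one (k : ℕ) : w1 m (1 : Matrix (Fin n) (Fin n) B) k = 1 := by
  unfold w1; split_ifs <;> simp

theorem w2_one (a b : ℕ) : w2 m (1 : Matrix (Fin n × Fin n) (Fin n × Fin n) B) a b = 1 := by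
  unfold w2; split_ifs <;> simp

theorem w1_map {B' : Type} [Ring B'] (X : Matrix (Fin n) (Fin n) B) (f : B →+* B') (k : ℕ) :
    (w1 m X k).map f = w1 m (X.map f) k := by
  unfold w1; split_ifs
  · rw [emb_map]
  · rw [Matrix.map_one _ (map_zero f) (map_one f)]

theorem w2_map {B' : Type} [Ring B'] (X : Matrix (Fin n × Fin n) (Fin n × Fin n) B) (f : B →+* B')
    (a b : ℕ) : (w2 m X a b).map f = w2 m (X.map f) a b := by
  unfold w2; split_ifs
  · rw [emb_map]
  · rw [Matrix.map_one _ (map_zero f) (map_one f)]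

theorem w1_commute {X Y : Matrix (Fin n) (Fin n) B} {k l : ℕ} (h : k ≠ l)
    (hc : ∀ a b c d, Commute (X a b) (Y c d)) : Commute (w1 m X k) (w1 m Y l) := by
  unfold w1
  split_ifs
  · exact emb_commute (legL_disj (by simpa using h)) X Y hc
  all_goals first | exact Commute.one_right _ | exact Commute.one_left _

theorem Leg.Disj.prod_left {W Ω Ω' Ω'' : Type} {l : Leg W Ω} {l' : Leg W Ω'} {l'' : Leg W Ω''}
    (h : l.Disj l') (h₁ : l.Disj l'') (h₂ : l'.Disj l'') : (l.prod l' h).Disj l'' where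
  left I y := by simp [Leg.prod, h₁.left, h₂.left]
  right I x := by simp [Leg.prod, h₁.right, h₂.right]
  comm I x y := by simp [Leg.prod, h₁.comm, h₂.comm]

theorem w2_w1_commute {C : Matrix (Fin n × Fin n) (Fin n × Fin n) B}
    {X : Matrix (Fin n) (Fin n) B} {a b k : ℕ} (ha : a ≠ k) (hb : b ≠ k)
    (hc : ∀ x y z w, Commute (C x y) (X z w)) : Commute (w2 m C a b) (w1 m X k) := by
  unfold w1 w2
  split_ifs
  · exact emb_commute (Leg.Disj.prod_left _ (legL_disj (by simpa using ha))
      (legL_disj (by simpa using hb))) C X hc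
  all_goals first | exact Commute.one_right _ | exact Commute.one_left _

theorem emb_prod_M1 {W : Type} [Fintype W] [DecidableEq W] {l l' : Leg W (Fin n)}
    (h : l.Disj l') (X : Matrix (Fin n) (Fin n) B) : emb (l.prod l' h) (M1 X) = emb l X := by
  suffices ∀ Z, emb (l.prod l' h) (M1 X) * Z = emb l X * Z by simpa using this 1
  intro Z
  ext I J
  rw [emb_mul_apply, emb_mul_apply, Fintype.sum_prod_type]
  refine Finset.sum_congr rfl fun x _ => ?_
  rw [Finset.sum_eq_single (l'.p I)]
  · have : l'.u (l.u I x) (l'.p I) = l.u I x := by rw [← h.right I x, l'.up]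
    simp [M1, Leg.prod, this]
  · intro y _ hy
    simp [M1, Leg.prod, hy.symm]
  · simp

theorem emb_prod_swap {W : Type} [Fintype W] [DecidableEq W] {l l' : Leg W (Fin n)}
    (h : l.Disj l') (C : Matrix (Fin n × Fin n) (Fin n × Fin n) B) :
    emb (l.prod l' h) (C.submatrix Prod.swap Prod.swap) = emb (l'.prod l h.symm) C := by
  suffices ∀ Z, emb (l.prod l' h) (C.submatrix Prod.swap Prod.swap) * Z =
    emb (l'.prod l h.symm) C * Z by simpa using this 1
  intro Z
  ext I J
  rw [emb_mul_apply, emb_mul_apply, Fintype.sum_prod_type, Fintype.sum_prod_type, Finset.sum_comm]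
  simp only [Leg.prod, Matrix.submatrix_apply, Prod.swap, h.comm]

theorem w2_M1 (X : Matrix (Fin n) (Fin n) B) {a b : ℕ} (ha : a < m) (hb : b < m) (h : a ≠ b) :
    w2 m (M1 X) a b = w1 m X a := by
  rw [w1, w2, dif_pos ⟨⟨ha, hb⟩, h⟩, dif_pos ha, emb_prod_M1]

theorem w2_swap (C : Matrix (Fin n × Fin n) (Fin n × Fin n) B) (a b : ℕ) :
    w2 m (C.submatrix Prod.swap Prod.swap) a b = w2 m C b a := by
  unfold w2
  by_cases h : (a < m ∧ b < m) ∧ a ≠ b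
  · have h' : (b < m ∧ a < m) ∧ b ≠ a := ⟨h.1.symm, h.2.symm⟩
    rw [dif_pos h, dif_pos h', emb_prod_swap]
  · have h' : ¬ ((b < m ∧ a < m) ∧ b ≠ a) := fun h' => h ⟨h'.1.symm, h'.2.symm⟩
    rw [dif_neg h, dif_neg h']

theorem w2_M2 (X : Matrix (Fin n) (Fin n) B) {a b : ℕ} (ha : a < m) (hb : b < m) (h : a ≠ b) :
    w2 m (M2 X) a b = w1 m X b := by
  rw [← w2_M1 X hb ha h.symm, ← w2_swap]
  congr 1

theorem leg1_eq (X : Matrix (Fin n) (Fin n) B) {a : ℕ} (ha : a < m) : leg1 n m X a = w1 m X a := by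
  ext I J
  rw [leg1, dif_pos ha, w1, dif_pos ha, emb_apply]
  congr 1
  simp only [legL, eq_iff_iff]
  constructor
  · intro h
    ext c
    by_cases hc : c = ⟨a, ha⟩
    · subst hc; simp
    · rw [Function.update_of_ne hc, h c (fun h' => hc (Fin.ext h'))]
  · intro h c hc
    rw [h, Function.update_of_ne]
    rintro rfl
    exact hc rfl

theorem leg2_eq (C : Matrix (Fin n × Fin n) (Fin n × Fin n) ℂ) {a b : ℕ} (ha : a < m) (hb : b < m)
    (hab : a ≠ b) : leg2 B n m C a b = w2 m (C.map (algebraMap ℂ B)) a b := by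
  ext I J
  rw [leg2, dif_pos ⟨ha, hb⟩, w2, dif_pos ⟨⟨ha, hb⟩, hab⟩, emb_apply]
  congr 1
  simp only [legL, Leg.prod, eq_iff_iff]
  constructor
  · intro h
    ext c
    by_cases hc : c = ⟨b, hb⟩
    · subst hc; simp
    by_cases hc' : c = ⟨a, ha⟩
    · subst hc'; rw [Function.update_of_ne hc]; simp
    · rw [Function.update_of_ne hc, Function.update_of_ne hc',
        h c (fun h' => hc' (Fin.ext h')) (fun h' => hc (Fin.ext h'))]
  · intro h c hc hc'
    rw [h, Function.update_of_ne, Function.update_of_ne]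
    · rintro rfl; exact hc rfl
    · rintro rfl; exact hc' rfl

variable (q B n m) in
/-- The braiding acting on the letters with indices `k`, `k + 1`. -/
def Tw (k : ℕ) : Matrix (Fin m → Fin n) (Fin m → Fin n) B := w2 m (TB q B n) k (k + 1)

variable (q B n m) in
/-- The inverse of the braiding acting on the letters with indices `k`, `k + 1`. -/
def Tw' (k : ℕ) : Matrix (Fin m → Fin n) (Fin m → Fin n) B :=
  w2 m (((Rcheck q n)⁻¹).map (algebraMap ℂ B)) k (k + 1)

theorem RcLeg_eq {k : ℕ} (hk : k + 1 < m) : RcLeg B q n m k = Tw n m q B k :=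
  leg2_eq _ (by omega) hk (by omega)

theorem RcLegInv_eq {k : ℕ} (hk : k + 1 < m) : RcLegInv B q n m k = Tw' n m q B k :=
  leg2_eq _ (by omega) hk (by omega)

theorem Tw_mul_inv (hq : q ≠ 0) (k : ℕ) : Tw n m q B k * Tw' n m q B k = 1 := by
  rw [Tw, Tw', ← w2_mul, TB_mul_inv' hq, w2_one]

theorem Tw_inv_mul (hq : q ≠ 0) (k : ℕ) : Tw' n m q B k * Tw n m q B k = 1 := by
  rw [Tw, Tw', ← w2_mul, TB_inv_mul hq, w2_one]

theorem Tw_map {B' : Type} [Ring B'] [Algebra ℂ B'] (f : B →ₐ[ℂ] B') (k : ℕ) :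
    (Tw n m q B k).map f = Tw n m q B' k := by
  rw [Tw, Tw, show ⇑f = ⇑(f : B →+* B') from rfl, w2_map]
  congr 1
  ext x y
  simp [TB]

theorem map_commute_algebraMap {Ω Ω' : Type} (C : Matrix Ω Ω ℂ) (X : Matrix Ω' Ω' B) (x y : Ω)
    (z w : Ω') : Commute ((C.map (algebraMap ℂ B)) x y) (X z w) := Algebra.commutes _ _

theorem Tw_commute_w1 (X : Matrix (Fin n) (Fin n) B) {k i : ℕ} (h : k ≠ i) (h' : k + 1 ≠ i) :
    Commute (Tw n m q B k) (w1 m X i) :=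
  w2_w1_commute h h' fun _ _ _ _ => map_commute_algebraMap _ _ _ _ _ _

theorem Tw'_commute_w1 (X : Matrix (Fin n) (Fin n) B) {k i : ℕ} (h : k ≠ i) (h' : k + 1 ≠ i) :
    Commute (Tw' n m q B k) (w1 m X i) :=
  w2_w1_commute h h' fun _ _ _ _ => map_commute_algebraMap _ _ _ _ _ _

theorem RLLK.Tw_asc {X Y K : Matrix (Fin n) (Fin n) B} (h : RLLK q X Y K) {k : ℕ} (hk : k + 1 < m) :
    Commute (Tw n m q B k) (asc (w1 m X) m) := by
  refine commute_asc_of_adjacent hk (fun i _ hi hi' => Tw_commute_w1 X hi.symm hi'.symm) ?_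
  have hk' : k < m := by omega
  rw [← w2_M1 X hk' hk (by omega), ← w2_M2 X hk' hk (by omega), ← w2_mul]
  change _ = _
  rw [Tw, ← w2_mul, h.tpp, w2_mul]

theorem RLLK.Tw_desc {X Y K : Matrix (Fin n) (Fin n) B} (h : RLLK q X Y K) {k : ℕ}
    (hk : k + 1 < m) : Commute (Tw n m q B k) (desc (w1 m K) m) := by
  refine commute_desc_of_adjacent hk (fun i _ hi hi' => Tw_commute_w1 K hi.symm hi'.symm) ?_
  have hk' : k < m := by omega
  rw [← w2_M1 K hk' hk (by omega), ← w2_M2 K hk' hk (by omega), ← w2_mul]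
  change _ = _
  rw [Tw, ← w2_mul, h.tkk, w2_mul]

variable (m) in
/-- The matrix `X₁ ⋯ Xₘ Kₘ ⋯ K₁`. -/
def LLw (X K : Matrix (Fin n) (Fin n) B) : Matrix (Fin m → Fin n) (Fin m → Fin n) B :=
  asc (w1 m X) m * desc (w1 m K) m

theorem RLLK.Tw_LLw {X Y K : Matrix (Fin n) (Fin n) B} (h : RLLK q X Y K) {k : ℕ}
    (hk : k + 1 < m) : Commute (Tw n m q B k) (LLw m X K) := (h.Tw_asc hk).mul_right (h.Tw_desc hk)

theorem RLLK.asc_legBar {X Y K : Matrix (Fin n) (Fin n) B} (hq : q ≠ 0) (h : RLLK q X Y K) :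
    asc (legBar q n m (X * K)) m = LLw m X K := by
  refine asc_braided (T := Tw n m q B) (T' := Tw' n m q B) (fun k _ => Tw_mul_inv hq k) ?_ ?_
    (fun k i _ hi => Tw_commute_w1 K (by omega) (by omega))
    (fun k i _ hi => Tw'_commute_w1 K (by omega) (by omega)) ?_ ?_
  · intro hm
    rw [legBar, leg1_eq _ hm, w1_mul]
  · intro k hk
    rw [legBar, RcLeg_eq hk, RcLegInv_eq hk]
  · intro k hk
    have hk' : k < m := by omega
    rw [← w2_M1 K hk' hk (by omega), ← w2_M2 K hk' hk (by omega), ← w2_mul, Tw, ← w2_mul, h.tkk,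
      w2_mul]
  · intro k hk
    have hk' : k < m := by omega
    rw [← w2_M1 K hk' hk (by omega), ← w2_M2 K hk' hk (by omega), ← w2_M1 X hk' hk (by omega),
      ← w2_M2 X hk' hk (by omega), Tw, ← w2_mul, ← w2_mul, ← w2_mul, ← w2_mul, h.tkx]

theorem asc_w1_mul {X X' : Matrix (Fin n) (Fin n) B} (h : ∀ a b c d, Commute (X a b) (X' c d)) :
    asc (w1 m (X * X')) m = asc (w1 m X) m * asc (w1 m X') m := by
  rw [← asc_mul_asc fun i _ j hj => w1_commute (by omega) fun a b c d => (h c d a b).symm]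
  exact asc_congr fun i _ => w1_mul X X' i

theorem desc_w1_mul {X X' : Matrix (Fin n) (Fin n) B} (h : ∀ a b c d, Commute (X a b) (X' c d)) :
    desc (w1 m (X * X')) m = desc (w1 m X) m * desc (w1 m X') m := by
  rw [← desc_mul_desc fun i _ j hj => w1_commute (by omega) fun a b c d => (h c d a b).symm]
  exact desc_congr fun i _ => w1_mul X X' i

end Words

/-! ### Matrices of matrices -/

section Blocks

set_option linter.unusedSectionVars false

variable {n m : ℕ} {q : ℂ} {B : Type} [Ring B] [Algebra ℂ B]

variable (q B n) in
/-- The R-matrix as a matrix of matrices: the outer indices are those of the first factor. -/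
def GX : Matrix (Fin n) (Fin n) (Matrix (Fin n) (Fin n) B) :=
  fun i j x y => RB q B n (i, x) (j, y)

variable (q B n) in
/-- The R-matrix as a matrix of matrices: the outer indices are those of the second factor. -/
def GK : Matrix (Fin n) (Fin n) (Matrix (Fin n) (Fin n) B) :=
  fun i j x y => RB q B n (x, i) (y, j)

theorem Rmat_fst_zero {i j : Fin n} (h : j < i) (x y : Fin n) : Rmat q n (i, x) (j, y) = 0 := by
  simp only [Rmat_apply, Prod.mk.injEq, Prod.swap, be]
  rw [if_neg (fun h' => h.ne h'.1)]
  split_ifs with h1 h2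
  · exact absurd (h1.1 ▸ h) h2.not_gt
  all_goals simp

theorem Rmat_snd_zero {i j : Fin n} (h : i < j) (x y : Fin n) : Rmat q n (x, i) (y, j) = 0 := by
  simp only [Rmat_apply, Prod.mk.injEq, Prod.swap, be]
  rw [if_neg (fun h' => h.ne' h'.2)]
  split_ifs with h1 h2
  · exact absurd (h1.2 ▸ h) h2.not_gt
  all_goals simp

theorem Rmat_fst_diag (i x y : Fin n) : Rmat q n (i, x) (i, y) = if y = x then al q i x else 0 := by
  simp only [Rmat_apply, Prod.mk.injEq, Prod.swap, true_and, be]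
  by_cases h : i = x <;> simp [h]

theorem Rmat_snd_diag (i x y : Fin n) : Rmat q n (x, i) (y, i) = if y = x then al q x i else 0 := by
  simp only [Rmat_apply, Prod.mk.injEq, Prod.swap, and_true, be]
  by_cases h : i = x <;> simp [h]

theorem al_ne_zero (hq : q ≠ 0) (i j : Fin n) : al q i j ≠ 0 := by
  unfold al; split_ifs <;> simp [hq]

/-- The first of three legs. -/
def leg31 (n : ℕ) : Leg ((Fin n × Fin n) × Fin n) (Fin n) where
  p w := w.1.1
  u w x := ((x, w.1.2), w.2)
  pu _ _ := rfl
  uu _ _ _ := rfl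
  up _ := rfl

/-- The second of three legs. -/
def leg32 (n : ℕ) : Leg ((Fin n × Fin n) × Fin n) (Fin n) where
  p w := w.1.2
  u w x := ((w.1.1, x), w.2)
  pu _ _ := rfl
  uu _ _ _ := rfl
  up _ := rfl

/-- The third of three legs. -/
def leg33 (n : ℕ) : Leg ((Fin n × Fin n) × Fin n) (Fin n) where
  p w := w.2
  u w x := (w.1, x)
  pu _ _ := rfl
  uu _ _ _ := rfl
  up _ := rfl

theorem disj12 : (leg31 n).Disj (leg32 n) := ⟨fun _ _ => rfl, fun _ _ => rfl, fun _ _ _ => rfl⟩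
theorem disj13 : (leg31 n).Disj (leg33 n) := ⟨fun _ _ => rfl, fun _ _ => rfl, fun _ _ _ => rfl⟩
theorem disj23 : (leg32 n).Disj (leg33 n) := ⟨fun _ _ => rfl, fun _ _ => rfl, fun _ _ _ => rfl⟩

theorem comp_M1 (G : Matrix (Fin n) (Fin n) (Matrix (Fin n) (Fin n) B)) :
    Matrix.compRingEquiv (Fin n × Fin n) (Fin n) B (M1 G) =
      emb ((leg31 n).prod (leg33 n) disj13) (Matrix.of fun w z => G w.1 z.1 w.2 z.2) := by
  ext ⟨⟨a, b⟩, c⟩ ⟨⟨a', b'⟩, c'⟩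
  rw [Matrix.compRingEquiv_apply, Matrix.comp_apply, emb_apply]
  simp only [M1]
  by_cases h : b = b' <;> simp [leg31, leg33, Leg.prod, h, eq_comm]

theorem comp_M2 (G : Matrix (Fin n) (Fin n) (Matrix (Fin n) (Fin n) B)) :
    Matrix.compRingEquiv (Fin n × Fin n) (Fin n) B (M2 G) =
      emb ((leg32 n).prod (leg33 n) disj23) (Matrix.of fun w z => G w.1 z.1 w.2 z.2) := by
  ext ⟨⟨a, b⟩, c⟩ ⟨⟨a', b'⟩, c'⟩
  rw [Matrix.compRingEquiv_apply, Matrix.comp_apply, emb_apply]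
  simp only [M2]
  by_cases h : a = a' <;> simp [leg32, leg33, Leg.prod, h, eq_comm]

theorem comp_RB :
    Matrix.compRingEquiv (Fin n × Fin n) (Fin n) B (RB q (Matrix (Fin n) (Fin n) B) n) =
      emb ((leg31 n).prod (leg32 n) disj12) (RB q B n) := by
  ext ⟨⟨a, b⟩, c⟩ ⟨⟨a', b'⟩, c'⟩
  rw [Matrix.compRingEquiv_apply, Matrix.comp_apply, emb_apply]
  by_cases h : c = c' <;>
    simp [leg31, leg32, Leg.prod, h, eq_comm, RB, Matrix.algebraMap_matrix_apply]

theorem RLLK_G (hq : q ≠ 0) : RLLK q (GX n q B) (GK n q⁻¹ B) (GK n q B) where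
  upper i j h := by ext x y; simp [GX, RB, Rmat_fst_zero h]
  lower i j h := by ext x y; simp [GK, RB, Rmat_snd_zero h]
  diag i := by
    ext x y
    simp only [Matrix.mul_apply, GX, GK, RB, Matrix.map_apply, Rmat_fst_diag, Rmat_snd_diag,
      Matrix.one_apply, ← map_mul, ← map_sum, al_inv]
    have := al_ne_zero hq i y
    by_cases h : x = y
    · simp [h, al_symm q y i]
      rw [← map_mul, mul_inv_cancel₀ this, map_one]
    · simp [h, eq_comm]
  diag' i := by
    ext x y
    simp only [Matrix.mul_apply, GX, GK, RB, Matrix.map_apply, Rmat_fst_diag, Rmat_snd_diag,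
      Matrix.one_apply, ← map_mul, ← map_sum, al_inv]
    have := al_ne_zero hq i y
    by_cases h : x = y
    · simp [h, al_symm q y i]
      rw [← map_mul, inv_mul_cancel₀ this, map_one]
    · simp [h, eq_comm]
  pp := by
    apply (Matrix.compRingEquiv (Fin n × Fin n) (Fin n) B).injective
    simp only [map_mul, comp_M1, comp_M2, comp_RB]
    exact yang_baxter q hq disj12 disj13 disj23
  mm := by
    apply (Matrix.compRingEquiv (Fin n × Fin n) (Fin n) B).injective
    simp only [map_mul, comp_M1, comp_M2, comp_RB]
    have h1 : emb ((leg31 n).prod (leg33 n) disj13) (Matrix.of fun w z => GK n q⁻¹ B w.1 z.1 w.2 z.2) =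
        emb ((leg33 n).prod (leg31 n) disj13.symm) (RB q⁻¹ B n) := emb_prod_swap disj13 _
    have h2 : emb ((leg32 n).prod (leg33 n) disj23) (Matrix.of fun w z => GK n q⁻¹ B w.1 z.1 w.2 z.2) =
        emb ((leg33 n).prod (leg32 n) disj23.symm) (RB q⁻¹ B n) := emb_prod_swap disj23 _
    rw [h1, h2]
    have h := yang_baxter (B := B) q hq disj13.symm disj23.symm disj12 (n := n)
    have i1 : emb ((leg33 n).prod (leg31 n) disj13.symm) (RB q⁻¹ B n) *
      emb ((leg33 n).prod (leg31 n) disj13.symm) (RB q B n) = 1 := by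
        rw [← map_mul, RB_inv_mul hq, map_one]
    have i1' : emb ((leg33 n).prod (leg31 n) disj13.symm) (RB q B n) *
      emb ((leg33 n).prod (leg31 n) disj13.symm) (RB q⁻¹ B n) = 1 := by
        rw [← map_mul, RB_mul_inv hq, map_one]
    have i2 : emb ((leg33 n).prod (leg32 n) disj23.symm) (RB q⁻¹ B n) *
      emb ((leg33 n).prod (leg32 n) disj23.symm) (RB q B n) = 1 := by
        rw [← map_mul, RB_inv_mul hq, map_one]
    have i2' : emb ((leg33 n).prod (leg32 n) disj23.symm) (RB q B n) *
      emb ((leg33 n).prod (leg32 n) disj23.symm) (RB q⁻¹ B n) = 1 := by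
        rw [← map_mul, RB_mul_inv hq, map_one]
    revert h i1 i1' i2 i2'
    generalize emb ((leg33 n).prod (leg31 n) disj13.symm) (RB q⁻¹ B n) = a'
    generalize emb ((leg33 n).prod (leg31 n) disj13.symm) (RB q B n) = a
    generalize emb ((leg33 n).prod (leg32 n) disj23.symm) (RB q⁻¹ B n) = b'
    generalize emb ((leg33 n).prod (leg32 n) disj23.symm) (RB q B n) = b
    generalize emb ((leg31 n).prod (leg32 n) disj12) (RB q B n) = r
    intro h i1 i1' i2 i2'
    calc r * a' * b' = b' * ((a' * a) * b) * r * a' * b' := by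
          rw [i1, one_mul, i2, one_mul]
      _ = b' * a' * (a * b * r) * a' * b' := by simp only [mul_assoc]
      _ = b' * a' * r * (b * (a * a') * b') := by rw [h]; simp only [mul_assoc]
      _ = b' * a' * r := by rw [i1', mul_one, i2', mul_one]
  pm := by
    apply (Matrix.compRingEquiv (Fin n × Fin n) (Fin n) B).injective
    simp only [map_mul, comp_M1, comp_M2, comp_RB]
    have h2 : emb ((leg32 n).prod (leg33 n) disj23) (Matrix.of fun w z => GK n q⁻¹ B w.1 z.1 w.2 z.2) =
        emb ((leg33 n).prod (leg32 n) disj23.symm) (RB q⁻¹ B n) := emb_prod_swap disj23 _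
    rw [h2]
    change emb ((leg31 n).prod (leg32 n) disj12) (RB q B n) *
      emb ((leg31 n).prod (leg33 n) disj13) (RB q B n) * _ =
      _ * emb ((leg31 n).prod (leg33 n) disj13) (RB q B n) * _
    have h := yang_baxter (B := B) q hq disj13 disj12 disj23.symm (n := n)
    have i2 : emb ((leg33 n).prod (leg32 n) disj23.symm) (RB q⁻¹ B n) *
      emb ((leg33 n).prod (leg32 n) disj23.symm) (RB q B n) = 1 := by
        rw [← map_mul, RB_inv_mul hq, map_one]
    have i2' : emb ((leg33 n).prod (leg32 n) disj23.symm) (RB q B n) *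
      emb ((leg33 n).prod (leg32 n) disj23.symm) (RB q⁻¹ B n) = 1 := by
        rw [← map_mul, RB_mul_inv hq, map_one]
    revert h i2 i2'
    generalize emb ((leg31 n).prod (leg33 n) disj13) (RB q B n) = a
    generalize emb ((leg33 n).prod (leg32 n) disj23.symm) (RB q⁻¹ B n) = b'
    generalize emb ((leg33 n).prod (leg32 n) disj23.symm) (RB q B n) = b
    generalize emb ((leg31 n).prod (leg32 n) disj12) (RB q B n) = r
    intro h i2 i2'
    calc r * a * b' = b' * (b * r * a) * b' := by
          rw [mul_assoc b r, ← mul_assoc b', i2, one_mul]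
      _ = b' * a * r * (b * b') := by rw [← h]; simp only [mul_assoc]
      _ = b' * a * r := by rw [i2', mul_one]
  inv := by
    apply (Matrix.compRingEquiv (Fin n) (Fin n) B).injective
    rw [map_mul, map_one]
    change (RB q⁻¹ B n).submatrix Prod.swap Prod.swap * (RB q B n).submatrix Prod.swap Prod.swap = 1
    rw [← Matrix.submatrix_mul _ _ _ _ _ Prod.swap_bijective, RB_inv_mul hq]
    exact Matrix.submatrix_one_equiv (Equiv.prodComm _ _)
  inv' := by
    apply (Matrix.compRingEquiv (Fin n) (Fin n) B).injective
    rw [map_mul, map_one]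
    change (RB q B n).submatrix Prod.swap Prod.swap * (RB q⁻¹ B n).submatrix Prod.swap Prod.swap = 1
    rw [← Matrix.submatrix_mul _ _ _ _ _ Prod.swap_bijective, RB_mul_inv hq]
    exact Matrix.submatrix_one_equiv (Equiv.prodComm _ _)

end Blocks

/-! ### The representations on words -/

section BlockWords

set_option linter.unusedSectionVars false

variable {n m : ℕ} {q : ℂ} {B : Type} [Ring B] [Algebra ℂ B]
variable {W : Type} [Fintype W] [DecidableEq W]

/-- Exchange of the outer and inner indices of a matrix of matrices. -/
def flip {V : Type} [Fintype V] [DecidableEq V] :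
    Matrix W W (Matrix V V B) →+* Matrix V V (Matrix W W B) where
  toFun Z := Matrix.of fun i j => Matrix.of fun I J => Z I J i j
  map_one' := by
    ext i j I J
    change (1 : Matrix W W (Matrix V V B)) I J i j = _
    by_cases h : i = j <;> by_cases h' : I = J <;> simp [Matrix.one_apply, h, h']
  map_mul' X Y := by
    ext i j I J
    rw [Matrix.mul_apply]
    simp only [Matrix.sum_apply, Matrix.of_apply, Matrix.mul_apply]
    exact Finset.sum_comm
  map_zero' := rfl
  map_add' _ _ := rfl

theorem flip_apply {V : Type} [Fintype V] [DecidableEq V] (Z : Matrix W W (Matrix V V B)) (i j : V)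
    (I J : W) : flip Z i j I J = Z I J i j := rfl

theorem flip_emb {V : Type} [Fintype V] [DecidableEq V] (l : Leg W V)
    (Z : Matrix V V (Matrix V V B)) : flip (emb l Z) = (flip Z).map (emb l) := by
  ext i j I J
  simp only [flip_apply, Matrix.map_apply, emb_apply]
  split_ifs <;> rfl

theorem flip_map_scalar (V : Type) [Fintype V] [DecidableEq V] (Z : Matrix W W B) :
    flip (Z.map (Matrix.scalar V)) = Matrix.scalar V Z := by
  ext i j I J
  by_cases h : i = j <;> simp [flip_apply, h]

theorem flip_GX : flip (GX n q B) = GK n q B := rfl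
theorem flip_GK : flip (GK n q B) = GX n q B := rfl

variable (W) in
/-- A matrix with scalar blocks. -/
def scal : Matrix (Fin n) (Fin n) B →+* Matrix (Fin n) (Fin n) (Matrix W W B) :=
  (Matrix.scalar W).mapMatrix

theorem scal_apply (X : Matrix (Fin n) (Fin n) B) (i j : Fin n) :
    scal W X i j = Matrix.scalar W (X i j) := rfl

/-- A matrix on pairs, the first index being the outer one and the second acting on a leg. -/
def blk (l : Leg W (Fin n)) :
    Matrix (Fin n × Fin n) (Fin n × Fin n) B →+* Matrix (Fin n) (Fin n) (Matrix W W B) :=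
  (emb l).mapMatrix.comp (Matrix.compRingEquiv (Fin n) (Fin n) B).symm.toRingHom

/-- A matrix on pairs, the second index being the outer one and the first acting on a leg. -/
def blk' (l : Leg W (Fin n)) :
    Matrix (Fin n × Fin n) (Fin n × Fin n) B →+* Matrix (Fin n) (Fin n) (Matrix W W B) :=
  (blk l).comp (Matrix.reindexRingEquiv B (Equiv.prodComm (Fin n) (Fin n))).toRingHom

theorem blk_apply (l : Leg W (Fin n)) (Z : Matrix (Fin n × Fin n) (Fin n × Fin n) B) (i j : Fin n) :
    blk l Z i j = emb l (Matrix.of fun x y => Z (i, x) (j, y)) := rfl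

theorem blk'_apply (l : Leg W (Fin n)) (Z : Matrix (Fin n × Fin n) (Fin n × Fin n) B)
    (i j : Fin n) : blk' l Z i j = emb l (Matrix.of fun x y => Z (x, i) (y, j)) := rfl

theorem emb_scalar {Ω : Type} [Fintype Ω] [DecidableEq Ω] (l : Leg W Ω) (c : B) :
    emb l (Matrix.scalar Ω c) = Matrix.scalar W c := by
  suffices ∀ Z, emb l (Matrix.scalar Ω c) * Z = Matrix.scalar W c * Z by simpa using this 1
  intro Z
  ext I J
  rw [emb_mul_apply]
  simp [Matrix.diagonal_apply, l.up]

theorem blk_M1 (l : Leg W (Fin n)) (X : Matrix (Fin n) (Fin n) B) : blk l (M1 X) = scal W X := by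
  ext1 i j
  rw [blk_apply, scal_apply, ← emb_scalar l]
  rfl

theorem blk_M2 (l : Leg W (Fin n)) (X : Matrix (Fin n) (Fin n) B) :
    blk l (M2 X) = Matrix.scalar (Fin n) (emb l X) := by
  ext1 i j
  rw [blk_apply, Matrix.scalar_apply, Matrix.diagonal_apply]
  by_cases h : i = j
  · rw [if_pos h]; congr 1; ext x y; simp [M2, h]
  · rw [if_neg h, ← map_zero (emb l)]; congr 1; ext x y; simp [M2, h]

theorem blk'_M1 (l : Leg W (Fin n)) (X : Matrix (Fin n) (Fin n) B) :
    blk' l (M1 X) = Matrix.scalar (Fin n) (emb l X) := by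
  ext1 i j
  rw [blk'_apply, Matrix.scalar_apply, Matrix.diagonal_apply]
  by_cases h : i = j
  · rw [if_pos h]; congr 1; ext x y; simp [M1, h]
  · rw [if_neg h, ← map_zero (emb l)]; congr 1; ext x y; simp [M1, h]

theorem blk'_M2 (l : Leg W (Fin n)) (X : Matrix (Fin n) (Fin n) B) : blk' l (M2 X) = scal W X := by
  ext1 i j
  rw [blk'_apply, scal_apply, ← emb_scalar l]
  rfl

theorem blk_RB (l : Leg W (Fin n)) : blk l (RB q B n) = (GX n q B).map (emb l) := rfl
theorem blk'_RB (l : Leg W (Fin n)) : blk' l (RB q B n) = (GK n q B).map (emb l) := rfl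

variable (q B n m) in
/-- The R-matrix with first factor outer and second factor the letter `k`. -/
def gX (k : ℕ) : Matrix (Fin n) (Fin n) (Matrix (Fin m → Fin n) (Fin m → Fin n) B) :=
  if h : k < m then (GX n q B).map (emb (legL n ⟨k, h⟩)) else 1

variable (q B n m) in
/-- The R-matrix with second factor outer and first factor the letter `k`. -/
def gK (k : ℕ) : Matrix (Fin n) (Fin n) (Matrix (Fin m → Fin n) (Fin m → Fin n) B) :=
  if h : k < m then (GK n q B).map (emb (legL n ⟨k, h⟩)) else 1

theorem flip_w1_GX (k : ℕ) : flip (w1 m (GX n q B) k) = gK n m q B k := by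
  unfold w1 gK
  split_ifs
  · rw [flip_emb, flip_GX]
  · exact map_one _

theorem flip_w1_GK (k : ℕ) : flip (w1 m (GK n q B) k) = gX n m q B k := by
  unfold w1 gX
  split_ifs
  · rw [flip_emb, flip_GK]
  · exact map_one _

variable (q B n m) in
/-- The image of `L⁺` on words. -/
def bX : Matrix (Fin n) (Fin n) (Matrix (Fin m → Fin n) (Fin m → Fin n) B) :=
  desc (gX n m q B) m

variable (q B n m) in
/-- The image of `L⁻` on words. -/
def bY : Matrix (Fin n) (Fin n) (Matrix (Fin m → Fin n) (Fin m → Fin n) B) :=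
  desc (gK n m q⁻¹ B) m

variable (q B n m) in
/-- The image of `(L⁻)⁻¹` on words. -/
def aK : Matrix (Fin n) (Fin n) (Matrix (Fin m → Fin n) (Fin m → Fin n) B) :=
  asc (gK n m q B) m

/-- The ring homomorphism `emb` as a homomorphism of algebras. -/
def embAlg {Ω : Type} [Fintype Ω] [DecidableEq Ω] (l : Leg W Ω) :
    Matrix Ω Ω B →ₐ[ℂ] Matrix W W B :=
  { emb l with
    commutes' := fun c => by
      simp only [Algebra.algebraMap_eq_smul_one]
      exact (emb_smul l c 1).trans (by rw [map_one]) }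

theorem RLLK_g (hq : q ≠ 0) (k : ℕ) : RLLK q (gX n m q B k) (gK n m q⁻¹ B k) (gK n m q B k) := by
  unfold gX gK
  split_ifs with h
  · exact (RLLK_G (B := B) hq).map (embAlg (legL n ⟨k, h⟩))
  · exact RLLK.one

theorem RB_commute (p : ℂ) (x y : Fin n × Fin n) (c : B) : Commute (RB p B n x y) c :=
  Algebra.commutes _ _

theorem commute_desc_entries {V : Type} [Fintype V] [DecidableEq V] {R : Type} [Ring R]
    {f : ℕ → Matrix V V R} {c : R} {k : ℕ} (h : ∀ i < k, ∀ a b, Commute c (f i a b)) (a b : V) :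
    Commute c (desc f k a b) := by
  induction k generalizing a b with
  | zero =>
    change Commute c ((1 : Matrix V V R) a b)
    rw [Matrix.one_apply]; split_ifs
    exacts [Commute.one_right _, Commute.zero_right _]
  | succ k ih =>
    exact Commute.sum_right _ _ _ fun x _ =>
      (h k (Nat.lt_succ_self k) a x).mul_right (ih (fun i hi => h i (by omega)) x b)

theorem commute_asc_entries {V : Type} [Fintype V] [DecidableEq V] {R : Type} [Ring R]
    {f : ℕ → Matrix V V R} {c : R} {k : ℕ} (h : ∀ i < k, ∀ a b, Commute c (f i a b)) (a b : V) :
    Commute c (asc f k a b) := by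
  induction k generalizing a b with
  | zero =>
    change Commute c ((1 : Matrix V V R) a b)
    rw [Matrix.one_apply]; split_ifs
    exacts [Commute.one_right _, Commute.zero_right _]
  | succ k ih =>
    exact Commute.sum_right _ _ _ fun x _ =>
      (ih (fun i hi => h i (by omega)) a x).mul_right (h k (Nat.lt_succ_self k) x b)

theorem gX_apply {k : ℕ} (h : k < m) (i j : Fin n) :
    gX n m q B k i j = w1 m (Matrix.of fun x y => RB q B n (i, x) (j, y)) k := by
  rw [gX, w1, dif_pos h, dif_pos h]; rfl

theorem gK_apply {k : ℕ} (h : k < m) (i j : Fin n) :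
    gK n m q B k i j = w1 m (Matrix.of fun x y => RB q B n (x, i) (y, j)) k := by
  rw [gK, w1, dif_pos h, dif_pos h]; rfl

theorem RLLK_prefix (hq : q ≠ 0) {k : ℕ} (hk : k ≤ m) :
    RLLK q (desc (gX n m q B) k) (desc (gK n m q⁻¹ B) k) (asc (gK n m q B) k) := by
  induction k with
  | zero => exact RLLK.one
  | succ k ih =>
    refine (RLLK_g hq k).mul (ih (by omega)) ?_ ?_ ?_ ?_ <;> intro a b c d <;>
      refine commute_desc_entries (fun i hi a' b' => ?_) c d
    · rw [gX_apply (by omega), gX_apply (by omega)]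
      exact w1_commute (by omega) fun _ _ _ _ => RB_commute _ _ _ _
    · rw [gX_apply (by omega), gK_apply (by omega)]
      exact w1_commute (by omega) fun _ _ _ _ => RB_commute _ _ _ _
    · rw [gK_apply (by omega), gX_apply (by omega)]
      exact w1_commute (by omega) fun _ _ _ _ => RB_commute _ _ _ _
    · rw [gK_apply (by omega), gK_apply (by omega)]
      exact w1_commute (by omega) fun _ _ _ _ => RB_commute _ _ _ _

theorem RLLK_words (hq : q ≠ 0) : RLLK q (bX n m q B) (bY n m q B) (aK n m q B) :=
  RLLK_prefix hq le_rfl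

theorem flip_asc_GX : flip (asc (w1 m (GX n q B)) m) = aK n m q B := by
  rw [map_asc]; exact asc_congr fun _ _ => flip_w1_GX _

theorem flip_desc_GK : flip (desc (w1 m (GK n q B)) m) = bX n m q B := by
  rw [map_desc]; exact desc_congr fun _ _ => flip_w1_GK _

theorem Tw_map_scalar (V : Type) [Fintype V] [DecidableEq V] (k : ℕ) :
    Tw n m q (Matrix V V B) k = (Tw n m q B k).map (Matrix.scalar V) :=
  (Tw_map (B := B) (Matrix.scalarAlgHom V ℂ) k).symm

theorem Tw_commute_aK (hq : q ≠ 0) {k : ℕ} (hk : k + 1 < m) :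
    Commute (Matrix.scalar (Fin n) (Tw n m q B k)) (aK n m q B) := by
  have h := ((RLLK_G (B := B) (n := n) hq).Tw_asc hk).map (flip (B := B))
  rwa [flip_asc_GX, Tw_map_scalar, flip_map_scalar] at h

theorem Tw_commute_bX (hq : q ≠ 0) {k : ℕ} (hk : k + 1 < m) :
    Commute (Matrix.scalar (Fin n) (Tw n m q B k)) (bX n m q B) := by
  have h := ((RLLK_G (B := B) (n := n) hq).Tw_desc hk).map (flip (B := B))
  rwa [flip_desc_GK, Tw_map_scalar, flip_map_scalar] at h

theorem scalar_commute_iff {V R : Type} [Fintype V] [DecidableEq V] [Ring R] {c : R}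
    {Z : Matrix V V R} : Commute (Matrix.scalar V c) Z ↔ ∀ i j, Commute c (Z i j) := by
  constructor
  · intro h i j
    have := congrFun (congrFun h.eq i) j
    simpa [Matrix.diagonal_mul, Matrix.mul_diagonal, Commute, SemiconjBy] using this
  · intro h
    ext i j
    simpa [Matrix.diagonal_mul, Matrix.mul_diagonal] using (h i j).eq

/-- Multiplicativity of the Gauss-type matrix `X₁ ⋯ Xₘ Kₘ ⋯ K₁` under the coproduct. -/
theorem flip_LLw {X K : Matrix (Fin n) (Fin n) B} :
    flip (LLw m (GX n q B * X.map (Matrix.scalar (Fin n)))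
      (K.map (Matrix.scalar (Fin n)) * GK n q B)) =
      aK n m q B * Matrix.scalar (Fin n) (LLw m X K) * bX n m q B := by
  have h1 : ∀ (X : Matrix (Fin n) (Fin n) B) (a b c d),
      Commute (GX n q B a b) ((X.map (Matrix.scalar (Fin n))) c d) := fun X a b c d =>
    (scalar_commute_iff.2 fun i j => (RB_commute _ _ _ _).symm).symm
  have h2 : ∀ (X : Matrix (Fin n) (Fin n) B) (a b c d),
      Commute ((X.map (Matrix.scalar (Fin n))) c d) (GK n q B a b) := fun X a b c d =>
    (scalar_commute_iff.2 fun i j => (RB_commute _ _ _ _).symm)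
  have h3 : ∀ Z : Matrix (Fin n) (Fin n) B, ∀ k, flip (w1 m (Z.map (Matrix.scalar (Fin n))) k) =
      Matrix.scalar (Fin n) (w1 m Z k) := fun Z k => by
    rw [← flip_map_scalar, w1_map]
  rw [LLw, map_mul, asc_w1_mul (h1 X), desc_w1_mul fun a b c d => h2 K c d a b, map_mul, map_mul,
    flip_asc_GX, flip_desc_GK, map_asc, map_desc, LLw, map_mul, map_asc, map_desc]
  simp only [mul_assoc]
  congr 2
  · exact asc_congr fun i _ => h3 X i
  · congr 1
    exact desc_congr fun i _ => h3 K i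

end BlockWords

section BlockRelations

set_option linter.unusedSectionVars false

variable {n m : ℕ} {q : ℂ} {B : Type} [Ring B] [Algebra ℂ B] {X Y K : Matrix (Fin n) (Fin n) B}

variable (n m) in
/-- The matrix `X` acting on a letter, as a block scalar matrix. -/
def dg (X : Matrix (Fin n) (Fin n) B) (k : ℕ) :
    Matrix (Fin n) (Fin n) (Matrix (Fin m → Fin n) (Fin m → Fin n) B) :=
  Matrix.scalar (Fin n) (w1 m X k)

theorem dg_mul (X X' : Matrix (Fin n) (Fin n) B) (k : ℕ) :
    dg n m (X * X') k = dg n m X k * dg n m X' k := by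
  rw [dg, w1_mul, map_mul]; rfl

theorem blk_M2_letter {k : ℕ} (hk : k < m) (Z : Matrix (Fin n) (Fin n) B) :
    blk (legL n ⟨k, hk⟩) (M2 Z) = dg n m Z k := by rw [blk_M2, dg, w1, dif_pos hk]

theorem blk'_M1_letter {k : ℕ} (hk : k < m) (Z : Matrix (Fin n) (Fin n) B) :
    blk' (legL n ⟨k, hk⟩) (M1 Z) = dg n m Z k := by rw [blk'_M1, dg, w1, dif_pos hk]

theorem blk_RB_letter {k : ℕ} (hk : k < m) :
    blk (legL n ⟨k, hk⟩) (RB q B n) = gX n m q B k := by rw [blk_RB, gX, dif_pos hk]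

theorem blk'_RB_letter {k : ℕ} (hk : k < m) :
    blk' (legL n ⟨k, hk⟩) (RB q B n) = gK n m q B k := by rw [blk'_RB, gK, dif_pos hk]

theorem RLLK.g_pp (h : RLLK q X Y K) {k : ℕ} (hk : k < m) :
    gX n m q B k * scal _ X * dg n m X k = dg n m X k * scal _ X * gX n m q B k := by
  have := congrArg (blk (legL n ⟨k, hk⟩)) h.pp
  simpa only [map_mul, blk_M1, blk_M2_letter hk, blk_RB_letter hk] using this

theorem RLLK.g_kx (h : RLLK q X Y K) {k : ℕ} (hk : k < m) :
    dg n m K k * gX n m q B k * scal _ X = scal _ X * gX n m q B k * dg n m K k := by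
  have := congrArg (blk (legL n ⟨k, hk⟩)) h.kx
  simpa only [map_mul, blk_M1, blk_M2_letter hk, blk_RB_letter hk] using this

theorem RLLK.g_kk (h : RLLK q X Y K) {k : ℕ} (hk : k < m) :
    gX n m q B k * dg n m K k * scal _ K = scal _ K * dg n m K k * gX n m q B k := by
  have := congrArg (blk (legL n ⟨k, hk⟩)) h.kk
  simpa only [map_mul, blk_M1, blk_M2_letter hk, blk_RB_letter hk] using this

theorem RLLK.g'_kx (h : RLLK q X Y K) {k : ℕ} (hk : k < m) :
    scal _ K * gK n m q B k * dg n m X k = dg n m X k * gK n m q B k * scal _ K := by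
  have := congrArg (blk' (legL n ⟨k, hk⟩)) h.kx
  simpa only [map_mul, blk'_M2, blk'_M1_letter hk, blk'_RB_letter hk] using this

theorem RLLK.g'_kk (h : RLLK q X Y K) {k : ℕ} (hk : k < m) :
    gK n m q B k * scal _ K * dg n m K k = dg n m K k * scal _ K * gK n m q B k := by
  have := congrArg (blk' (legL n ⟨k, hk⟩)) h.kk
  simpa only [map_mul, blk'_M2, blk'_M1_letter hk, blk'_RB_letter hk] using this

theorem dg_commute_gX (Z : Matrix (Fin n) (Fin n) B) {k j : ℕ} (hj : j < m) (h : k ≠ j) :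
    Commute (dg n m Z k) (gX n m q B j) :=
  scalar_commute_iff.2 fun a b => by
    rw [gX_apply hj]
    exact w1_commute h fun _ _ _ _ => (RB_commute _ _ _ _).symm

theorem dg_commute_gK (Z : Matrix (Fin n) (Fin n) B) {k j : ℕ} (hj : j < m) (h : k ≠ j) :
    Commute (dg n m Z k) (gK n m q B j) :=
  scalar_commute_iff.2 fun a b => by
    rw [gK_apply hj]
    exact w1_commute h fun _ _ _ _ => (RB_commute _ _ _ _).symm

theorem RLLK.legBar_zero_bX (h : RLLK q X Y K) (hm : 0 < m) :
    Commute (dg n m (X * K) 0) (bX n m q B * scal _ X) := by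
  have key : ∀ k, 1 ≤ k → k ≤ m →
      Commute (dg n m (X * K) 0) (desc (gX n m q B) k * scal _ X) := by
    intro k hk
    induction k, hk using Nat.le_induction with
    | base =>
      intro _
      change _ = _
      rw [dg_mul]
      change _ * (_ * 1 * _) = _ * 1 * _ * _
      rw [mul_one]
      calc dg n m X 0 * dg n m K 0 * (gX n m q B 0 * scal _ X)
          = dg n m X 0 * (dg n m K 0 * gX n m q B 0 * scal _ X) := by simp only [mul_assoc]
        _ = dg n m X 0 * scal _ X * gX n m q B 0 * dg n m K 0 := by
          rw [h.g_kx hm]; simp only [mul_assoc]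
        _ = _ := by rw [← h.g_pp hm]; simp only [mul_assoc]
    | succ k hk ih =>
      intro hkm
      change Commute _ (gX n m q B k * desc (gX n m q B) k * _)
      rw [mul_assoc]
      exact (dg_commute_gX _ (by omega) (by omega)).mul_right (ih (by omega))
  exact key m hm le_rfl

theorem RLLK.legBar_zero_aK (h : RLLK q X Y K) (hm : 0 < m) :
    Commute (dg n m (X * K) 0) (scal _ K * aK n m q B) := by
  have key : ∀ k, 1 ≤ k → k ≤ m →
      Commute (dg n m (X * K) 0) (scal _ K * asc (gK n m q B) k) := by
    intro k hk
    induction k, hk using Nat.le_induction with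
    | base =>
      intro _
      change _ = _
      rw [dg_mul]
      change _ * (_ * (1 * _)) = _ * (1 * _) * _
      rw [one_mul]
      calc dg n m X 0 * dg n m K 0 * (scal _ K * gK n m q B 0)
          = dg n m X 0 * (dg n m K 0 * scal _ K * gK n m q B 0) := by simp only [mul_assoc]
        _ = dg n m X 0 * gK n m q B 0 * scal _ K * dg n m K 0 := by
          rw [← h.g'_kk hm]; simp only [mul_assoc]
        _ = _ := by rw [← h.g'_kx hm]; simp only [mul_assoc]
    | succ k hk ih =>
      intro hkm
      change Commute _ (_ * (asc (gK n m q B) k * gK n m q B k))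
      rw [← mul_assoc]
      exact (ih (by omega)).mul_right (dg_commute_gK _ (by omega) (by omega))
  exact key m hm le_rfl

theorem Tw_commute_scal (Z : Matrix (Fin n) (Fin n) B) (k : ℕ) :
    Commute (Matrix.scalar (Fin n) (Tw n m q B k)) (scal _ Z) :=
  scalar_commute_iff.2 fun a b => (scalar_commute_iff.2 fun I J => by
    rw [show Tw n m q B k = (Tw n m q ℂ k).map (algebraMap ℂ B) from
      (Tw_map (Algebra.ofId ℂ B) k).symm]
    exact (Algebra.commutes _ _).symm).symm

theorem Tw'_commute_of {k : ℕ} (hq : q ≠ 0)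
    {Z : Matrix (Fin n) (Fin n) (Matrix (Fin m → Fin n) (Fin m → Fin n) B)}
    (h : Commute (Matrix.scalar (Fin n) (Tw n m q B k)) Z) :
    Commute (Matrix.scalar (Fin n) (Tw' n m q B k)) Z := by
  have h1 : Matrix.scalar (Fin n) (Tw n m q B k) * Matrix.scalar (Fin n) (Tw' n m q B k) = 1 := by
    rw [← map_mul, Tw_mul_inv hq, map_one]
  have h2 : Matrix.scalar (Fin n) (Tw' n m q B k) * Matrix.scalar (Fin n) (Tw n m q B k) = 1 := by
    rw [← map_mul, Tw_inv_mul hq, map_one]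
  exact Commute.units_inv_left (u := ⟨_, _, h1, h2⟩) h

theorem legBar_commute_of (hq : q ≠ 0) {L : Matrix (Fin n) (Fin n) B}
    {Z : Matrix (Fin n) (Fin n) (Matrix (Fin m → Fin n) (Fin m → Fin n) B)} {k : ℕ} (hk : k < m)
    (h0 : Commute (dg n m L 0) Z)
    (hT : ∀ k, k + 1 < m → Commute (Matrix.scalar (Fin n) (Tw n m q B k)) Z) :
    Commute (Matrix.scalar (Fin n) (legBar q n m L k)) Z := by
  induction k with
  | zero => rwa [legBar, leg1_eq _ hk]
  | succ k ih =>
    rw [legBar, RcLeg_eq hk, RcLegInv_eq hk, map_mul, map_mul]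
    exact ((hT k hk).mul_left (ih (by omega))).mul_left (Tw'_commute_of hq (hT k hk))

theorem RLLK.legBar_bX (hq : q ≠ 0) (h : RLLK q X Y K) {k : ℕ} (hk : k < m) :
    Commute (Matrix.scalar (Fin n) (legBar q n m (X * K) k)) (bX n m q B * scal _ X) :=
  legBar_commute_of hq hk (h.legBar_zero_bX (by omega)) fun _ hk =>
    (Tw_commute_bX hq hk).mul_right (Tw_commute_scal _ _)

theorem RLLK.legBar_aK (hq : q ≠ 0) (h : RLLK q X Y K) {k : ℕ} (hk : k < m) :
    Commute (Matrix.scalar (Fin n) (legBar q n m (X * K) k)) (scal _ K * aK n m q B) :=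
  legBar_commute_of hq hk (h.legBar_zero_aK (by omega)) fun _ hk =>
    (Tw_commute_scal _ _).mul_right (Tw_commute_aK hq hk)

theorem scalar_desc (m' : ℕ) : Matrix.scalar (Fin n) (desc (w1 m K) m') = desc (dg n m K) m' :=
  map_desc _ _ _

theorem RLLK.desc_bX_scal (h : RLLK q X Y K) {k : ℕ} (hk : k ≤ m) :
    Commute (desc (dg n m K) k * desc (gX n m q B) k) (scal _ (X * K)) := by
  induction k with
  | zero => exact Commute.one_left _ |>.mul_left (Commute.one_left _)
  | succ k ih =>
    have hk' : k < m := hk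
    have e : desc (dg n m K) (k + 1) * desc (gX n m q B) (k + 1) =
        (dg n m K k * gX n m q B k) * (desc (dg n m K) k * desc (gX n m q B) k) := by
      have : Commute (gX n m q B k) (desc (dg n m K) k) :=
        commute_desc fun i hi => (dg_commute_gX K hk' (by omega)).symm
      calc dg n m K k * desc (dg n m K) k * (gX n m q B k * desc (gX n m q B) k)
          = dg n m K k * (desc (dg n m K) k * gX n m q B k) * desc (gX n m q B) k := by
            simp only [mul_assoc]
        _ = _ := by rw [← this.eq]; simp only [mul_assoc]
    rw [e]
    refine Commute.mul_left ?_ (ih (by omega))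
    change _ = _
    rw [map_mul]
    calc dg n m K k * gX n m q B k * (scal _ X * scal _ K)
        = dg n m K k * gX n m q B k * scal _ X * scal _ K := by simp only [mul_assoc]
      _ = scal _ X * (gX n m q B k * dg n m K k * scal _ K) := by
        rw [h.g_kx hk']; simp only [mul_assoc]
      _ = _ := by rw [h.g_kk hk']; simp only [mul_assoc]

/-- Moving a matrix `X K` through `X₁ ⋯ Xₘ Kₘ ⋯ K₁`. -/
theorem RLLK.LLw_bX_scal (h : RLLK q X Y K) :
    Matrix.scalar (Fin n) (LLw m X K) * bX n m q B * scal _ (X * K) =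
      Matrix.scalar (Fin n) (asc (w1 m X) m) * scal _ (X * K) *
        Matrix.scalar (Fin n) (desc (w1 m K) m) * bX n m q B := by
  rw [LLw, map_mul, scalar_desc]
  have := (h.desc_bX_scal (m := m) le_rfl).eq
  rw [mul_assoc _ _ (bX n m q B), mul_assoc, bX, this]
  simp only [mul_assoc]

end BlockRelations

/-! ### Splitting off the last letter, and the Jucys–Murphy elements -/

section LastLetter

set_option linter.unusedSectionVars false

variable {n m : ℕ} {q : ℂ} {B : Type} [Ring B] [Algebra ℂ B] {X Y K : Matrix (Fin n) (Fin n) B}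

/-- Matrices on words of length `m + 1` as matrices of matrices on words of length `m`. -/
def lastBlk : Matrix (Fin (m + 1) → Fin n) (Fin (m + 1) → Fin n) B ≃+*
    Matrix (Fin n) (Fin n) (Matrix (Fin m → Fin n) (Fin m → Fin n) B) :=
  (Matrix.reindexRingEquiv B (Fin.snocEquiv fun _ => Fin n).symm).trans
    (Matrix.compRingEquiv (Fin n) (Fin m → Fin n) B).symm

theorem lastBlk_apply (Z : Matrix (Fin (m + 1) → Fin n) (Fin (m + 1) → Fin n) B) (i j : Fin n)
    (I J : Fin m → Fin n) :
    lastBlk Z i j I J = Z (Fin.snoc (α := fun _ => Fin n) I i) (Fin.snoc (α := fun _ => Fin n) J j) :=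
  rfl

theorem lastBlk_w1 {k : ℕ} (hk : k < m) (Z : Matrix (Fin n) (Fin n) B) :
    lastBlk (w1 (m + 1) Z k) = dg n m Z k := by
  ext i j I J
  rw [lastBlk_apply, w1, dif_pos (by omega : k < m + 1), emb_apply, dg, Matrix.scalar_apply,
    Matrix.diagonal_apply, w1, dif_pos hk]
  have e : (⟨k, by omega⟩ : Fin (m + 1)) = Fin.castSucc ⟨k, hk⟩ := rfl
  simp only [e, legL, Fin.snoc_castSucc, ← Fin.snoc_update, Fin.snoc_inj]
  by_cases h : i = j
  · simp only [h, and_true, if_true, emb_apply]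
  · rw [if_neg (fun h' => h h'.2.symm), if_neg h]; rfl

theorem lastBlk_w1_last (Z : Matrix (Fin n) (Fin n) B) :
    lastBlk (w1 (m + 1) Z m) = scal (Fin m → Fin n) Z := by
  ext i j I J
  rw [lastBlk_apply, w1, dif_pos (by omega : m < m + 1), emb_apply, scal_apply, Matrix.scalar_apply,
    Matrix.diagonal_apply]
  have e : (⟨m, by omega⟩ : Fin (m + 1)) = Fin.last m := rfl
  simp only [e, legL, Fin.snoc_last, Fin.update_snoc_last, Fin.snoc_inj, and_true, eq_comm]

theorem lastBlk_w2_last {k : ℕ} (hk : k < m) (C : Matrix (Fin n × Fin n) (Fin n × Fin n) B) :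
    lastBlk (w2 (m + 1) C m k) = blk (legL n ⟨k, hk⟩) C := by
  ext i j I J
  rw [lastBlk_apply, w2, dif_pos ⟨by omega, by omega⟩, emb_apply, blk_apply, emb_apply]
  have e : (⟨m, by omega⟩ : Fin (m + 1)) = Fin.last m := rfl
  have e' : (⟨k, by omega⟩ : Fin (m + 1)) = Fin.castSucc ⟨k, hk⟩ := rfl
  simp only [e, e', legL, Leg.prod, Fin.snoc_last, Fin.snoc_castSucc, Fin.update_snoc_last,
    ← Fin.snoc_update, Fin.snoc_inj, and_true, Matrix.of_apply]
  congr

theorem lastBlk_w2_last' {k : ℕ} (hk : k < m) (C : Matrix (Fin n × Fin n) (Fin n × Fin n) B) :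
    lastBlk (w2 (m + 1) C k m) = blk' (legL n ⟨k, hk⟩) C := by
  rw [← w2_swap, lastBlk_w2_last hk]
  rfl

/-- The product `X₁ ⋯ X_{m+1} K_{m+1} ⋯ K₁` in terms of its last letter. -/
theorem lastBlk_LLw :
    lastBlk (LLw (m + 1) X K) = Matrix.scalar (Fin n) (asc (w1 m X) m) *
      scal _ (X * K) * Matrix.scalar (Fin n) (desc (w1 m K) m) := by
  have h1 : lastBlk (asc (w1 (m + 1) X) m) = Matrix.scalar (Fin n) (asc (w1 m X) m) := by
    rw [← RingEquiv.coe_toRingHom, map_asc, map_asc]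
    exact asc_congr fun i hi => lastBlk_w1 hi _
  have h2 : lastBlk (desc (w1 (m + 1) K) m) = Matrix.scalar (Fin n) (desc (w1 m K) m) := by
    rw [← RingEquiv.coe_toRingHom, map_desc, map_desc]
    exact desc_congr fun i hi => lastBlk_w1 hi _
  rw [LLw, asc, desc, map_mul, map_mul, map_mul, h1, h2, lastBlk_w1_last, lastBlk_w1_last, map_mul]
  simp only [mul_assoc]

theorem RLLK.lastBlk_LLw_bX (h : RLLK q X Y K) :
    lastBlk (LLw (m + 1) X K) * bX n m q B =
      Matrix.scalar (Fin n) (LLw m X K) * bX n m q B * scal _ (X * K) := by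
  rw [h.LLw_bX_scal, lastBlk_LLw]

variable (q B n m) in
/-- The product `R_{k,k-1} ⋯ R_{k,1} R_{k,0}`. -/
def jmL (k : ℕ) : Matrix (Fin m → Fin n) (Fin m → Fin n) B := desc (w2 m (RB q B n) k) k

variable (q B n m) in
/-- The product `R_{0,k} R_{1,k} ⋯ R_{k-1,k}`. -/
def jmR (k : ℕ) : Matrix (Fin m → Fin n) (Fin m → Fin n) B :=
  asc (fun j => w2 m (RB q B n) j k) k

variable (B n m) in
/-- The permutation of the letters `k` and `k + 1`. -/
def Pw (k : ℕ) : Matrix (Fin m → Fin n) (Fin m → Fin n) B := w2 m (PB B n) k (k + 1)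

theorem Pw_mul_self (k : ℕ) : Pw n m B k * Pw n m B k = 1 := by
  rw [Pw, ← w2_mul, PB_mul_self, w2_one]

theorem PB_mul_eq (C : Matrix (Fin n × Fin n) (Fin n × Fin n) B) :
    PB B n * C = C.submatrix Prod.swap Prod.swap * PB B n := by
  ext p r
  simp only [Matrix.mul_apply, PB_apply, Matrix.submatrix_apply]
  rw [Finset.sum_eq_single p.swap, Finset.sum_eq_single r.swap] <;> simp +contextual
  intro a b h h'
  exact absurd (by rw [h']; rfl) h

theorem Tw_eq_left (k : ℕ) : Tw n m q B k = Pw n m B k * w2 m (RB q B n) k (k + 1) := by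
  rw [Tw, TB_eq, w2_mul, Pw]

theorem Tw_eq_right (k : ℕ) : Tw n m q B k = w2 m (RB q B n) (k + 1) k * Pw n m B k := by
  rw [Tw, TB_eq, PB_mul_eq, w2_mul, Pw, w2_swap]

theorem Pw_conj_left {k j : ℕ} (hk : k + 1 < m) (hj : j < k)
    (C : Matrix (Fin n × Fin n) (Fin n × Fin n) B) :
    Pw n m B k * w2 m C k j = w2 m C (k + 1) j * Pw n m B k := by
  unfold Pw w2
  rw [dif_pos ⟨by omega, by omega⟩, dif_pos ⟨by omega, by omega⟩, dif_pos ⟨by omega, by omega⟩]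
  exact PB_conj_pair _ _ _ C

theorem Pw_conj_right {k j : ℕ} (hk : k + 1 < m) (hj : j < k)
    (C : Matrix (Fin n × Fin n) (Fin n × Fin n) B) :
    Pw n m B k * w2 m C j k = w2 m C j (k + 1) * Pw n m B k := by
  unfold Pw w2
  rw [dif_pos ⟨by omega, by omega⟩, dif_pos ⟨by omega, by omega⟩, dif_pos ⟨by omega, by omega⟩]
  exact PB_conj _ _ _ C

theorem desc_intertwine {R : Type} [Ring R] {p : R} {x y : ℕ → R} {k : ℕ}
    (h : ∀ j < k, p * x j = y j * p) : p * desc x k = desc y k * p := by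
  induction k with
  | zero => exact (mul_one p).trans (one_mul p).symm
  | succ k ih =>
    rw [desc, desc, ← mul_assoc, h k (by omega), mul_assoc, ih fun j hj => h j (by omega), mul_assoc]

theorem asc_intertwine {R : Type} [Ring R] {p : R} {x y : ℕ → R} {k : ℕ}
    (h : ∀ j < k, p * x j = y j * p) : p * asc x k = asc y k * p := by
  induction k with
  | zero => exact (mul_one p).trans (one_mul p).symm
  | succ k ih =>
    rw [asc, asc, ← mul_assoc, ih fun j hj => h j (by omega), mul_assoc, h k (by omega), mul_assoc]

theorem jm_step {k : ℕ} (hk : k + 1 < m) :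
    Tw n m q B k * (jmL n m q B k * jmR n m q B k) * Tw n m q B k =
      jmL n m q B (k + 1) * jmR n m q B (k + 1) := by
  have h1 : Pw n m B k * jmL n m q B k = desc (w2 m (RB q B n) (k + 1)) k * Pw n m B k :=
    desc_intertwine fun j hj => Pw_conj_left hk hj _
  have h2 : Pw n m B k * jmR n m q B k =
      asc (fun j => w2 m (RB q B n) j (k + 1)) k * Pw n m B k :=
    asc_intertwine fun j hj => Pw_conj_right hk hj _
  calc _ = w2 m (RB q B n) (k + 1) k * (Pw n m B k * jmL n m q B k) * jmR n m q B k *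
        (Pw n m B k * w2 m (RB q B n) k (k + 1)) := by
        rw [← Tw_eq_left, ← mul_assoc (w2 m (RB q B n) (k + 1) k), ← Tw_eq_right]
        simp only [mul_assoc]
    _ = jmL n m q B (k + 1) * (Pw n m B k * jmR n m q B k) * Pw n m B k *
        w2 m (RB q B n) k (k + 1) := by
        rw [h1, jmL, desc]; simp only [mul_assoc]
    _ = jmL n m q B (k + 1) * asc (fun j => w2 m (RB q B n) j (k + 1)) k *
        (Pw n m B k * Pw n m B k) * w2 m (RB q B n) k (k + 1) := by
        rw [h2]; simp only [mul_assoc]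
    _ = _ := by rw [Pw_mul_self, mul_one, jmR, asc, mul_assoc]

theorem lastBlk_jm : lastBlk (jmL n (m + 1) q B m * jmR n (m + 1) q B m) =
    bX n m q B * aK n m q B := by
  rw [map_mul]
  congr 1
  · rw [jmL, ← RingEquiv.coe_toRingHom, map_desc]
    exact desc_congr fun i hi => (lastBlk_w2_last hi _).trans (blk_RB_letter hi)
  · rw [jmR, ← RingEquiv.coe_toRingHom, map_asc]
    exact asc_congr fun i hi => (lastBlk_w2_last' hi _).trans (blk'_RB_letter hi)

theorem lastBlk_jm_of_lt {k : ℕ} (hk : k < m) :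
    lastBlk (jmL n (m + 1) q B k * jmR n (m + 1) q B k) =
      Matrix.scalar (Fin n) (jmL n m q B k * jmR n m q B k) := by
  have key : ∀ a b, a < m → b < m → a ≠ b → ∀ C : Matrix (Fin n × Fin n) (Fin n × Fin n) B,
      lastBlk (w2 (m + 1) C a b) = Matrix.scalar (Fin n) (w2 m C a b) := by
    intro a b ha hb hab C
    ext i j I J
    rw [lastBlk_apply, w2, dif_pos ⟨by omega, by omega⟩, emb_apply, w2, dif_pos ⟨by omega, by omega⟩,
      Matrix.scalar_apply, Matrix.diagonal_apply]
    have e : (⟨a, by omega⟩ : Fin (m + 1)) = Fin.castSucc ⟨a, ha⟩ := rfl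
    have e' : (⟨b, by omega⟩ : Fin (m + 1)) = Fin.castSucc ⟨b, hb⟩ := rfl
    simp only [e, e', legL, Leg.prod, Fin.snoc_castSucc, ← Fin.snoc_update, Fin.snoc_inj]
    by_cases h : i = j
    · simp only [h, and_true, if_true, emb_apply]
    · rw [if_neg (fun h' => h h'.2.symm), if_neg h]; rfl
  rw [map_mul, map_mul]
  congr 1
  · rw [jmL, jmL, ← RingEquiv.coe_toRingHom, map_desc, map_desc]
    exact desc_congr fun i hi => key _ _ hk (by omega) (by omega) _
  · rw [jmR, jmR, ← RingEquiv.coe_toRingHom, map_asc, map_asc]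
    exact asc_congr fun i hi => key _ _ (by omega) hk (by omega) _

/-- The image of a Jucys–Murphy element. -/
theorem rep_yJM {N : ℕ} (ψ : Hecke q m →ₐ[ℂ] Matrix (Fin N → Fin n) (Fin N → Fin n) ℂ)
    (hN : m ≤ N) (hψ : ∀ k, k < m - 1 → ψ (Tn q m k) = Tw n N q ℂ k) {k : ℕ} (hk : k < m) :
    ψ (yJM q m (k + 1)) = jmL n N q ℂ k * jmR n N q ℂ k := by
  induction k with
  | zero => rw [yJM, map_one]; exact (one_mul 1).symm
  | succ k ih =>
    rw [yJM, map_mul, map_mul, ih (by omega), Tp, Nat.add_sub_cancel, hψ k (by omega),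
      jm_step (by omega)]

end LastLetter

section KXEntries

variable {n : ℕ} {q : ℂ} {B : Type} [Ring B] [Algebra ℂ B]

theorem RLLK.kx_apply {X Y K : Matrix (Fin n) (Fin n) B} (h : RLLK q X Y K) (i j p r : Fin n) :
    al q i r • (K p r * X i j) + (if r = i then ∑ x, be q i x • (K p x * X x j) else 0) =
      al q j p • (X i j * K p r) + (if p = j then ∑ x, be q x p • (X i x * K x r) else 0) := by
  have h1 := congrFun (congrFun h.kx (i, p)) (j, r)
  have e1 : ∀ Z : Matrix (Fin n × Fin n) (Fin n × Fin n) B,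
      (M2 K * Z) (i, p) (j, r) = ∑ x, K p x * Z (i, x) (j, r) := fun Z => by
    rw [M2_eq_emb, emb_mul_apply]; rfl
  have e2 : ∀ Z : Matrix (Fin n × Fin n) (Fin n × Fin n) B,
      (M1 X * Z) (i, p) (j, r) = ∑ x, X i x * Z (x, p) (j, r) := fun Z => by
    rw [M1_eq_emb, emb_mul_apply]; rfl
  rw [mul_assoc, mul_assoc, e1, e2] at h1
  simp only [RB_mul, M1, M2, Prod.swap, mul_add, Finset.sum_add_distrib, mul_smul_comm, mul_ite,
    mul_zero, smul_ite, smul_zero, Finset.sum_ite_eq', Finset.mem_univ, if_true] at h1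
  convert h1 using 2
  · by_cases h : r = i
    · simp [h]
    · simp [h, Ne.symm h]
  · by_cases h : p = j
    · simp [h]
    · simp [h]

end KXEntries

section Weights

variable {n m : ℕ}

/-- The content of a word: the number of occurrences of each letter. -/
def cnt (I : Fin m → Fin n) : Fin n → ℕ := ∑ k, Pi.single (I k) 1

theorem cnt_apply (I : Fin m → Fin n) (i : Fin n) : cnt I i = ∑ k, if I k = i then 1 else 0 := by
  simp [cnt, Finset.sum_apply, Pi.single_apply, eq_comm]

theorem cnt_update (I : Fin m → Fin n) (k : Fin m) (x : Fin n) :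
    cnt (Function.update I k x) + Pi.single (I k) 1 = cnt I + Pi.single x 1 := by
  unfold cnt
  rw [← Finset.add_sum_erase _ _ (Finset.mem_univ k), ← Finset.add_sum_erase _ _ (Finset.mem_univ k),
    Function.update_self, Finset.sum_congr rfl fun l hl => by
      rw [Function.update_of_ne (Finset.ne_of_mem_erase hl)]]
  abel

/-- The matrix `X` shifts contents by `β - α`. -/
def Wt (X : Matrix (Fin m → Fin n) (Fin m → Fin n) ℂ) (α β : Fin n → ℕ) : Prop :=
  ∀ I J, X I J ≠ 0 → cnt I + α = cnt J + β

theorem Wt.mul {X X' : Matrix (Fin m → Fin n) (Fin m → Fin n) ℂ} {α β γ δ : Fin n → ℕ}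
    (h : Wt X α β) (h' : Wt X' γ δ) : Wt (X * X') (α + γ) (β + δ) := by
  intro I J hIJ
  obtain ⟨L, -, hL⟩ := Finset.exists_ne_zero_of_sum_ne_zero hIJ
  have h1 := h I L (left_ne_zero_of_mul hL)
  have h2 := h' L J (right_ne_zero_of_mul hL)
  rw [← add_assoc, h1, add_right_comm, h2, add_assoc, add_comm δ]

theorem Wt.of_add {X : Matrix (Fin m → Fin n) (Fin m → Fin n) ℂ} {α β γ : Fin n → ℕ}
    (h : Wt X (α + γ) (β + γ)) : Wt X α β := fun I J hIJ => by
  have := h I J hIJ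
  rw [← add_assoc, ← add_assoc] at this
  exact add_right_cancel this

theorem Wt.sum {V : Type} [Fintype V] {X : V → Matrix (Fin m → Fin n) (Fin m → Fin n) ℂ}
    {α β : Fin n → ℕ} (h : ∀ v, Wt (X v) α β) : Wt (∑ v, X v) α β := by
  intro I J hIJ
  rw [Matrix.sum_apply] at hIJ
  obtain ⟨v, -, hv⟩ := Finset.exists_ne_zero_of_sum_ne_zero hIJ
  exact h v I J hv

theorem Rmat_ne_zero {q : ℂ} {a b c d : Fin n} (h : Rmat q n (a, b) (c, d) ≠ 0) :
    (a = c ∧ b = d) ∨ (a = d ∧ b = c) := by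
  unfold Rmat at h
  by_contra! hc
  refine h ?_
  rw [if_neg fun h' => hc.1 h'.1 h'.2, if_neg fun h' => hc.2 h'.2.1 h'.1]

theorem gK_weight {q : ℂ} {k : ℕ} (hk : k < m) (i j : Fin n) :
    Wt (gK n m q ℂ k i j) (Pi.single i 1) (Pi.single j 1) := by
  intro I J h
  rw [gK_apply hk, w1, dif_pos hk, emb_apply] at h
  split_ifs at h with hJ
  have h1 := cnt_update I ⟨k, hk⟩ (J ⟨k, hk⟩)
  change J = Function.update I ⟨k, hk⟩ (J ⟨k, hk⟩) at hJ
  change Rmat q n (I ⟨k, hk⟩, i) (J ⟨k, hk⟩, j) ≠ 0 at h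
  · rw [← hJ] at h1
    rcases Rmat_ne_zero h with ⟨h2, h3⟩ | ⟨h2, h3⟩
    · rw [h2] at h1; rw [h3, add_right_cancel h1]
    · rw [h2, ← h3] at h1; exact h1.symm
  · exact absurd rfl h

theorem asc_gK_weight {q : ℂ} {k : ℕ} (hk : k ≤ m) (i j : Fin n) :
    Wt (asc (gK n m q ℂ) k i j) (Pi.single i 1) (Pi.single j 1) := by
  induction k generalizing i j with
  | zero =>
    intro I J h
    change (1 : Matrix (Fin n) (Fin n) (Matrix (Fin m → Fin n) (Fin m → Fin n) ℂ)) i j I J ≠ 0 at h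
    by_cases hij : i = j
    · subst hij
      rw [Matrix.one_apply_eq, Matrix.one_apply] at h
      split_ifs at h with hIJ
      · rw [hIJ]
      · exact absurd rfl h
    · rw [Matrix.one_apply_ne hij] at h; exact absurd rfl h
  | succ k ih =>
    refine Wt.sum fun x => Wt.of_add (γ := Pi.single x 1) ?_
    have h := (ih (by omega) i x).mul (gK_weight (q := q) (by omega : k < m) x j)
    rwa [add_comm (Pi.single x 1) (Pi.single j 1)] at h

theorem aK_weight {q : ℂ} (i j : Fin n) :
    Wt (aK n m q ℂ i j) (Pi.single i 1) (Pi.single j 1) := asc_gK_weight le_rfl i j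

theorem Rmat_swap_transpose {q : ℂ} (a b c d : Fin n) :
    Rmat q n (a, b) (c, d) = Rmat q n (d, c) (b, a) := by
  simp only [Rmat_apply, Prod.mk.injEq, Prod.swap, al, be]
  grind

theorem gX_transpose {q : ℂ} (k : ℕ) (i j : Fin n) :
    gX n m q ℂ k i j = (gK n m q ℂ k j i).transpose := by
  by_cases hk : k < m
  · rw [gX_apply hk, gK_apply hk, w1, w1, dif_pos hk, dif_pos hk]
    ext I J
    rw [Matrix.transpose_apply, emb_apply, emb_apply]
    have e : (J = Function.update I ⟨k, hk⟩ (J ⟨k, hk⟩)) = (I = Function.update J ⟨k, hk⟩ (I ⟨k, hk⟩)) := by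
      simp only [Function.eq_update_iff, true_and, eq_iff_iff]
      exact ⟨fun h x hx => (h x hx).symm, fun h x hx => (h x hx).symm⟩
    change (if J = Function.update I ⟨k, hk⟩ (J ⟨k, hk⟩) then _ else _) =
      (if I = Function.update J ⟨k, hk⟩ (I ⟨k, hk⟩) then _ else _)
    refine if_congr (iff_of_eq e) ?_ rfl
    exact Rmat_swap_transpose _ _ _ _
  · rw [gX, gK, dif_neg hk, dif_neg hk, Matrix.one_apply, Matrix.one_apply]
    by_cases h : i = j
    · simp [h]
    · simp [h, Ne.symm h]

theorem desc_gX_transpose {q : ℂ} (k : ℕ) (i j : Fin n) :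
    desc (gX n m q ℂ) k i j = (asc (gK n m q ℂ) k j i).transpose := by
  induction k generalizing i j with
  | zero =>
    rw [desc, asc, Matrix.one_apply, Matrix.one_apply]
    by_cases h : i = j
    · simp [h]
    · simp [h, Ne.symm h]
  | succ k ih =>
    rw [desc, asc, Matrix.mul_apply, Matrix.mul_apply, Matrix.transpose_sum]
    exact Finset.sum_congr rfl fun x _ => by rw [Matrix.transpose_mul, ih, gX_transpose]

theorem bX_transpose {q : ℂ} (i j : Fin n) : bX n m q ℂ i j = (aK n m q ℂ j i).transpose :=
  desc_gX_transpose m i j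

theorem bX_weight {q : ℂ} (i j : Fin n) :
    Wt (bX n m q ℂ i j) (Pi.single i 1) (Pi.single j 1) := fun I J h => by
  rw [bX_transpose] at h
  exact (aK_weight j i J I h).symm

/-- The diagonal matrix with entries `q` to the number of occurrences of `i`. -/
def tD (n m : ℕ) (q : ℂ) (i : Fin n) : Matrix (Fin m → Fin n) (Fin m → Fin n) ℂ :=
  Matrix.diagonal fun I => q ^ cnt I i

theorem prod_al_eq {q : ℂ} (I : Fin m → Fin n) (i : Fin n) : ∏ k, al q i (I k) = q ^ cnt I i := by
  rw [cnt_apply, ← Finset.prod_pow_eq_pow_sum]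
  exact Finset.prod_congr rfl fun k _ => by simp only [al, eq_comm (a := i)]; split_ifs <;> simp

theorem gK_diag {q : ℂ} {k : ℕ} (hk : k < m) (i : Fin n) :
    gK n m q ℂ k i i = Matrix.diagonal fun I => al q i (I ⟨k, hk⟩) := by
  rw [gK_apply hk, w1, dif_pos hk]
  ext I J
  rw [emb_apply, Matrix.diagonal_apply]
  simp only [legL, Matrix.of_apply, RB, Matrix.map_apply, Rmat_snd_diag, Algebra.algebraMap_self,
    RingHom.id_apply]
  by_cases h : I = J
  · subst h; simp [al_symm]
  · rw [if_neg h]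
    split_ifs with h1 h2
    · rw [h2, Function.update_eq_self] at h1; exact absurd h1.symm h
    · rfl
    · rfl

theorem asc_gK_upper {q : ℂ} {k : ℕ} (hq : q ≠ 0) (hk : k ≤ m) {i j : Fin n} (h : i < j) :
    asc (gK n m q ℂ) k i j = 0 := (RLLK_prefix hq hk).lowerK i j h

theorem asc_gK_diag {q : ℂ} {k : ℕ} (hq : q ≠ 0) (hk : k ≤ m) (i : Fin n) :
    asc (gK n m q ℂ) k i i =
      Matrix.diagonal fun I => ∏ l : Fin m, if (l : ℕ) < k then al q i (I l) else 1 := by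
  induction k with
  | zero => ext I J; simp [asc, Matrix.one_apply, Matrix.diagonal_apply]
  | succ k ih =>
    rw [asc, Matrix.mul_apply, Finset.sum_eq_single i, ih (by omega), gK_diag (by omega),
      Matrix.diagonal_mul_diagonal]
    · congr 1; ext I
      have : ∀ l : Fin m, (if (l : ℕ) < k + 1 then al q i (I l) else 1) =
          (if (l : ℕ) < k then al q i (I l) else 1) * (if l = ⟨k, by omega⟩ then al q i (I l) else 1) := by
        intro l
        simp only [Fin.ext_iff]
        rcases lt_trichotomy (l : ℕ) k with h | h | h
        · rw [if_pos (by omega), if_pos h, if_neg (by omega), mul_one]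
        · rw [if_pos (by omega), if_neg (by omega), if_pos h, one_mul]
        · rw [if_neg (by omega), if_neg (by omega), if_neg (by omega), one_mul]
      simp only [this, Finset.prod_mul_distrib, Finset.prod_ite_eq', Finset.mem_univ, if_true]
    · intro x _ hx
      rcases lt_or_gt_of_ne hx with hx | hx
      · have : gK n m q ℂ k x i = 0 := (RLLK_g hq k).lowerK x i hx
        rw [this, mul_zero]
      · rw [asc_gK_upper hq (by omega) hx, zero_mul]
    · simp

theorem aK_diag {q : ℂ} (hq : q ≠ 0) (i : Fin n) : aK n m q ℂ i i = tD n m q i := by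
  rw [aK, asc_gK_diag hq le_rfl, tD]
  congr 1; ext I
  rw [← prod_al_eq]
  exact Finset.prod_congr rfl fun l _ => if_pos l.2

theorem bX_diag {q : ℂ} (hq : q ≠ 0) (i : Fin n) : bX n m q ℂ i i = tD n m q i := by
  rw [bX_transpose, aK_diag hq, tD, Matrix.diagonal_transpose]

end Weights

section RaisingLowering

variable {n m : ℕ} {q : ℂ}

/-- The coefficient with which the raising operator changes the letter at position `l`. -/
def raiseCoeff (q : ℂ) (x y : Fin n) (I : Fin m → Fin n) (l : Fin m) (k : ℕ) : ℂ :=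
  (q - q⁻¹) * ∏ l' : Fin m, if (l' : ℕ) < k then
    (if l' < l then al q y (I l') else if l' = l then 1 else al q x (I l')) else 1

theorem gK_succ_apply {k : ℕ} (hk : k < m) {x y : Fin n} (hxy : x < y) (I J : Fin m → Fin n) :
    gK n m q ℂ k y x I J =
      if I ⟨k, hk⟩ = x ∧ J = Function.update I ⟨k, hk⟩ y then q - q⁻¹ else 0 := by
  rw [gK_apply hk, w1, dif_pos hk, emb_apply]
  change (if J = Function.update I ⟨k, hk⟩ (J ⟨k, hk⟩) then
    Rmat q n (I ⟨k, hk⟩, y) (J ⟨k, hk⟩, x) else 0) = _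
  rw [Rmat_apply]
  by_cases h : I ⟨k, hk⟩ = x ∧ J = Function.update I ⟨k, hk⟩ y
  · have hJ : J ⟨k, hk⟩ = y := by rw [h.2, Function.update_self]
    rw [if_pos h, hJ, if_pos h.2, h.1, if_neg (by simp [hxy.ne]), zero_add]
    exact (if_pos rfl).trans (if_pos hxy)
  · rw [if_neg h]
    split_ifs with h1 h2 h3 h3
    · rw [Prod.mk.injEq] at h2; exact absurd h2.2 hxy.ne
    · rw [Prod.mk.injEq] at h2; exact absurd h2.2 hxy.ne
    · rw [Prod.swap, Prod.mk.injEq] at h3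
      simp only at h3
      rw [h3.1] at h1
      exact absurd ⟨h3.2.symm, h1⟩ h
    · simp
    · rfl

theorem asc_gK_succ_apply (hq : q ≠ 0) {k : ℕ} (hk : k ≤ m) {x y : Fin n}
    (hxy : (y : ℕ) = x + 1) (I J : Fin m → Fin n) :
    asc (gK n m q ℂ) k y x I J = ∑ l : Fin m,
      if (l : ℕ) < k ∧ I l = x ∧ J = Function.update I l y then raiseCoeff q x y I l k else 0 := by
  induction k with
  | zero =>
    have : y ≠ x := fun h => by rw [h] at hxy; omega
    simp [asc, Matrix.one_apply_ne this]
  | succ k ih =>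
    have hlt : x < y := by rw [Fin.lt_def]; omega
    have hz : ∀ z : Fin n, z ≠ x → z ≠ y →
        asc (gK n m q ℂ) k y z * gK n m q ℂ k z x = 0 := by
      intro z h1 h2
      rcases lt_or_gt_of_ne h1 with h | h
      · have : gK n m q ℂ k z x = 0 := (RLLK_g hq k).lowerK z x h
        rw [this, mul_zero]
      · have : y < z := by
          rw [Fin.lt_def] at h ⊢
          have := Fin.val_ne_of_ne h2
          omega
        rw [asc_gK_upper hq (by omega) this, zero_mul]
    rw [asc, Matrix.mul_apply, Fintype.sum_eq_add x y hlt.ne fun z hz' => hz z hz'.1 hz'.2,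
      Matrix.add_apply, gK_diag (by omega), asc_gK_diag hq (by omega), Matrix.mul_diagonal,
      Matrix.diagonal_mul, ih (by omega), gK_succ_apply (by omega) hlt,
      ← Finset.add_sum_erase _ _ (Finset.mem_univ (⟨k, by omega⟩ : Fin m)),
      ← Finset.add_sum_erase (Finset.univ : Finset (Fin m)) (fun l : Fin m =>
        if (l : ℕ) < k + 1 ∧ I l = x ∧ J = Function.update I l y then raiseCoeff q x y I l (k + 1)
        else 0) (Finset.mem_univ (⟨k, by omega⟩ : Fin m)), if_neg (by simp), zero_add, add_comm]
    congr 1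
    · simp only [lt_add_one, true_and]
      split_ifs with h
      · rw [raiseCoeff, mul_comm]
        congr 1
        refine Finset.prod_congr rfl fun l _ => ?_
        simp only [Fin.lt_def, Fin.ext_iff]
        rcases lt_trichotomy (l : ℕ) k with h' | h' | h'
        · rw [if_pos h', if_pos (by omega), if_pos h']
        · rw [if_neg (by omega), if_pos (by omega), if_neg (by omega), if_pos h']
        · rw [if_neg (by omega), if_neg (by omega)]
      · rw [mul_zero]
    · rw [Finset.sum_mul]
      refine Finset.sum_congr rfl fun l hl => ?_
      have hlk : (l : ℕ) ≠ k := fun h => Finset.ne_of_mem_erase hl (Fin.ext h)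
      have e : ((l : ℕ) < k + 1) = ((l : ℕ) < k) := by rw [eq_iff_iff]; omega
      simp only [e]
      split_ifs with h
      · have hJ : J ⟨k, by omega⟩ = I ⟨k, by omega⟩ := by
          rw [h.2.2, Function.update_of_ne fun h' => hlk (Fin.ext_iff.1 h').symm]
        rw [raiseCoeff, raiseCoeff, mul_assoc, hJ,
          ← Finset.mul_prod_erase _ _ (Finset.mem_univ (⟨k, by omega⟩ : Fin m)),
          ← Finset.mul_prod_erase (Finset.univ : Finset (Fin m)) (fun l' : Fin m =>
            if (l' : ℕ) < k + 1 then
              (if l' < l then al q y (I l') else if l' = l then 1 else al q x (I l')) else 1)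
            (Finset.mem_univ (⟨k, by omega⟩ : Fin m)), if_neg (by simp), if_pos (by simp),
            if_neg (by rw [Fin.lt_def]; simp only; omega), if_neg (by rw [Fin.ext_iff]; simp only; omega),
            one_mul, mul_comm (al q x _)]
        congr 2
        refine Finset.prod_congr rfl fun l' hl' => ?_
        have : (l' : ℕ) ≠ k := fun h => Finset.ne_of_mem_erase hl' (Fin.ext h)
        have e : ((l' : ℕ) < k + 1) = ((l' : ℕ) < k) := by rw [eq_iff_iff]; omega
        simp only [e]
      · rw [zero_mul]

/-- The raising operators on words. -/
def ME (n m : ℕ) (q : ℂ) (i : ℕ) : Matrix (Fin m → Fin n) (Fin m → Fin n) ℂ :=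
  if h : i + 1 < n then aK n m q ℂ ⟨i + 1, h⟩ ⟨i, by omega⟩ else 0

/-- The lowering operators on words. -/
def MF (n m : ℕ) (q : ℂ) (i : ℕ) : Matrix (Fin m → Fin n) (Fin m → Fin n) ℂ :=
  (ME n m q i).transpose

theorem MF_eq {i : ℕ} (h : i + 1 < n) : MF n m q i = bX n m q ℂ ⟨i, by omega⟩ ⟨i + 1, h⟩ := by
  rw [MF, ME, dif_pos h, bX_transpose]

theorem ME_apply (hq : q ≠ 0) {i : ℕ} (h : i + 1 < n) (I J : Fin m → Fin n) :
    ME n m q i I J = ∑ l : Fin m,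
      if I l = ⟨i, by omega⟩ ∧ J = Function.update I l ⟨i + 1, h⟩ then
        raiseCoeff q ⟨i, by omega⟩ ⟨i + 1, h⟩ I l m else 0 := by
  rw [ME, dif_pos h, aK, asc_gK_succ_apply hq le_rfl rfl]
  exact Finset.sum_congr rfl fun l _ => if_congr (by simp) rfl rfl

theorem ME_support (hq : q ≠ 0) {i : ℕ} {I J : Fin m → Fin n} (hIJ : ME n m q i I J ≠ 0) :
    ∃ (h : i + 1 < n) (l : Fin m), I l = ⟨i, by omega⟩ ∧ J = Function.update I l ⟨i + 1, h⟩ := by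
  by_cases h : i + 1 < n
  · rw [ME_apply hq h] at hIJ
    obtain ⟨l, -, hl⟩ := Finset.exists_ne_zero_of_sum_ne_zero hIJ
    exact ⟨h, l, by_contra fun h' => hl (if_neg h')⟩
  · rw [ME, dif_neg h] at hIJ; exact absurd rfl hIJ

theorem raiseCoeff_ne_zero (hq : q ≠ 0) (hq2 : q - q⁻¹ ≠ 0) (x y : Fin n) (I : Fin m → Fin n)
    (l : Fin m) (k : ℕ) : raiseCoeff q x y I l k ≠ 0 := by
  refine mul_ne_zero hq2 (Finset.prod_ne_zero_iff.2 fun l' _ => ?_)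
  split_ifs
  · exact al_ne_zero hq _ _
  · exact one_ne_zero
  · exact al_ne_zero hq _ _
  · exact one_ne_zero

theorem ME_weight (q : ℂ) {i : ℕ} (h : i + 1 < n) :
    Wt (ME n m q i) (Pi.single ⟨i + 1, h⟩ 1) (Pi.single ⟨i, by omega⟩ 1) := by
  rw [ME, dif_pos h]; exact aK_weight _ _

theorem MF_weight (q : ℂ) {i : ℕ} (h : i + 1 < n) :
    Wt (MF n m q i) (Pi.single ⟨i, by omega⟩ 1) (Pi.single ⟨i + 1, h⟩ 1) := by
  rw [MF_eq h]; exact bX_weight _ _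

theorem ME_MF_commute (hq : q ≠ 0) {i k : ℕ} (hik : i ≠ k) : Commute (ME n m q k) (MF n m q i) := by
  by_cases hk : k + 1 < n
  · by_cases hi : i + 1 < n
    · have h := (RLLK_words (n := n) (m := m) (B := ℂ) hq).kx_apply ⟨i, by omega⟩ ⟨i + 1, hi⟩
        ⟨k + 1, hk⟩ ⟨k, by omega⟩
      rw [if_neg (by simp; omega), if_neg (by simp; omega), add_zero, add_zero, al, al,
        if_neg (by simp; omega), if_neg (by simp; omega), one_smul, one_smul] at h
      rw [MF_eq hi, ME, dif_pos hk]
      exact h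
    · rw [MF, ME, ME, dif_neg hi, Matrix.transpose_zero]; exact Commute.zero_right _
  · rw [ME, dif_neg hk]; exact Commute.zero_left _

theorem ME_MF_sub (hq : q ≠ 0) {i : ℕ} (h : i + 1 < n) :
    ME n m q i * MF n m q i - MF n m q i * ME n m q i = Matrix.diagonal fun I : Fin m → Fin n =>
      (1 - q⁻¹ ^ 2) * (q ^ (2 * cnt I ⟨i, by omega⟩) - q ^ (2 * cnt I ⟨i + 1, h⟩)) := by
  have hw := RLLK_words (n := n) (m := m) (B := ℂ) hq
  have hr := hw.kx_apply ⟨i, by omega⟩ ⟨i + 1, h⟩ ⟨i + 1, h⟩ ⟨i, by omega⟩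
  rw [if_pos rfl, if_pos rfl, Finset.sum_eq_single ⟨i + 1, h⟩, Finset.sum_eq_single ⟨i, by omega⟩,
    al, al, if_pos rfl, if_pos rfl, be, if_pos (by simp [Fin.lt_def]), aK_diag hq, aK_diag hq,
    bX_diag hq, bX_diag hq, ← MF_eq h] at hr
  · have hE : aK n m q ℂ ⟨i + 1, h⟩ ⟨i, by omega⟩ = ME n m q i := by rw [ME, dif_pos h]
    rw [hE] at hr
    have h2 : q • (ME n m q i * MF n m q i - MF n m q i * ME n m q i) = (q - q⁻¹) •
        (tD n m q ⟨i, by omega⟩ * tD n m q ⟨i, by omega⟩ -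
          tD n m q ⟨i + 1, h⟩ * tD n m q ⟨i + 1, h⟩) := by
      rw [smul_sub, smul_sub, sub_eq_sub_iff_add_eq_add, hr]
      abel
    have h3 : ∀ Z : Matrix (Fin m → Fin n) (Fin m → Fin n) ℂ, q⁻¹ • (q • Z) = Z := fun Z => by
      rw [smul_smul, inv_mul_cancel₀ hq, one_smul]
    rw [← h3 (_ - _), h2, tD, tD, Matrix.diagonal_mul_diagonal, Matrix.diagonal_mul_diagonal,
      Matrix.diagonal_sub, ← Matrix.diagonal_smul, ← Matrix.diagonal_smul]
    congr 1; ext I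
    simp only [Pi.smul_apply, smul_eq_mul]
    field_simp
    ring
  · intro x _ hx
    rcases lt_or_gt_of_ne hx with hx' | hx'
    · rw [hw.upper _ _ hx', zero_mul, smul_zero]
    · rw [be, if_neg, zero_smul]
      rw [Fin.lt_def] at hx' ⊢
      simp only at hx' ⊢
      omega
  · simp
  · intro x _ hx
    rcases lt_or_gt_of_ne hx with hx' | hx'
    · rw [be, if_neg, zero_smul]
      rw [Fin.lt_def] at hx' ⊢
      simp only at hx' ⊢
      omega
    · rw [hw.lowerK _ _ hx', zero_mul, smul_zero]
  · simp

end RaisingLowering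

section Triangular

variable {n m : ℕ} {q : ℂ}

/-- The diagonal matrix whose entries depend on the content of the word only. -/
def dgc (m : ℕ) (f : (Fin n → ℕ) → ℂ) : Matrix (Fin m → Fin n) (Fin m → Fin n) ℂ :=
  Matrix.diagonal fun I => f (cnt I)

/-- The projection to the words of content `ν`. -/
def wp (m : ℕ) (ν : Fin n → ℕ) : Matrix (Fin m → Fin n) (Fin m → Fin n) ℂ :=
  dgc m fun μ => if μ = ν then 1 else 0

theorem dgc_mul_dgc (f g : (Fin n → ℕ) → ℂ) : dgc m f * dgc m g = dgc m (f * g) := by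
  rw [dgc, dgc, Matrix.diagonal_mul_diagonal]; rfl

theorem dgc_mul_wp (f : (Fin n → ℕ) → ℂ) (ν : Fin n → ℕ) : dgc m f * wp m ν = f ν • wp m ν := by
  rw [wp, dgc_mul_dgc, dgc, dgc, ← Matrix.diagonal_smul]
  congr 1; ext I
  by_cases h : cnt I = ν <;> simp [h]

theorem wp_mul_dgc (f : (Fin n → ℕ) → ℂ) (ν : Fin n → ℕ) : wp m ν * dgc m f = f ν • wp m ν := by
  rw [← dgc_mul_wp, wp, dgc_mul_dgc, dgc_mul_dgc, mul_comm]

theorem wp_mul_self (ν : Fin n → ℕ) : wp m ν * wp m ν = wp m ν := by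
  refine (dgc_mul_wp (fun μ => if μ = ν then (1 : ℂ) else 0) ν).trans ?_
  simp

theorem dgc_one : dgc m (fun _ : Fin n → ℕ => 1) = 1 := Matrix.diagonal_one

theorem dgc_eq_sum (f : (Fin n → ℕ) → ℂ) :
    dgc m f = ∑ ν ∈ Finset.univ.image (cnt (n := n) (m := m)), f ν • wp m ν := by
  ext I J
  rw [Matrix.sum_apply]
  simp only [Matrix.smul_apply, wp, dgc, Matrix.diagonal_apply]
  by_cases h : I = J
  · subst h
    simp
  · simp [h]

theorem sum_wp : ∑ ν ∈ Finset.univ.image (cnt (n := n) (m := m)), wp m ν = 1 := by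
  rw [← dgc_one, dgc_eq_sum]; simp

theorem tD_eq_dgc (i : Fin n) : tD n m q i = dgc m fun ν => q ^ ν i := rfl

theorem Wt.dgc_mul {X : Matrix (Fin m → Fin n) (Fin m → Fin n) ℂ} {α β : Fin n → ℕ}
    (h : Wt X α β) (f : (Fin n → ℕ) → ℂ) : dgc m f * X = X * dgc m fun ν => f (ν + β - α) := by
  ext I J
  rw [dgc, dgc, Matrix.diagonal_mul, Matrix.mul_diagonal, mul_comm]
  by_cases h0 : X I J = 0
  · rw [h0, zero_mul, zero_mul]
  · rw [← h I J h0, add_tsub_cancel_right]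

theorem Wt.mul_dgc {X : Matrix (Fin m → Fin n) (Fin m → Fin n) ℂ} {α β : Fin n → ℕ}
    (h : Wt X α β) (f : (Fin n → ℕ) → ℂ) : X * dgc m f = (dgc m fun ν => f (ν + α - β)) * X := by
  ext I J
  rw [dgc, dgc, Matrix.diagonal_mul, Matrix.mul_diagonal, mul_comm]
  by_cases h0 : X I J = 0
  · rw [h0, mul_zero, mul_zero]
  · rw [h I J h0, add_tsub_cancel_right]

theorem ME_dgc (i : ℕ) (f : (Fin n → ℕ) → ℂ) :
    ∃ g, dgc m f * ME n m q i = ME n m q i * dgc m g := by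
  by_cases h : i + 1 < n
  · exact ⟨_, (ME_weight q h).dgc_mul f⟩
  · exact ⟨f, by rw [ME, dif_neg h, mul_zero, zero_mul]⟩

theorem MF_dgc (i : ℕ) (f : (Fin n → ℕ) → ℂ) :
    ∃ g, MF n m q i * dgc m f = dgc m g * MF n m q i := by
  by_cases h : i + 1 < n
  · exact ⟨_, (MF_weight q h).mul_dgc f⟩
  · exact ⟨f, by rw [MF, ME, dif_neg h, Matrix.transpose_zero, mul_zero, zero_mul]⟩

theorem ME_MF_eq (hq : q ≠ 0) (i k : ℕ) :
    ∃ f, MF n m q i * ME n m q k = ME n m q k * MF n m q i - dgc m f := by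
  by_cases hik : i = k
  · subst hik
    by_cases h : i + 1 < n
    · exact ⟨fun ν => (1 - q⁻¹ ^ 2) * (q ^ (2 * ν ⟨i, by omega⟩) - q ^ (2 * ν ⟨i + 1, h⟩)), by
        rw [dgc, ← ME_MF_sub hq h, sub_sub_cancel]⟩
    · exact ⟨0, by
        rw [MF, ME, dif_neg h, Matrix.transpose_zero, mul_zero, zero_sub, dgc]; simp⟩
  · refine ⟨0, ?_⟩
    rw [(ME_MF_commute hq hik).eq, dgc]
    simp

/-- Monomials in the lowering operators, starting with a projection. -/
inductive FMono (n m : ℕ) (q : ℂ) : Matrix (Fin m → Fin n) (Fin m → Fin n) ℂ → Prop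
  | base (ν : Fin n → ℕ) : FMono n m q (wp m ν)
  | step (i : ℕ) {X} (h : FMono n m q X) : FMono n m q (X * MF n m q i)

/-- Monomials of triangular shape: raising operators, a projection, lowering operators. -/
inductive TMono (n m : ℕ) (q : ℂ) : Matrix (Fin m → Fin n) (Fin m → Fin n) ℂ → Prop
  | of {X} (h : FMono n m q X) : TMono n m q X
  | step (i : ℕ) {X} (h : TMono n m q X) : TMono n m q (ME n m q i * X)

/-- The span of the monomials of triangular shape. -/
def triSpan (n m : ℕ) (q : ℂ) : Submodule ℂ (Matrix (Fin m → Fin n) (Fin m → Fin n) ℂ) :=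
  Submodule.span ℂ {X | TMono n m q X}

/-- The algebra generated by the raising and lowering operators and the weight projections. -/
def opAlg (n m : ℕ) (q : ℂ) : Subalgebra ℂ (Matrix (Fin m → Fin n) (Fin m → Fin n) ℂ) :=
  Algebra.adjoin ℂ (Set.range (ME n m q) ∪ Set.range (MF n m q) ∪ Set.range (wp m))

theorem ME_mem_opAlg (i : ℕ) : ME n m q i ∈ opAlg n m q :=
  Algebra.subset_adjoin (Or.inl (Or.inl ⟨i, rfl⟩))

theorem MF_mem_opAlg (i : ℕ) : MF n m q i ∈ opAlg n m q :=
  Algebra.subset_adjoin (Or.inl (Or.inr ⟨i, rfl⟩))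

theorem wp_mem_opAlg (ν : Fin n → ℕ) : wp m ν ∈ opAlg n m q :=
  Algebra.subset_adjoin (Or.inr ⟨ν, rfl⟩)

theorem mul_left_mem_of_span {A : Type} [Ring A] [Algebra ℂ A] {s : Set A} {p : Submodule ℂ A} {a : A}
    (h : ∀ x ∈ s, a * x ∈ p) {x : A} (hx : x ∈ Submodule.span ℂ s) : a * x ∈ p := by
  have : Submodule.span ℂ s ≤ p.comap (LinearMap.mulLeft ℂ a) := Submodule.span_le.2 h
  exact this hx

theorem mul_right_mem_of_span {A : Type} [Ring A] [Algebra ℂ A] {s : Set A} {p : Submodule ℂ A} {a : A}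
    (h : ∀ x ∈ s, x * a ∈ p) {x : A} (hx : x ∈ Submodule.span ℂ s) : x * a ∈ p := by
  have : Submodule.span ℂ s ≤ p.comap (LinearMap.mulRight ℂ a) := Submodule.span_le.2 h
  exact this hx

theorem triSpan_ME {X : Matrix (Fin m → Fin n) (Fin m → Fin n) ℂ} (h : X ∈ triSpan n m q) (i : ℕ) :
    ME n m q i * X ∈ triSpan n m q :=
  mul_left_mem_of_span (fun _ hx => Submodule.subset_span (TMono.step i hx)) h

theorem TMono.mul_MF {X : Matrix (Fin m → Fin n) (Fin m → Fin n) ℂ} (h : TMono n m q X) (i : ℕ) :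
    TMono n m q (X * MF n m q i) := by
  induction h with
  | of h => exact .of (.step i h)
  | step k h ih => rw [mul_assoc]; exact .step k ih

theorem triSpan_mul_MF {X : Matrix (Fin m → Fin n) (Fin m → Fin n) ℂ} (h : X ∈ triSpan n m q)
    (i : ℕ) : X * MF n m q i ∈ triSpan n m q :=
  mul_right_mem_of_span (fun _ hx => Submodule.subset_span (TMono.mul_MF hx i)) h

theorem FMono.dgc_mul {X : Matrix (Fin m → Fin n) (Fin m → Fin n) ℂ} (h : FMono n m q X)
    (f : (Fin n → ℕ) → ℂ) : dgc m f * X ∈ triSpan n m q := by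
  induction h with
  | base ν =>
    rw [dgc_mul_wp]
    exact Submodule.smul_mem _ _ (Submodule.subset_span (.of (.base ν)))
  | step k h ih => rw [← mul_assoc]; exact triSpan_mul_MF ih k

theorem TMono.dgc_mul {X : Matrix (Fin m → Fin n) (Fin m → Fin n) ℂ} (h : TMono n m q X)
    (f : (Fin n → ℕ) → ℂ) : dgc m f * X ∈ triSpan n m q := by
  induction h generalizing f with
  | of h => exact h.dgc_mul f
  | step k h ih =>
    obtain ⟨g, hg⟩ := ME_dgc (q := q) (m := m) k f
    rw [← mul_assoc, hg, mul_assoc]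
    exact triSpan_ME (ih g) k

theorem triSpan_dgc {X : Matrix (Fin m → Fin n) (Fin m → Fin n) ℂ} (h : X ∈ triSpan n m q)
    (f : (Fin n → ℕ) → ℂ) : dgc m f * X ∈ triSpan n m q :=
  mul_left_mem_of_span (fun _ hx => TMono.dgc_mul hx f) h

theorem dgc_mem_triSpan (f : (Fin n → ℕ) → ℂ) : dgc m f ∈ triSpan n m q := by
  rw [dgc_eq_sum]
  exact Submodule.sum_mem _ fun ν _ =>
    Submodule.smul_mem _ _ (Submodule.subset_span (.of (.base ν)))

theorem triSpan_MF (hq : q ≠ 0) {X : Matrix (Fin m → Fin n) (Fin m → Fin n) ℂ}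
    (h : X ∈ triSpan n m q) (i : ℕ) : MF n m q i * X ∈ triSpan n m q := by
  refine mul_left_mem_of_span (fun X hX => ?_) h
  induction hX with
  | of h =>
    induction h with
    | base ν =>
      obtain ⟨g, hg⟩ := MF_dgc (q := q) (m := m) i fun μ => if μ = ν then 1 else 0
      rw [wp, hg]
      exact triSpan_mul_MF (dgc_mem_triSpan g) i
    | step k h ih => rw [← mul_assoc]; exact triSpan_mul_MF ih k
  | step k h ih =>
    obtain ⟨f, hf⟩ := ME_MF_eq (n := n) (m := m) hq i k
    rw [← mul_assoc, hf, sub_mul, mul_assoc]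
    exact Submodule.sub_mem _ (triSpan_ME ih k) (h.dgc_mul f)

/-- The triangular decomposition of the algebra of operators. -/
theorem opAlg_le_triSpan (hq : q ≠ 0) {X : Matrix (Fin m → Fin n) (Fin m → Fin n) ℂ}
    (hX : X ∈ opAlg n m q) : X ∈ triSpan n m q := by
  suffices h : ∀ Z ∈ triSpan n m q, X * Z ∈ triSpan n m q by
    have := h 1 (by rw [← dgc_one]; exact dgc_mem_triSpan _)
    rwa [mul_one] at this
  induction hX using Algebra.adjoin_induction with
  | mem x hx =>
    rcases hx with (⟨i, rfl⟩ | ⟨i, rfl⟩) | ⟨ν, rfl⟩ <;> intro Z hZ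
    · exact triSpan_ME hZ i
    · exact triSpan_MF hq hZ i
    · exact triSpan_dgc hZ _
  | algebraMap r =>
    intro Z hZ
    rw [← Algebra.smul_def]
    exact Submodule.smul_mem _ _ hZ
  | add x y _ _ hx hy => intro Z hZ; rw [add_mul]; exact Submodule.add_mem _ (hx Z hZ) (hy Z hZ)
  | mul x y _ _ hx hy => intro Z hZ; rw [mul_assoc]; exact hx _ (hy Z hZ)

end Triangular

section Annihilator

variable {n m : ℕ} {q : ℂ}

theorem pow_two_mul_injective (hq : q ≠ 0) (hq' : NotRootOfUnity q) {a b : ℕ}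
    (h : q ^ (2 * a) = q ^ (2 * b)) : a = b := by
  wlog hab : a ≤ b generalizing a b
  · exact (this h.symm (by omega)).symm
  by_contra hne
  refine hq' (2 * (b - a)) (by omega) ?_
  have : q ^ (2 * b) = q ^ (2 * a) * q ^ (2 * (b - a)) := by rw [← pow_add]; congr 1; omega
  rw [this] at h
  exact (mul_right_eq_self₀.1 h.symm).resolve_right (pow_ne_zero _ hq)

theorem cnt_le (I : Fin m → Fin n) (i : Fin n) : cnt I i ≤ m := by
  rw [cnt_apply]
  refine (Finset.sum_le_sum fun k _ => (by split_ifs <;> omega : _ ≤ 1)).trans ?_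
  simp

theorem sum_cnt (I : Fin m → Fin n) : ∑ i, cnt I i = m := by
  simp only [cnt_apply]
  rw [Finset.sum_comm]
  simp

/-- A subspace of matrices closed under `Y ↦ tᵢ Y tᵢ` and killed by the trace is killed by the
traces against diagonal matrices. -/
theorem trace_mul_wp_eq_zero (hq : q ≠ 0) (hq' : NotRootOfUnity q)
    {𝒦 : Submodule ℂ (Matrix (Fin m → Fin n) (Fin m → Fin n) ℂ)}
    (htr : ∀ Y ∈ 𝒦, Y.trace = 0) (ht : ∀ Y ∈ 𝒦, ∀ i, tD n m q i * Y * tD n m q i ∈ 𝒦)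
    {Y : Matrix (Fin m → Fin n) (Fin m → Fin n) ℂ} (hY : Y ∈ 𝒦) (ν : Fin n → ℕ) :
    (Y * wp m ν).trace = 0 := by
  let Good : ((Fin n → ℕ) → ℂ) → Prop := fun f => ∀ Y ∈ 𝒦, (Y * dgc m f).trace = 0
  have hpow : ∀ f, Good f → ∀ i, Good fun μ => f μ * q ^ (2 * μ i) := by
    intro f hf i Y hY
    have := hf _ (ht Y hY i)
    rw [mul_assoc, mul_assoc, Matrix.trace_mul_comm, tD_eq_dgc, dgc_mul_dgc, mul_assoc,
      dgc_mul_dgc] at this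
    rw [← this]
    congr 3; ext μ
    simp only [Pi.mul_apply]; ring
  have hpoly : ∀ f, Good f → ∀ i, ∀ p : Polynomial ℂ, Good fun μ => f μ * p.eval (q ^ (2 * μ i)) := by
    intro f hf i p
    induction p using Polynomial.induction_on' with
    | add p r hp hr =>
      intro Y hY
      have : dgc m (fun μ : Fin n → ℕ => f μ * (p + r).eval (q ^ (2 * μ i))) =
          dgc m (fun μ => f μ * p.eval (q ^ (2 * μ i))) +
            dgc m (fun μ => f μ * r.eval (q ^ (2 * μ i))) := by
        rw [dgc, dgc, dgc, Matrix.diagonal_add]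
        congr 1; ext I; rw [Polynomial.eval_add, mul_add]
      rw [this, mul_add, Matrix.trace_add, hp Y hY, hr Y hY, add_zero]
    | monomial k c =>
      have : ∀ k, Good fun μ => f μ * (q ^ (2 * μ i)) ^ k := by
        intro k
        induction k with
        | zero => simpa using hf
        | succ k ih =>
          have := hpow _ ih i
          simpa only [mul_assoc, ← pow_succ] using this
      intro Y hY
      have e : dgc m (fun μ : Fin n → ℕ => f μ * ((Polynomial.monomial k) c).eval (q ^ (2 * μ i))) =
          c • dgc m (fun μ => f μ * (q ^ (2 * μ i)) ^ k) := by
        rw [dgc, dgc, ← Matrix.diagonal_smul]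
        congr 1; ext I
        rw [Polynomial.eval_monomial, Pi.smul_apply, smul_eq_mul]; ring
      rw [e, mul_smul_comm, Matrix.trace_smul, this k Y hY, smul_zero]
  by_cases hν : ∃ I : Fin m → Fin n, cnt I = ν
  swap
  · have : wp m ν = 0 := by
      rw [wp, dgc]
      simp only [not_exists] at hν
      simp [hν]
    rw [this, mul_zero, Matrix.trace_zero]
  obtain ⟨I₀, rfl⟩ := hν
  let p : Fin n → Polynomial ℂ := fun i =>
    ∏ k ∈ (Finset.range (m + 1)).erase (cnt I₀ i), (Polynomial.X - Polynomial.C (q ^ (2 * k)))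
  have hp0 : ∀ i, (p i).eval (q ^ (2 * cnt I₀ i)) ≠ 0 := by
    intro i
    simp only [p, Polynomial.eval_prod, Polynomial.eval_sub, Polynomial.eval_X, Polynomial.eval_C]
    refine Finset.prod_ne_zero_iff.2 fun k hk => sub_ne_zero.2 fun h => ?_
    exact Finset.ne_of_mem_erase hk (pow_two_mul_injective hq hq' h).symm
  have hp1 : ∀ (I : Fin m → Fin n) i, cnt I i ≠ cnt I₀ i → (p i).eval (q ^ (2 * cnt I i)) = 0 := by
    intro I i h
    simp only [p, Polynomial.eval_prod, Polynomial.eval_sub, Polynomial.eval_X, Polynomial.eval_C]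
    exact Finset.prod_eq_zero (Finset.mem_erase.2 ⟨h, Finset.mem_range.2 (by have := cnt_le I i; omega)⟩)
      (sub_self _)
  have hprod : ∀ s : Finset (Fin n), Good fun μ => ∏ i ∈ s, (p i).eval (q ^ (2 * μ i)) := by
    intro s
    induction s using Finset.induction_on with
    | empty =>
      intro Y hY
      simp only [Finset.prod_empty]
      rw [dgc_one, mul_one, htr Y hY]
    | insert i s hi ih =>
      have := hpoly _ ih i (p i)
      simpa only [Finset.prod_insert hi, mul_comm] using this
  have key := hprod Finset.univ Y hY
  have e : dgc m (fun μ : Fin n → ℕ => ∏ i, (p i).eval (q ^ (2 * μ i))) =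
      (∏ i, (p i).eval (q ^ (2 * cnt I₀ i))) • wp m (cnt I₀) := by
    rw [wp, dgc, dgc, ← Matrix.diagonal_smul]
    congr 1; ext I
    rw [Pi.smul_apply, smul_eq_mul]
    by_cases h : cnt I = cnt I₀
    · rw [if_pos h, h, mul_one]
    · rw [if_neg h, mul_zero]
      obtain ⟨i, hi⟩ := Function.ne_iff.1 h
      exact Finset.prod_eq_zero (Finset.mem_univ i) (hp1 I i hi)
  rw [e, mul_smul_comm, Matrix.trace_smul, smul_eq_mul] at key
  exact (mul_eq_zero.1 key).resolve_left (Finset.prod_ne_zero_iff.2 fun i _ => hp0 i)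

theorem FMono.mul_tD (hq : q ≠ 0) {X : Matrix (Fin m → Fin n) (Fin m → Fin n) ℂ}
    (h : FMono n m q X) (i : Fin n) : ∃ c : ℂ, c ≠ 0 ∧ X * tD n m q i = c • X := by
  induction h with
  | base ν => exact ⟨q ^ ν i, pow_ne_zero _ hq, by rw [tD_eq_dgc, wp_mul_dgc]⟩
  | @step k X h ih =>
    obtain ⟨c, hc, hX⟩ := ih
    by_cases hk : k + 1 < n
    · have hw := MF_weight (m := m) q hk
      have key : MF n m q k * tD n m q i =
          (q ^ ((Pi.single ⟨k, by omega⟩ 1 : Fin n → ℕ) i) *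
            (q ^ ((Pi.single ⟨k + 1, hk⟩ 1 : Fin n → ℕ) i))⁻¹) • (tD n m q i * MF n m q k) := by
        ext I J
        rw [tD, Matrix.mul_diagonal, Matrix.smul_apply, Matrix.diagonal_mul, smul_eq_mul]
        by_cases h0 : MF n m q k I J = 0
        · rw [h0, zero_mul, mul_zero, mul_zero]
        · have := congrFun (hw I J h0) i
          simp only [Pi.add_apply] at this
          have h2 : q ^ cnt J i * q ^ ((Pi.single ⟨k + 1, hk⟩ 1 : Fin n → ℕ) i) =
              q ^ cnt I i * q ^ ((Pi.single ⟨k, by omega⟩ 1 : Fin n → ℕ) i) := by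
            rw [← pow_add, ← pow_add, this]
          have h3 : q ^ ((Pi.single ⟨k + 1, hk⟩ 1 : Fin n → ℕ) i) ≠ 0 := pow_ne_zero _ hq
          rw [← mul_assoc, mul_comm _ (MF n m q k I J)]
          congr 1
          field_simp
          rw [h2]; ring
      refine ⟨(q ^ ((Pi.single ⟨k, by omega⟩ 1 : Fin n → ℕ) i) *
        (q ^ ((Pi.single ⟨k + 1, hk⟩ 1 : Fin n → ℕ) i))⁻¹) * c,
        mul_ne_zero (mul_ne_zero (pow_ne_zero _ hq) (inv_ne_zero (pow_ne_zero _ hq))) hc, ?_⟩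
      rw [mul_assoc, key, mul_smul_comm, ← mul_assoc, hX, smul_mul_assoc, smul_smul]
    · refine ⟨c, hc, ?_⟩
      rw [MF, ME, dif_neg hk, Matrix.transpose_zero, mul_zero, zero_mul, smul_zero]

theorem TMono.mul_tD (hq : q ≠ 0) {X : Matrix (Fin m → Fin n) (Fin m → Fin n) ℂ}
    (h : TMono n m q X) (i : Fin n) : ∃ c : ℂ, c ≠ 0 ∧ X * tD n m q i = c • X := by
  induction h with
  | of h => exact h.mul_tD hq i
  | step k h ih =>
    obtain ⟨c, hc, hX⟩ := ih
    exact ⟨c, hc, by rw [mul_assoc, hX, mul_smul_comm]⟩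

theorem trace_mul_opAlg_eq_zero (hq : q ≠ 0) (hq' : NotRootOfUnity q)
    {𝒦 : Submodule ℂ (Matrix (Fin m → Fin n) (Fin m → Fin n) ℂ)}
    (htr : ∀ Y ∈ 𝒦, Y.trace = 0)
    (ha : ∀ Y ∈ 𝒦, ∀ i j, j ≤ i → tD n m q j * Y * aK n m q ℂ i j ∈ 𝒦)
    (hb : ∀ Y ∈ 𝒦, ∀ i j, i ≤ j → bX n m q ℂ i j * Y * tD n m q i ∈ 𝒦)
    {X Y : Matrix (Fin m → Fin n) (Fin m → Fin n) ℂ} (hX : X ∈ opAlg n m q) (hY : Y ∈ 𝒦) :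
    (Y * X).trace = 0 := by
  have hF : ∀ X, FMono n m q X → ∀ Y ∈ 𝒦, (Y * X).trace = 0 := by
    intro X hX
    induction hX with
    | base ν =>
      refine fun Y hY => trace_mul_wp_eq_zero hq hq' htr (fun Y hY i => ?_) hY ν
      rw [← aK_diag hq] at *
      have := ha Y hY i i le_rfl
      rwa [← aK_diag hq] at this
    | @step k X h ih =>
      intro Y hY
      by_cases hk : k + 1 < n
      · have h1 := ih _ (hb Y hY ⟨k, by omega⟩ ⟨k + 1, hk⟩ (by simp [Fin.le_def]))
        have h2 : ∃ c : ℂ, c ≠ 0 ∧ tD n m q ⟨k, by omega⟩ * X = c • X := by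
          clear h1 ih
          induction h with
          | base ν => exact ⟨q ^ ν ⟨k, by omega⟩, pow_ne_zero _ hq, by rw [tD_eq_dgc, dgc_mul_wp]⟩
          | step l h ih =>
            obtain ⟨c, hc, hX⟩ := ih
            exact ⟨c, hc, by rw [← mul_assoc, hX, smul_mul_assoc]⟩
        obtain ⟨c, hc, hX⟩ := h2
        rw [mul_assoc, hX, mul_smul_comm, Matrix.trace_smul, smul_eq_mul, ← MF_eq hk, mul_assoc,
          Matrix.trace_mul_comm, mul_assoc] at h1
        exact (mul_eq_zero.1 h1).resolve_left hc
      · rw [MF, ME, dif_neg hk]; simp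
  have hT : ∀ X, TMono n m q X → ∀ Y ∈ 𝒦, (Y * X).trace = 0 := by
    intro X hX
    induction hX with
    | of h => exact hF _ h
    | @step k X h ih =>
      intro Y hY
      by_cases hk : k + 1 < n
      · have h1 := ih _ (ha Y hY ⟨k + 1, hk⟩ ⟨k, by omega⟩ (by simp [Fin.le_def]))
        obtain ⟨c, hc, hX⟩ := h.mul_tD hq ⟨k, by omega⟩
        have hE : aK n m q ℂ ⟨k + 1, hk⟩ ⟨k, by omega⟩ = ME n m q k := by rw [ME, dif_pos hk]
        rw [hE, mul_assoc, mul_assoc, Matrix.trace_mul_comm, mul_assoc, mul_assoc, hX,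
          mul_smul_comm, mul_smul_comm, Matrix.trace_smul, smul_eq_mul] at h1
        exact (mul_eq_zero.1 h1).resolve_left hc
      · rw [ME, dif_neg hk]; simp
  have := opAlg_le_triSpan hq hX
  have h2 : triSpan n m q ≤ LinearMap.ker (Matrix.traceLinearMap (Fin m → Fin n) ℂ ℂ ∘ₗ
      LinearMap.mulLeft ℂ Y) := Submodule.span_le.2 fun X hX => hT X hX Y hY
  exact h2 this

end Annihilator

section Commutant

variable {n m : ℕ} {q : ℂ}

/-- The transposition of the positions `k` and `k + 1`. -/
def ps {k : ℕ} (hk : k + 1 < m) : Equiv.Perm (Fin m) := Equiv.swap ⟨k, by omega⟩ ⟨k + 1, hk⟩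

theorem mem_closure_ps (σ : Equiv.Perm (Fin m)) :
    σ ∈ Submonoid.closure {τ : Equiv.Perm (Fin m) | ∃ k, ∃ hk : k + 1 < m, τ = ps hk} := by
  rcases m with - | m
  · rw [Subsingleton.elim σ 1]; exact one_mem _
  · have := Equiv.Perm.mclosure_swap_castSucc_succ m
    have h2 : σ ∈ (⊤ : Submonoid (Equiv.Perm (Fin (m + 1)))) := trivial
    rw [← this] at h2
    refine Submonoid.closure_mono ?_ h2
    rintro _ ⟨i, rfl⟩
    exact ⟨i, by omega, rfl⟩

theorem comp_ps {k : ℕ} (hk : k + 1 < m) (J : Fin m → Fin n) :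
    J ∘ ps hk = Function.update (Function.update J ⟨k, by omega⟩ (J ⟨k + 1, hk⟩)) ⟨k + 1, hk⟩
      (J ⟨k, by omega⟩) := by
  ext1 x
  simp only [Function.comp_apply, ps, Equiv.swap_apply_def, Function.update_apply]
  grind

theorem TB_apply {B : Type} [Ring B] [Algebra ℂ B] (p r : Fin n × Fin n) :
    TB q B n p r = RB q B n p.swap r := by
  rw [TB_eq, Matrix.mul_apply]
  simp [PB_apply]

theorem mul_Tw_apply {B : Type} [Ring B] [Algebra ℂ B] {k : ℕ} (hk : k + 1 < m)
    (Z : Matrix (Fin m → Fin n) (Fin m → Fin n) B) (I J : Fin m → Fin n) :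
    (Z * Tw n m q B k) I J = al q (J ⟨k, by omega⟩) (J ⟨k + 1, hk⟩) • Z I (J ∘ ps hk) +
      be q (J ⟨k + 1, hk⟩) (J ⟨k, by omega⟩) • Z I J := by
  have hk' : (k < m ∧ k + 1 < m) ∧ k ≠ k + 1 := by omega
  rw [Tw, w2, dif_pos hk', mul_emb_apply]
  simp only [TB_apply, RB, Matrix.map_apply]
  rw [← (Equiv.prodComm (Fin n) (Fin n)).sum_comp]
  simp only [Equiv.prodComm_apply, Prod.swap_swap, ← Algebra.commutes, ← Algebra.smul_def]
  rw [sum_Rmat_col]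
  simp only [Prod.swap_swap]
  congr 2
  · congr 1
    rw [comp_ps]; rfl
  · congr 1
    exact Leg.up _ _

theorem Tw_mul_apply {B : Type} [Ring B] [Algebra ℂ B] {k : ℕ} (hk : k + 1 < m)
    (Z : Matrix (Fin m → Fin n) (Fin m → Fin n) B) (I J : Fin m → Fin n) :
    (Tw n m q B k * Z) I J = al q (I ⟨k, by omega⟩) (I ⟨k + 1, hk⟩) • Z (I ∘ ps hk) J +
      be q (I ⟨k + 1, hk⟩) (I ⟨k, by omega⟩) • Z I J := by
  have hk' : (k < m ∧ k + 1 < m) ∧ k ≠ k + 1 := by omega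
  rw [Tw, w2, dif_pos hk', emb_mul_apply]
  simp only [TB_apply, RB, Matrix.map_apply, ← Algebra.smul_def]
  rw [sum_Rmat_row]
  simp only [Prod.swap_swap, Prod.fst_swap, Prod.snd_swap]
  congr 2
  · rw [al_symm]; rfl
  · congr 1
    rw [comp_ps]; rfl
  · congr 1
    exact Leg.up _ _

theorem cnt_comp_perm (I : Fin m → Fin n) (σ : Equiv.Perm (Fin m)) : cnt (I ∘ σ) = cnt I :=
  Equiv.sum_comp σ fun k => (Pi.single (I k) 1 : Fin n → ℕ)

variable (n m q) in
/-- The commutant of the action of the Hecke algebra. -/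
def cent : Subalgebra ℂ (Matrix (Fin m → Fin n) (Fin m → Fin n) ℂ) :=
  Subalgebra.centralizer ℂ {Z | ∃ k, k + 1 < m ∧ Z = Tw n m q ℂ k}

theorem mem_cent {X : Matrix (Fin m → Fin n) (Fin m → Fin n) ℂ} :
    X ∈ cent n m q ↔ ∀ k, k + 1 < m → Commute (Tw n m q ℂ k) X := by
  rw [cent, Subalgebra.mem_centralizer_iff]
  constructor
  · exact fun h k hk => h _ ⟨k, hk, rfl⟩
  · rintro h _ ⟨k, hk, rfl⟩
    exact h k hk

theorem mem_cent_iff_apply {X : Matrix (Fin m → Fin n) (Fin m → Fin n) ℂ} :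
    X ∈ cent n m q ↔ ∀ k (hk : k + 1 < m), ∀ I J : Fin m → Fin n,
      al q (I ⟨k, by omega⟩) (I ⟨k + 1, hk⟩) * X (I ∘ ps hk) J +
        be q (I ⟨k + 1, hk⟩) (I ⟨k, by omega⟩) * X I J =
      al q (J ⟨k, by omega⟩) (J ⟨k + 1, hk⟩) * X I (J ∘ ps hk) +
        be q (J ⟨k + 1, hk⟩) (J ⟨k, by omega⟩) * X I J := by
  rw [mem_cent]
  refine forall₂_congr fun k hk => ?_
  rw [commute_iff_eq, ← Matrix.ext_iff]
  refine forall₂_congr fun I J => ?_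
  rw [Tw_mul_apply hk, mul_Tw_apply hk]
  simp only [smul_eq_mul]

theorem aK_mem_cent (hq : q ≠ 0) (i j : Fin n) : aK n m q ℂ i j ∈ cent n m q := by
  refine mem_cent.2 fun k hk => ?_
  have h := Tw_commute_aK (n := n) (B := ℂ) hq hk
  rw [scalar_commute_iff] at h
  exact h i j

theorem bX_mem_cent (hq : q ≠ 0) (i j : Fin n) : bX n m q ℂ i j ∈ cent n m q := by
  refine mem_cent.2 fun k hk => ?_
  have h := Tw_commute_bX (n := n) (B := ℂ) hq hk
  rw [scalar_commute_iff] at h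
  exact h i j

theorem Tw_commute_dgc {k : ℕ} (hk : k + 1 < m) (f : (Fin n → ℕ) → ℂ) :
    Commute (Tw n m q ℂ k) (dgc m f) := by
  rw [commute_iff_eq]
  ext I J
  rw [Tw_mul_apply hk, mul_Tw_apply hk]
  simp only [dgc, Matrix.diagonal_apply, smul_eq_mul]
  have hs : ∀ I : Fin m → Fin n, (I ∘ ps hk) ∘ ps hk = I := fun I => by
    ext1 x; simp [ps]
  have hI : ∀ I : Fin m → Fin n, (I ∘ ps hk) ⟨k, by omega⟩ = I ⟨k + 1, hk⟩ := fun I => by simp [ps]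
  have hI' : ∀ I : Fin m → Fin n, (I ∘ ps hk) ⟨k + 1, hk⟩ = I ⟨k, by omega⟩ := fun I => by simp [ps]
  by_cases h : I = J
  · subst h
    simp [eq_comm, cnt_comp_perm]
  · by_cases h' : I ∘ ps hk = J
    · subst h'
      rw [hs, hI, hI', al_symm]
      simp [h, cnt_comp_perm]
    · have : I ≠ J ∘ ps hk := by
        rintro rfl; exact h' (hs J)
      simp [h, h', this]

theorem dgc_mem_cent (f : (Fin n → ℕ) → ℂ) : dgc m f ∈ cent n m q :=
  mem_cent.2 fun _ hk => Tw_commute_dgc hk f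

theorem opAlg_le_cent (hq : q ≠ 0) : opAlg n m q ≤ cent n m q := by
  refine Algebra.adjoin_le ?_
  rintro _ ((⟨i, rfl⟩ | ⟨i, rfl⟩) | ⟨ν, rfl⟩)
  · rw [ME]; split_ifs
    · exact aK_mem_cent hq _ _
    · exact zero_mem _
  · by_cases h : i + 1 < n
    · rw [MF_eq h]; exact bX_mem_cent hq _ _
    · rw [MF, ME, dif_neg h, Matrix.transpose_zero]; exact zero_mem _
  · exact dgc_mem_cent _

/-- An element of the commutant killing a word kills all its rearrangements, provided the letters
of the word are distinct. -/
theorem cent_mulVec_perm {s : Matrix (Fin m → Fin n) (Fin m → Fin n) ℂ} (hs : s ∈ cent n m q)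
    {w : Fin m → Fin n} (hw : Function.Injective w) (h : ∀ I, s I w = 0) (σ : Equiv.Perm (Fin m)) :
    ∀ I, s I (w ∘ σ) = 0 := by
  have key : ∀ (σ : Equiv.Perm (Fin m)) {k : ℕ} (hk : k + 1 < m), (∀ I, s I (w ∘ σ) = 0) →
      ∀ I, s I (w ∘ ⇑(σ * ps hk)) = 0 := by
    intro σ k hk ih I
    have := mem_cent_iff_apply.1 hs k hk I (w ∘ σ)
    rw [ih, ih, mul_zero, mul_zero, mul_zero, add_zero, add_zero] at this
    have h1 : al q ((w ∘ σ) ⟨k, by omega⟩) ((w ∘ σ) ⟨k + 1, hk⟩) = 1 := by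
      rw [al, if_neg]
      simp [hw.eq_iff]
    rw [h1, one_mul] at this
    exact this.symm
  have hσ := mem_closure_ps σ
  induction hσ using Submonoid.closure_induction_right with
  | one => simpa using h
  | mul_right x _ y hy ih =>
    obtain ⟨k, hk, rfl⟩ := hy
    exact key x hk ih

end Commutant

section DistinctLetters

open scoped Matrix

variable {n m : ℕ} {q : ℂ}

theorem ME_apply' (hq : q ≠ 0) {i : ℕ} (h : i + 1 < n) (I J : Fin m → Fin n) :
    ME n m q i I J = ∑ l : Fin m,
      if J l = ⟨i + 1, h⟩ ∧ I = Function.update J l ⟨i, by omega⟩ then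
        raiseCoeff q ⟨i, by omega⟩ ⟨i + 1, h⟩ I l m else 0 := by
  rw [ME_apply hq h]
  refine Finset.sum_congr rfl fun l _ => if_congr ?_ rfl rfl
  constructor
  · rintro ⟨h1, rfl⟩
    simp [← h1]
  · rintro ⟨h1, rfl⟩
    simp [← h1]

theorem MF_mulVec_single (hq : q ≠ 0) {i : ℕ} (h : i + 1 < n) {J : Fin m → Fin n}
    (hJ : Function.Injective J) {l : Fin m} (hl : J l = ⟨i, by omega⟩) :
    MF n m q i *ᵥ Pi.single J 1 = raiseCoeff q ⟨i, by omega⟩ ⟨i + 1, h⟩ J l m •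
      (Pi.single (Function.update J l ⟨i + 1, h⟩) 1 : (Fin m → Fin n) → ℂ) := by
  ext I
  rw [Matrix.mulVec_single_one, Matrix.col_apply, MF, Matrix.transpose_apply, ME_apply hq h,
    Finset.sum_eq_single l]
  · simp [hl, Pi.single_apply]
  · intro x _ hx
    rw [if_neg]
    rintro ⟨h1, -⟩
    exact hx (hJ (h1.trans hl.symm))
  · simp

theorem ME_mulVec_single (hq : q ≠ 0) {i : ℕ} (h : i + 1 < n) {J : Fin m → Fin n} {l l' : Fin m}
    (hll : l ≠ l') (hl : ∀ x, J x = ⟨i + 1, h⟩ ↔ x = l ∨ x = l') :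
    ME n m q i *ᵥ Pi.single J 1 =
      raiseCoeff q ⟨i, by omega⟩ ⟨i + 1, h⟩ (Function.update J l ⟨i, by omega⟩) l m •
        (Pi.single (Function.update J l ⟨i, by omega⟩) 1 : (Fin m → Fin n) → ℂ) +
      raiseCoeff q ⟨i, by omega⟩ ⟨i + 1, h⟩ (Function.update J l' ⟨i, by omega⟩) l' m •
        (Pi.single (Function.update J l' ⟨i, by omega⟩) 1 : (Fin m → Fin n) → ℂ) := by
  ext I
  rw [Matrix.mulVec_single_one, Matrix.col_apply, ME_apply' hq h, Finset.sum_eq_add l l' hll]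
  · rw [Pi.add_apply, Pi.smul_apply, Pi.smul_apply, Pi.single_apply, Pi.single_apply]
    congr 1
    · by_cases hI : I = Function.update J l ⟨i, by omega⟩
      · rw [if_pos ⟨(hl l).2 (Or.inl rfl), hI⟩, if_pos hI, hI, smul_eq_mul, mul_one]
      · rw [if_neg (fun h => hI h.2), if_neg hI, smul_zero]
    · by_cases hI : I = Function.update J l' ⟨i, by omega⟩
      · rw [if_pos ⟨(hl l').2 (Or.inr rfl), hI⟩, if_pos hI, hI, smul_eq_mul, mul_one]
      · rw [if_neg (fun h => hI h.2), if_neg hI, smul_zero]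
  · intro x _ hx
    rw [if_neg]
    rintro ⟨h1, -⟩
    rcases (hl x).1 h1 with h | h
    · exact hx.1 h
    · exact hx.2 h
  · simp
  · simp

theorem ME_MF_mulVec_single (hq : q ≠ 0) (hq2 : q - q⁻¹ ≠ 0) {i : ℕ} (h : i + 1 < n)
    {w : Fin m → Fin n} (hw : Function.Injective w) {l l' : Fin m} (hl : w l = ⟨i, by omega⟩)
    (hl' : w l' = ⟨i + 1, h⟩) : ∃ c c' : ℂ, c' ≠ 0 ∧
      (ME n m q i * MF n m q i) *ᵥ Pi.single w 1 = c • (Pi.single w 1 : (Fin m → Fin n) → ℂ) +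
        c' • Pi.single (Equiv.swap ⟨i, by omega⟩ ⟨i + 1, h⟩ ∘ w) 1 := by
  have hll : l ≠ l' := by
    rintro rfl
    rw [hl] at hl'; simp at hl'
  rw [← Matrix.mulVec_mulVec, MF_mulVec_single hq h hw hl, Matrix.mulVec_smul,
    ME_mulVec_single hq h hll, smul_add, smul_smul, smul_smul]
  · have e1 : Function.update (Function.update w l ⟨i + 1, h⟩) l ⟨i, by omega⟩ = w := by
      simp [← hl]
    have e2 : Function.update (Function.update w l ⟨i + 1, h⟩) l' ⟨i, by omega⟩ =
        Equiv.swap ⟨i, by omega⟩ ⟨i + 1, h⟩ ∘ w := by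
      ext1 x
      have h1 := @hw x l
      have h2 := @hw x l'
      simp only [Function.update_apply, Function.comp_apply, Equiv.swap_apply_def, ← hl, ← hl']
      grind
    rw [e1, e2]
    exact ⟨_, _, mul_ne_zero (raiseCoeff_ne_zero hq hq2 _ _ _ _ _)
        (raiseCoeff_ne_zero hq hq2 _ _ _ _ _), rfl⟩
  · intro x
    have h2 := @hw x l'
    simp only [Function.update_apply, ← hl']
    grind

/-- The operator algebra acts transitively on the words with letters `0, …, m - 1` all distinct. -/
theorem exists_opAlg_mulVec (hq : q ≠ 0) (hq2 : q - q⁻¹ ≠ 0) (σ : Equiv.Perm (Fin m)) :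
    ∃ p ∈ opAlg (m + n) m q, p *ᵥ Pi.single (Fin.castAdd n) 1 =
      (Pi.single (Fin.castAdd n ∘ σ) 1 : (Fin m → Fin (m + n)) → ℂ) := by
  have hσ := mem_closure_ps σ
  induction hσ using Submonoid.closure_induction_left with
  | one => exact ⟨1, one_mem _, by rw [Matrix.one_mulVec]; rfl⟩
  | mul_left x hx σ _ ih =>
    obtain ⟨k, hk, rfl⟩ := hx
    obtain ⟨p, hp, h⟩ := ih
    obtain ⟨c, c', hc', hEF⟩ := ME_MF_mulVec_single (n := m + n) hq hq2
      (i := k) (w := Fin.castAdd n ∘ σ) (by omega)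
      ((Fin.castAdd_injective m n).comp σ.injective) (l := σ.symm ⟨k, by omega⟩)
      (l' := σ.symm ⟨k + 1, hk⟩) (by simp) (by simp)
    refine ⟨c'⁻¹ • (ME (m + n) m q k * MF (m + n) m q k * p - c • p), ?_, ?_⟩
    · exact Subalgebra.smul_mem _ (sub_mem (mul_mem (mul_mem (ME_mem_opAlg k) (MF_mem_opAlg k)) hp)
        (Subalgebra.smul_mem _ hp _)) _
    · rw [Matrix.smul_mulVec, Matrix.sub_mulVec, ← Matrix.mulVec_mulVec, Matrix.smul_mulVec, h,
        hEF, add_sub_cancel_left, smul_smul, inv_mul_cancel₀ hc', one_smul]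
      congr 1
      ext1 x
      simp only [Function.comp_apply, ps, Equiv.Perm.coe_mul, Equiv.swap_apply_def]
      grind

theorem cnt_eq_iff_exists_perm {I J : Fin m → Fin n} :
    cnt I = cnt J ↔ ∃ σ : Equiv.Perm (Fin m), I = J ∘ σ := by
  constructor
  · intro h
    have hc : ∀ y, Nonempty ({x // I x = y} ≃ {x // J x = y}) := by
      intro y
      have := congrFun h y
      rw [cnt_apply, cnt_apply, ← Finset.card_filter, ← Finset.card_filter] at this
      refine Fintype.card_eq.1 ?_
      rw [Fintype.card_subtype, Fintype.card_subtype, this]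
    exact ⟨Equiv.ofFiberEquiv fun y => (hc y).some,
      (funext fun x => Equiv.ofFiberEquiv_map (fun y => (hc y).some) x).symm⟩
  · rintro ⟨σ, rfl⟩
    exact cnt_comp_perm _ _

end DistinctLetters

section DoubleCommutant

open scoped Matrix

variable {n m : ℕ} {q : ℂ}

theorem NotRootOfUnity.sub_inv_ne_zero (hq : q ≠ 0) (hq' : NotRootOfUnity q) : q - q⁻¹ ≠ 0 := by
  intro h
  refine hq' 2 (by norm_num) ?_
  rw [pow_two]
  nth_rewrite 2 [sub_eq_zero.1 h]
  exact mul_inv_cancel₀ hq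

theorem wp_apply (ν : Fin n → ℕ) (I J : Fin m → Fin n) :
    (wp m ν) I J = if I = J ∧ cnt I = ν then 1 else 0 := by
  rw [wp, dgc, Matrix.diagonal_apply]
  by_cases h : I = J <;> simp [h]

theorem wp_mul_apply (ν : Fin n → ℕ) (X : Matrix (Fin m → Fin n) (Fin m → Fin n) ℂ)
    (I J : Fin m → Fin n) : (wp m ν * X) I J = if cnt I = ν then X I J else 0 := by
  rw [wp, dgc, Matrix.diagonal_mul]; simp

theorem mul_wp_apply (ν : Fin n → ℕ) (X : Matrix (Fin m → Fin n) (Fin m → Fin n) ℂ)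
    (I J : Fin m → Fin n) : (X * wp m ν) I J = if cnt J = ν then X I J else 0 := by
  rw [wp, dgc, Matrix.mul_diagonal]; simp

theorem wp_mul_mul_wp_mem (hq : q ≠ 0) (hq2 : q - q⁻¹ ≠ 0)
    {s : Matrix (Fin m → Fin (m + n)) (Fin m → Fin (m + n)) ℂ} (hs : s ∈ cent (m + n) m q) :
    wp m (cnt (Fin.castAdd n)) * s * wp m (cnt (Fin.castAdd n)) ∈ opAlg (m + n) m q := by
  choose p hp hpw using fun σ => exists_opAlg_mulVec (m := m) (n := n) hq hq2 σ
  set ω : Fin (m + n) → ℕ := cnt (Fin.castAdd n : Fin m → Fin (m + n)) with hω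
  set y := ∑ σ : Equiv.Perm (Fin m), s (Fin.castAdd n ∘ σ) (Fin.castAdd n) • p σ with hy
  have hyP : y ∈ opAlg (m + n) m q :=
    sum_mem fun σ _ => Subalgebra.smul_mem _ (hp σ) _
  have hωP : wp m ω ∈ opAlg (m + n) m q := wp_mem_opAlg _
  suffices h : wp m ω * s * wp m ω = wp m ω * y * wp m ω by
    rw [h]; exact mul_mem (mul_mem hωP hyP) hωP
  rw [← sub_eq_zero, ← sub_mul, ← mul_sub]
  have hd : wp m ω * (s - y) ∈ cent (m + n) m q :=
    mul_mem (dgc_mem_cent _) (sub_mem hs (opAlg_le_cent hq hyP))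
  have h0 : ∀ I, (wp m ω * (s - y)) I (Fin.castAdd n) = 0 := by
    intro I
    rw [wp_mul_apply]
    split_ifs with hI
    · obtain ⟨τ, rfl⟩ := cnt_eq_iff_exists_perm.1 hI
      have hpe : ∀ σ, p σ (Fin.castAdd n ∘ τ) (Fin.castAdd n) = if σ = τ then 1 else 0 := by
        intro σ
        have := congrFun (hpw σ) (Fin.castAdd n ∘ τ)
        rw [Matrix.mulVec_single_one, Matrix.col_apply, Pi.single_apply] at this
        rw [this]
        refine if_congr ?_ rfl rfl
        constructor
        · intro h
          ext x
          have := Fin.castAdd_injective m n (congrFun h x)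
          rw [this]
        · rintro rfl; rfl
      rw [Matrix.sub_apply, hy, Matrix.sum_apply]
      simp [hpe]
    · rfl
  ext I J
  rw [mul_wp_apply, Matrix.zero_apply]
  split_ifs with hJ
  · obtain ⟨τ, rfl⟩ := cnt_eq_iff_exists_perm.1 hJ
    exact cent_mulVec_perm hd (Fin.castAdd_injective m n) h0 τ I
  · rfl

/-- The weight `ν` is generated by the weight `ω` in the operator algebra. -/
def GenFrom (n m : ℕ) (q : ℂ) (ω ν : Fin n → ℕ) : Prop :=
  ∃ x ∈ opAlg n m q, ∃ y ∈ opAlg n m q, wp m ν = x * wp m ω * y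

theorem GenFrom.refl (ω : Fin n → ℕ) : GenFrom n m q ω ω :=
  ⟨1, one_mem _, 1, one_mem _, by rw [one_mul, mul_one]⟩

theorem GenFrom.of_lower (hq : q ≠ 0) (hq' : NotRootOfUnity q) {ω ν ν' : Fin n → ℕ} {i : ℕ}
    (hi : i + 1 < n) (h0 : ν ⟨i, by omega⟩ = 0) (h1 : ν ⟨i + 1, hi⟩ ≠ 0)
    (hν : ν + Pi.single ⟨i, by omega⟩ 1 = ν' + Pi.single ⟨i + 1, hi⟩ 1)
    (h : GenFrom n m q ω ν') : GenFrom n m q ω ν := by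
  obtain ⟨x, hx, y, hy, hxy⟩ := h
  have hE : ME n m q i * wp m ν = wp m ν' * ME n m q i := by
    ext I J
    rw [mul_wp_apply, wp_mul_apply]
    by_cases hIJ : ME n m q i I J = 0
    · simp [hIJ]
    · have := ME_weight q hi I J hIJ
      refine if_congr ?_ rfl rfl
      constructor
      · intro hJ
        rw [hJ, hν] at this
        exact add_right_cancel this
      · intro hI
        rw [hI, ← hν] at this
        exact (add_right_cancel this).symm
  have hF : MF n m q i * wp m ν = 0 := by
    ext I J
    rw [mul_wp_apply]
    split_ifs with hJ
    · by_contra hIJ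
      have := congrFun (MF_weight q hi I J hIJ) ⟨i, by omega⟩
      rw [hJ] at this
      simp [h0] at this
    · rfl
  have hFE : MF n m q i * ME n m q i * wp m ν =
      -((1 - q⁻¹ ^ 2) * (1 - q ^ (2 * ν ⟨i + 1, hi⟩))) • wp m ν := by
    have h2 : MF n m q i * ME n m q i = ME n m q i * MF n m q i -
        dgc m fun μ => (1 - q⁻¹ ^ 2) * (q ^ (2 * μ ⟨i, by omega⟩) - q ^ (2 * μ ⟨i + 1, hi⟩)) := by
      rw [dgc, ← ME_MF_sub hq hi, sub_sub_cancel]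
    rw [h2, sub_mul, mul_assoc, hF, mul_zero, zero_sub, dgc_mul_wp, h0, neg_smul]
    simp
  set c := -((1 - q⁻¹ ^ 2) * (1 - q ^ (2 * ν ⟨i + 1, hi⟩))) with hc
  have hc0 : c ≠ 0 := by
    rw [hc, neg_ne_zero]
    refine mul_ne_zero ?_ ?_
    · rw [sub_ne_zero, inv_pow]
      intro h
      exact hq' 2 (by norm_num) (inv_eq_one.1 h.symm)
    · rw [sub_ne_zero]
      exact fun h => hq' _ (by omega) h.symm
  refine ⟨c⁻¹ • (MF n m q i * x), Subalgebra.smul_mem _ (mul_mem (MF_mem_opAlg i) hx) _,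
    y * ME n m q i, mul_mem hy (ME_mem_opAlg i), ?_⟩
  calc wp m ν = c⁻¹ • (c • wp m ν) := by rw [smul_smul, inv_mul_cancel₀ hc0, one_smul]
    _ = c⁻¹ • (MF n m q i * (wp m ν' * ME n m q i)) := by rw [← hFE, ← hE, mul_assoc]
    _ = _ := by rw [hxy]; simp only [smul_mul_assoc, mul_assoc]

theorem GenFrom.mul_mul_mem {ω ν μ : Fin n → ℕ} (hq : q ≠ 0)
    (hω : ∀ s ∈ cent n m q, wp m ω * s * wp m ω ∈ opAlg n m q) (h : GenFrom n m q ω ν)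
    (h' : GenFrom n m q ω μ) {s : Matrix (Fin m → Fin n) (Fin m → Fin n) ℂ}
    (hs : s ∈ cent n m q) : wp m ν * s * wp m μ ∈ opAlg n m q := by
  obtain ⟨x, hx, y, hy, hxy⟩ := h
  obtain ⟨x', hx', y', hy', hxy'⟩ := h'
  rw [hxy, hxy']
  have := mul_mem (mul_mem hx (hω (y * s * x')
    (mul_mem (mul_mem (opAlg_le_cent hq hy) hs) (opAlg_le_cent hq hx')))) hy'
  simpa only [mul_assoc] using this

/-- The word `0, 1, …, j - 1, x, w_{j+1}, w_{j+2}, …`. -/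
def stair {n m : ℕ} (w : Fin m → Fin (m + n)) (j : ℕ) (x : Fin (m + n)) : Fin m → Fin (m + n) :=
  fun k => if (k : ℕ) < j then Fin.castAdd n k else if (k : ℕ) = j then x else w k

theorem stair_genFrom (hq : q ≠ 0) (hq' : NotRootOfUnity q) {w : Fin m → Fin (m + n)}
    (hw : Monotone w) {j : ℕ} (hj : j < m) {ω : Fin (m + n) → ℕ}
    (h : GenFrom (m + n) m q ω (cnt (stair w j ⟨j, by omega⟩))) (x : ℕ) (hjx : j ≤ x)
    (hx : x ≤ w ⟨j, hj⟩) :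
    GenFrom (m + n) m q ω (cnt (stair w j ⟨x, hx.trans_lt (w _).2⟩)) := by
  induction x, hjx using Nat.le_induction with
  | base => exact h
  | succ x hjx ih =>
    have hx' := hx.trans_lt (w ⟨j, hj⟩).2
    refine GenFrom.of_lower hq hq' (i := x) hx' ?_ ?_ ?_ (ih (by omega))
    · rw [cnt_apply]
      refine Finset.sum_eq_zero fun k _ => ?_
      rw [if_neg]
      intro hk
      have hk := congrArg Fin.val hk
      simp only [stair] at hk
      split_ifs at hk with h1 h2
      · have : (k : ℕ) = x := hk
        omega
      · have : x + 1 = x := hk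
        omega
      · have : w ⟨j, hj⟩ ≤ w k := hw (by rw [Fin.le_def]; simp; omega)
        rw [Fin.le_def] at this
        have : (w k : ℕ) = x := hk
        omega
    · rw [cnt_apply]
      refine ne_of_gt (Finset.sum_pos' (fun _ _ => Nat.zero_le _) ⟨⟨j, hj⟩, Finset.mem_univ _, ?_⟩)
      simp [stair]
    · have hu : stair w j ⟨x + 1, hx'⟩ =
          Function.update (stair w j ⟨x, by omega⟩) ⟨j, hj⟩ ⟨x + 1, hx'⟩ := by
        ext1 k
        simp only [stair, Function.update_apply, Fin.ext_iff]
        split_ifs <;> first | rfl | omega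
      rw [hu]
      have := cnt_update (stair w j ⟨x, by omega⟩) ⟨j, hj⟩ (⟨x + 1, hx'⟩ : Fin (m + n))
      rw [← this]
      congr 2
      simp [stair]

theorem genFrom_of_forall_le (hq : q ≠ 0) (hq' : NotRootOfUnity q) {w : Fin m → Fin (m + n)}
    (hwm : ∀ k, m ≤ (w k : ℕ)) :
    GenFrom (m + n) m q (cnt (Fin.castAdd n : Fin m → Fin (m + n))) (cnt w) := by
  rw [← cnt_comp_perm w (Tuple.sort w)]
  set v := w ∘ Tuple.sort w with hv
  have hmono : Monotone v := Tuple.monotone_sort w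
  have hvm : ∀ k, m ≤ (v k : ℕ) := fun k => hwm _
  have key : ∀ d j (hjm : j + d = m), GenFrom (m + n) m q
      (cnt (Fin.castAdd n : Fin m → Fin (m + n)))
      (cnt fun k => if (k : ℕ) < j then Fin.castAdd n k else v k) := by
    intro d
    induction d with
    | zero =>
      intro j hj
      convert GenFrom.refl _ using 3 with k
      rw [if_pos (by omega)]
    | succ d ih =>
      intro j hj
      have hj' : j < m := by omega
      have h1 := ih (j + 1) (by omega)
      have h2 := stair_genFrom hq hq' hmono hj' (ω := cnt (Fin.castAdd n)) (by
        convert h1 using 3 with k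
        simp only [stair, Fin.ext_iff]
        split_ifs <;> simp <;> omega) (v ⟨j, hj'⟩) (by have := hvm ⟨j, hj'⟩; omega) le_rfl
      convert h2 using 3 with k
      simp only [stair]
      split_ifs with h3 h4
      · rfl
      · congr 1; exact Fin.ext h4
      · rfl
  simpa using key m 0 (by omega)

end DoubleCommutant

section Compression

variable {n N m : ℕ} {q : ℂ}

/-- The compression of an operator to the words with letters in the image of `f`. -/
def cmp (f : Fin n → Fin N) (X : Matrix (Fin m → Fin N) (Fin m → Fin N) ℂ) :
    Matrix (Fin m → Fin n) (Fin m → Fin n) ℂ := X.submatrix (f ∘ ·) (f ∘ ·)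

theorem comp_left_injective {f : Fin n → Fin N} (hf : Function.Injective f) :
    Function.Injective (fun I : Fin m → Fin n => f ∘ I) := fun _ _ h =>
  funext fun x => hf (congrFun h x)

theorem cmp_mul_left {f : Fin n → Fin N} (hf : Function.Injective f)
    {Z : Matrix (Fin m → Fin N) (Fin m → Fin N) ℂ}
    (hZ : ∀ (I : Fin m → Fin n) K, Z (f ∘ I) K ≠ 0 → ∃ J : Fin m → Fin n, f ∘ J = K)
    (X : Matrix (Fin m → Fin N) (Fin m → Fin N) ℂ) : cmp f (Z * X) = cmp f Z * cmp f X := by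
  ext I J
  rw [cmp, Matrix.submatrix_apply, Matrix.mul_apply, Matrix.mul_apply]
  symm
  refine Fintype.sum_of_injective _ (comp_left_injective hf) _ _ ?_ fun _ => rfl
  intro K hK
  by_cases h : Z (f ∘ I) K = 0
  · rw [h, zero_mul]
  · exact (hK (hZ I K h)).elim

theorem cmp_mul_right {f : Fin n → Fin N} (hf : Function.Injective f)
    {Z : Matrix (Fin m → Fin N) (Fin m → Fin N) ℂ}
    (hZ : ∀ (J : Fin m → Fin n) K, Z K (f ∘ J) ≠ 0 → ∃ I : Fin m → Fin n, f ∘ I = K)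
    (X : Matrix (Fin m → Fin N) (Fin m → Fin N) ℂ) : cmp f (X * Z) = cmp f X * cmp f Z := by
  ext I J
  rw [cmp, Matrix.submatrix_apply, Matrix.mul_apply, Matrix.mul_apply]
  symm
  refine Fintype.sum_of_injective _ (comp_left_injective hf) _ _ ?_ fun _ => rfl
  intro K hK
  by_cases h : Z K (f ∘ J) = 0
  · rw [h, mul_zero]
  · exact (hK (hZ J K h)).elim

theorem al_comp {f : Fin n → Fin N} (hf : StrictMono f) (a b : Fin n) :
    al q (f a) (f b) = al q a b := by
  simp [al, hf.injective.eq_iff]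

theorem be_comp {f : Fin n → Fin N} (hf : StrictMono f) (a b : Fin n) :
    be q (f a) (f b) = be q a b := by
  simp [be, hf.lt_iff_lt]

theorem cnt_comp_apply {f : Fin n → Fin N} (hf : Function.Injective f) (I : Fin m → Fin n)
    (i : Fin n) : cnt (f ∘ I) (f i) = cnt I i := by
  simp [cnt_apply, hf.eq_iff]

theorem cnt_comp_apply_of_notMem {f : Fin n → Fin N} (I : Fin m → Fin n)
    {i : Fin N} (hi : i ∉ Set.range f) : cnt (f ∘ I) i = 0 := by
  rw [cnt_apply]
  refine Finset.sum_eq_zero fun k _ => if_neg fun h => hi ⟨_, h⟩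

/-- The extension by zero of an operator to words in a larger alphabet. -/
def extz (f : Fin n → Fin N) (X : Matrix (Fin m → Fin n) (Fin m → Fin n) ℂ) :
    Matrix (Fin m → Fin N) (Fin m → Fin N) ℂ := fun A A' =>
  Function.extend (fun p : (Fin m → Fin n) × (Fin m → Fin n) => (f ∘ p.1, f ∘ p.2))
    (fun p => X p.1 p.2) 0 (A, A')

theorem extz_apply {f : Fin n → Fin N} (hf : Function.Injective f)
    (X : Matrix (Fin m → Fin n) (Fin m → Fin n) ℂ) (I J : Fin m → Fin n) :
    extz f X (f ∘ I) (f ∘ J) = X I J := by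
  refine Function.Injective.extend_apply (f := fun p : (Fin m → Fin n) × (Fin m → Fin n) =>
    (f ∘ p.1, f ∘ p.2)) ?_ _ _ (I, J)
  intro p p' h
  simp only [Prod.mk.injEq] at h
  exact Prod.ext (comp_left_injective hf h.1) (comp_left_injective hf h.2)

theorem extz_eq_zero {f : Fin n → Fin N} {X : Matrix (Fin m → Fin n) (Fin m → Fin n) ℂ}
    {A A' : Fin m → Fin N}
    (h : ¬((∃ I : Fin m → Fin n, f ∘ I = A) ∧ ∃ I : Fin m → Fin n, f ∘ I = A')) :
    extz f X A A' = 0 := by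
  refine Function.extend_apply' _ _ _ ?_
  rintro ⟨p, hp⟩
  simp only [Prod.mk.injEq] at hp
  exact h ⟨⟨_, hp.1⟩, ⟨_, hp.2⟩⟩

theorem cmp_extz {f : Fin n → Fin N} (hf : Function.Injective f)
    (X : Matrix (Fin m → Fin n) (Fin m → Fin n) ℂ) : cmp f (extz f X) = X := by
  ext I J; exact extz_apply hf X I J

theorem exists_comp_eq_iff_ps (f : Fin n → Fin N) {k : ℕ} (hk : k + 1 < m) (A : Fin m → Fin N) :
    (∃ I : Fin m → Fin n, f ∘ I = A ∘ ps hk) ↔ ∃ I : Fin m → Fin n, f ∘ I = A := by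
  have hs : ∀ A : Fin m → Fin N, (A ∘ ps hk) ∘ ps hk = A := fun A => by
    ext1 x; simp [ps]
  constructor
  · rintro ⟨I, hI⟩
    refine ⟨I ∘ ps hk, ?_⟩
    rw [← Function.comp_assoc, hI, hs]
  · rintro ⟨I, rfl⟩
    exact ⟨I ∘ ps hk, rfl⟩

theorem extz_mem_cent {f : Fin n → Fin N} (hf : StrictMono f)
    {X : Matrix (Fin m → Fin n) (Fin m → Fin n) ℂ} (hX : X ∈ cent n m q) :
    extz f X ∈ cent N m q := by
  rw [mem_cent_iff_apply] at hX ⊢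
  intro k hk A A'
  by_cases hA : ∃ I : Fin m → Fin n, f ∘ I = A
  · by_cases hA' : ∃ I : Fin m → Fin n, f ∘ I = A'
    · obtain ⟨I, rfl⟩ := hA
      obtain ⟨J, rfl⟩ := hA'
      rw [Function.comp_assoc, Function.comp_assoc]
      simp only [extz_apply hf.injective, Function.comp_apply, al_comp hf, be_comp hf]
      exact hX k hk I J
    · rw [extz_eq_zero, extz_eq_zero, extz_eq_zero (A' := A' ∘ ps hk)]
      · simp
      all_goals simp [hA', exists_comp_eq_iff_ps]
  · rw [extz_eq_zero, extz_eq_zero, extz_eq_zero (A' := A' ∘ ps hk)]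
    · simp
    all_goals simp [hA, exists_comp_eq_iff_ps]

theorem raiseCoeff_comp {f : Fin n → Fin N} (hf : StrictMono f) (x y : Fin n) (I : Fin m → Fin n)
    (l : Fin m) (k : ℕ) : raiseCoeff q (f x) (f y) (f ∘ I) l k = raiseCoeff q x y I l k := by
  simp [raiseCoeff, al_comp hf]

theorem natAdd_strictMono (m : ℕ) : StrictMono (Fin.natAdd m : Fin n → Fin (m + n)) :=
  Fin.strictMono_natAdd m

theorem cmp_ME (hq : q ≠ 0) (i : ℕ) :
    cmp (Fin.natAdd m) (ME (m + n) m q i) = if m ≤ i then ME n m q (i - m) else 0 := by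
  ext I J
  rw [cmp, Matrix.submatrix_apply]
  by_cases h : i + 1 < m + n
  · rw [ME_apply hq h]
    split_ifs with hi
    · obtain ⟨i, rfl⟩ := Nat.exists_eq_add_of_le hi
      have h' : i + 1 < n := by omega
      rw [Nat.add_sub_cancel_left, ME_apply hq h']
      have e1 : (⟨m + i, by omega⟩ : Fin (m + n)) = Fin.natAdd m ⟨i, by omega⟩ := rfl
      have e2 : (⟨m + i + 1, h⟩ : Fin (m + n)) = Fin.natAdd m ⟨i + 1, h'⟩ := rfl
      refine Finset.sum_congr rfl fun l _ => ?_
      rw [e1, e2, raiseCoeff_comp (natAdd_strictMono m)]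
      refine if_congr (and_congr ?_ ?_) rfl rfl
      · exact (natAdd_strictMono m).injective.eq_iff
      · rw [← Function.comp_update]
        exact (comp_left_injective (natAdd_strictMono m).injective).eq_iff
    · refine Finset.sum_eq_zero fun l _ => if_neg ?_
      rintro ⟨h1, -⟩
      have : m + (I l : ℕ) = i := congrArg Fin.val h1
      omega
  · rw [ME, dif_neg h]
    split_ifs with hi
    · rw [ME, dif_neg (by omega)]; rfl
    · rfl

theorem ME_comp_range (hq : q ≠ 0) {i : ℕ} (I : Fin m → Fin n) (K : Fin m → Fin (m + n))
    (h : ME (m + n) m q i (Fin.natAdd m ∘ I) K ≠ 0) :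
    ∃ J : Fin m → Fin n, Fin.natAdd m ∘ J = K := by
  obtain ⟨hi, l, h1, rfl⟩ := ME_support hq h
  have h2 : m + (I l : ℕ) = i := congrArg Fin.val h1
  refine ⟨Function.update I l ⟨i + 1 - m, by omega⟩, ?_⟩
  rw [Function.comp_update]
  congr 1
  exact Fin.ext (by simp; omega)

theorem cmp_wp_mem (ν : Fin (m + n) → ℕ) :
    cmp (Fin.natAdd m) (wp m ν) ∈ opAlg n m q := by
  have : cmp (Fin.natAdd m) (wp m ν) = 0 ∨
      cmp (Fin.natAdd m) (wp m ν) = wp m fun i : Fin n => ν (Fin.natAdd m i) := by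
    by_cases h : ∃ I : Fin m → Fin n, cnt (Fin.natAdd m ∘ I) = ν
    · right
      obtain ⟨I₀, rfl⟩ := h
      ext I J
      rw [cmp, Matrix.submatrix_apply, wp_apply, wp_apply]
      refine if_congr (and_congr (comp_left_injective (natAdd_strictMono m).injective).eq_iff ?_)
        rfl rfl
      constructor
      · intro h
        ext i
        rw [← h, cnt_comp_apply (natAdd_strictMono m).injective]
      · intro h
        ext i
        by_cases hi : i ∈ Set.range (Fin.natAdd m : Fin n → Fin (m + n))
        · obtain ⟨i, rfl⟩ := hi
          rw [cnt_comp_apply (natAdd_strictMono m).injective, h]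
        · rw [cnt_comp_apply_of_notMem _ hi, cnt_comp_apply_of_notMem _ hi]
    · left
      ext I J
      rw [cmp, Matrix.submatrix_apply, wp_apply, if_neg fun h' => h ⟨I, h'.2⟩]
      rfl
  rcases this with h | h <;> rw [h]
  · exact zero_mem _
  · exact wp_mem_opAlg _

theorem cmp_transpose (f : Fin n → Fin N) (X : Matrix (Fin m → Fin N) (Fin m → Fin N) ℂ) :
    cmp f X.transpose = (cmp f X).transpose := rfl

theorem cmp_TMono_mem (hq : q ≠ 0) {X : Matrix (Fin m → Fin (m + n)) (Fin m → Fin (m + n)) ℂ}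
    (h : TMono (m + n) m q X) : cmp (Fin.natAdd m) X ∈ opAlg n m q := by
  induction h with
  | of h =>
    induction h with
    | base ν => exact cmp_wp_mem ν
    | step i h ih =>
      rw [cmp_mul_right (natAdd_strictMono m).injective fun J K h => ME_comp_range hq J K h]
      refine mul_mem ih ?_
      rw [MF, cmp_transpose, cmp_ME hq]
      split_ifs
      · exact MF_mem_opAlg _
      · exact zero_mem _
  | step i h ih =>
    rw [cmp_mul_left (natAdd_strictMono m).injective fun J K h => ME_comp_range hq J K h]
    refine mul_mem ?_ ih
    rw [cmp_ME hq]
    split_ifs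
    · exact ME_mem_opAlg _
    · exact zero_mem _

/-- The commutant of the Hecke algebra action is generated by the raising and lowering operators
and the weight projections. -/
theorem cent_le_opAlg (hq : q ≠ 0) (hq' : NotRootOfUnity q) : cent n m q ≤ opAlg n m q := by
  intro X hX
  have hf := natAdd_strictMono (n := n) m
  have hE := extz_mem_cent hf hX
  have hP : extz (Fin.natAdd m) X ∈ opAlg (m + n) m q := by
    have hsum : extz (Fin.natAdd m) X = ∑ ν ∈ Finset.univ.image (cnt (n := m + n) (m := m)),
        ∑ μ ∈ Finset.univ.image (cnt (n := m + n) (m := m)),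
          wp m ν * extz (Fin.natAdd m) X * wp m μ := by
      simp only [← Finset.mul_sum, ← Finset.sum_mul, sum_wp, one_mul, mul_one]
    rw [hsum]
    refine sum_mem fun ν _ => sum_mem fun μ _ => ?_
    by_cases h : ∃ I J : Fin m → Fin n, cnt (Fin.natAdd m ∘ I) = ν ∧ cnt (Fin.natAdd m ∘ J) = μ
    · obtain ⟨I, J, rfl, rfl⟩ := h
      exact GenFrom.mul_mul_mem hq
        (fun s hs => wp_mul_mul_wp_mem hq (hq'.sub_inv_ne_zero hq) hs)
        (genFrom_of_forall_le hq hq' fun k => by simp)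
        (genFrom_of_forall_le hq hq' fun k => by simp) hE
    · convert zero_mem (opAlg (m + n) m q) using 1
      ext A A'
      rw [mul_wp_apply, wp_mul_apply, Matrix.zero_apply]
      split_ifs with h1 h2
      · refine extz_eq_zero ?_
        rintro ⟨⟨I, rfl⟩, J, rfl⟩
        exact h ⟨I, J, h2, h1⟩
      · rfl
      · rfl
  rw [← cmp_extz hf.injective X]
  have hT := opAlg_le_triSpan hq hP
  generalize extz (Fin.natAdd m) X = Z at hT
  induction hT using Submodule.span_induction with
  | mem x hx => exact cmp_TMono_mem hq hx
  | zero => exact zero_mem _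
  | add x y _ _ hx hy => exact add_mem hx hy
  | smul a x _ hx => exact Subalgebra.smul_mem _ hx a

theorem opAlg_eq_cent (hq : q ≠ 0) (hq' : NotRootOfUnity q) : opAlg n m q = cent n m q :=
  le_antisymm (opAlg_le_cent hq) (cent_le_opAlg hq hq')

end Compression

/-! ### The pairing between operators and the coefficients of a matrix -/

section Pairing

set_option linter.unusedSectionVars false

variable {W : Type} [Fintype W] [DecidableEq W] {B : Type} [Ring B] [Algebra ℂ B]

/-- The trace of the product of a scalar matrix with `Z`. -/
def trp (Z : Matrix W W B) : Matrix W W ℂ →ₗ[ℂ] B where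
  toFun Y := ∑ I, ∑ J, Y I J • Z J I
  map_add' Y Y' := by simp only [Matrix.add_apply, add_smul, Finset.sum_add_distrib]
  map_smul' c Y := by
    simp only [Matrix.smul_apply, smul_assoc, Finset.smul_sum, RingHom.id_apply]

theorem trp_apply (Z : Matrix W W B) (Y : Matrix W W ℂ) :
    trp Z Y = ∑ I, ∑ J, Y I J • Z J I := rfl

theorem trp_single (Z : Matrix W W B) (I J : W) : trp Z (Matrix.single I J 1) = Z J I := by
  rw [trp_apply, Finset.sum_eq_single I, Finset.sum_eq_single J]
  · simp
  · intro K _ hK; rw [Matrix.single_apply_of_col_ne _ _ hK.symm, zero_smul]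
  · simp
  · intro K _ hK
    refine Finset.sum_eq_zero fun _ _ => ?_
    rw [Matrix.single_apply_of_row_ne hK.symm, zero_smul]
  · simp

theorem trp_map_left (C : Matrix W W ℂ) (Z : Matrix W W B) (Y : Matrix W W ℂ) :
    trp (C.map (algebraMap ℂ B) * Z) Y = trp Z (Y * C) := by
  simp only [trp_apply, Matrix.mul_apply, Matrix.map_apply, Finset.smul_sum, Finset.sum_smul,
    ← Algebra.smul_def, smul_smul]
  refine Finset.sum_congr rfl fun I _ => ?_
  rw [Finset.sum_comm]

theorem trp_map_right (C : Matrix W W ℂ) (Z : Matrix W W B) (Y : Matrix W W ℂ) :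
    trp (Z * C.map (algebraMap ℂ B)) Y = trp Z (C * Y) := by
  simp only [trp_apply, Matrix.mul_apply, Matrix.map_apply, Finset.smul_sum, Finset.sum_smul,
    ← Algebra.commutes, ← Algebra.smul_def, smul_smul]
  rw [Finset.sum_comm]
  conv_rhs => rw [Finset.sum_comm]
  refine Finset.sum_congr rfl fun I _ => ?_
  rw [Finset.sum_comm]
  refine Finset.sum_congr rfl fun J _ => Finset.sum_congr rfl fun K _ => ?_
  rw [mul_comm]

theorem map_trp {B' : Type} [Ring B'] [Algebra ℂ B'] (f : B →ₗ[ℂ] B') (Z : Matrix W W B)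
    (Y : Matrix W W ℂ) : f (trp Z Y) = trp (Z.map f) Y := by
  simp [trp_apply]

theorem trp_add (Z Z' : Matrix W W B) (Y : Matrix W W ℂ) :
    trp (Z + Z') Y = trp Z Y + trp Z' Y := by
  simp only [trp_apply, Matrix.add_apply, smul_add, Finset.sum_add_distrib]

theorem trp_sum {ι : Type} (s : Finset ι) (Z : ι → Matrix W W B) (Y : Matrix W W ℂ) :
    trp (∑ i ∈ s, Z i) Y = ∑ i ∈ s, trp (Z i) Y := by
  induction s using Finset.induction_on with
  | empty => simp [trp_apply]
  | insert a s ha ih => rw [Finset.sum_insert ha, Finset.sum_insert ha, trp_add, ih]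

theorem trp_complex (Z Y : Matrix W W ℂ) : trp Z Y = (Y * Z).trace := by
  simp [trp_apply, Matrix.trace, Matrix.mul_apply]

theorem trp_scalar_mul (c : B) (Z : Matrix W W B) (Y : Matrix W W ℂ) :
    trp (Matrix.scalar W c * Z) Y = c * trp Z Y := by
  simp [trp_apply, Matrix.diagonal_mul, Finset.mul_sum]

theorem trp_mul_scalar (c : B) (Z : Matrix W W B) (Y : Matrix W W ℂ) :
    trp (Z * Matrix.scalar W c) Y = trp Z Y * c := by
  simp [trp_apply, Matrix.mul_diagonal, Finset.sum_mul]

end Pairing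

/-! ### Homomorphisms from the quantized enveloping algebra -/

section Homs

variable {n m : ℕ} {q : ℂ}

theorem inverse_map_eq {R : Type} [Monoid R] {x y z : R} (h : x * y = 1) (h' : z * x = 1) :
    y = z := (left_inv_eq_right_inv h' h).symm

theorem map_lift_eq {B : Type} [Ring B] [Algebra ℂ B] {X Y K' : Matrix (Fin n) (Fin n) B}
    (h : RLLK q X Y K') {K : Matrix (Fin n) (Fin n) (Uq q n)}
    (hU : RLLK q (Lp q n) (Lm q n) K) {f : Uq q n →ₐ[ℂ] B}
    (h1 : ∀ i j, f (lp q n i j) = X i j) (h2 : ∀ i j, f (lm q n i j) = Y i j) :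
    (Lp q n).map f = X ∧ K.map f = K' := by
  refine ⟨Matrix.ext h1, ?_⟩
  have e : (Lm q n).map f = Y := Matrix.ext h2
  have := (hU.map f).inv
  rw [e] at this
  exact inverse_map_eq this h.inv'

theorem LLw_map {B B' : Type} [Ring B] [Ring B'] [Algebra ℂ B] [Algebra ℂ B'] (f : B →ₐ[ℂ] B')
    (X K : Matrix (Fin n) (Fin n) B) : (LLw m X K).map f = LLw m (X.map f) (K.map f) := by
  have h1 : ∀ X : Matrix (Fin n) (Fin n) B, ∀ k, (f : B →+* B').mapMatrix (w1 m X k) =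
      w1 m (X.map f) k := fun X k => w1_map X (f : B →+* B') k
  change (f : B →+* B').mapMatrix _ = _
  rw [LLw, map_mul, map_asc, map_desc, LLw]
  simp only [h1]

theorem exists_eps {K : Matrix (Fin n) (Fin n) (Uq q n)} (hU : RLLK q (Lp q n) (Lm q n) K) :
    ∃ f : Uq q n →ₐ[ℂ] ℂ, ∀ m, (LLw m (Lp q n) K).map f = 1 := by
  obtain ⟨f, h1, h2⟩ := exists_lift (RLL.one (q := q) (n := n) (B := ℂ))
  obtain ⟨e1, e2⟩ := map_lift_eq RLLK.one hU h1 h2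
  refine ⟨f, fun m => ?_⟩
  rw [LLw_map, e1, e2, LLw]
  rw [show w1 m (1 : Matrix (Fin n) (Fin n) ℂ) = fun _ => 1 from funext w1_one]
  have ha : ∀ m', asc (fun _ => (1 : Matrix (Fin m → Fin n) (Fin m → Fin n) ℂ)) m' = 1 := by
    intro m'; induction m' with
    | zero => rfl
    | succ k ih => rw [asc, ih, one_mul]
  have hd : ∀ m', desc (fun _ => (1 : Matrix (Fin m → Fin n) (Fin m → Fin n) ℂ)) m' = 1 := by
    intro m'; induction m' with
    | zero => rfl
    | succ k ih => rw [desc, ih, one_mul]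
  exact (congrArg₂ _ (ha m) (hd m)).trans (one_mul 1)

theorem exists_delta (hq : q ≠ 0) {K : Matrix (Fin n) (Fin n) (Uq q n)}
    (hU : RLLK q (Lp q n) (Lm q n) K) :
    ∃ f : Uq q n →ₐ[ℂ] Matrix (Fin n) (Fin n) (Uq q n), ∀ m,
      flip ((LLw m (Lp q n) K).map f) =
        aK n m q (Uq q n) * Matrix.scalar (Fin n) (LLw m (Lp q n) K) * bX n m q (Uq q n) := by
  have hX : ∀ (Z : Matrix (Fin n) (Fin n) (Uq q n)) (a b c d : Fin n),
      Commute (GX n q (Uq q n) a b) (Z.map (Matrix.scalar (Fin n)) c d) := fun Z a b c d =>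
    (scalar_commute_iff.2 fun i j => (RB_commute _ _ _ _).symm).symm
  have hY : ∀ (Z : Matrix (Fin n) (Fin n) (Uq q n)) (a b c d : Fin n),
      Commute (GK n q⁻¹ (Uq q n) a b) (Z.map (Matrix.scalar (Fin n)) c d) := fun Z a b c d =>
    (scalar_commute_iff.2 fun i j => (RB_commute _ _ _ _).symm).symm
  have h := (RLLK_G (B := Uq q n) (n := n) hq).mul (hU.map (Matrix.scalarAlgHom (Fin n) ℂ))
    (fun a b c d => hX _ a b c d) (fun a b c d => hX _ a b c d) (fun a b c d => hY _ a b c d)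
    (fun a b c d => hY _ a b c d)
  obtain ⟨f, h1, h2⟩ := exists_lift h.toRLL
  obtain ⟨e1, e2⟩ := map_lift_eq h hU h1 h2
  refine ⟨f, fun m => ?_⟩
  rw [LLw_map, e1, e2]
  exact flip_LLw

theorem exists_gamma {K : Matrix (Fin n) (Fin n) (Uq q n)} (hU : RLLK q (Lp q n) (Lm q n) K) :
    ∃ f : Uq q n →ₐ[ℂ] Uq q n, (Lp q n * K).map f = (4 : ℂ) • (Lp q n * K) := by
  have h := hU.smul (c := 2) two_ne_zero
  obtain ⟨f, h1, h2⟩ := exists_lift h.toRLL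
  obtain ⟨e1, e2⟩ := map_lift_eq h hU h1 h2
  refine ⟨f, ?_⟩
  rw [Matrix.map_mul, e1, e2, smul_mul_smul_comm]
  norm_num

end Homs

section Kernel

variable {n m : ℕ} {q : ℂ}

theorem aK_map {B : Type} [Ring B] [Algebra ℂ B] (i j : Fin n) :
    aK n m q B i j = (aK n m q ℂ i j).map (algebraMap ℂ B) := by
  have h : ∀ k, gK n m q B k = (algebraMap ℂ B).mapMatrix.mapMatrix (gK n m q ℂ k) := by
    intro k
    ext1 i j
    by_cases hk : k < m
    · rw [gK_apply hk, RingHom.mapMatrix_apply, Matrix.map_apply, gK_apply hk,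
        RingHom.mapMatrix_apply, w1_map]
      congr 1
    · rw [gK, gK, dif_neg hk, dif_neg hk, map_one]
  have : aK n m q B = (algebraMap ℂ B).mapMatrix.mapMatrix (aK n m q ℂ) := by
    rw [aK, aK, map_asc]; exact asc_congr fun k _ => h k
  rw [this]; rfl

theorem bX_map {B : Type} [Ring B] [Algebra ℂ B] (i j : Fin n) :
    bX n m q B i j = (bX n m q ℂ i j).map (algebraMap ℂ B) := by
  have h : ∀ k, gX n m q B k = (algebraMap ℂ B).mapMatrix.mapMatrix (gX n m q ℂ k) := by
    intro k
    ext1 i j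
    by_cases hk : k < m
    · rw [gX_apply hk, RingHom.mapMatrix_apply, Matrix.map_apply, gX_apply hk,
        RingHom.mapMatrix_apply, w1_map]
      congr 1
    · rw [gX, gX, dif_neg hk, dif_neg hk, map_one]
  have : bX n m q B = (algebraMap ℂ B).mapMatrix.mapMatrix (bX n m q ℂ) := by
    rw [bX, bX, map_desc]; exact desc_congr fun k _ => h k
  rw [this]; rfl

theorem Wt.mul_tD {X : Matrix (Fin m → Fin n) (Fin m → Fin n) ℂ} {i j : Fin n} (hq : q ≠ 0)
    (h : Wt X (Pi.single i 1) (Pi.single j 1)) (l : Fin n) :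
    ∃ c : ℂ, c ≠ 0 ∧ X * tD n m q l = c • (tD n m q l * X) := by
  refine ⟨q ^ (Pi.single i 1 : Fin n → ℕ) l * (q ^ (Pi.single j 1 : Fin n → ℕ) l)⁻¹,
    mul_ne_zero (pow_ne_zero _ hq) (inv_ne_zero (pow_ne_zero _ hq)), ?_⟩
  ext I J
  rw [tD, Matrix.smul_apply, Matrix.diagonal_mul, Matrix.mul_diagonal, smul_eq_mul]
  by_cases h0 : X I J = 0
  · rw [h0]; ring
  · have := congrFun (h I J h0) l
    simp only [Pi.add_apply] at this
    have e : q ^ cnt I l * q ^ (Pi.single i 1 : Fin n → ℕ) l =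
      q ^ cnt J l * q ^ (Pi.single j 1 : Fin n → ℕ) l := by rw [← pow_add, ← pow_add, this]
    have hj : q ^ (Pi.single j 1 : Fin n → ℕ) l ≠ 0 := pow_ne_zero _ hq
    field_simp
    linear_combination -e

theorem tD_mul_injective (hq : q ≠ 0) (l : Fin n) {Y : Matrix (Fin m → Fin n) (Fin m → Fin n) ℂ}
    (h : tD n m q l * Y * tD n m q l = 0) : Y = 0 := by
  ext I J
  have := congrFun (congrFun h I) J
  rw [tD, Matrix.mul_diagonal, Matrix.diagonal_mul, Matrix.zero_apply] at this
  rcases mul_eq_zero.1 this with h1 | h1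
  · exact (mul_eq_zero.1 h1).resolve_left (pow_ne_zero _ hq)
  · exact absurd h1 (pow_ne_zero _ hq)

theorem ker_closed (hq : q ≠ 0) {𝒦 : Submodule ℂ (Matrix (Fin m → Fin n) (Fin m → Fin n) ℂ)}
    (h : ∀ Y ∈ 𝒦, ∀ i j, ∑ k, bX n m q ℂ k j * Y * aK n m q ℂ i k ∈ 𝒦) (l : Fin n) :
    ∀ Y ∈ 𝒦, ∀ i j, bX n m q ℂ l j * Y * aK n m q ℂ i l ∈ 𝒦 := by
  induction l using WellFoundedLT.induction with
  | ind l ih =>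
  have hlow := (RLLK_words (n := n) (m := m) (B := ℂ) hq).lowerK
  have hup := (RLLK_words (n := n) (m := m) (B := ℂ) hq).upper
  have hmin : ∀ Y ∈ 𝒦, ∀ i j, (i = l ∨ j = l) → bX n m q ℂ l j * Y * aK n m q ℂ i l ∈ 𝒦 := by
    intro Y hY i j hij
    have h1 := h Y hY i j
    rw [← Finset.add_sum_erase _ _ (Finset.mem_univ l)] at h1
    refine (Submodule.add_mem_iff_left _ (sum_mem fun k hk => ?_)).1 h1
    rcases lt_or_gt_of_ne (Finset.ne_of_mem_erase hk) with hk | hk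
    · exact ih k hk Y hY i j
    · rcases hij with rfl | rfl
      · rw [hlow _ _ hk, mul_zero]; exact zero_mem _
      · rw [hup _ _ hk, zero_mul, zero_mul]; exact zero_mem _
  let f : 𝒦 →ₗ[ℂ] 𝒦 := ((LinearMap.mulRight ℂ (tD n m q l)).comp
    (LinearMap.mulLeft ℂ (tD n m q l))).restrict (p := 𝒦) (q := 𝒦) fun Y hY => by
      have := hmin Y hY l l (Or.inl rfl)
      rwa [aK_diag hq, bX_diag hq] at this
  have hf : Function.Surjective f := by
    refine LinearMap.surjective_of_injective ((injective_iff_map_eq_zero f).2 fun Y hY => ?_)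
    exact Subtype.ext (tD_mul_injective hq l (congrArg Subtype.val hY))
  intro Y hY i j
  obtain ⟨⟨Y', hY'⟩, e⟩ := hf ⟨Y, hY⟩
  replace e : tD n m q l * Y' * tD n m q l = Y := congrArg Subtype.val e
  obtain ⟨c, -, hc⟩ := (bX_weight (m := m) (q := q) l j).mul_tD hq l
  have h1 := hmin _ (hmin Y' hY' l j (Or.inl rfl)) i l (Or.inr rfl)
  rw [aK_diag hq, bX_diag hq] at h1
  rw [← e, ← mul_assoc, ← mul_assoc, hc]
  simp only [smul_mul_assoc]
  convert Submodule.smul_mem _ c h1 using 2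
  simp only [mul_assoc]

theorem trp_LLw_eq_zero_iff (hq : q ≠ 0) (hq' : NotRootOfUnity q)
    {K : Matrix (Fin n) (Fin n) (Uq q n)} (hU : RLLK q (Lp q n) (Lm q n) K)
    (Y : Matrix (Fin m → Fin n) (Fin m → Fin n) ℂ) :
    trp (LLw m (Lp q n) K) Y = 0 ↔ ∀ X ∈ cent n m q, (Y * X).trace = 0 := by
  constructor
  · intro hY X hX
    rw [← opAlg_eq_cent hq hq'] at hX
    obtain ⟨ε, hε⟩ := exists_eps hU
    obtain ⟨δ, hδ⟩ := exists_delta hq hU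
    have key : ∀ Y ∈ LinearMap.ker (trp (LLw m (Lp q n) K)), ∀ i j,
        ∑ k, bX n m q ℂ k j * Y * aK n m q ℂ i k ∈ LinearMap.ker (trp (LLw m (Lp q n) K)) := by
      intro Y hY i j
      rw [LinearMap.mem_ker] at hY ⊢
      have h1 := congrArg δ.toLinearMap hY
      rw [map_trp, map_zero] at h1
      have h2 : trp (flip ((LLw m (Lp q n) K).map δ) i j) Y = 0 := by
        have := congrFun (congrFun h1 i) j
        rw [trp_apply, Matrix.sum_apply] at this
        simp only [Matrix.sum_apply] at this
        exact this
      rw [hδ m, Matrix.mul_apply] at h2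
      simp only [Matrix.scalar_apply, Matrix.mul_diagonal, trp_sum, aK_map (B := Uq q n),
        bX_map (B := Uq q n), trp_map_right,
        mul_assoc, trp_map_left] at h2
      rw [map_sum, ← h2]
      simp only [mul_assoc]
    have hc := ker_closed hq key
    refine trace_mul_opAlg_eq_zero hq hq' (𝒦 := LinearMap.ker (trp (LLw m (Lp q n) K))) ?_ ?_ ?_
      hX hY
    · intro Y hY
      have h1 := congrArg ε.toLinearMap (LinearMap.mem_ker.1 hY)
      rw [map_trp, map_zero] at h1
      have h2 : trp ((LLw m (Lp q n) K).map ε) Y = 0 := h1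
      rwa [hε m, trp_complex, mul_one] at h2
    · intro Y hY i j _
      have := hc j Y hY i j
      rwa [bX_diag hq] at this
    · intro Y hY i j _
      have := hc i Y hY i j
      rwa [aK_diag hq] at this
  · intro hY
    refine (Module.forall_dual_apply_eq_zero_iff ℂ _).1 fun f => ?_
    rw [map_trp, trp_complex]
    refine hY _ (mem_cent.2 fun k hk => ?_)
    have h := hU.Tw_LLw (m := m) hk
    have h3 : Tw n m q (Uq q n) k = (Tw n m q ℂ k).map (algebraMap ℂ (Uq q n)) :=
      (Tw_map (Algebra.ofId ℂ (Uq q n)) k).symm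
    rw [h3] at h
    generalize LLw m (Lp q n) K = Z at h
    generalize Tw n m q ℂ k = C at h
    ext I J
    have h4 := congrArg f (congrFun (congrFun h.eq I) J)
    simp only [Matrix.mul_apply, Matrix.map_apply, map_sum, ← Algebra.commutes, ← Algebra.smul_def,
      map_smul, smul_eq_mul] at h4 ⊢
    rw [h4]
    exact Finset.sum_congr rfl fun _ _ => mul_comm _ _

end Kernel

section Crossing

set_option linter.unusedSectionVars false

variable {n m : ℕ} {q : ℂ}

variable (n m q) in
/-- The operator `D₁ ⋯ Dₘ`. -/
def Dw : Matrix (Fin m → Fin n) (Fin m → Fin n) ℂ :=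
  Matrix.diagonal fun I => ∏ a, q ^ (-2 * ((I a : ℕ) : ℤ))

variable (n m q) in
/-- The inverse of `D₁ ⋯ Dₘ`. -/
def Dwi : Matrix (Fin m → Fin n) (Fin m → Fin n) ℂ :=
  Matrix.diagonal fun I => (∏ a, q ^ (-2 * ((I a : ℕ) : ℤ)))⁻¹

theorem dw_ne_zero (hq : q ≠ 0) (I : Fin m → Fin n) : ∏ a, q ^ (-2 * ((I a : ℕ) : ℤ)) ≠ 0 :=
  Finset.prod_ne_zero_iff.2 fun _ _ => zpow_ne_zero _ hq

theorem Dw_mul_Dwi (hq : q ≠ 0) : Dw n m q * Dwi n m q = 1 := by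
  rw [Dw, Dwi, Matrix.diagonal_mul_diagonal, ← Matrix.diagonal_one]
  congr 1; ext I
  exact mul_inv_cancel₀ (dw_ne_zero hq I)

theorem Dwi_mul_Dw (hq : q ≠ 0) : Dwi n m q * Dw n m q = 1 := by
  rw [Dw, Dwi, Matrix.diagonal_mul_diagonal, ← Matrix.diagonal_one]
  congr 1; ext I
  exact inv_mul_cancel₀ (dw_ne_zero hq I)

theorem prod_comp_cnt (f : Fin n → ℂ) (I : Fin m → Fin n) :
    ∏ a, f (I a) = ∏ i, f i ^ cnt I i := by
  rw [Finset.prod_comp f I]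
  rw [← Finset.prod_subset (Finset.subset_univ (Finset.univ.image I))]
  · refine Finset.prod_congr rfl fun i _ => ?_
    rw [cnt_apply, Finset.card_filter]
  · intro i _ hi
    have : cnt I i = 0 := by
      rw [cnt_apply]
      refine Finset.sum_eq_zero fun k _ => if_neg fun h => hi ?_
      exact Finset.mem_image.2 ⟨k, Finset.mem_univ _, h⟩
    rw [this, pow_zero]

theorem Dw_eq_dgc : Dw n m q = dgc m fun ν => ∏ i : Fin n, (q ^ (-2 * ((i : ℕ) : ℤ))) ^ ν i := by
  rw [Dw, dgc]
  congr 1; ext I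
  exact prod_comp_cnt (fun i => q ^ (-2 * ((i : ℕ) : ℤ))) I

theorem Dwi_eq_dgc : Dwi n m q = dgc m fun ν =>
    (∏ i : Fin n, (q ^ (-2 * ((i : ℕ) : ℤ))) ^ ν i)⁻¹ := by
  rw [Dwi, dgc]
  congr 1; ext I
  rw [prod_comp_cnt (fun i => q ^ (-2 * ((i : ℕ) : ℤ))) I]

theorem dw_update (hq : q ≠ 0) (I : Fin m → Fin n) (k : Fin m) (b : Fin n) :
    ∏ a, q ^ (-2 * ((Function.update I k b a : ℕ) : ℤ)) =
      (∏ a, q ^ (-2 * ((I a : ℕ) : ℤ))) * (q ^ (-2 * ((I k : ℕ) : ℤ)))⁻¹ *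
        q ^ (-2 * ((b : ℕ) : ℤ)) := by
  rw [← Finset.mul_prod_erase _ _ (Finset.mem_univ k),
    ← Finset.mul_prod_erase _ (fun a => q ^ (-2 * ((I a : ℕ) : ℤ))) (Finset.mem_univ k),
    Function.update_self]
  have : ∏ x ∈ Finset.univ.erase k, q ^ (-2 * ((Function.update I k b x : ℕ) : ℤ)) =
      ∏ x ∈ Finset.univ.erase k, q ^ (-2 * ((I x : ℕ) : ℤ)) :=
    Finset.prod_congr rfl fun x hx => by rw [Function.update_of_ne (Finset.ne_of_mem_erase hx)]
  rw [this]
  field_simp [zpow_ne_zero _ hq]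

theorem cross_leg (hq : q ≠ 0) {A A' : Fin n → Fin n → Matrix (Fin n) (Fin n) ℂ}
    (h : ∀ w y a c, ∑ x, ∑ b, A x y a b * q ^ (-2 * ((b : ℕ) : ℤ)) * A' w x b c =
      if w = y ∧ a = c then q ^ (-2 * ((a : ℕ) : ℤ)) else 0) (k : Fin m) (w y : Fin n) :
    ∑ x, emb (legL n k) (A x y) * Dw n m q * emb (legL n k) (A' w x) =
      if w = y then Dw n m q else 0 := by
  ext I J
  rw [Matrix.sum_apply]
  have h1 : ∀ x, (emb (legL n k) (A x y) * Dw n m q * emb (legL n k) (A' w x)) I J =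
      (if J = Function.update I k (J k) then (∏ a, q ^ (-2 * ((I a : ℕ) : ℤ))) *
        (q ^ (-2 * ((I k : ℕ) : ℤ)))⁻¹ else 0) *
        ∑ b, A x y (I k) b * q ^ (-2 * ((b : ℕ) : ℤ)) * A' w x b (J k) := by
    intro x
    rw [mul_assoc, emb_mul_apply, Finset.mul_sum]
    refine Finset.sum_congr rfl fun b _ => ?_
    rw [Dw, Matrix.diagonal_mul, emb_apply]
    simp only [legL, Function.update_idem, Function.update_self]
    rw [dw_update hq]
    split_ifs <;> ring
  simp only [h1]
  rw [← Finset.mul_sum, h]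
  have hk : q ^ (-2 * ((I k : ℕ) : ℤ)) ≠ 0 := zpow_ne_zero _ hq
  by_cases hw : w = y
  · simp only [hw, true_and, if_true]
    rw [Dw, Matrix.diagonal_apply]
    by_cases hIJ : I = J
    · subst hIJ
      rw [Function.update_eq_self, if_pos rfl, if_pos rfl, if_pos rfl, mul_assoc,
        inv_mul_cancel₀ hk, mul_one]
    · rw [if_neg hIJ]
      by_cases h2 : I k = J k
      · rw [if_neg, zero_mul]
        intro h3; rw [← h2, Function.update_eq_self] at h3; exact hIJ h3.symm
      · rw [if_neg h2, mul_zero]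
  · simp [hw]

theorem cross_desc {R : Type} [Ring R] {D : R} {g g' : ℕ → Matrix (Fin n) (Fin n) R} {k : ℕ}
    (h : ∀ i < k, ∀ w y, ∑ x, g i x y * D * g' i w x = if w = y then D else 0)
    (hc : ∀ i < k, ∀ l < k, i ≠ l → ∀ a b c d, Commute (g i a b) (g l c d))
    (hc' : ∀ i < k, ∀ l < k, i ≠ l → ∀ a b c d, Commute (g' i a b) (g' l c d)) (w y : Fin n) :
    ∑ x, desc g k x y * D * asc g' k w x = if w = y then D else 0 := by
  induction k generalizing w y with
  | zero =>
    simp only [desc, asc, Matrix.one_apply, ite_mul, mul_ite, one_mul, zero_mul, mul_one, mul_zero]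
    simp [Finset.sum_ite_eq]
  | succ k ih =>
    have h1 : ∀ x, desc g (k + 1) x y * D * asc g' (k + 1) w x =
        ∑ v, ∑ u, desc g k u y * (g k x u * D * g' k v x) * asc g' k w v := by
      intro x
      rw [desc, asc, Matrix.mul_apply, Matrix.mul_apply, Finset.sum_mul, Finset.sum_mul_sum,
        Finset.sum_comm]
      refine Finset.sum_congr rfl fun v _ => Finset.sum_congr rfl fun u _ => ?_
      have e1 : Commute (g k x u) (desc g k u y) := commute_desc_entries
        (fun i hi a b => hc k (by omega) i (by omega) (by omega) x u a b) u y
      have e2 : Commute (g' k v x) (asc g' k w v) := commute_asc_entries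
        (fun i hi a b => hc' k (by omega) i (by omega) (by omega) v x a b) w v
      rw [e1.eq, ← e2.eq]
      simp only [mul_assoc]
    simp only [h1]
    rw [Finset.sum_comm]
    have h2 : ∀ v, ∑ x, ∑ u, desc g k u y * (g k x u * D * g' k v x) * asc g' k w v =
        desc g k v y * D * asc g' k w v := by
      intro v
      rw [Finset.sum_comm]
      simp only [← Finset.sum_mul, ← Finset.mul_sum, h k (by omega)]
      simp
    simp only [h2]
    exact ih (fun i hi => h i (by omega)) (fun i hi l hl => hc i (by omega) l (by omega))
      (fun i hi l hl => hc' i (by omega) l (by omega)) w y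

theorem sum_zpow_range (hq : q ≠ 0) (c N : ℕ) :
    ∑ x ∈ Finset.range N, (if c < x then (q - q⁻¹) * q ^ (-2 * (x : ℤ)) else 0) =
      if c < N then q ^ (-2 * (c : ℤ) - 1) - q ^ (-2 * (N : ℤ) + 1) else 0 := by
  induction N with
  | zero => simp
  | succ N ih =>
    rw [Finset.sum_range_succ, ih]
    have e : (q - q⁻¹) * q ^ (-2 * (N : ℤ)) = q ^ (-2 * (N : ℤ) + 1) - q ^ (-2 * (N : ℤ) - 1) := by
      rw [zpow_add₀ hq, zpow_sub₀ hq, zpow_one]; field_simp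
    rcases lt_trichotomy c N with h | rfl | h
    · rw [if_pos h, if_pos h, if_pos (by omega), e]; push_cast; ring_nf
    · rw [if_neg (lt_irrefl _), if_neg (lt_irrefl _), if_pos (by omega)]; push_cast; ring_nf
    · rw [if_neg (by omega), if_neg (by omega), if_neg (by omega), zero_add]

theorem sum_be_be (hq : q ≠ 0) (c a : Fin n) :
    ∑ x, be q x a * q ^ (-2 * ((x : ℕ) : ℤ)) * be q⁻¹ c x =
      if c < a then -(q - q⁻¹) * (q ^ (-2 * ((c : ℕ) : ℤ) - 1) - q ^ (-2 * ((a : ℕ) : ℤ) + 1))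
      else 0 := by
  have h1 : ∀ x : Fin n, be q x a * q ^ (-2 * ((x : ℕ) : ℤ)) * be q⁻¹ c x =
      (fun x : ℕ => if x < (a : ℕ) then -(q - q⁻¹) *
        (if (c : ℕ) < x then (q - q⁻¹) * q ^ (-2 * (x : ℤ)) else 0) else 0) x := by
    intro x
    rw [be_inv]
    simp only [be, Fin.lt_def]
    split_ifs <;> ring
  simp only [h1]
  rw [Fin.sum_univ_eq_sum_range (fun x : ℕ => if x < (a : ℕ) then -(q - q⁻¹) *
        (if (c : ℕ) < x then (q - q⁻¹) * q ^ (-2 * (x : ℤ)) else 0) else 0) n,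
    ← Finset.sum_filter]
  have h2 : (Finset.range n).filter (fun x => x < (a : ℕ)) = Finset.range a := by
    ext x; simp; omega
  rw [h2, ← Finset.mul_sum, sum_zpow_range hq]
  simp only [Fin.lt_def]
  split_ifs <;> ring

theorem cross_Rmat (hq : q ≠ 0) (w y a c : Fin n) :
    ∑ x, ∑ b, Rmat q n (x, a) (y, b) * q ^ (-2 * ((b : ℕ) : ℤ)) * Rmat q⁻¹ n (w, b) (x, c) =
      if w = y ∧ a = c then q ^ (-2 * ((a : ℕ) : ℤ)) else 0 := by
  have h1 : ∀ x b, Rmat q n (x, a) (y, b) * q ^ (-2 * ((b : ℕ) : ℤ)) * Rmat q⁻¹ n (w, b) (x, c) =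
      (if x = y then if b = a then al q y a * q ^ (-2 * ((a : ℕ) : ℤ)) *
        Rmat q⁻¹ n (w, a) (y, c) else 0 else 0) +
      (if b = x then (if a = y then be q x a * q ^ (-2 * ((x : ℕ) : ℤ)) *
        Rmat q⁻¹ n (w, x) (x, c) else 0) else 0) := by
    intro x b
    rw [Rmat_apply]
    simp only [Prod.mk.injEq, Prod.swap]
    grind
  simp only [h1, Finset.sum_add_distrib, Finset.sum_ite_eq', Finset.mem_univ, if_true]
  by_cases hay : a = y
  · subst hay
    simp only [if_true]
    have h2 : ∀ x, be q x a * q ^ (-2 * ((x : ℕ) : ℤ)) * Rmat q⁻¹ n (w, x) (x, c) =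
        (if x = w then (if c = w then be q w a * q ^ (-2 * ((w : ℕ) : ℤ)) * q⁻¹ else 0) else 0) +
        (if c = w then be q x a * q ^ (-2 * ((x : ℕ) : ℤ)) * be q⁻¹ w x else 0) := by
      intro x
      rw [Rmat_apply]
      simp only [Prod.mk.injEq, Prod.swap, al]
      grind
    simp only [h2, Finset.sum_add_distrib, Finset.sum_ite_eq', Finset.mem_univ, if_true]
    by_cases hcw : c = w
    · subst hcw
      simp only [if_true]
      rw [sum_be_be hq, Rmat_apply]
      simp only [Prod.mk.injEq, Prod.swap, al, be_inv]
      have e1 : q ^ (-2 * ((c : ℕ) : ℤ) - 1) = q ^ (-2 * ((c : ℕ) : ℤ)) * q⁻¹ := by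
        rw [zpow_sub₀ hq, zpow_one]; rfl
      have e2 : q ^ (-2 * ((a : ℕ) : ℤ) + 1) = q ^ (-2 * ((a : ℕ) : ℤ)) * q := by
        rw [zpow_add₀ hq, zpow_one]
      rw [e1, e2]
      simp only [be]
      rcases lt_trichotomy c a with h | h | h
      · simp only [h, h.ne, h.ne', if_true, if_false]; simp; ring
      · subst h; simp; field_simp
      · simp [h.not_gt, h.ne, h.ne']
    · simp only [if_neg hcw, Finset.sum_const_zero]
      rw [Rmat_apply]
      simp only [Prod.mk.injEq, Prod.swap, al, hcw, and_false, if_false]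
      by_cases h : a = w
      · subst h; by_cases h' : a = c
        · exact absurd h'.symm hcw
        · simp [h', Ne.symm h']
      · simp [h, Ne.symm h]
  · simp only [if_neg hay, Finset.sum_const_zero, add_zero]
    rw [Rmat_apply]
    simp only [Prod.mk.injEq, Prod.swap, al]
    by_cases h : y = w
    · subst h
      by_cases h' : c = a
      · subst h'; simp [Ne.symm hay]
      · simp [h', Ne.symm h', Ne.symm hay]
    · simp [h, Ne.symm h, Ne.symm hay]

theorem Rmat_rev (a b c d : Fin n) :
    Rmat q n (a.rev, b.rev) (c.rev, d.rev) = Rmat q n (b, a) (d, c) := by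
  rw [Rmat_apply, Rmat_apply]
  simp only [Prod.mk.injEq, Prod.swap, al, be, Fin.rev_inj, Fin.rev_lt_rev]
  grind

theorem zpow_rev (hq : q ≠ 0) (b : Fin n) : q ^ (-2 * ((b : ℕ) : ℤ)) =
    q ^ (-2 * ((n : ℤ) - 1)) * q⁻¹ ^ (-2 * ((b.rev : ℕ) : ℤ)) := by
  rw [inv_zpow', ← zpow_add₀ hq, Fin.val_rev]
  congr 1
  have := b.isLt
  push_cast [Nat.cast_sub (show (b : ℕ) + 1 ≤ n by omega)]
  ring

theorem cross_Rmat_swap (hq : q ≠ 0) (w y a c : Fin n) :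
    ∑ x, ∑ b, Rmat q⁻¹ n (a, x) (b, y) * q ^ (-2 * ((b : ℕ) : ℤ)) * Rmat q n (b, w) (c, x) =
      if w = y ∧ a = c then q ^ (-2 * ((a : ℕ) : ℤ)) else 0 := by
  have h := cross_Rmat (inv_ne_zero hq) w.rev y.rev a.rev c.rev
  rw [← Equiv.sum_comp Fin.revPerm] at h
  simp only [Fin.revPerm_apply, inv_inv, Fin.rev_inj] at h
  have h1 : ∀ x : Fin n, ∑ b, Rmat q⁻¹ n (x.rev, a.rev) (y.rev, b) * q⁻¹ ^ (-2 * ((b : ℕ) : ℤ)) *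
      Rmat q n (w.rev, b) (x.rev, c.rev) = ∑ b, Rmat q⁻¹ n (a, x) (b, y) *
        q⁻¹ ^ (-2 * ((b.rev : ℕ) : ℤ)) * Rmat q n (b, w) (c, x) := by
    intro x
    rw [← Equiv.sum_comp Fin.revPerm]
    simp only [Fin.revPerm_apply, Rmat_rev]
  simp only [h1] at h
  have h2 : ∀ x b, Rmat q⁻¹ n (a, x) (b, y) * q ^ (-2 * ((b : ℕ) : ℤ)) * Rmat q n (b, w) (c, x) =
      q ^ (-2 * ((n : ℤ) - 1)) * (Rmat q⁻¹ n (a, x) (b, y) *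
        q⁻¹ ^ (-2 * ((b.rev : ℕ) : ℤ)) * Rmat q n (b, w) (c, x)) := by
    intro x b; rw [zpow_rev hq b]; ring
  simp only [h2, ← Finset.mul_sum]
  rw [h, zpow_rev hq a]
  split_ifs <;> simp

/-- The crossing relation for the words in `gX`. -/
theorem cross_X (hq : q ≠ 0) (w y : Fin n) :
    ∑ x, bX n m q ℂ x y * Dw n m q * asc (gX n m q⁻¹ ℂ) m w x =
      if w = y then Dw n m q else 0 := by
  refine cross_desc (fun i hi w y => ?_) (fun i hi l hl h a b c d => ?_)
    (fun i hi l hl h a b c d => ?_) w y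
  · have := cross_leg hq (A := fun x y => Matrix.of fun a b => Rmat q n (x, a) (y, b))
      (A' := fun x y => Matrix.of fun a b => Rmat q⁻¹ n (x, a) (y, b))
      (fun w y a c => by simpa using cross_Rmat hq w y a c) ⟨i, hi⟩ w y
    rw [← this]
    refine Finset.sum_congr rfl fun x _ => ?_
    rw [gX_apply hi, gX_apply hi, w1, w1, dif_pos hi, dif_pos hi]
    rfl
  · rw [gX_apply hi, gX_apply hl]
    exact w1_commute h fun a b c d => Commute.all _ _
  · rw [gX_apply hi, gX_apply hl]
    exact w1_commute h fun a b c d => Commute.all _ _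

/-- The crossing relation for the words in `gK`. -/
theorem cross_K (hq : q ≠ 0) (w y : Fin n) :
    ∑ x, bY n m q ℂ x y * Dw n m q * aK n m q ℂ w x =
      if w = y then Dw n m q else 0 := by
  refine cross_desc (fun i hi w y => ?_) (fun i hi l hl h a b c d => ?_)
    (fun i hi l hl h a b c d => ?_) w y
  · have := cross_leg hq (A := fun x y => Matrix.of fun a b => Rmat q⁻¹ n (a, x) (b, y))
      (A' := fun x y => Matrix.of fun a b => Rmat q n (a, x) (b, y))
      (fun w y a c => by simpa using cross_Rmat_swap hq w y a c) ⟨i, hi⟩ w y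
    rw [← this]
    refine Finset.sum_congr rfl fun x _ => ?_
    rw [gK_apply hi, gK_apply hi, w1, w1, dif_pos hi, dif_pos hi]
    rfl
  · rw [gK_apply hi, gK_apply hl]
    exact w1_commute h fun a b c d => Commute.all _ _
  · rw [gK_apply hi, gK_apply hl]
    exact w1_commute h fun a b c d => Commute.all _ _

end Crossing

section Transfer

set_option linter.unusedSectionVars false

variable {n m : ℕ} {q : ℂ} {B : Type} [Ring B] [Algebra ℂ B] {X Y K : Matrix (Fin n) (Fin n) B}

variable (n m q B) in
/-- The inverse of `bX`. -/
def bXi : Matrix (Fin n) (Fin n) (Matrix (Fin m → Fin n) (Fin m → Fin n) B) :=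
  asc (gX n m q⁻¹ B) m

theorem asc_mul_desc_eq_one {R : Type} [Ring R] {x y : ℕ → R} {k : ℕ}
    (h : ∀ i < k, x i * y i = 1) : asc x k * desc y k = 1 := by
  induction k with
  | zero => exact mul_one 1
  | succ k ih =>
    rw [asc, desc, mul_assoc, ← mul_assoc (x k), h k (by omega), one_mul,
      ih fun i hi => h i (by omega)]

theorem bXi_mul_bX (hq : q ≠ 0) : bXi n m q B * bX n m q B = 1 := by
  refine asc_mul_desc_eq_one fun i hi => ?_
  rw [← blk_RB_letter hi, ← blk_RB_letter hi, ← map_mul, RB_inv_mul hq, map_one]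

theorem bXi_map (i j : Fin n) : bXi n m q B i j = (bXi n m q ℂ i j).map (algebraMap ℂ B) := by
  have h : ∀ k, gX n m q⁻¹ B k = (algebraMap ℂ B).mapMatrix.mapMatrix (gX n m q⁻¹ ℂ k) := by
    intro k
    ext1 i j
    by_cases hk : k < m
    · rw [gX_apply hk, RingHom.mapMatrix_apply, Matrix.map_apply, gX_apply hk,
        RingHom.mapMatrix_apply, w1_map]
      congr 1
    · simp only [gX, dif_neg hk, map_one]
  rw [bXi, asc_congr fun k _ => h k, ← map_asc]
  rfl

theorem bY_map (i j : Fin n) : bY n m q B i j = (bY n m q ℂ i j).map (algebraMap ℂ B) := by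
  have h : ∀ k, gK n m q⁻¹ B k = (algebraMap ℂ B).mapMatrix.mapMatrix (gK n m q⁻¹ ℂ k) := by
    intro k
    ext1 i j
    by_cases hk : k < m
    · rw [gK_apply hk, RingHom.mapMatrix_apply, Matrix.map_apply, gK_apply hk,
        RingHom.mapMatrix_apply, w1_map]
      congr 1
    · simp only [gK, dif_neg hk, map_one]
  rw [bY, desc_congr fun k _ => h k, ← map_desc]
  rfl

/-- Moving an entry of `X` through a pairing with a matrix commuting with `bX * X`. -/
theorem mul_trp_of_commute (hq : q ≠ 0) {Z : Matrix (Fin m → Fin n) (Fin m → Fin n) B}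
    (hZ : Commute (Matrix.scalar (Fin n) Z) (bX n m q B * scal _ X))
    (Y : Matrix (Fin m → Fin n) (Fin m → Fin n) ℂ) (i j : Fin n) :
    X i j * trp Z Y = ∑ k, trp Z (∑ x, bX n m q ℂ x k * Y * bXi n m q ℂ i x) * X k j := by
  have h1 : scal _ X * Matrix.scalar (Fin n) Z =
      bXi n m q B * Matrix.scalar (Fin n) Z * bX n m q B * scal _ X := by
    rw [mul_assoc, mul_assoc, hZ.eq, ← mul_assoc, ← mul_assoc, bXi_mul_bX hq, one_mul]
  have h2 := congrArg (fun M => trp (M i j) Y) h1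
  beta_reduce at h2
  rw [Matrix.scalar_apply, Matrix.mul_diagonal, scal_apply, trp_scalar_mul] at h2
  rw [h2, Matrix.mul_apply, trp_sum]
  refine Finset.sum_congr rfl fun k _ => ?_
  rw [scal_apply, trp_mul_scalar, Matrix.mul_apply, trp_sum, map_sum]
  congr 1
  refine Finset.sum_congr rfl fun x _ => ?_
  rw [Matrix.mul_diagonal, bX_map, bXi_map, trp_map_right, mul_assoc, trp_map_left, mul_assoc]

/-- Moving an entry of `K` through a pairing with a matrix commuting with `K * aK`. -/
theorem trp_mul_of_commute (hq : q ≠ 0) {Z : Matrix (Fin m → Fin n) (Fin m → Fin n) B}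
    (hZ : Commute (Matrix.scalar (Fin n) Z) (scal _ K * aK n m q B))
    (Y : Matrix (Fin m → Fin n) (Fin m → Fin n) ℂ) (i k : Fin n) :
    trp Z Y * K i k = ∑ j, K i j * trp Z (∑ x, bY n m q ℂ x k * Y * aK n m q ℂ j x) := by
  have h1 : Matrix.scalar (Fin n) Z * scal _ K =
      scal _ K * (aK n m q B * Matrix.scalar (Fin n) Z * bY n m q B) := by
    rw [← mul_assoc, ← mul_assoc, ← hZ.eq, mul_assoc, mul_assoc (scal _ K),
      (RLLK_words hq).inv', mul_one]
  have h2 := congrArg (fun M => trp (M i k) Y) h1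
  beta_reduce at h2
  rw [Matrix.scalar_apply, Matrix.diagonal_mul, scal_apply, trp_mul_scalar] at h2
  rw [h2, Matrix.mul_apply, trp_sum]
  refine Finset.sum_congr rfl fun k _ => ?_
  rw [scal_apply, trp_scalar_mul, Matrix.mul_apply, trp_sum, map_sum]
  congr 1
  refine Finset.sum_congr rfl fun x _ => ?_
  rw [Matrix.mul_diagonal, aK_map, bY_map, trp_map_right, trp_map_left, mul_assoc]

theorem eq_zero_of_sum_mul_upper {X Y : Matrix (Fin n) (Fin n) B} (h : RLL q X Y) {w : Fin n → B}
    (hw : ∀ j, ∑ k, w k * X k j = 0) (j : Fin n) : w j = 0 := by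
  induction j using WellFoundedLT.induction with
  | ind j ih =>
    have h1 : w j * X j j = 0 := by
      rw [← hw j]
      refine (Finset.sum_eq_single (f := fun k => w k * X k j) j (fun k _ hk => ?_)
        fun h => absurd (Finset.mem_univ _) h).symm
      rcases lt_or_gt_of_ne hk with hk | hk
      · rw [ih k hk, zero_mul]
      · rw [h.upper k j hk, mul_zero]
    rw [← mul_one (w j), ← h.diag j, ← mul_assoc, h1, zero_mul]

theorem eq_zero_of_sum_mul_inv (h : Y * K = 1) {w : Fin n → B}
    (hw : ∀ i, ∑ k, K i k * w k = 0) (j : Fin n) : w j = 0 := by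
  have : ∑ i, Y j i * ∑ k, K i k * w k = w j := by
    simp only [Finset.mul_sum]
    rw [Finset.sum_comm]
    have h1 : ∀ k, ∑ i, Y j i * (K i k * w k) = (Y * K) j k * w k := by
      intro k; rw [Matrix.mul_apply, Finset.sum_mul]; simp only [mul_assoc]
    simp only [h1, h]
    simp [Matrix.one_apply]
  rw [← this]
  simp [hw]

/-- A functional on words whose pairing is central satisfies the transfer identity for `bX`. -/
theorem trace_bX_of_central (hq : q ≠ 0) (hq' : NotRootOfUnity q)
    {K : Matrix (Fin n) (Fin n) (Uq q n)} (hU : RLLK q (Lp q n) (Lm q n) K)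
    {Z : Matrix (Fin m → Fin n) (Fin m → Fin n) (Uq q n)} (hZL : Z = LLw m (Lp q n) K)
    (hZ : Commute (Matrix.scalar (Fin n) Z) (bX n m q (Uq q n) * scal _ (Lp q n)))
    {Y : Matrix (Fin m → Fin n) (Fin m → Fin n) ℂ} (hY : ∀ i j, Commute (lp q n i j) (trp Z Y))
    (i k : Fin n) {s : Matrix (Fin m → Fin n) (Fin m → Fin n) ℂ} (hs : s ∈ cent n m q) :
    ∑ x, (bX n m q ℂ x k * Y * bXi n m q ℂ i x * s).trace = if i = k then (Y * s).trace else 0 := by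
  have h1 : trp Z ((∑ x, bX n m q ℂ x k * Y * bXi n m q ℂ i x) - if i = k then Y else 0) = 0 := by
    refine eq_zero_of_sum_mul_upper (w := fun k => trp Z ((∑ x, bX n m q ℂ x k * Y *
      bXi n m q ℂ i x) - if i = k then Y else 0)) hU.toRLL (fun j => ?_) k
    simp only [map_sub, sub_mul, Finset.sum_sub_distrib]
    rw [← mul_trp_of_commute hq hZ Y i j]
    have h2 : ∀ k, trp Z (if i = k then Y else 0) * Lp q n k j =
        if i = k then trp Z Y * Lp q n i j else 0 := by
      intro k; split_ifs with h
      · rw [h]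
      · rw [map_zero, zero_mul]
    simp only [h2, Finset.sum_ite_eq, Finset.mem_univ, if_true]
    rw [sub_eq_zero]
    exact (hY i j).eq
  rw [hZL, trp_LLw_eq_zero_iff hq hq' hU] at h1
  have h3 := h1 s hs
  rw [sub_mul, Matrix.trace_sub, Finset.sum_mul, Matrix.trace_sum, sub_eq_zero] at h3
  rw [h3]
  split_ifs <;> simp

/-- A functional on words whose pairing is central satisfies the transfer identity for `aK`. -/
theorem trace_aK_of_central (hq : q ≠ 0) (hq' : NotRootOfUnity q)
    {K : Matrix (Fin n) (Fin n) (Uq q n)} (hU : RLLK q (Lp q n) (Lm q n) K)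
    {Z : Matrix (Fin m → Fin n) (Fin m → Fin n) (Uq q n)} (hZL : Z = LLw m (Lp q n) K)
    (hZ : Commute (Matrix.scalar (Fin n) Z) (scal _ K * aK n m q (Uq q n)))
    {Y : Matrix (Fin m → Fin n) (Fin m → Fin n) ℂ} (hY : ∀ i j, Commute (K i j) (trp Z Y))
    (j k : Fin n) {s : Matrix (Fin m → Fin n) (Fin m → Fin n) ℂ} (hs : s ∈ cent n m q) :
    ∑ x, (bY n m q ℂ x k * Y * aK n m q ℂ j x * s).trace = if j = k then (Y * s).trace else 0 := by
  have h1 : trp Z ((∑ x, bY n m q ℂ x k * Y * aK n m q ℂ j x) - if j = k then Y else 0) = 0 := by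
    refine eq_zero_of_sum_mul_inv (w := fun j => trp Z ((∑ x, bY n m q ℂ x k * Y *
      aK n m q ℂ j x) - if j = k then Y else 0)) hU.inv (fun i => ?_) j
    simp only [map_sub, mul_sub, Finset.sum_sub_distrib]
    rw [← trp_mul_of_commute hq hZ Y i k]
    have h2 : ∀ j, K i j * trp Z (if j = k then Y else 0) =
        if j = k then K i k * trp Z Y else 0 := by
      intro k; split_ifs with h
      · rw [h]
      · rw [map_zero, mul_zero]
    simp only [h2, Finset.sum_ite_eq', Finset.mem_univ, if_true]
    rw [sub_eq_zero]
    exact (hY i k).eq.symm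
  rw [hZL, trp_LLw_eq_zero_iff hq hq' hU] at h1
  have h3 := h1 s hs
  rw [sub_mul, Matrix.trace_sub, Finset.sum_mul, Matrix.trace_sum, sub_eq_zero] at h3
  rw [h3]
  split_ifs <;> simp

end Transfer

section TraceProperty

set_option linter.unusedSectionVars false

variable {n m : ℕ} {q : ℂ}

local notation "Mw" => Matrix (Fin m → Fin n) (Fin m → Fin n) ℂ

theorem sum_swap_of_sum {R : Type} [Ring R] [IsStablyFiniteRing R]
    {P Q : Fin n → Fin n → R} (h : ∀ k i, ∑ x, P k x * Q x i = if i = k then 1 else 0) (x y : Fin n) :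
    ∑ k, Q x k * P k y = if x = y then 1 else 0 := by
  have h1 : Matrix.of P * Matrix.of Q = 1 := by
    ext k i
    rw [Matrix.mul_apply, Matrix.one_apply]
    simp only [Matrix.of_apply, h, eq_comm]
  have h2 := mul_eq_one_comm.1 h1
  have := congrFun (congrFun h2 x) y
  rwa [Matrix.mul_apply, Matrix.one_apply] at this

theorem sum_bXi_bX (hq : q ≠ 0) (x y : Fin n) :
    ∑ k, bXi n m q ℂ k x * Dwi n m q * bX n m q ℂ y k = if x = y then Dwi n m q else 0 := by
  have h := sum_swap_of_sum (n := n) (P := fun k x => bX n m q ℂ x k)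
    (Q := fun x i => Dw n m q * bXi n m q ℂ i x * Dwi n m q) (fun k i => by
      simp only [← mul_assoc]
      rw [← Finset.sum_mul, bXi, cross_X hq, ite_mul, Dw_mul_Dwi hq, zero_mul]) x y
  have h2 := congrArg (Dwi n m q * ·) h
  simp only [Finset.mul_sum, ← mul_assoc, Dwi_mul_Dw hq, one_mul] at h2
  rw [h2, mul_ite, mul_one, mul_zero]

theorem sum_aK_bY (hq : q ≠ 0) (x y : Fin n) :
    ∑ k, Dw n m q * aK n m q ℂ k x * Dwi n m q * bY n m q ℂ y k = if x = y then 1 else 0 :=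
  sum_swap_of_sum (n := n) (P := fun k x => bY n m q ℂ x k)
    (Q := fun x i => Dw n m q * aK n m q ℂ i x * Dwi n m q) (fun k i => by
      simp only [← mul_assoc]
      rw [← Finset.sum_mul, cross_K hq, ite_mul, Dw_mul_Dwi hq, zero_mul]) x y

theorem Dw_mem_cent : Dw n m q ∈ cent n m q := by rw [Dw_eq_dgc]; exact dgc_mem_cent _
theorem Dwi_mem_cent : Dwi n m q ∈ cent n m q := by rw [Dwi_eq_dgc]; exact dgc_mem_cent _

theorem trace_bX_comm (hq : q ≠ 0) {Y : Mw}
    (h : ∀ i k, ∀ s ∈ cent n m q, ∑ x, (bX n m q ℂ x k * Y * bXi n m q ℂ i x * s).trace =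
      if i = k then (Y * s).trace else 0) (y k : Fin n) {s : Mw} (hs : s ∈ cent n m q) :
    (Y * Dwi n m q * (s * bX n m q ℂ y k)).trace =
      (Y * Dwi n m q * (bX n m q ℂ y k * s)).trace := by
  have h1 : ∀ i, ∑ x, (bX n m q ℂ x k * Y * bXi n m q ℂ i x *
      (Dwi n m q * bX n m q ℂ y i * s)).trace =
      if i = k then (Y * (Dwi n m q * bX n m q ℂ y i * s)).trace else 0 := fun i =>
    h i k _ (mul_mem (mul_mem Dwi_mem_cent (bX_mem_cent hq _ _)) hs)
  have h2 := Finset.sum_congr rfl fun i (_ : i ∈ Finset.univ) => h1 i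
  rw [Finset.sum_ite_eq' Finset.univ k, if_pos (Finset.mem_univ _), Finset.sum_comm] at h2
  have h3 : ∀ x, ∑ i, (bX n m q ℂ x k * Y * bXi n m q ℂ i x *
      (Dwi n m q * bX n m q ℂ y i * s)).trace =
      if x = y then (bX n m q ℂ x k * Y * Dwi n m q * s).trace else 0 := by
    intro x
    rw [← Matrix.trace_sum]
    have : ∀ i, bX n m q ℂ x k * Y * bXi n m q ℂ i x * (Dwi n m q * bX n m q ℂ y i * s) =
        bX n m q ℂ x k * Y * (bXi n m q ℂ i x * Dwi n m q * bX n m q ℂ y i) * s := by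
      intro i; simp only [mul_assoc]
    simp only [this, ← Finset.mul_sum, ← Finset.sum_mul, sum_bXi_bX hq]
    split_ifs <;> simp [mul_assoc]
  simp only [h3, Finset.sum_ite_eq', Finset.mem_univ, if_true] at h2
  simp only [mul_assoc] at h2 ⊢
  rw [← h2, Matrix.trace_mul_comm (bX n m q ℂ y k)]
  simp only [mul_assoc]

theorem trace_aK_comm (hq : q ≠ 0) {Y : Mw}
    (h : ∀ j k, ∀ s ∈ cent n m q, ∑ x, (bY n m q ℂ x k * Y * aK n m q ℂ j x * s).trace =
      if j = k then (Y * s).trace else 0) (j y : Fin n) {s : Mw} (hs : s ∈ cent n m q) :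
    (Y * aK n m q ℂ j y * s).trace = (Y * (s * (Dw n m q * aK n m q ℂ j y * Dwi n m q))).trace := by
  have h1 : ∀ k, ∑ x, (bY n m q ℂ x k * Y * aK n m q ℂ j x *
      (s * (Dw n m q * aK n m q ℂ k y * Dwi n m q))).trace =
      if j = k then (Y * (s * (Dw n m q * aK n m q ℂ k y * Dwi n m q))).trace else 0 := fun k =>
    h j k _ (mul_mem hs (mul_mem (mul_mem Dw_mem_cent (aK_mem_cent hq _ _)) Dwi_mem_cent))
  have h2 := Finset.sum_congr rfl fun i (_ : i ∈ Finset.univ) => h1 i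
  rw [Finset.sum_ite_eq Finset.univ j, if_pos (Finset.mem_univ _), Finset.sum_comm] at h2
  have h3 : ∀ x, ∑ k, (bY n m q ℂ x k * Y * aK n m q ℂ j x *
      (s * (Dw n m q * aK n m q ℂ k y * Dwi n m q))).trace =
      if x = y then (Y * aK n m q ℂ j x * s).trace else 0 := by
    intro x
    have : ∀ k, (bY n m q ℂ x k * Y * aK n m q ℂ j x *
        (s * (Dw n m q * aK n m q ℂ k y * Dwi n m q))).trace =
        (Y * aK n m q ℂ j x * s *
          (Dw n m q * aK n m q ℂ k y * Dwi n m q * bY n m q ℂ x k)).trace := by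
      intro k
      rw [mul_assoc, mul_assoc, Matrix.trace_mul_comm]
      simp only [mul_assoc]
    simp only [this]
    rw [← Matrix.trace_sum, ← Finset.mul_sum, sum_aK_bY hq]
    simp only [eq_comm (a := x)]
    split_ifs <;> simp
  simp only [h3, Finset.sum_ite_eq', Finset.mem_univ, if_true] at h2
  exact h2

/-- The functional attached to a central element is a trace. -/
theorem trace_property (hq : q ≠ 0) (hq' : NotRootOfUnity q) {Y : Mw}
    (hB : ∀ i k, ∀ s ∈ cent n m q, ∑ x, (bX n m q ℂ x k * Y * bXi n m q ℂ i x * s).trace =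
      if i = k then (Y * s).trace else 0)
    (hA : ∀ j k, ∀ s ∈ cent n m q, ∑ x, (bY n m q ℂ x k * Y * aK n m q ℂ j x * s).trace =
      if j = k then (Y * s).trace else 0)
    {s t : Mw} (hs : s ∈ cent n m q) (ht : t ∈ cent n m q) :
    (Y * Dwi n m q * (s * t)).trace = (Y * Dwi n m q * (t * s)).trace := by
  have hb := fun y k s hs => trace_bX_comm hq hB y k (s := s) hs
  have hw0 : ∀ μ ν : Fin n → ℕ, μ ≠ ν → ∀ s ∈ cent n m q,
      (Y * Dwi n m q * (wp m μ * s * wp m ν)).trace = 0 := by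
    intro μ ν hμν s hs
    obtain ⟨i, hi⟩ := Function.ne_iff.1 hμν
    have h1 := hb i i (wp m μ * s * wp m ν)
      (mul_mem (mul_mem (dgc_mem_cent _) hs) (dgc_mem_cent _))
    rw [bX_diag hq, tD_eq_dgc, mul_assoc (wp m μ * s), wp_mul_dgc, ← mul_assoc (dgc m _),
      ← mul_assoc (dgc m _), dgc_mul_wp] at h1
    simp only [mul_smul_comm, smul_mul_assoc, Matrix.trace_smul, smul_eq_mul] at h1
    have h2 : q ^ ν i - q ^ μ i ≠ 0 := by
      intro h
      rw [sub_eq_zero] at h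
      refine hi (pow_two_mul_injective hq hq' ?_).symm
      rw [mul_comm, pow_mul, h, ← pow_mul, mul_comm]
    have h3 : (q ^ ν i - q ^ μ i) * (Y * Dwi n m q * (wp m μ * s * wp m ν)).trace = 0 := by
      rw [sub_mul, h1, sub_self]
    exact (mul_eq_zero.1 h3).resolve_left h2
  have hw : ∀ ν : Fin n → ℕ, ∀ s ∈ cent n m q,
      (Y * Dwi n m q * (s * wp m ν)).trace = (Y * Dwi n m q * (wp m ν * s)).trace := by
    intro ν s hs
    have e1 : (Y * Dwi n m q * (s * wp m ν)).trace =
        (Y * Dwi n m q * (wp m ν * s * wp m ν)).trace := by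
      conv_lhs => rw [← one_mul s, ← sum_wp, Finset.sum_mul, Finset.sum_mul, Finset.mul_sum,
        Matrix.trace_sum]
      by_cases hν : ν ∈ Finset.univ.image (cnt (n := n) (m := m))
      · exact Finset.sum_eq_single ν (fun μ _ hμ => hw0 μ ν hμ s hs) fun h => absurd hν h
      · rw [Finset.sum_eq_zero fun μ hμ => hw0 μ ν (fun h => hν (h ▸ hμ)) s hs]
        rw [show wp m ν = 0 from ?_]
        · simp
        · rw [wp, dgc, ← Matrix.diagonal_zero]
          congr 1; ext I
          exact if_neg fun h => hν (Finset.mem_image.2 ⟨I, Finset.mem_univ _, h⟩)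
    have e2 : (Y * Dwi n m q * (wp m ν * s)).trace =
        (Y * Dwi n m q * (wp m ν * s * wp m ν)).trace := by
      conv_lhs => rw [← mul_one (wp m ν * s), ← sum_wp, Finset.mul_sum, Finset.mul_sum,
        Matrix.trace_sum]
      by_cases hν : ν ∈ Finset.univ.image (cnt (n := n) (m := m))
      · exact Finset.sum_eq_single ν (fun μ _ hμ => hw0 ν μ hμ.symm s hs) fun h => absurd hν h
      · rw [Finset.sum_eq_zero fun μ hμ => hw0 ν μ (fun h => hν (h ▸ hμ)) s hs]
        rw [show wp m ν = 0 from ?_]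
        · simp
        · rw [wp, dgc, ← Matrix.diagonal_zero]
          congr 1; ext I
          exact if_neg fun h => hν (Finset.mem_image.2 ⟨I, Finset.mem_univ _, h⟩)
    rw [e1, e2]
  have hd : ∀ f : (Fin n → ℕ) → ℂ, ∀ s ∈ cent n m q,
      (Y * Dwi n m q * (s * dgc m f)).trace = (Y * Dwi n m q * (dgc m f * s)).trace := by
    intro f s hs
    simp only [dgc_eq_sum f, Finset.mul_sum, Finset.sum_mul, Matrix.trace_sum, mul_smul_comm,
      smul_mul_assoc, Matrix.trace_smul, hw _ s hs]
  have ha : ∀ j y, ∀ s ∈ cent n m q, (Y * Dwi n m q * (aK n m q ℂ j y * s)).trace =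
      (Y * Dwi n m q * (s * aK n m q ℂ j y)).trace := by
    intro j y s hs
    have hswap : ∀ s ∈ cent n m q, (Y * (s * Dwi n m q)).trace = (Y * Dwi n m q * s).trace := by
      intro s hs
      have := hd (fun ν => ∏ i : Fin n, (q ^ (-2 * ((i : ℕ) : ℤ))) ^ ν i) (s * Dwi n m q)
        (mul_mem hs Dwi_mem_cent)
      rw [← Dw_eq_dgc, mul_assoc s, Dwi_mul_Dw hq, mul_one] at this
      rw [this, mul_assoc Y, ← mul_assoc (Dwi n m q), Dwi_mul_Dw hq, one_mul]
    have h1 := trace_aK_comm hq hA j y (s := s * Dwi n m q) (mul_mem hs Dwi_mem_cent)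
    have e1 : Y * aK n m q ℂ j y * (s * Dwi n m q) = Y * (aK n m q ℂ j y * s * Dwi n m q) := by
      simp only [mul_assoc]
    have e2 : Y * (s * Dwi n m q * (Dw n m q * aK n m q ℂ j y * Dwi n m q)) =
        Y * (s * aK n m q ℂ j y * Dwi n m q) := by
      congr 1
      rw [mul_assoc (Dw n m q), mul_assoc s, ← mul_assoc (Dwi n m q), Dwi_mul_Dw hq, one_mul,
        mul_assoc]
    rw [e1, e2, hswap _ (mul_mem (aK_mem_cent hq _ _) hs),
      hswap _ (mul_mem hs (aK_mem_cent hq _ _))] at h1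
    exact h1
  rw [← opAlg_eq_cent hq hq'] at ht
  induction ht using Algebra.adjoin_induction generalizing s with
  | mem x hx =>
    rcases hx with (⟨i, rfl⟩ | ⟨i, rfl⟩) | ⟨ν, rfl⟩
    · by_cases h : i + 1 < n
      · rw [ME, dif_pos h]; exact (ha _ _ s hs).symm
      · rw [ME, dif_neg h, mul_zero, zero_mul]
    · by_cases h : i + 1 < n
      · rw [MF_eq h]; exact hb _ _ s hs
      · rw [MF, ME, dif_neg h, Matrix.transpose_zero, mul_zero, zero_mul]
    · exact hw ν s hs
  | algebraMap r => rw [Algebra.commutes]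
  | add x y _ _ h1 h2 => rw [mul_add, add_mul, mul_add, mul_add, Matrix.trace_add, Matrix.trace_add,
      h1 hs, h2 hs]
  | mul x y hx hy h1 h2 =>
    rw [← opAlg] at hx hy
    rw [opAlg_eq_cent hq hq'] at hx hy
    rw [← mul_assoc s, h2 (mul_mem hs hx), ← mul_assoc y, h1 (mul_mem hy hs), mul_assoc x]

end TraceProperty

section Span

set_option linter.unusedSectionVars false

variable {n m : ℕ} {q : ℂ} {B B' : Type} [Ring B] [Algebra ℂ B] [Ring B'] [Algebra ℂ B']
  {X Y K : Matrix (Fin n) (Fin n) B}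

theorem legBar_map (f : B →ₐ[ℂ] B') (X : Matrix (Fin n) (Fin n) B) (k : ℕ) :
    (legBar q n m X k).map f = legBar q n m (X.map f) k := by
  have h2 : ∀ (C : Matrix (Fin n × Fin n) (Fin n × Fin n) ℂ) (a b : ℕ),
      (leg2 B n m C a b).map f = leg2 B' n m C a b := by
    intro C a b
    ext I J
    simp only [leg2, Matrix.map_apply]
    split_ifs <;> simp
  induction k with
  | zero =>
    ext I J
    simp only [legBar, leg1, Matrix.map_apply]
    split_ifs <;> simp
  | succ k ih =>
    simp only [legBar, RcLeg, RcLegInv] at ih ⊢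
    rw [Matrix.map_mul, Matrix.map_mul, h2, h2, ih]

theorem legBar_smul (c : ℂ) (X : Matrix (Fin n) (Fin n) B) (k : ℕ) :
    legBar q n m (c • X) k = c • legBar q n m X k := by
  induction k with
  | zero =>
    ext I J
    simp only [legBar, leg1, Matrix.smul_apply]
    split_ifs <;> simp
  | succ k ih => rw [legBar, ih, legBar, mul_smul_comm, smul_mul_assoc]

theorem asc_smul {R : Type} [Ring R] [Algebra ℂ R] (c : ℂ) (x : ℕ → R) (k : ℕ) :
    asc (fun i => c • x i) k = c ^ k • asc x k := by
  induction k with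
  | zero => simp [asc]
  | succ k ih => rw [asc, ih, asc, smul_mul_smul_comm, pow_succ]

theorem asc_legBar_map (f : B →ₐ[ℂ] B') (X : Matrix (Fin n) (Fin n) B) (k : ℕ) :
    (asc (legBar q n m X) k).map f = asc (legBar q n m (X.map f)) k := by
  change (f : B →+* B').mapMatrix _ = _
  rw [map_asc]
  exact asc_congr fun i _ => legBar_map f X i

theorem RLLK.LLw_comm_bX (hq : q ≠ 0) (h : RLLK q X Y K) :
    Commute (Matrix.scalar (Fin n) (LLw m X K)) (bX n m q B * scal _ X) := by
  rw [← h.asc_legBar hq, map_asc]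
  exact (commute_asc fun k hk => (h.legBar_bX hq hk).symm).symm

theorem RLLK.LLw_comm_aK (hq : q ≠ 0) (h : RLLK q X Y K) :
    Commute (Matrix.scalar (Fin n) (LLw m X K)) (scal _ K * aK n m q B) := by
  rw [← h.asc_legBar hq, map_asc]
  exact (commute_asc fun k hk => (h.legBar_aK hq hk).symm).symm

theorem trp_mem {W : Type} [Fintype W] [DecidableEq W] {N : Submodule ℂ B} {Z : Matrix W W B}
    (hZ : ∀ I J, Z I J ∈ N) (Y : Matrix W W ℂ) : trp Z Y ∈ N := by
  rw [trp_apply]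
  exact N.sum_mem fun I _ => N.sum_mem fun J _ => N.smul_mem _ (hZ _ _)

variable (m) in
/-- The span of the entries of `LLw m X K`. -/
def Msp (X K : Matrix (Fin n) (Fin n) B) : Submodule ℂ B := LinearMap.range (trp (LLw m X K))

theorem LLw_mem_Msp (I J : Fin m → Fin n) : LLw m X K I J ∈ Msp m X K :=
  ⟨Matrix.single J I 1, trp_single _ _ _⟩

theorem tD_inv (hq : q ≠ 0) (i : Fin n) : tD n m q i * tD n m q⁻¹ i = 1 := by
  rw [tD, tD, Matrix.diagonal_mul_diagonal, ← Matrix.diagonal_one]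
  congr 1
  ext I
  rw [inv_pow, mul_inv_cancel₀ (pow_ne_zero _ hq)]

theorem tD_inv' (hq : q ≠ 0) (i : Fin n) : tD n m q⁻¹ i * tD n m q i = 1 := by
  simpa using tD_inv (m := m) (inv_ne_zero hq) i

theorem RLLK.Msp_mul (hq : q ≠ 0) (h : RLLK q X Y K) {x : B} (hx : x ∈ Msp m X K) (j k : Fin n) :
    x * (X * K) j k ∈ Msp (m + 1) X K := by
  obtain ⟨C, rfl⟩ := hx
  induction hj : n - (j : ℕ) using Nat.strong_induction_on generalizing j C with
  | _ a ih =>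
  have key := congrFun (congrFun (h.lastBlk_LLw_bX (m := m)) j) k
  replace key := congrArg (fun Z => trp Z (tD n m q⁻¹ j * C)) key
  beta_reduce at key
  simp only [Matrix.mul_apply (M := lastBlk _),
    Matrix.mul_apply (M := Matrix.scalar _ _ * _)] at key
  rw [trp_sum, trp_sum] at key
  have h1 : ∀ i, (Matrix.scalar (Fin n) (LLw m X K) * bX n m q B) j i =
      LLw m X K * (bX n m q ℂ j i).map (algebraMap ℂ B) := by
    intro i
    rw [← bX_map (B := B), Matrix.scalar_apply, Matrix.diagonal_mul]
  simp only [h1, scal_apply, trp_mul_scalar, trp_map_right] at key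
  rw [eq_comm, ← Finset.add_sum_erase _ _ (Finset.mem_univ j), bX_diag hq, ← mul_assoc, tD_inv hq,
    one_mul] at key
  rw [← eq_sub_iff_add_eq] at key
  rw [key]
  refine sub_mem (sum_mem fun i _ => ?_) (sum_mem fun i hi => ?_)
  · rw [bX_map (B := B), trp_map_right]
    exact trp_mem (fun I J => LLw_mem_Msp _ _) _
  · rcases lt_or_gt_of_ne (Finset.ne_of_mem_erase hi) with hi | hi
    · rw [(RLLK_words (B := ℂ) (m := m) hq).upper _ _ hi, zero_mul, map_zero, zero_mul]
      exact zero_mem _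
    · exact ih _ (by have := i.2; have := j.2; have : (j : ℕ) < i := hi; omega) i _ rfl

/-- The subalgebra generated by the entries of a matrix. -/
def Lalg (L : Matrix (Fin n) (Fin n) B) : Subalgebra ℂ B :=
  Algebra.adjoin ℂ {x : B | ∃ i j, x = L i j}

theorem mem_Lalg (L : Matrix (Fin n) (Fin n) B) (i j : Fin n) : L i j ∈ Lalg L :=
  Algebra.subset_adjoin ⟨i, j, rfl⟩

theorem exists_map_val (L : Matrix (Fin n) (Fin n) B) :
    ∃ L' : Matrix (Fin n) (Fin n) (Lalg L), L'.map (Lalg L).val = L :=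
  ⟨Matrix.of fun i j => ⟨L i j, mem_Lalg L i j⟩, rfl⟩

theorem RLLK.Msp_le (hq : q ≠ 0) (h : RLLK q X Y K) :
    Msp m X K ≤ Subalgebra.toSubmodule (Lalg (X * K)) := by
  rintro _ ⟨C, rfl⟩
  refine trp_mem (fun I J => ?_) C
  obtain ⟨L', hL'⟩ := exists_map_val (X * K)
  rw [← h.asc_legBar hq, ← hL', ← asc_legBar_map]
  have h1 := ((asc (legBar q n m L') m) I J).2
  rw [hL']
  exact h1

theorem RLLK.one_mem_Msp : (1 : B) ∈ Msp 0 X K := by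
  convert LLw_mem_Msp (X := X) (K := K) (m := 0) Fin.elim0 Fin.elim0
  simp [LLw, asc, desc]

theorem RLLK.Lalg_eq_iSup (hq : q ≠ 0) (h : RLLK q X Y K) :
    Subalgebra.toSubmodule (Lalg (X * K)) = ⨆ m, Msp m X K := by
  refine le_antisymm (fun x hx => ?_) (iSup_le fun m => h.Msp_le hq)
  suffices H : ∀ y ∈ ⨆ m, Msp m X K, y * x ∈ ⨆ m, Msp m X K by
    simpa using H 1 (Submodule.mem_iSup_of_mem 0 RLLK.one_mem_Msp)
  change x ∈ Algebra.adjoin ℂ _ at hx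
  induction hx using Algebra.adjoin_induction with
  | mem x hx =>
    obtain ⟨i, j, rfl⟩ := hx
    intro y hy
    induction hy using Submodule.iSup_induction' with
    | mem m y hy => exact Submodule.mem_iSup_of_mem (m + 1) (h.Msp_mul hq hy i j)
    | zero => rw [zero_mul]; exact zero_mem _
    | add x y _ _ hx hy => rw [add_mul]; exact add_mem hx hy
  | algebraMap r =>
    intro y hy
    rw [← Algebra.commutes, ← Algebra.smul_def]
    exact Submodule.smul_mem _ _ hy
  | add a b _ _ ha hb => intro y hy; rw [mul_add]; exact add_mem (ha y hy) (hb y hy)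
  | mul a b _ _ ha hb => intro y hy; rw [← mul_assoc]; exact hb _ (ha y hy)

theorem RLLK.map_Msp (hq : q ≠ 0) (h : RLLK q X Y K) {f : B →ₐ[ℂ] B}
    (hf : (X * K).map f = (4 : ℂ) • (X * K)) {x : B} (hx : x ∈ Msp m X K) :
    f x = (4 : ℂ) ^ m • x := by
  obtain ⟨C, rfl⟩ := hx
  change (f : B →ₗ[ℂ] B) _ = _
  rw [map_trp]
  have : (LLw m X K).map (f : B →ₗ[ℂ] B) = (4 : ℂ) ^ m • LLw m X K := by
    rw [← h.asc_legBar hq]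
    exact (asc_legBar_map f _ _).trans
      (by rw [hf, show legBar q n m ((4 : ℂ) • (X * K)) = _ from funext (legBar_smul _ _), asc_smul])
  rw [this]
  simp only [trp_apply, Matrix.smul_apply, Finset.smul_sum]
  exact Finset.sum_congr rfl fun I _ => Finset.sum_congr rfl fun J _ => smul_comm _ _ _

end Span

section Centralizer

variable {n m : ℕ} {q : ℂ} {K : Matrix (Fin n) (Fin n) (Uq q n)}

theorem trace_tD_conj (hq : q ≠ 0) (hq' : NotRootOfUnity q) (k : Fin n)
    {C : Matrix (Fin m → Fin n) (Fin m → Fin n) ℂ}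
    (h : ∀ s ∈ cent n m q, ((tD n m q k * (tD n m q k * C * tD n m q⁻¹ k) * tD n m q⁻¹ k - C)
      * s).trace = 0) {s : Matrix (Fin m → Fin n) (Fin m → Fin n) ℂ} (hs : s ∈ cent n m q) :
    ((tD n m q k * C * tD n m q⁻¹ k - C) * s).trace = 0 := by
  have e : s = ∑ μ ∈ Finset.univ.image (cnt (n := n) (m := m)),
      ∑ ν ∈ Finset.univ.image (cnt (n := n) (m := m)), wp m μ * s * wp m ν := by
    simp only [← Finset.mul_sum, ← Finset.sum_mul, sum_wp, one_mul, mul_one]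
  rw [e]
  simp only [Finset.mul_sum, Matrix.trace_sum]
  refine Finset.sum_eq_zero fun μ _ => Finset.sum_eq_zero fun ν _ => ?_
  have hw : ∀ μ, wp m μ ∈ cent n m q := fun μ => dgc_mem_cent _
  have h1 := h _ (mul_mem (mul_mem (hw μ) hs) (hw ν))
  have h2 : ∀ D : Matrix (Fin m → Fin n) (Fin m → Fin n) ℂ,
      (tD n m q k * D * tD n m q⁻¹ k * (wp m μ * s * wp m ν)).trace =
        (q ^ ν k * (q ^ μ k)⁻¹) * (D * (wp m μ * s * wp m ν)).trace := by
    intro D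
    have e1 : tD n m q⁻¹ k * wp m μ = (q ^ μ k)⁻¹ • wp m μ := by
      rw [tD_eq_dgc, dgc_mul_wp, inv_pow]
    have e2 : wp m ν * tD n m q k = q ^ ν k • wp m ν := by rw [tD_eq_dgc, wp_mul_dgc]
    rw [mul_assoc, mul_assoc, Matrix.trace_mul_comm,
      show D * (tD n m q⁻¹ k * (wp m μ * s * wp m ν)) * tD n m q k =
        D * ((tD n m q⁻¹ k * wp m μ) * s * (wp m ν * tD n m q k)) by simp only [mul_assoc], e1, e2]
    simp only [smul_mul_assoc, mul_smul_comm, Matrix.trace_smul, smul_eq_mul]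
    ring
  rw [sub_mul, Matrix.trace_sub, h2] at h1 ⊢
  rw [h2] at h1
  set t := (C * (wp m μ * s * wp m ν)).trace
  rw [← mul_assoc, ← sub_one_mul, mul_eq_zero] at h1
  rcases h1 with h1 | h1
  · have h3 : q ^ (2 * ν k) = q ^ (2 * μ k) := by
      have := pow_ne_zero (μ k) hq
      field_simp at h1
      rw [mul_comm 2, mul_comm 2, pow_mul, pow_mul]
      linear_combination h1
    rw [pow_two_mul_injective hq hq' h3, mul_inv_cancel₀ (pow_ne_zero _ hq), one_mul, sub_self]
  · rw [h1, mul_zero, sub_self]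

theorem lp_mul_trp (hq : q ≠ 0) (hU : RLLK q (Lp q n) (Lm q n) K) (k : Fin n)
    (C : Matrix (Fin m → Fin n) (Fin m → Fin n) ℂ) :
    lp q n k k * trp (LLw m (Lp q n) K) C =
      trp (LLw m (Lp q n) K) (tD n m q k * C * tD n m q⁻¹ k) * lp q n k k := by
  have h := hU.LLw_comm_bX (m := m) hq
  rw [scalar_commute_iff] at h
  have h1 := h k k
  rw [upper_mul_diag (RLLK_words hq).upper fun i j hij => by
    rw [scal_apply, hU.upper i j hij, map_zero]] at h1
  rw [bX_map (B := Uq q n), bX_diag hq, scal_apply] at h1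
  have hc : ∀ D : Matrix (Fin m → Fin n) (Fin m → Fin n) ℂ, ∀ c : Uq q n,
      Commute (D.map (algebraMap ℂ (Uq q n))) (Matrix.scalar _ c) := by
    intro D c
    ext I J
    simp [Matrix.diagonal_mul, Matrix.mul_diagonal, Algebra.commutes]
  have h2 := congrArg (fun Z => trp Z (C * tD n m q⁻¹ k)) h1.eq
  beta_reduce at h2
  rw [← mul_assoc, trp_mul_scalar, trp_map_right, (hc _ _).eq, mul_assoc, trp_scalar_mul,
    trp_map_left, mul_assoc C, tD_inv' hq, mul_one, ← mul_assoc] at h2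
  exact h2.symm

theorem commute_of_sq (hq : q ≠ 0) (hq' : NotRootOfUnity q) (hU : RLLK q (Lp q n) (Lm q n) K)
    (k : Fin n) {x : Uq q n} (hx : x ∈ Msp m (Lp q n) K)
    (h : Commute (lp q n k k * lp q n k k) x) : Commute (lp q n k k) x := by
  obtain ⟨C, rfl⟩ := hx
  have hu : ∀ x : Uq q n, x * lp q n k k = 0 → x = 0 := fun x hx => by
    have := congrArg (· * lm q n k k) hx
    beta_reduce at this
    rwa [mul_assoc, show lp q n k k * lm q n k k = 1 from hU.diag k, mul_one, zero_mul] at this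
  have h1 : trp (LLw m (Lp q n) K)
      (tD n m q k * (tD n m q k * C * tD n m q⁻¹ k) * tD n m q⁻¹ k - C) = 0 := by
    refine hu _ (hu _ ?_)
    rw [map_sub, sub_mul, ← lp_mul_trp hq hU, sub_mul, mul_assoc, ← lp_mul_trp hq hU, ← mul_assoc,
      mul_assoc (trp _ _), h.eq, sub_self]
  have h2 : trp (LLw m (Lp q n) K) (tD n m q k * C * tD n m q⁻¹ k - C) = 0 := by
    rw [trp_LLw_eq_zero_iff hq hq' hU] at h1 ⊢
    exact fun s hs => trace_tD_conj hq hq' k h1 hs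
  rw [Commute, SemiconjBy, lp_mul_trp hq hU, sub_eq_zero.1 ((map_sub _ _ _).symm.trans h2)]

theorem commute_lp_K (hq : q ≠ 0) (hq' : NotRootOfUnity q) (hU : RLLK q (Lp q n) (Lm q n) K)
    {x : Uq q n} (hx : x ∈ Msp m (Lp q n) K) (h : ∀ i j, Commute ((Lp q n * K) i j) x) (k i : Fin n) :
    Commute (lp q n i k) x ∧ Commute (K k i) x := by
  induction hk : n - (k : ℕ) using Nat.strong_induction_on generalizing i k with
  | _ a ih =>
  have ih' : ∀ l, k < l → ∀ i, Commute (lp q n i l) x ∧ Commute (K l i) x := fun l hl i =>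
    ih _ (by have := l.2; have := k.2; have : (k : ℕ) < l := hl; omega) l i rfl
  have h1 : ∀ i j, (i = k ∨ j = k) → Commute (lp q n i k * K k j) x := by
    intro i j hij
    have h2 := h i j
    rw [Matrix.mul_apply, ← Finset.add_sum_erase _ _ (Finset.mem_univ k)] at h2
    have h3 : Commute (∑ l ∈ Finset.univ.erase k, Lp q n i l * K l j) x := by
      refine Commute.sum_left _ _ _ fun l hl => ?_
      rcases lt_or_gt_of_ne (Finset.ne_of_mem_erase hl) with hl | hl
      · rcases hij with rfl | rfl
        · rw [hU.upper _ _ hl, zero_mul]; exact Commute.zero_left _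
        · rw [hU.lowerK _ _ hl, mul_zero]; exact Commute.zero_left _
      · exact (ih' l hl i).1.mul_left (ih' l hl j).2
    have h4 := h2.sub_left h3
    rw [add_sub_cancel_right] at h4
    exact h4
  have hKk : K k k = lp q n k k := hU.diagK k
  have hd : Commute (lp q n k k) x :=
    commute_of_sq hq hq' hU k hx (by simpa only [hKk] using h1 k k (Or.inl rfl))
  have e1 : lp q n k k * lm q n k k = 1 := hU.diag k
  have e2 : lm q n k k * lp q n k k = 1 := hU.diag' k
  have hd' : Commute (lm q n k k) x := by
    change lm q n k k * x = x * lm q n k k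
    calc lm q n k k * x = lm q n k k * (x * lp q n k k) * lm q n k k := by
          rw [mul_assoc, mul_assoc, e1, mul_one]
      _ = x * lm q n k k := by rw [← hd.eq, ← mul_assoc, e2, one_mul]
  constructor
  · have := (h1 i k (Or.inr rfl)).mul_left hd'
    rwa [hKk, mul_assoc, e1, mul_one] at this
  · have := hd'.mul_left (h1 k i (Or.inl rfl))
    rwa [← mul_assoc, e2, one_mul] at this

end Centralizer

/-! ### Trace functionals on the commutant -/

section TraceVanish

variable {n m : ℕ} {q : ℂ}

local notation "Mw" => Matrix (Fin m → Fin n) (Fin m → Fin n) ℂ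

theorem Wt.mul_wp {X : Mw} {α β ν ν' : Fin n → ℕ} (h : Wt X α β) (e : ν' + α = ν + β) :
    X * wp m ν = wp m ν' * X := by
  ext I J
  rw [mul_wp_apply, wp_mul_apply]
  by_cases h0 : X I J = 0
  · simp [h0]
  · refine if_congr ?_ rfl rfl
    have := h I J h0
    constructor
    · rintro h1
      rw [h1, ← e] at this
      exact add_right_cancel this
    · rintro h1
      rw [h1, e] at this
      exact (add_right_cancel this).symm

/-- The sum of the letters of a word of the given content. -/
def ht (ν : Fin n → ℕ) : ℕ := ∑ j : Fin n, (j : ℕ) * ν j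

theorem ht_add (ν μ : Fin n → ℕ) : ht (ν + μ) = ht ν + ht μ := by
  simp [ht, mul_add, Finset.sum_add_distrib]

theorem ht_single (i : Fin n) : ht (Pi.single i 1) = i := by
  simp [ht, Pi.single_apply]

theorem ht_cnt_le (I : Fin m → Fin n) : ht (cnt I) ≤ n * m := by
  calc ht (cnt I) ≤ ∑ j, n * cnt I j :=
        Finset.sum_le_sum fun j _ => Nat.mul_le_mul_right _ j.2.le
    _ = n * m := by rw [← Finset.mul_sum, sum_cnt]

/-- A weight projection of height at least `N`, followed by lowering operators. -/
inductive FLow (n m : ℕ) (q : ℂ) (N : ℕ) : Matrix (Fin m → Fin n) (Fin m → Fin n) ℂ → Prop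
  | base (ν : Fin n → ℕ) (h : N ≤ ht ν) : FLow n m q N (wp m ν)
  | step (i : ℕ) {X} (h : FLow n m q N X) : FLow n m q N (X * MF n m q i)

theorem FMono.fLow {X : Mw} (h : FMono n m q X) : FLow n m q 0 X := by
  induction h with
  | base ν => exact .base ν (Nat.zero_le _)
  | step i _ ih => exact .step i ih

variable (n m q) in
/-- The span of the elements `FLow`. -/
def fSpan (N : ℕ) : Submodule ℂ Mw := Submodule.span ℂ {X | FLow n m q N X}

theorem fSpan_mul_MF {N : ℕ} {X : Mw} (h : X ∈ fSpan n m q N) (i : ℕ) :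
    X * MF n m q i ∈ fSpan n m q N :=
  mul_right_mem_of_span (fun _ (hX : FLow n m q N _) => Submodule.subset_span (FLow.step i hX)) h

theorem FLow.mul_dgc {N : ℕ} {X : Mw} (h : FLow n m q N X) (f : (Fin n → ℕ) → ℂ) :
    X * dgc m f ∈ fSpan n m q N := by
  induction h generalizing f with
  | base ν h =>
    rw [wp_mul_dgc]
    exact Submodule.smul_mem _ _ (Submodule.subset_span (.base ν h))
  | step i _ ih =>
    obtain ⟨g, hg⟩ := MF_dgc (m := m) (n := n) (q := q) i f
    rw [mul_assoc, hg, ← mul_assoc]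
    exact fSpan_mul_MF (ih g) i

theorem FLow.eq_zero {N : ℕ} {X : Mw} (h : FLow n m q N X) (hN : n * m < N) : X = 0 := by
  induction h with
  | base ν h =>
    ext I J
    rw [wp_apply, Matrix.zero_apply, if_neg]
    rintro ⟨-, h1⟩
    have := ht_cnt_le I
    rw [h1] at this
    omega
  | step i _ ih => rw [ih, zero_mul]

theorem FLow.mul_ME (hq : q ≠ 0) {N : ℕ} {X : Mw} (h : FLow n m q N X) (i : ℕ) :
    ∃ X₁ ∈ fSpan n m q (N + 1), ∃ X₂ ∈ fSpan n m q N, X * ME n m q i = ME n m q i * X₁ + X₂ := by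
  induction h with
  | base ν h =>
    by_cases hi : i + 1 < n
    swap
    · exact ⟨0, zero_mem _, 0, zero_mem _, by rw [ME, dif_neg hi]; simp⟩
    by_cases hν : ν ⟨i, by omega⟩ = 0
    · refine ⟨0, zero_mem _, 0, zero_mem _, ?_⟩
      rw [mul_zero, zero_add]
      ext I J
      rw [wp_mul_apply, Matrix.zero_apply, ite_eq_right_iff]
      intro h1
      by_contra h0
      have := congrFun (ME_weight q hi I J h0) ⟨i, by omega⟩
      simp only [Pi.add_apply, Pi.single_apply, Fin.mk.injEq] at this
      rw [h1, hν] at this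
      simp at this
    · obtain ⟨ν', e⟩ : ∃ ν' : Fin n → ℕ, ν = ν' + Pi.single (⟨i, by omega⟩ : Fin n) 1 :=
        ⟨ν - Pi.single (⟨i, by omega⟩ : Fin n) 1, (tsub_add_cancel_of_le fun x => by
          by_cases hx : x = (⟨i, by omega⟩ : Fin n)
          · subst hx; simp; omega
          · simp [hx]).symm⟩
      refine ⟨wp m (ν' + Pi.single ⟨i + 1, hi⟩ 1), Submodule.subset_span (.base _ ?_), 0,
        zero_mem _, ?_⟩
      · rw [e, ht_add, ht_single] at h
        rw [ht_add, ht_single]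
        simp only at h ⊢
        omega
      · rw [add_zero, (ME_weight q hi).mul_wp (ν' := ν) (by rw [e]; abel)]
  | @step k X h ih =>
    obtain ⟨X₁, h₁, X₂, h₂, e⟩ := ih
    obtain ⟨f, hf⟩ := ME_MF_eq (n := n) (m := m) hq k i
    refine ⟨X₁ * MF n m q k, fSpan_mul_MF h₁ k, X₂ * MF n m q k - X * dgc m f,
      sub_mem (fSpan_mul_MF h₂ k) (h.mul_dgc f), ?_⟩
    rw [mul_assoc, hf, mul_sub, ← mul_assoc, e, add_mul, mul_assoc, add_sub_assoc]

theorem fSpan_mul_ME (hq : q ≠ 0) {N : ℕ} {X : Mw} (h : X ∈ fSpan n m q N) (i : ℕ) :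
    ∃ X₁ ∈ fSpan n m q (N + 1), ∃ X₂ ∈ fSpan n m q N, X * ME n m q i = ME n m q i * X₁ + X₂ := by
  induction h using Submodule.span_induction with
  | mem X h => exact h.mul_ME hq i
  | zero => exact ⟨0, zero_mem _, 0, zero_mem _, by simp⟩
  | add X Y _ _ hX hY =>
    obtain ⟨X₁, h₁, X₂, h₂, e⟩ := hX
    obtain ⟨Y₁, k₁, Y₂, k₂, f⟩ := hY
    exact ⟨_, add_mem h₁ k₁, _, add_mem h₂ k₂, by rw [add_mul, e, f, mul_add]; abel⟩
  | smul c X _ hX =>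
    obtain ⟨X₁, h₁, X₂, h₂, e⟩ := hX
    exact ⟨_, Submodule.smul_mem _ c h₁, _, Submodule.smul_mem _ c h₂, by
      rw [smul_mul_assoc, e, smul_add, mul_smul_comm]⟩

theorem FLow.mem_opAlg {N : ℕ} {X : Mw} (h : FLow n m q N X) : X ∈ opAlg n m q := by
  induction h with
  | base ν _ => exact wp_mem_opAlg ν
  | step i _ ih => exact mul_mem ih (MF_mem_opAlg i)

theorem fSpan_le {N : ℕ} {X : Mw} (h : X ∈ fSpan n m q N) : X ∈ opAlg n m q :=
  (Submodule.span_le (p := Subalgebra.toSubmodule (opAlg n m q))).2 (fun _ h => h.mem_opAlg) h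

theorem FLow.ht_comm {N : ℕ} {X : Mw} (h : FLow n m q N X) :
    (∃ ν, X = wp m ν) ∨ ∃ s : ℕ, dgc m (fun ν => (ht ν : ℂ)) * X =
      X * dgc m (fun ν => (ht ν : ℂ)) + (s + 1 : ℂ) • X := by
  have hF : ∀ i, dgc m (fun ν => (ht ν : ℂ)) * MF n m q i =
      MF n m q i * dgc m (fun ν => (ht ν : ℂ)) + MF n m q i := by
    intro i
    by_cases hi : i + 1 < n
    swap
    · simp [MF, ME, dif_neg hi]
    ext I J
    rw [dgc, Matrix.add_apply, Matrix.diagonal_mul, Matrix.mul_diagonal]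
    by_cases h0 : MF n m q i I J = 0
    · rw [h0]; ring
    have h1 := congrArg ht (MF_weight q hi I J h0)
    rw [ht_add, ht_add, ht_single, ht_single] at h1
    simp only at h1
    have h2 : ht (cnt I) = ht (cnt J) + 1 := by omega
    rw [h2]
    push_cast
    ring
  induction h with
  | base ν h => exact Or.inl ⟨ν, rfl⟩
  | @step i X _ ih =>
    right
    rcases ih with ⟨ν, rfl⟩ | ⟨s, hs⟩
    · refine ⟨0, ?_⟩
      have e : dgc m (fun ν => (ht ν : ℂ)) * wp m ν = wp m ν * dgc m (fun ν => (ht ν : ℂ)) := by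
        rw [dgc_mul_wp, wp_mul_dgc]
      rw [← mul_assoc, e, mul_assoc, hF, mul_add, ← mul_assoc]
      simp
    · refine ⟨s + 1, ?_⟩
      rw [← mul_assoc, hs, add_mul, mul_assoc X, hF, mul_add, ← mul_assoc, smul_mul_assoc]
      push_cast
      module

theorem TMono.exists_list {X : Mw} (h : TMono n m q X) :
    ∃ (l : List ℕ) (Y : Mw), FMono n m q Y ∧ X = (l.map (ME n m q)).prod * Y := by
  induction h with
  | of h => exact ⟨[], _, h, by simp⟩
  | step i _ ih =>
    obtain ⟨l, Y, hY, rfl⟩ := ih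
    exact ⟨i :: l, Y, hY, by simp [mul_assoc]⟩

theorem trace_eq_zero_of_wp (hq : q ≠ 0) (g : Mw →ₗ[ℂ] ℂ)
    (hg : ∀ s ∈ opAlg n m q, ∀ t ∈ opAlg n m q, g (s * t) = g (t * s))
    (h0 : ∀ ν, g (wp m ν) = 0) {s : Mw} (hs : s ∈ opAlg n m q) : g s = 0 := by
  have hF : ∀ N, ∀ X ∈ fSpan n m q N, g X = 0 := by
    intro N X hX
    refine (Submodule.span_le (p := LinearMap.ker g)).2 (fun X hX => ?_) hX
    rcases hX.ht_comm with ⟨ν, rfl⟩ | ⟨s, e⟩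
    · exact h0 ν
    · have hd : dgc m (fun ν => (ht ν : ℂ)) ∈ opAlg n m q := by
        rw [dgc_eq_sum]
        exact sum_mem fun ν _ => Subalgebra.smul_mem _ (wp_mem_opAlg ν) _
      have h1 := congrArg g e
      rw [map_add, hg _ hd _ hX.mem_opAlg, map_smul, left_eq_add, smul_eq_mul, mul_eq_zero] at h1
      exact h1.resolve_left (by exact_mod_cast Nat.succ_ne_zero s)
  have hE : ∀ l : List ℕ, (l.map (ME n m q)).prod ∈ opAlg n m q := fun l =>
    list_prod_mem fun x hx => by
      obtain ⟨i, -, rfl⟩ := List.mem_map.1 hx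
      exact ME_mem_opAlg i
  have key : ∀ r N' N, n * m < N + N' → ∀ l : List ℕ, l.length = r → ∀ X ∈ fSpan n m q N,
      g ((l.map (ME n m q)).prod * X) = 0 := by
    intro r
    induction r with
    | zero =>
      intro N' N _ l hl X hX
      rw [List.length_eq_zero_iff.1 hl, List.map_nil, List.prod_nil, one_mul]
      exact hF N X hX
    | succ r ihr =>
      intro N'
      induction N' with
      | zero =>
        intro N hN l _ X hX
        have : X = 0 := (Submodule.mem_bot ℂ).1
          ((Submodule.span_le (p := ⊥)).2 (fun X hX => hX.eq_zero (by omega)) hX)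
        rw [this, mul_zero, map_zero]
      | succ N' ihN =>
        intro N hN l hl X hX
        obtain ⟨i, l, rfl⟩ := List.exists_cons_of_length_eq_add_one hl
        obtain ⟨X₁, h₁, X₂, h₂, e⟩ := fSpan_mul_ME hq hX i
        rw [List.map_cons, List.prod_cons, mul_assoc, hg _ (ME_mem_opAlg i) _
          (mul_mem (hE l) (fSpan_le hX)), mul_assoc, e, mul_add, map_add,
          ihr (n * m + 1) N (by omega) l (by simpa using hl) X₂ h₂, add_zero, ← mul_assoc]
        have := ihN (N + 1) (by omega) (l ++ [i]) (by simpa using hl) X₁ h₁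
        simpa using this
  refine (Submodule.span_le (p := LinearMap.ker g)).2 (fun X hX => ?_) (opAlg_le_triSpan hq hs)
  obtain ⟨l, Y, hY, rfl⟩ := hX.exists_list
  exact key l.length (n * m + 1) 0 (by omega) l rfl Y (Submodule.subset_span hY.fLow)

end TraceVanish

theorem NotRootOfUnity.zpow_injective {q : ℂ} (hq : q ≠ 0) (hq' : NotRootOfUnity q) {a b : ℤ}
    (h : q ^ a = q ^ b) : a = b := by
  have key : ∀ c : ℤ, 0 < c → q ^ c ≠ 1 := fun c hc h1 => by
    lift c to ℕ using hc.le
    exact hq' c (by exact_mod_cast hc) (by simpa using h1)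
  rcases lt_trichotomy a b with hab | hab | hab
  · exact absurd (by rw [zpow_sub₀ hq, h, div_self (zpow_ne_zero _ hq)]) (key (b - a) (by omega))
  · exact hab
  · exact absurd (by rw [zpow_sub₀ hq, h, div_self (zpow_ne_zero _ hq)]) (key (a - b) (by omega))

section Swap

open Polynomial

variable {A : Type} [Ring A] [Algebra ℂ A]

theorem eq_of_casimir_aux {g : A →ₗ[ℂ] ℂ} {S : Subalgebra ℂ A}
    (hg : ∀ s ∈ S, ∀ t ∈ S, g (s * t) = g (t * s)) {E F C W W' : A} (hE : E ∈ S) (hF : F ∈ S)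
    (hC : C ∈ S) (hW' : W' ∈ S) {c : ℂ} (hFE : F * E * W = C * W - c • W)
    (hEF : E * F * W' = C * W' - c • W') (hFW : F * W' = W * F) (hEW : E * W = W' * E)
    (hCW' : Commute C W') (p : ℂ[X]) :
    g (aeval C p * W') - g (aeval C p * W) = p.eval c * (g W' - g W) := by
  have hp : ∀ p : ℂ[X], aeval C p ∈ S := fun p =>
    Algebra.adjoin_le (Set.singleton_subset_iff.2 hC) (aeval_mem_adjoin_singleton ℂ C)
  have hcom : ∀ {w : A}, Commute C w → ∀ p : ℂ[X], Commute (aeval C p) w := by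
    intro w hw p
    induction p using Polynomial.induction_on' with
    | add p r hp hr => rw [map_add]; exact hp.add_left hr
    | monomial k a =>
      rw [aeval_monomial]
      exact (show Commute (algebraMap ℂ A a) w from Algebra.commutes a w).mul_left (hw.pow_left k)
  have hCF : C * (F * W') = F * W' * C := by
    have h1 : C * W = F * E * W + c • W := by rw [hFE]; abel
    have h2 : C * W' = E * F * W' + c • W' := by rw [hEF]; abel
    rw [mul_assoc F, ← hCW'.eq, h2, hFW, ← mul_assoc, h1, add_mul, mul_add, smul_mul_assoc,
      mul_smul_comm, mul_assoc (F * E), ← hFW]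
    simp only [mul_assoc]
  have key : ∀ p : ℂ[X], g (aeval C p * (C * W' - c • W')) = g (aeval C p * (C * W - c • W)) := by
    intro p
    rw [← hEF, ← hFE, mul_assoc E, ← mul_assoc, hg _ (mul_mem (hp p) hE) _ (mul_mem hF hW'),
      ← mul_assoc, ← (hcom hCF p).eq, mul_assoc, mul_assoc, ← hEW, mul_assoc]
  obtain ⟨r, hr⟩ : X - Polynomial.C c ∣ p - Polynomial.C (p.eval c) :=
    dvd_iff_isRoot.2 (by simp)
  have hr' : aeval C p = aeval C r * (C - algebraMap ℂ A c) + algebraMap ℂ A (p.eval c) := by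
    have := congrArg (aeval C) hr
    rw [map_sub, aeval_C, sub_eq_iff_eq_add] at this
    rw [this, mul_comm (X - Polynomial.C c) r, map_mul, map_sub, aeval_X, aeval_C]
  have h3 := key r
  rw [hr', add_mul, add_mul, map_add, map_add, mul_assoc, mul_assoc, sub_mul, sub_mul,
    ← Algebra.smul_def, ← Algebra.smul_def, ← Algebra.smul_def, ← Algebra.smul_def, h3, map_smul,
    map_smul]
  simp only [smul_eq_mul]
  ring

theorem aeval_mul_of_eigen {C W : A} {c : ℂ} (h : C * W = c • W) (p : ℂ[X]) :
    aeval C p * W = p.eval c • W := by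
  induction p using Polynomial.induction_on' with
  | add p r hp hr => rw [map_add, add_mul, hp, hr, eval_add, add_smul]
  | monomial k a =>
    have : ∀ k : ℕ, C ^ k * W = c ^ k • W := by
      intro k
      induction k with
      | zero => simp
      | succ k ih => rw [pow_succ', mul_assoc, ih, mul_smul_comm, h, smul_smul, pow_succ]
    rw [aeval_monomial, eval_monomial, ← Algebra.smul_def, smul_mul_assoc, this, smul_smul]

theorem eq_of_casimir {g : A →ₗ[ℂ] ℂ} {S : Subalgebra ℂ A}
    (hg : ∀ s ∈ S, ∀ t ∈ S, g (s * t) = g (t * s)) {E F C : A} {W : ℕ → A} (hE : E ∈ S)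
    (hF : F ∈ S) (hC : C ∈ S) (hW : ∀ j, W j ∈ S) {c : ℕ → ℂ} {r k : ℕ}
    (hFE : ∀ j < r, F * E * W j = C * W j - c j • W j)
    (hEF : ∀ j < r, E * F * W (j + 1) = C * W (j + 1) - c j • W (j + 1))
    (hFW : ∀ j < r, F * W (j + 1) = W j * F) (hEW : ∀ j < r, E * W j = W (j + 1) * E)
    (hCW : ∀ j, Commute C (W j)) (h0 : C * W 0 = c r • W 0) (hr : C * W r = c r • W r)
    (hc : ∀ i < r, ∀ j ≤ r, c i = c j → i = j ∨ i + j + 1 = r) (hk : 2 * k ≤ r) :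
    g (W k) = g (W (r - k)) := by
  obtain ⟨p, hp⟩ : ∃ p : ℂ[X], ∀ j ≤ r, p.eval (c j) = if k ≤ j ∧ j < r - k then 1 else 0 := by
    refine ⟨Lagrange.interpolate ((Finset.range (r + 1)).image c) id
      (fun x => if x ∈ (Finset.Ico k (r - k)).image c then 1 else 0), fun j hj => ?_⟩
    have hm : c j ∈ (Finset.range (r + 1)).image c :=
      Finset.mem_image_of_mem _ (Finset.mem_range.2 (by omega))
    refine (Lagrange.eval_interpolate_at_node _ (Set.injOn_id _) hm).trans (if_congr ?_ rfl rfl)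
    simp only [Finset.mem_image, Finset.mem_Ico]
    constructor
    · rintro ⟨i, hi, h⟩
      rcases hc i (by omega) j hj h with h | h <;> omega
    · exact fun h => ⟨j, h, rfl⟩
  have h1 : ∑ j ∈ Finset.range r, (g (aeval C p * W (j + 1)) - g (aeval C p * W j)) = 0 := by
    rw [Finset.sum_range_sub fun j => g (aeval C p * W j), aeval_mul_of_eigen h0,
      aeval_mul_of_eigen hr, hp r le_rfl, if_neg (by omega)]
    simp
  have h2 : ∑ j ∈ Finset.range r, (g (aeval C p * W (j + 1)) - g (aeval C p * W j)) =
      ∑ j ∈ Finset.Ico k (r - k), (g (W (j + 1)) - g (W j)) := by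
    rw [← Finset.sum_subset (s₁ := Finset.Ico k (r - k))]
    · refine Finset.sum_congr rfl fun j hj => ?_
      rw [Finset.mem_Ico] at hj
      have hj' : j < r := by omega
      rw [eq_of_casimir_aux hg hE hF hC (hW _) (hFE j hj') (hEF j hj') (hFW j hj')
        (hEW j hj') (hCW _), hp j hj'.le, if_pos hj, one_mul]
    · intro j hj
      rw [Finset.mem_Ico] at hj
      exact Finset.mem_range.2 (by omega)
    · intro j hj hj2
      have hj' : j < r := Finset.mem_range.1 hj
      rw [Finset.mem_Ico] at hj2
      rw [eq_of_casimir_aux hg hE hF hC (hW _) (hFE j hj') (hEF j hj') (hFW j hj')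
        (hEW j hj') (hCW _), hp j hj'.le, if_neg hj2, zero_mul]
  rw [h1, Finset.sum_Ico_eq_sub _ (by omega), Finset.sum_range_sub fun j => g (W j),
    Finset.sum_range_sub fun j => g (W j)] at h2
  linear_combination h2

end Swap

section TraceSwap

variable {n m : ℕ} {q : ℂ}

local notation "Mw" => Matrix (Fin m → Fin n) (Fin m → Fin n) ℂ

theorem trace_swap (hq : q ≠ 0) (hq' : NotRootOfUnity q) {g : Mw →ₗ[ℂ] ℂ}
    (hg : ∀ s ∈ opAlg n m q, ∀ t ∈ opAlg n m q, g (s * t) = g (t * s)) {i : ℕ} (hi : i + 1 < n)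
    (ν : Fin n → ℕ) {a b : ℕ} (hab : a ≤ b) :
    g (wp m (Function.update (Function.update ν ⟨i, by omega⟩ a) ⟨i + 1, hi⟩ b)) =
      g (wp m (Function.update (Function.update ν ⟨i, by omega⟩ b) ⟨i + 1, hi⟩ a)) := by
  have hi' : i < n := by omega
  set x : Fin n := ⟨i, hi'⟩ with hx
  set y : Fin n := ⟨i + 1, hi⟩ with hy
  have hxy : x ≠ y := by rw [hx, hy, Ne, Fin.mk.injEq]; omega
  let N : ℕ → ℕ → Fin n → ℕ := fun a b => Function.update (Function.update ν x a) y b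
  have Nx : ∀ a b, N a b x = a := fun a b => by simp [N, hxy]
  have Ny : ∀ a b, N a b y = b := fun a b => by simp [N]
  have Nadd : ∀ a b, N (a + 1) b + Pi.single y 1 = N a (b + 1) + Pi.single x 1 := by
    intro a b
    funext t
    simp only [N, Pi.add_apply, Function.update_apply, Pi.single_apply]
    by_cases h1 : t = y
    · subst h1; simp [hxy.symm]
    · by_cases h2 : t = x
      · subst h2; simp [hxy]
      · simp [h1, h2]
  set r := a + b with hr
  set E := ME n m q i with hE
  set F := MF n m q i with hF
  let h : (Fin n → ℕ) → ℂ := fun ν => q ^ (2 * ν x) + q ^ (2 * ((ν y : ℤ) - 1))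
  let c : ℕ → ℂ := fun j => q ^ (2 * j) + q ^ (2 * ((r : ℤ) - j - 1))
  let C := F * E + dgc m h
  let W : ℕ → Mw := fun j => wp m (N j (r - j))
  have hWE : Wt E (Pi.single y 1) (Pi.single x 1) := ME_weight q hi
  have hWF : Wt F (Pi.single x 1) (Pi.single y 1) := MF_weight q hi
  have hdW : ∀ j ≤ r, dgc m h * W j = c j • W j := by
    intro j hj
    rw [dgc_mul_wp]
    simp only [h, c, Nx, Ny]
    rw [Nat.cast_sub hj]
  have hsub : E * F - F * E = dgc m fun ν =>
      (1 - q⁻¹ ^ 2) * (q ^ (2 * ν x) - q ^ (2 * ν y)) := ME_MF_sub hq hi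
  have hsubW : ∀ j ≤ r, E * F * W j = F * E * W j +
      ((1 - q⁻¹ ^ 2) * (q ^ (2 * j) - q ^ (2 * (r - j)))) • W j := by
    intro j _
    have := congrArg (· * W j) hsub
    beta_reduce at this
    rw [sub_mul, dgc_mul_wp, Nx, Ny, sub_eq_iff_eq_add] at this
    rw [this, add_comm]
  have hFE : ∀ j ≤ r, F * E * W j = C * W j - c j • W j := by
    intro j hj
    rw [add_mul, hdW j hj, add_sub_cancel_right]
  have hFW0 : F * W 0 = 0 := by
    ext I J
    rw [mul_wp_apply, Matrix.zero_apply, ite_eq_right_iff]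
    intro h1
    by_contra h0
    have := congrFun (hWF I J h0) x
    rw [h1, Pi.add_apply, Pi.add_apply, Nx] at this
    simp [hxy] at this
  have hEWr : E * W r = 0 := by
    ext I J
    rw [mul_wp_apply, Matrix.zero_apply, ite_eq_right_iff]
    intro h1
    by_contra h0
    have := congrFun (hWE I J h0) y
    rw [h1, Pi.add_apply, Pi.add_apply, Ny] at this
    simp [hxy.symm] at this
  have hCmem : C ∈ opAlg n m q := by
    refine add_mem (mul_mem (MF_mem_opAlg i) (ME_mem_opAlg i)) ?_
    rw [dgc_eq_sum]
    exact sum_mem fun ν _ => Subalgebra.smul_mem _ (wp_mem_opAlg ν) _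
  have hcsub : ∀ j, c (j + 1) - c j =
      (1 - q⁻¹ ^ 2) * (q ^ (2 * (j + 1)) - q ^ (2 * ((r : ℤ) - (j + 1)))) := by
    intro j
    have e1 : q ^ (2 * ((r : ℤ) - (j + 1))) = q ^ (2 * ((r : ℤ) - j - 1 - 1)) * q ^ 2 := by
      rw [← zpow_natCast q 2, ← zpow_add₀ hq]; congr 1; push_cast; ring
    have e2 : q ^ (2 * ((r : ℤ) - j - 1)) = q ^ (2 * ((r : ℤ) - j - 1 - 1)) * q ^ 2 := by
      rw [← zpow_natCast q 2, ← zpow_add₀ hq]; congr 1; push_cast; ring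
    have e3 : q ^ (2 * ((r : ℤ) - (j + 1 : ℕ) - 1)) = q ^ (2 * ((r : ℤ) - j - 1 - 1)) := by
      congr 1; push_cast; ring
    simp only [c]
    rw [e1, e2, e3]
    field_simp
    ring
  have hW0 : W b = wp m (N b a) := by simp only [W, hr, Nat.add_sub_cancel]
  have hWa : W a = wp m (N a b) := by simp only [W, hr, Nat.add_sub_cancel_left]
  change g (wp m (N a b)) = g (wp m (N b a))
  rw [← hW0, ← hWa]
  have hb : b = r - a := by omega
  rw [hb]
  refine eq_of_casimir hg (ME_mem_opAlg i) (MF_mem_opAlg i) hCmem (fun j => wp_mem_opAlg _)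
    (c := c) (fun j hj => hFE j hj.le) (fun j hj => ?_) (fun j hj => ?_) (fun j hj => ?_)
    (fun j => ?_) ?_ ?_ ?_ (by omega)
  · rw [hsubW (j + 1) hj, hFE (j + 1) hj, sub_add, ← sub_smul]
    congr 2
    have := hcsub j
    have e : q ^ (2 * (r - (j + 1))) = q ^ (2 * ((r : ℤ) - (j + 1))) := by
      rw [← zpow_natCast]; congr 1; push_cast [Nat.cast_sub (show j + 1 ≤ r from hj)]; ring
    rw [e, ← this]
    ring
  · refine hWF.mul_wp ?_
    have := Nadd j (r - (j + 1))
    rw [show r - (j + 1) + 1 = r - j by omega] at this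
    exact this.symm
  · refine hWE.mul_wp ?_
    have := Nadd j (r - (j + 1))
    rw [show r - (j + 1) + 1 = r - j by omega] at this
    exact this
  · have h1 : Wt (F * E) _ _ := hWF.mul hWE
    exact Commute.add_left (h1.mul_wp (by rw [add_comm (Pi.single x 1)]))
      (by rw [Commute, SemiconjBy, dgc_mul_wp, wp_mul_dgc])
  · have h1 := hsubW 0 (Nat.zero_le _)
    rw [mul_assoc, hFW0, mul_zero, hFE 0 (Nat.zero_le _), eq_comm, sub_add, sub_eq_zero,
      ← sub_smul] at h1
    rw [h1]
    congr 1
    simp only [c]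
    rw [show 2 * ((r : ℤ) - r - 1) = -2 by ring, show (2 * ((r : ℤ) - (0 : ℕ) - 1)) = 2 * (r : ℤ) - 2 by simp; ring,
      zpow_sub₀ hq, zpow_neg, show q ^ (2 * (r : ℤ)) = q ^ (2 * r) by rw [← zpow_natCast]; simp]
    simp only [Nat.sub_zero, mul_zero, pow_zero]
    norm_cast
    field_simp
    ring
  · have h1 := hFE r le_rfl
    rw [mul_assoc, hEWr, mul_zero, eq_comm, sub_eq_zero] at h1
    exact h1
  · intro j hj k hk hjk
    simp only [c] at hjk
    have e : ∀ j : ℕ, q ^ (2 * j) = q ^ (2 * (j : ℤ)) := fun j => by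
      rw [← zpow_natCast]; simp
    rw [e, e] at hjk
    have e2 : ∀ j : ℕ, q ^ (2 * (j : ℤ)) * q ^ (2 * ((r : ℤ) - j - 1)) = q ^ (2 * ((r : ℤ) - 1)) :=
      fun j => by rw [← zpow_add₀ hq]; congr 1; ring
    have h3 : (q ^ (2 * (j : ℤ)) - q ^ (2 * (k : ℤ))) *
        (q ^ (2 * (j : ℤ)) - q ^ (2 * ((r : ℤ) - k - 1))) = 0 := by
      linear_combination (q ^ (2 * (j : ℤ))) * hjk + e2 k - e2 j
    rcases mul_eq_zero.1 h3 with h3 | h3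
    · left
      have := hq'.zpow_injective hq (sub_eq_zero.1 h3)
      omega
    · right
      have := hq'.zpow_injective hq (sub_eq_zero.1 h3)
      omega

/-- A trace functional on the commutant attains its lexicographically maximal weight on a
dominant weight. -/
theorem antitone_of_maximal (hq : q ≠ 0) (hq' : NotRootOfUnity q) {g : Mw →ₗ[ℂ] ℂ}
    (hg : ∀ s ∈ opAlg n m q, ∀ t ∈ opAlg n m q, g (s * t) = g (t * s)) {ν : Fin n → ℕ}
    (hν : g (wp m ν) ≠ 0) (hmax : ∀ μ, g (wp m μ) ≠ 0 → toLex μ ≤ toLex ν) : Antitone ν := by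
  obtain _ | n := n
  · exact fun x => x.elim0
  refine Fin.antitone_iff_succ_le.2 fun i => ?_
  by_contra! h
  have h1 := trace_swap hq hq' hg (i := i) (by omega) ν h.le
  have e1 : (⟨i, by omega⟩ : Fin (n + 1)) = i.castSucc := rfl
  have e2 : (⟨i + 1, by omega⟩ : Fin (n + 1)) = i.succ := rfl
  rw [e1, e2, Function.update_eq_self, Function.update_eq_self] at h1
  rw [h1] at hν
  refine absurd (hmax _ hν) (not_le.2 ⟨i.castSucc, fun j hj => ?_, ?_⟩)
  · have hj1 : j ≠ i.castSucc := hj.ne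
    have hj2 : j ≠ i.succ := (hj.trans i.castSucc_lt_succ).ne
    simp [hj1, hj2]
  · simp [i.castSucc_lt_succ.ne, h]

theorem exists_antitone (hq : q ≠ 0) (hq' : NotRootOfUnity q) {g : Mw →ₗ[ℂ] ℂ}
    (hg : ∀ s ∈ opAlg n m q, ∀ t ∈ opAlg n m q, g (s * t) = g (t * s)) {s : Mw}
    (hs : s ∈ opAlg n m q) (h : g s ≠ 0) :
    ∃ ν : Fin n → ℕ, Antitone ν ∧ g (wp m ν) ≠ 0 ∧ (∀ μ, g (wp m μ) ≠ 0 → toLex μ ≤ toLex ν) := by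
  have h1 : ∃ ν, g (wp m ν) ≠ 0 := by
    by_contra! h1
    exact h (trace_eq_zero_of_wp hq g hg h1 hs)
  let f : Finset (Lex (Fin n → ℕ)) :=
    (Finset.univ.image fun I : Fin m → Fin n => toLex (cnt I)).filter fun ν => g (wp m (ofLex ν)) ≠ 0
  have hf : ∀ ν, g (wp m ν) ≠ 0 → toLex ν ∈ f := by
    intro ν hν
    refine Finset.mem_filter.2 ⟨?_, hν⟩
    by_contra h2
    refine hν ?_
    have : wp m ν = 0 := by
      ext I J
      rw [wp_apply, Matrix.zero_apply, if_neg]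
      rintro ⟨-, h3⟩
      exact h2 (Finset.mem_image.2 ⟨I, Finset.mem_univ _, by rw [h3]⟩)
    rw [this, map_zero]
  obtain ⟨ν, hν⟩ := h1
  obtain ⟨μ, hμ, hmax⟩ := f.exists_max_image id ⟨_, hf ν hν⟩
  have hμ' := (Finset.mem_filter.1 hμ).2
  have hm : ∀ κ, g (wp m κ) ≠ 0 → toLex κ ≤ toLex (ofLex μ) := fun κ hκ => hmax _ (hf κ hκ)
  exact ⟨ofLex μ, antitone_of_maximal hq hq' hg hμ' hm, hμ', hm⟩

end TraceSwap

/-! ### Highest weight vectors which are eigenvectors of the Jucys–Murphy elements -/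

section HighestWeight

open scoped Matrix

variable {n m : ℕ} {q : ℂ}

/-- The part of a vector supported on words with the given last letter. -/
def sl (u : (Fin (m + 1) → Fin n) → ℂ) (x : Fin n) : (Fin m → Fin n) → ℂ :=
  fun I => u (Fin.snoc (α := fun _ => Fin n) I x)

theorem sl_mulVec (Z : Matrix (Fin (m + 1) → Fin n) (Fin (m + 1) → Fin n) ℂ)
    (u : (Fin (m + 1) → Fin n) → ℂ) (x : Fin n) :
    sl (Z *ᵥ u) x = ∑ y, lastBlk Z x y *ᵥ sl u y := by
  funext I
  rw [sl, Matrix.mulVec, dotProduct, ← (Fin.snocEquiv fun _ => Fin n).sum_comp,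
    Fintype.sum_prod_type, Finset.sum_apply]
  rfl

theorem lastBlk_aK (i j x y : Fin n) : lastBlk (aK n (m + 1) q ℂ i j) x y =
    (if x = y then al q x j • aK n m q ℂ i j else 0) +
      if j = x then be q x y • aK n m q ℂ i y else 0 := by
  have h1 : (asc (gK n (m + 1) q ℂ) m).map lastBlk =
      (aK n m q ℂ).map (Matrix.scalar (Fin n)) := by
    change (lastBlk : Matrix (Fin (m + 1) → Fin n) (Fin (m + 1) → Fin n) ℂ ≃+*
        Matrix (Fin n) (Fin n) (Matrix (Fin m → Fin n) (Fin m → Fin n) ℂ)).toRingHom.mapMatrix _ =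
      (Matrix.scalar (Fin n) : Matrix (Fin m → Fin n) (Fin m → Fin n) ℂ →+* _).mapMatrix _
    rw [map_asc, aK, map_asc]
    refine asc_congr fun k hk => ?_
    ext i j : 2
    rw [RingHom.mapMatrix_apply, RingHom.mapMatrix_apply, Matrix.map_apply, Matrix.map_apply,
      gK_apply (by omega), gK_apply hk]
    exact congrFun (congrFun (lastBlk_w1 (B := ℂ) hk _) _) _
  have h2 : ∀ k, lastBlk (asc (gK n (m + 1) q ℂ) m i k) = Matrix.scalar (Fin n) (aK n m q ℂ i k) :=
    fun k => congrFun (congrFun h1 i) k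
  rw [aK, asc, Matrix.mul_apply, map_sum, Matrix.sum_apply]
  have h3 : ∀ k, lastBlk (asc (gK n (m + 1) q ℂ) m i k * gK n (m + 1) q ℂ m k j) x y =
      Rmat q n (x, k) (y, j) • aK n m q ℂ i k := by
    intro k
    rw [map_mul, h2, gK_apply (Nat.lt_succ_self m), lastBlk_w1_last, Matrix.scalar_apply,
      Matrix.diagonal_mul, scal_apply, Matrix.scalar_apply, Matrix.of_apply, RB, Matrix.map_apply]
    rw [Algebra.algebraMap_self, RingHom.id_apply, ← Matrix.smul_one_eq_diagonal, mul_smul_comm,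
      mul_one]
  rw [Finset.sum_congr rfl fun k _ => h3 k]
  simp only [Rmat_apply, Prod.mk.injEq, Prod.swap, add_smul, Finset.sum_add_distrib, ite_smul,
    zero_smul]
  congr 1
  · by_cases h : x = y
    · subst h
      simp
    · simp [h, Ne.symm h]
  · by_cases h : j = x
    · subst h
      simp
    · simp [h]

/-- The conditions on a highest weight vector. -/
structure IsHW (q : ℂ) (u : (Fin m → Fin n) → ℂ) (l : Fin n → ℕ) : Prop where
  ann : ∀ i j, j < i → aK n m q ℂ i j *ᵥ u = 0
  wt : ∀ I, u I ≠ 0 → cnt I = l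

theorem cnt_snoc (I : Fin m → Fin n) (x : Fin n) :
    cnt (Fin.snoc (α := fun _ => Fin n) I x) = cnt I + Pi.single x 1 := by
  rw [cnt, Fin.sum_univ_castSucc]
  simp [cnt]

theorem IsHW.relation {u : (Fin (m + 1) → Fin n) → ℂ} {l : Fin n → ℕ} (h : IsHW q u l)
    {i j : Fin n} (hij : j < i) (x : Fin n) :
    al q x j • aK n m q ℂ i j *ᵥ sl u x +
      (if j = x then ∑ y, be q x y • aK n m q ℂ i y *ᵥ sl u y else 0) = 0 := by
  have h1 := sl_mulVec (aK n (m + 1) q ℂ i j) u x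
  rw [h.ann i j hij] at h1
  simp only [lastBlk_aK, Matrix.add_mulVec, Finset.sum_add_distrib] at h1
  refine Eq.trans ?_ h1.symm
  congr 1
  · rw [Finset.sum_eq_single x (fun y _ hy => by rw [if_neg hy.symm, Matrix.zero_mulVec])
      (by simp), if_pos rfl, Matrix.smul_mulVec]
  · by_cases hj : j = x
    · simp only [if_pos hj, Matrix.smul_mulVec]
    · simp [if_neg hj]

theorem IsHW.slice (hq : q ≠ 0) {u : (Fin (m + 1) → Fin n) → ℂ} {l : Fin n → ℕ} (h : IsHW q u l)
    {p : Fin n} (hp : ∀ y, p < y → sl u y = 0) :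
    (∀ i j y, j < i → y ≠ j → aK n m q ℂ i j *ᵥ sl u y = 0) ∧
      (∀ i, p < i → aK n m q ℂ i p *ᵥ sl u p = 0) := by
  constructor
  · intro i j y hij hy
    have := h.relation hij y
    rw [if_neg hy.symm, add_zero] at this
    exact (smul_eq_zero.1 this).resolve_left (al_ne_zero hq _ _)
  · intro i hi
    have := h.relation hi p
    rw [if_pos rfl, Finset.sum_eq_zero, add_zero] at this
    · exact (smul_eq_zero.1 this).resolve_left (al_ne_zero hq _ _)
    · intro y _
      by_cases hy : p < y
      · rw [hp y hy, Matrix.mulVec_zero, smul_zero]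
      · rw [be, if_neg hy, zero_smul]

theorem IsHW.sum_slices (hq : q ≠ 0) {u : (Fin (m + 1) → Fin n) → ℂ} {l : Fin n → ℕ}
    (h : IsHW q u l) {p : Fin n} (hp : ∀ y, p < y → sl u y = 0) (i : Fin n) :
    ∑ y, aK n m q ℂ i y *ᵥ sl u y =
      if i < p then ∑ y, aK n m q ℂ i y *ᵥ sl u y
      else q ^ (-2 * (p : ℤ)) • aK n m q ℂ i p *ᵥ sl u p := by
  split_ifs with hip
  · rfl
  have hs : ∀ y, y < i → q • aK n m q ℂ i y *ᵥ sl u y +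
      ∑ w, (if y < w then (q - q⁻¹) • aK n m q ℂ i w *ᵥ sl u w else 0) = 0 := by
    intro y hy
    have := h.relation hy y
    rw [if_pos rfl, al, if_pos rfl] at this
    simpa only [be, ite_smul, zero_smul] using this
  have hz : ∀ y, p < y → aK n m q ℂ i y *ᵥ sl u y = 0 := fun y hy => by
    rw [hp y hy, Matrix.mulVec_zero]
  generalize hsy : (fun y => aK n m q ℂ i y *ᵥ sl u y) = s at hs hz ⊢
  have hsy' : ∀ y, aK n m q ℂ i y *ᵥ sl u y = s y := congrFun hsy
  simp only [hsy'] at hs hz ⊢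
  have key : ∀ k : ℕ, k ≤ p → ∑ y : Fin n, (if (p : ℕ) - k ≤ y then s y else 0) =
      q ^ (-2 * (k : ℤ)) • s p := by
    intro k hk
    induction k with
    | zero =>
      simp only [Nat.sub_zero, CharP.cast_eq_zero, mul_zero, zpow_zero, one_smul]
      rw [Finset.sum_eq_single p, if_pos le_rfl]
      · intro y _ hy
        split_ifs with h1
        · exact hz y (lt_of_le_of_ne h1 hy.symm)
        · rfl
      · simp
    | succ k ih =>
      have ih := ih (by omega)
      let y : Fin n := ⟨p - (k + 1), by omega⟩
      have hyi : y < i := by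
        rw [Fin.lt_def]
        have : (p : ℕ) ≤ i := by simpa using hip
        simp only [y]; omega
      have e1 : ∑ w : Fin n, (if (p : ℕ) - (k + 1) ≤ w then s w else 0) =
          s y + ∑ w : Fin n, (if (p : ℕ) - k ≤ w then s w else 0) := by
        rw [← Finset.sum_filter, ← Finset.sum_filter]
        rw [show Finset.univ.filter (fun w : Fin n => (p : ℕ) - (k + 1) ≤ w) =
          insert y (Finset.univ.filter fun w : Fin n => (p : ℕ) - k ≤ w) by
            ext w; simp only [Finset.mem_filter, Finset.mem_univ, true_and, Finset.mem_insert,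
              Fin.ext_iff, y]; omega]
        rw [Finset.sum_insert (by simp [y]; omega)]
      have e2 := hs y hyi
      have e3 : ∑ w, (if y < w then (q - q⁻¹) • s w else 0) =
          (q - q⁻¹) • ∑ w : Fin n, (if (p : ℕ) - k ≤ w then s w else 0) := by
        rw [Finset.smul_sum]
        refine Finset.sum_congr rfl fun w _ => ?_
        rw [smul_ite, smul_zero]
        refine if_congr ?_ rfl rfl
        rw [Fin.lt_def]; simp only [y]; omega
      rw [e3, ih, smul_smul, ← eq_neg_iff_add_eq_zero, ← neg_smul] at e2
      have e4 : s y = (q⁻¹ * -((q - q⁻¹) * q ^ (-2 * (k : ℤ)))) • s p := by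
        rw [mul_smul, ← e2, smul_smul, inv_mul_cancel₀ hq, one_smul]
      rw [e1, ih, e4, ← add_smul]
      congr 1
      rw [show (-2 * ((k + 1 : ℕ) : ℤ)) = -2 * (k : ℤ) + (-2) by push_cast; ring, zpow_add₀ hq,
        zpow_neg q 2]
      norm_cast
      field_simp
      ring
  have := key p le_rfl
  simpa using this

theorem jm_last_slice (hq : q ≠ 0) {u : (Fin (m + 1) → Fin n) → ℂ} {l : Fin n → ℕ}
    (h : IsHW q u l) {p : Fin n} (hp : ∀ y, p < y → sl u y = 0) (hlp : l p ≠ 0) :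
    sl ((jmL n (m + 1) q ℂ m * jmR n (m + 1) q ℂ m) *ᵥ u) p =
      q ^ (2 * ((l p : ℤ) - 1 - p)) • sl u p := by
  have hT : tD n m q p *ᵥ sl u p = q ^ (l p - 1) • sl u p := by
    funext I
    rw [tD, Matrix.mulVec_diagonal, Pi.smul_apply, smul_eq_mul]
    by_cases h0 : sl u p I = 0
    · rw [h0, mul_zero, mul_zero]
    · have := congrFun (h.wt _ h0) p
      rw [cnt_snoc, Pi.add_apply, Pi.single_eq_same] at this
      rw [← this, Nat.add_sub_cancel]
  rw [sl_mulVec, lastBlk_jm]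
  have e : ∀ y, (bX n m q ℂ * aK n m q ℂ) p y *ᵥ sl u y =
      ∑ k, bX n m q ℂ p k *ᵥ (aK n m q ℂ k y *ᵥ sl u y) := by
    intro y
    rw [Matrix.mul_apply, Matrix.sum_mulVec]
    simp only [Matrix.mulVec_mulVec]
  simp only [e]
  rw [Finset.sum_comm]
  have e2 : ∀ k, ∑ y, bX n m q ℂ p k *ᵥ (aK n m q ℂ k y *ᵥ sl u y) =
      bX n m q ℂ p k *ᵥ ∑ y, aK n m q ℂ k y *ᵥ sl u y := fun k =>
    (map_sum (Matrix.mulVecLin (bX n m q ℂ p k)) _ _).symm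
  simp only [e2]
  rw [Finset.sum_eq_single p]
  · rw [h.sum_slices hq hp, if_neg (lt_irrefl p), bX_diag hq, aK_diag hq, hT, smul_smul,
      Matrix.mulVec_smul, hT, smul_smul]
    congr 1
    rw [← zpow_natCast, ← zpow_add₀ hq, ← zpow_add₀ hq]
    congr 1
    omega
  · intro k _ hk
    rcases lt_or_gt_of_ne hk with hk | hk
    · rw [(RLLK_words hq).upper _ _ hk, Matrix.zero_mulVec]
    · rw [h.sum_slices hq hp, if_neg hk.not_gt, (h.slice hq hp).2 k hk, smul_zero,
        Matrix.mulVec_zero]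
  · simp

/-- The multiplicities of the contents of the Jucys–Murphy eigenvalues of a highest weight
vector. -/
theorem IsHW.content_count (hq : q ≠ 0) (hq' : NotRootOfUnity q) {u : (Fin m → Fin n) → ℂ}
    {l : Fin n → ℕ} (h : IsHW q u l) (hu : u ≠ 0) {c : ℕ → ℤ}
    (hc : ∀ k < m, (jmL n m q ℂ k * jmR n m q ℂ k) *ᵥ u = q ^ (2 * c k) • u) (x : ℤ) :
    (∑ k ∈ Finset.range m, if c k = x then 1 else 0) =
      ∑ i : Fin n, if 0 ≤ x + i ∧ x + i < l i then 1 else 0 := by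
  induction m generalizing l with
  | zero =>
    obtain ⟨I, hI⟩ := Function.ne_iff.1 hu
    rw [← h.wt I hI, Finset.sum_range_zero, Finset.sum_eq_zero]
    intro i _
    rw [if_neg]
    rw [cnt]
    simp
  | succ m ih =>
    have hne : ∃ p, sl u p ≠ 0 := by
      obtain ⟨I, hI⟩ := Function.ne_iff.1 hu
      refine ⟨I (Fin.last m), Function.ne_iff.2 ⟨Fin.init I, ?_⟩⟩
      simpa [sl] using hI
    obtain ⟨p, hp0, hp⟩ : ∃ p, sl u p ≠ 0 ∧ ∀ y, p < y → sl u y = 0 := by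
      obtain ⟨p, hp, hmax⟩ := (Finset.univ.filter fun p => sl u p ≠ 0).exists_max_image id
        ⟨hne.choose, by simpa using hne.choose_spec⟩
      refine ⟨p, by simpa using hp, fun y hy => ?_⟩
      by_contra h0
      exact absurd (hmax y (by simpa using h0)) (not_le.2 hy)
    obtain ⟨I, hI⟩ := Function.ne_iff.1 hp0
    have hIl : cnt I + Pi.single p 1 = l := by rw [← cnt_snoc]; exact h.wt _ hI
    have hlp : l p ≠ 0 := by rw [← hIl]; simp
    have hu' : IsHW q (sl u p) (cnt I) := by
      refine ⟨fun i j hij => ?_, fun J hJ => ?_⟩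
      · by_cases hpj : p = j
        · subst hpj; exact (h.slice hq hp).2 i hij
        · exact (h.slice hq hp).1 i j p hij hpj
      · have := h.wt _ hJ
        rw [cnt_snoc, ← hIl] at this
        exact add_right_cancel this
    have hc' : ∀ k < m, (jmL n m q ℂ k * jmR n m q ℂ k) *ᵥ sl u p = q ^ (2 * c k) • sl u p := by
      intro k hk
      have := congrArg (fun v => sl v p) (hc k (by omega))
      beta_reduce at this
      rw [sl_mulVec, lastBlk_jm_of_lt hk, Finset.sum_eq_single p] at this
      · rw [Matrix.scalar_apply, Matrix.diagonal_apply_eq] at this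
        exact this
      · intro y _ hy
        rw [Matrix.scalar_apply, Matrix.diagonal_apply_ne _ hy.symm, Matrix.zero_mulVec]
      · simp
    have hcm : c m = (l p : ℤ) - 1 - p := by
      have h1 := congrArg (fun v => sl v p) (hc m (by omega))
      beta_reduce at h1
      rw [jm_last_slice hq h hp hlp] at h1
      have h2 : q ^ (2 * ((l p : ℤ) - 1 - p)) = q ^ (2 * c m) := smul_left_injective ℂ hp0 h1
      have := hq'.zpow_injective hq h2
      omega
    rw [Finset.sum_range_succ, ih hu' hp0 hc', hcm]
    have e : (if (l p : ℤ) - 1 - p = x then 1 else 0) =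
        ∑ i : Fin n, if i = p ∧ (l p : ℤ) - 1 - p = x then 1 else 0 := by
      rw [Finset.sum_eq_single p]
      · simp
      · intro b _ hb; simp [hb]
      · simp
    rw [e, ← Finset.sum_add_distrib]
    refine Finset.sum_congr rfl fun i _ => ?_
    have h3 := congrFun hIl i
    rw [Pi.add_apply] at h3
    by_cases hi : i = p
    · subst hi
      rw [Pi.single_eq_same] at h3
      rw [← h3]
      push_cast
      split_ifs <;> first | rfl | (exfalso; omega)
    · rw [Pi.single_eq_of_ne hi, add_zero] at h3
      rw [h3]
      simp [hi]

end HighestWeight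

/-! ### Faithfulness of the action of the Hecke algebra on words in a large alphabet -/

section HeckeSpan

set_option linter.unusedSectionVars false

variable {H : Type} [Ring H] [Algebra ℂ H] {q : ℂ} {M : ℕ} {T : ℕ → H}

theorem desc_mul_gen (hb : ∀ i, i + 1 < M → T i * T (i + 1) * T i = T (i + 1) * T i * T (i + 1))
    (hc : ∀ i j, i + 1 < j → j < M → Commute (T i) (T j)) {j l i : ℕ} (hM : j + l ≤ M)
    (hi : j ≤ i) (hil : i + 1 < j + l) :
    desc (fun a => T (j + a)) l * T (i + 1) = T i * desc (fun a => T (j + a)) l := by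
  induction l with
  | zero => omega
  | succ l ih =>
    rcases Nat.lt_or_ge (i + 1) (j + l) with h | h
    · rw [desc, mul_assoc, ih (by omega) h, ← mul_assoc, ← mul_assoc,
        (hc i (j + l) h (by omega)).eq]
    · obtain ⟨l, rfl⟩ : ∃ l', l = l' + 1 := ⟨l - 1, by omega⟩
      obtain rfl : i = j + l := by omega
      have hd : Commute (T (j + l + 1)) (desc (fun a => T (j + a)) l) :=
        commute_desc fun a ha => (hc (j + a) (j + l + 1) (by omega) (by omega)).symm
      rw [desc, desc, ← add_assoc, mul_assoc, mul_assoc, ← hd.eq, ← mul_assoc, ← mul_assoc,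
        ← hb _ (by omega), mul_assoc, mul_assoc]

variable (T) in
/-- A set of normal forms for words in the first `k` generators. -/
def heckeForms : ℕ → Finset H
  | 0 => {1}
  | k + 1 => Finset.image₂ (· * ·) (heckeForms k)
      ((Finset.range (k + 2)).image fun l => desc (fun a => T (k + 1 - l + a)) l)

theorem card_heckeForms_le (k : ℕ) : (heckeForms T k).card ≤ (k + 1).factorial := by
  induction k with
  | zero => simp [heckeForms]
  | succ k ih =>
    refine (Finset.card_image₂_le _ _ _).trans ?_
    rw [Nat.factorial_succ (k + 1), mul_comm]
    exact Nat.mul_le_mul (Finset.card_image_le.trans (by simp)) ih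

theorem mul_mem_heckeForms
    (hquad : ∀ i < M, T i * T i = (q - q⁻¹) • T i + 1)
    (hb : ∀ i, i + 1 < M → T i * T (i + 1) * T i = T (i + 1) * T i * T (i + 1))
    (hc : ∀ i j, i + 1 < j → j < M → Commute (T i) (T j)) {k : ℕ} (hk : k ≤ M) {x : H}
    (hx : x ∈ Submodule.span ℂ (heckeForms T k : Set H)) {i : ℕ} (hi : i < k) :
    x * T i ∈ Submodule.span ℂ (heckeForms T k : Set H) := by
  induction k generalizing x i with
  | zero => omega
  | succ k ih =>
    have hmem : ∀ y ∈ Submodule.span ℂ (heckeForms T k : Set H), ∀ l ≤ k + 1,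
        y * desc (fun a => T (k + 1 - l + a)) l ∈
          Submodule.span ℂ (heckeForms T (k + 1) : Set H) := by
      intro y hy l hl
      induction hy using Submodule.span_induction with
      | mem y hy =>
        refine Submodule.subset_span ?_
        exact Finset.mem_image₂_of_mem hy
          (Finset.mem_image_of_mem _ (Finset.mem_range.2 (by omega)))
      | zero => rw [zero_mul]; exact zero_mem _
      | add a b _ _ ha hb => rw [add_mul]; exact add_mem ha hb
      | smul c a _ ha => rw [smul_mul_assoc]; exact Submodule.smul_mem _ _ ha
    induction hx using Submodule.span_induction with
    | zero => rw [zero_mul]; exact zero_mem _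
    | add a b _ _ ha hb => rw [add_mul]; exact add_mem ha hb
    | smul c a _ ha => rw [smul_mul_assoc]; exact Submodule.smul_mem _ _ ha
    | mem x hx =>
    obtain ⟨y, hy, d, hd, rfl⟩ := Finset.mem_image₂.1 (Finset.mem_coe.1 hx)
    obtain ⟨l, hl, rfl⟩ := Finset.mem_image.1 hd
    have hl := Finset.mem_range.1 hl
    have hy : y ∈ Submodule.span ℂ (heckeForms T k : Set H) := Submodule.subset_span hy
    have hdesc : ∀ l, l ≤ k → desc (fun a => T (k + 1 - (l + 1) + a)) (l + 1) =
        desc (fun a => T (k + 1 - l + a)) l * T (k - l) := by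
      intro l hl
      rw [show k + 1 - (l + 1) = k - l by omega]
      have : ∀ p, desc (fun a => T (k - l + a)) (p + 1) =
          desc (fun a => T (k + 1 - l + a)) p * T (k - l) := by
        intro p
        induction p with
        | zero => simp [desc]
        | succ p ih => rw [desc, ih, desc, mul_assoc]; congr 2; omega
      exact this l
    rcases lt_trichotomy (i + 1 + l) (k + 1) with h | h | h
    · have : Commute (T i) (desc (fun a => T (k + 1 - l + a)) l) :=
        commute_desc fun a ha => hc i (k + 1 - l + a) (by omega) (by omega)
      rw [mul_assoc, ← this.eq, ← mul_assoc]
      exact hmem _ (ih (by omega) hy (by omega)) l (by omega)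
    · have := hdesc l (by omega)
      rw [mul_assoc, show i = k - l by omega, ← this]
      exact hmem _ hy _ (by omega)
    · obtain ⟨l, rfl⟩ : ∃ l', l = l' + 1 := ⟨l - 1, by omega⟩
      rcases Nat.lt_or_ge (k + 1) (i + 1 + (l + 1)) with h' | h'
      · rcases eq_or_lt_of_le (show k - l ≤ i by omega) with rfl | h''
        · rw [hdesc l (by omega), mul_assoc, mul_assoc, hquad _ (by omega), mul_add, mul_one, mul_add,
            mul_smul_comm, mul_smul_comm, ← hdesc l (by omega)]
          exact add_mem (Submodule.smul_mem _ _ (hmem _ hy _ (by omega))) (hmem _ hy _ (by omega))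
        · obtain ⟨i, rfl⟩ : ∃ i', i = i' + 1 := ⟨i - 1, by omega⟩
          rw [mul_assoc, desc_mul_gen hb hc (by omega) (by omega) (by omega), ← mul_assoc]
          exact hmem _ (ih (by omega) hy (by omega)) _ (by omega)
      · omega

end HeckeSpan

section Relations

variable {m N : ℕ} {q : ℂ}

local notation "Mw" => Matrix (Fin m → Fin N) (Fin m → Fin N) ℂ

theorem Tw_quad (hq : q ≠ 0) {k : ℕ} (hk : k + 1 < m) :
    Tw N m q ℂ k * Tw N m q ℂ k = (q - q⁻¹) • Tw N m q ℂ k + 1 := by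
  suffices h : ∀ Z : Mw, Tw N m q ℂ k * (Tw N m q ℂ k * Z) =
      (q - q⁻¹) • (Tw N m q ℂ k * Z) + Z by simpa using h 1
  intro Z
  ext I J
  rw [Tw_mul_apply hk, Matrix.add_apply, Matrix.smul_apply, Tw_mul_apply hk, Tw_mul_apply hk]
  have h1 : (I ∘ ps hk) ⟨k, by omega⟩ = I ⟨k + 1, hk⟩ := by simp [ps]
  have h2 : (I ∘ ps hk) ⟨k + 1, hk⟩ = I ⟨k, by omega⟩ := by simp [ps]
  have h3 : (I ∘ ps hk) ∘ ps hk = I := by ext x; simp [ps]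
  rw [h1, h2, h3]
  simp only [smul_eq_mul]
  rcases lt_trichotomy (I ⟨k, by omega⟩) (I ⟨k + 1, hk⟩) with h | h | h
  · simp only [al, be, if_neg h.ne, if_neg h.ne', if_pos h, if_neg h.not_gt]
    ring
  · have h4 : I ∘ ps hk = I := by
      ext x
      simp only [Function.comp_apply, ps, Equiv.swap_apply_def]
      grind
    rw [h4, h]
    simp only [al, be, if_true, lt_irrefl, if_false]
    field_simp
    ring
  · simp only [al, be, if_neg h.ne, if_neg h.ne', if_pos h, if_neg h.not_gt]
    ring

theorem Tw_far {i j : ℕ} (h : i + 1 < j) (hj : j + 1 < m) :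
    Commute (Tw N m q ℂ i) (Tw N m q ℂ j) := by
  have hi : i + 1 < m := by omega
  change _ = _
  rw [← mul_one (Tw N m q ℂ i * _), ← mul_one (Tw N m q ℂ j * _), mul_assoc, mul_assoc]
  generalize (1 : Mw) = Z
  ext I J
  simp only [Tw_mul_apply hi, Tw_mul_apply hj]
  have e : (I ∘ ps hi) ∘ ps hj = (I ∘ ps hj) ∘ ps hi := by
    ext x
    simp only [Function.comp_apply, ps, Equiv.swap_apply_def]
    grind
  have h1 : (I ∘ ps hi) ⟨j, by omega⟩ = I ⟨j, by omega⟩ := by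
    simp only [Function.comp_apply, ps, Equiv.swap_apply_def]; grind
  have h2 : (I ∘ ps hi) ⟨j + 1, hj⟩ = I ⟨j + 1, hj⟩ := by
    simp only [Function.comp_apply, ps, Equiv.swap_apply_def]; grind
  have h3 : (I ∘ ps hj) ⟨i, by omega⟩ = I ⟨i, by omega⟩ := by
    simp only [Function.comp_apply, ps, Equiv.swap_apply_def]; grind
  have h4 : (I ∘ ps hj) ⟨i + 1, hi⟩ = I ⟨i + 1, hi⟩ := by
    simp only [Function.comp_apply, ps, Equiv.swap_apply_def]; grind
  rw [e, h1, h2, h3, h4]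
  simp only [smul_eq_mul]
  ring

/-- Replace the three letters starting at `k`. -/
def put3 (I : Fin m → Fin N) (k : ℕ) (x y z : Fin N) : Fin m → Fin N := fun c =>
  if (c : ℕ) = k then x else if (c : ℕ) = k + 1 then y else if (c : ℕ) = k + 2 then z else I c

theorem braid_aux (hq : q ≠ 0) (F : Fin N → Fin N → Fin N → ℂ) (x y z : Fin N) :
    let A := fun (G : Fin N → Fin N → Fin N → ℂ) (x y z : Fin N) =>
      al q x y * G y x z + be q y x * G x y z
    let B := fun (G : Fin N → Fin N → Fin N → ℂ) (x y z : Fin N) =>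
      al q y z * G x z y + be q z y * G x y z
    A (B (A F)) x y z = B (A (B F)) x y z := by
  intro A B
  simp only [A, B, al, be]
  rcases lt_trichotomy x y with h1 | h1 | h1 <;> rcases lt_trichotomy y z with h2 | h2 | h2 <;>
    rcases lt_trichotomy x z with h3 | h3 | h3 <;>
    first
    | (exfalso; order)
    | (subst_vars
       simp [*, LT.lt.ne, LT.lt.ne', LT.lt.not_gt]
       try first | ring1 | (field_simp; ring1))

theorem Tw_braid (hq : q ≠ 0) {k : ℕ} (hk : k + 2 < m) :
    Tw N m q ℂ k * Tw N m q ℂ (k + 1) * Tw N m q ℂ k =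
      Tw N m q ℂ (k + 1) * Tw N m q ℂ k * Tw N m q ℂ (k + 1) := by
  have h0 : k + 1 < m := by omega
  have h1 : k + 1 + 1 < m := by omega
  rw [← mul_one (Tw N m q ℂ k * _ * _), ← mul_one (Tw N m q ℂ (k + 1) * _ * _)]
  simp only [mul_assoc]
  generalize (1 : Mw) = Z
  ext I J
  let G := fun (Z : Mw) x y z => Z (put3 I k x y z) J
  have hA : ∀ Z : Mw, G (Tw N m q ℂ k * Z) = fun x y z =>
      al q x y * G Z y x z + be q y x * G Z x y z := by
    intro Z
    funext x y z
    simp only [G]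
    rw [Tw_mul_apply h0]
    have e : put3 I k x y z ∘ ps h0 = put3 I k y x z := by
      ext c
      simp only [Function.comp_apply, ps, Equiv.swap_apply_def, put3, Fin.ext_iff]
      grind
    rw [e]
    simp [put3]
  have hB : ∀ Z : Mw, G (Tw N m q ℂ (k + 1) * Z) = fun x y z =>
      al q y z * G Z x z y + be q z y * G Z x y z := by
    intro Z
    funext x y z
    simp only [G]
    rw [Tw_mul_apply h1]
    have e : put3 I k x y z ∘ ps h1 = put3 I k x z y := by
      ext c
      simp only [Function.comp_apply, ps, Equiv.swap_apply_def, put3, Fin.ext_iff]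
      grind
    rw [e]
    simp [put3, show k + 1 + 1 ≠ k by omega]
  have hI : I = put3 I k (I ⟨k, by omega⟩) (I ⟨k + 1, h0⟩) (I ⟨k + 2, hk⟩) := by
    ext c
    simp only [put3]
    split_ifs with h h' h''
    · exact congrArg (fun c => (I c : ℕ)) (Fin.ext h)
    · exact congrArg (fun c => (I c : ℕ)) (Fin.ext h')
    · exact congrArg (fun c => (I c : ℕ)) (Fin.ext h'')
    · rfl
  rw [hI]
  change G _ _ _ _ = G _ _ _ _
  rw [hA, hB, hA, hB, hA, hB]
  exact braid_aux hq (G Z) _ _ _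

variable (N m) in
/-- The action of the Hecke algebra on words. -/
def heckeRep (hq : q ≠ 0) : Hecke q m →ₐ[ℂ] Mw :=
  RingQuot.liftAlgHom ℂ ⟨FreeAlgebra.lift ℂ fun i : Fin (m - 1) => Tw N m q ℂ i, by
    intro x y h
    induction h with
    | quad i =>
      simp only [map_mul, map_sub, map_add, FreeAlgebra.lift_ι_apply, AlgHom.commutes, map_zero]
      rw [sub_mul, mul_add, Tw_quad hq (by omega), mul_add, ← map_mul, mul_inv_cancel₀ hq, map_one,
        ← Algebra.commutes, ← Algebra.smul_def, ← Algebra.smul_def, sub_smul]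
      abel
    | braid i j h =>
      simp only [map_mul, FreeAlgebra.lift_ι_apply, h]
      exact Tw_braid hq (by omega)
    | commute i j h =>
      simp only [map_mul, FreeAlgebra.lift_ι_apply]
      exact Tw_far h (by omega)⟩

theorem heckeRep_Tn (hq : q ≠ 0) {k : ℕ} (hk : k < m - 1) :
    heckeRep m N hq (Tn q m k) = Tw N m q ℂ k := by
  rw [Tn, dif_pos hk, Tgen, heckeRep, RingQuot.liftAlgHom_mkAlgHom_apply, FreeAlgebra.lift_ι_apply]

end Relations

section Faithful

open scoped Matrix

variable {m N : ℕ} {q : ℂ}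

theorem Tn_quad (hq : q ≠ 0) {i : ℕ} (hi : i < m - 1) :
    Tn q m i * Tn q m i = (q - q⁻¹) • Tn q m i + 1 := by
  have h := RingQuot.mkAlgHom_rel ℂ (HeckeRel.quad (q := q) (m := m) ⟨i, hi⟩)
  simp only [map_mul, map_sub, map_add, AlgHom.commutes, map_zero] at h
  rw [Tn, dif_pos hi, Tgen]
  have hqq : algebraMap ℂ (Hecke q m) q * algebraMap ℂ (Hecke q m) q⁻¹ = 1 := by
    rw [← map_mul, mul_inv_cancel₀ hq, map_one]
  rw [sub_mul, mul_add, mul_add, hqq, ← Algebra.commutes, ← Algebra.smul_def,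
    ← Algebra.smul_def] at h
  have aux : ∀ {H : Type} [Ring H] [Algebra ℂ H] (t : H), t * t + q⁻¹ • t - (q • t + 1) = 0 →
      t * t = (q - q⁻¹) • t + 1 := fun t ht => by
    rw [sub_smul, ← sub_eq_zero, ← ht]
    abel
  exact aux _ h

theorem Tn_braid {i : ℕ} (hi : i + 1 < m - 1) :
    Tn q m i * Tn q m (i + 1) * Tn q m i = Tn q m (i + 1) * Tn q m i * Tn q m (i + 1) := by
  have h := RingQuot.mkAlgHom_rel ℂ
    (HeckeRel.braid (q := q) (m := m) ⟨i, by omega⟩ ⟨i + 1, hi⟩ rfl)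
  simp only [map_mul] at h
  rw [Tn, dif_pos (by omega), Tn, dif_pos hi]
  exact h

theorem Tn_far (i j : ℕ) (h : i + 1 < j) (hj : j < m - 1) : Commute (Tn q m i) (Tn q m j) := by
  have h := RingQuot.mkAlgHom_rel ℂ
    (HeckeRel.commute (q := q) (m := m) ⟨i, by omega⟩ ⟨j, hj⟩ h)
  simp only [map_mul] at h
  rw [Tn, dif_pos (by omega), Tn, dif_pos hj]
  exact h

theorem span_heckeForms (hq : q ≠ 0) :
    Submodule.span ℂ (heckeForms (Tn q m) (m - 1) : Set (Hecke q m)) = ⊤ := by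
  refine Submodule.eq_top_iff'.2 fun h => ?_
  obtain ⟨a, rfl⟩ := RingQuot.mkAlgHom_surjective ℂ (HeckeRel q m) h
  have key : ∀ x ∈ Submodule.span ℂ (heckeForms (Tn q m) (m - 1) : Set (Hecke q m)),
      x * RingQuot.mkAlgHom ℂ (HeckeRel q m) a ∈
        Submodule.span ℂ (heckeForms (Tn q m) (m - 1) : Set (Hecke q m)) := by
    induction a using FreeAlgebra.induction with
    | grade0 r =>
      intro x hx
      rw [AlgHom.commutes, ← Algebra.commutes, ← Algebra.smul_def]
      exact Submodule.smul_mem _ _ hx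
    | grade1 i =>
      intro x hx
      have := mul_mem_heckeForms (q := q) (fun i hi => Tn_quad hq hi) (fun i hi => Tn_braid hi)
        Tn_far le_rfl hx i.2
      rwa [Tn, dif_pos i.2] at this
    | mul a b ha hb =>
      intro x hx
      rw [map_mul, ← mul_assoc]
      exact hb _ (ha _ hx)
    | add a b ha hb =>
      intro x hx
      rw [map_add, mul_add]
      exact add_mem (ha _ hx) (hb _ hx)
  have h1 : ∀ k, (1 : Hecke q m) ∈ heckeForms (Tn q m) k := by
    intro k
    induction k with
    | zero => simp [heckeForms]
    | succ k ih =>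
      refine Finset.mem_image₂.2 ⟨1, ih, 1, Finset.mem_image.2 ⟨0, by simp, rfl⟩, one_mul 1⟩
  have := key 1 (Submodule.subset_span (h1 _))
  rwa [one_mul] at this

theorem heckeRep_injective (hq : q ≠ 0) {w : Fin m → Fin N} (hw : Function.Injective w) :
    Function.Injective (heckeRep m N hq) := by
  let f : Hecke q m →ₗ[ℂ] ((Fin m → Fin N) → ℂ) :=
    ((Matrix.mulVecBilin ℂ ℂ).flip (Pi.single w 1)) ∘ₗ (heckeRep m N hq).toLinearMap
  have hf : ∀ h, f h = heckeRep m N hq h *ᵥ Pi.single w 1 := fun h => rfl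
  have hfin : Module.Finite ℂ (Hecke q m) := ⟨⟨_, span_heckeForms hq⟩⟩
  have hle : Module.finrank ℂ (Hecke q m) ≤ m.factorial := by
    rw [← finrank_top, ← span_heckeForms hq]
    refine (finrank_span_finset_le_card _).trans ((card_heckeForms_le _).trans (le_of_eq ?_))
    cases m <;> rfl
  have hrange : ∀ σ : Equiv.Perm (Fin m), Pi.single (w ∘ σ) 1 ∈ LinearMap.range f := by
    intro σ
    have hσ := mem_closure_ps σ
    induction hσ using Submonoid.closure_induction_right with
    | one => exact ⟨1, by rw [hf, map_one, Matrix.one_mulVec]; rfl⟩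
    | mul_right x _ y hy ih =>
      obtain ⟨k, hk, rfl⟩ := hy
      obtain ⟨h, hh⟩ := ih
      set I := w ∘ x with hI
      refine ⟨Tn q m k * h - be q (I ⟨k + 1, hk⟩) (I ⟨k, by omega⟩) • h, ?_⟩
      rw [map_sub, map_smul, hh, hf, map_mul, ← Matrix.mulVec_mulVec, ← hf, hh,
        heckeRep_Tn hq (by omega)]
      funext J
      rw [Pi.sub_apply, Pi.smul_apply, Matrix.mulVec_single_one, Matrix.col_apply,
        ← mul_one (Tw N m q ℂ k), Tw_mul_apply hk, Matrix.one_apply, Matrix.one_apply]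
      have e1 : J ∘ ps hk = I ↔ J = w ∘ ⇑(x * ps hk) := by
        rw [Equiv.Perm.coe_mul, ← Function.comp_assoc, ← hI]
        constructor
        · intro h; rw [← h]; ext c; simp [ps]
        · rintro rfl; ext c; simp [ps]
      have e2 : J = w ∘ ⇑(x * ps hk) → al q (J ⟨k, by omega⟩) (J ⟨k + 1, hk⟩) = 1 := by
        rintro rfl
        rw [al, if_neg]
        intro h
        have := (hw.comp (x * ps hk).injective) h
        simp at this
      have hs : (Pi.single I 1 : (Fin m → Fin N) → ℂ) J = if J = I then 1 else 0 := Pi.single_apply _ _ _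
      rw [hs, Pi.single_apply, if_congr e1 rfl rfl]
      by_cases h3 : J = I
      · subst h3
        split_ifs with h4
        · rw [e2 h4]; simp
        · simp
      · rw [if_neg h3]
        split_ifs with h4
        · rw [e2 h4]; simp
        · simp
  have hlin : LinearIndependent ℂ (fun σ : Equiv.Perm (Fin m) =>
      (⟨Pi.single (w ∘ σ) 1, hrange σ⟩ : LinearMap.range f)) := by
    refine LinearIndependent.of_comp (LinearMap.range f).subtype ?_
    have := (Pi.basisFun ℂ (Fin m → Fin N)).linearIndependent.comp
      (fun σ : Equiv.Perm (Fin m) => w ∘ σ) fun σ τ h => Equiv.ext fun x => hw (congrFun h x)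
    convert this using 1
    funext σ
    exact (Pi.basisFun_apply ℂ _ _).symm
  have hge := hlin.fintype_card_le_finrank
  rw [Fintype.card_perm, Fintype.card_fin] at hge
  have hrk := LinearMap.finrank_range_add_finrank_ker f
  have hker : LinearMap.ker f = ⊥ := Submodule.finrank_eq_zero.1 (by omega)
  intro a b hab
  refine LinearMap.ker_eq_bot.1 hker ?_
  rw [hf, hf, hab]

end Faithful

/-! ### Diagonals of Young diagrams -/

section Diagonals

theorem mem_iff_lt_card_diag {Y : Finset (ℕ × ℕ)} (hY : IsLowerSet (Y : Set (ℕ × ℕ))) (i j : ℕ) :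
    (i, j) ∈ Y ↔ min i j < (Y.filter fun c => ctn c = (j : ℤ) - i).card := by
  constructor
  · intro h
    rw [← Nat.succ_le_iff, ← Finset.card_range (min i j).succ]
    refine Finset.card_le_card_of_injOn (fun t => (t + (i - min i j), t + (j - min i j))) ?_ ?_
    · intro t ht
      have ht := Finset.mem_range.1 (Finset.mem_coe.1 ht)
      refine Finset.mem_coe.2 (Finset.mem_filter.2 ⟨?_, ?_⟩)
      · exact hY (show ((t + (i - min i j), t + (j - min i j)) : ℕ × ℕ) ≤ (i, j) from
          ⟨by dsimp only; omega, by dsimp only; omega⟩) h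
      · simp only [ctn]; omega
    · intro t _ t' _ h
      simp only [Prod.mk.injEq] at h
      omega
  · intro h
    by_contra h'
    refine absurd h (not_lt.2 ?_)
    conv_rhs => rw [← Finset.card_range (min i j)]
    refine Finset.card_le_card_of_injOn (fun c => min c.1 c.2) ?_ ?_
    · rintro ⟨a, b⟩ hc
      obtain ⟨h1, h2⟩ := Finset.mem_filter.1 (Finset.mem_coe.1 hc)
      simp only [ctn] at h2
      refine Finset.mem_coe.2 (Finset.mem_range.2 ?_)
      by_contra h3
      exact h' (hY (show ((i, j) : ℕ × ℕ) ≤ (a, b) from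
        ⟨by dsimp only at h3 ⊢; omega, by dsimp only at h3 ⊢; omega⟩) h1)
    · rintro ⟨a, b⟩ hc ⟨a', b'⟩ hc' h
      have h2 := (Finset.mem_filter.1 (Finset.mem_coe.1 hc)).2
      have h3 := (Finset.mem_filter.1 (Finset.mem_coe.1 hc')).2
      simp only [ctn] at h2 h3 h
      rw [Prod.mk.injEq]
      omega

/-- The lengths of the first `n` rows of a Young diagram. -/
def rowW (n : ℕ) (μ : YoungDiagram) : Fin n → ℕ := fun i => μ.rowLen i

theorem eq_rowW_of_card_diag {n : ℕ} {μ : YoungDiagram} {ν : Fin n → ℕ} (hν : Antitone ν)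
    (h : ∀ x : ℤ, (μ.cells.filter fun c => ctn c = x).card =
      ∑ i : Fin n, if 0 ≤ x + i ∧ x + i < ν i then 1 else 0) :
    ν = rowW n μ ∧ ∀ c ∈ μ.cells, c.1 < n := by
  let Y : Finset (ℕ × ℕ) := Finset.univ.biUnion fun i : Fin n =>
    (Finset.range (ν i)).image fun j => ((i : ℕ), j)
  have hmem : ∀ a b, (a, b) ∈ Y ↔ ∃ h : a < n, b < ν ⟨a, h⟩ := by
    intro a b
    simp only [Y, Finset.mem_biUnion, Finset.mem_univ, true_and, Finset.mem_image,
      Finset.mem_range, Prod.mk.injEq]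
    constructor
    · rintro ⟨i, j, hj, rfl, rfl⟩; exact ⟨i.2, hj⟩
    · rintro ⟨h, hb⟩; exact ⟨⟨a, h⟩, b, hb, rfl, rfl⟩
  have hY : IsLowerSet (Y : Set (ℕ × ℕ)) := by
    rintro ⟨a, b⟩ ⟨a', b'⟩ ⟨h1, h2⟩ hab
    obtain ⟨h, hb⟩ := (hmem a b).1 hab
    dsimp only at h1 h2
    refine (hmem a' b').2 ⟨by omega, ?_⟩
    have : ν ⟨a, h⟩ ≤ ν ⟨a', by omega⟩ := hν h1
    omega
  have hcard : ∀ x : ℤ, (Y.filter fun c => ctn c = x).card =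
      ∑ i : Fin n, if 0 ≤ x + i ∧ x + i < ν i then 1 else 0 := by
    intro x
    rw [← Finset.card_filter]
    symm
    refine Finset.card_bij (fun i _ => ((i : ℕ), (x + i).toNat)) ?_ ?_ ?_
    · intro i hi
      have hi := (Finset.mem_filter.1 hi).2
      refine Finset.mem_filter.2 ⟨(hmem _ _).2 ⟨i.2, ?_⟩, ?_⟩
      · simp only [Fin.eta]; omega
      · simp only [ctn]; omega
    · intro i _ j _ h
      exact Fin.ext (Prod.mk.inj h).1
    · rintro ⟨a, b⟩ hab
      obtain ⟨h1, h2⟩ := Finset.mem_filter.1 hab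
      obtain ⟨h, hb⟩ := (hmem a b).1 h1
      simp only [ctn] at h2
      refine ⟨⟨a, h⟩, Finset.mem_filter.2 ⟨Finset.mem_univ _, ?_⟩, ?_⟩
      · dsimp only; omega
      · rw [Prod.mk.injEq]; exact ⟨rfl, by dsimp only; omega⟩
  have hYμ : ∀ a b, (a, b) ∈ Y ↔ (a, b) ∈ μ.cells := by
    intro a b
    rw [mem_iff_lt_card_diag hY, mem_iff_lt_card_diag μ.isLowerSet, hcard, h]
  constructor
  · funext i
    have key : ∀ b, b < ν i ↔ b < μ.rowLen i := by
      intro b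
      rw [← YoungDiagram.mem_iff_lt_rowLen, ← YoungDiagram.mem_cells, ← hYμ, hmem]
      exact ⟨fun h => ⟨i.2, h⟩, fun ⟨_, h⟩ => h⟩
    have h1 := key (ν i)
    have h2 := key (μ.rowLen i)
    rw [rowW]
    omega
  · rintro ⟨a, b⟩ hab
    exact ((hmem a b).1 ((hYμ a b).2 hab)).1

theorem StdTab.card_diag {m : ℕ} {μ : YoungDiagram} (U : StdTab μ m) (x : ℤ) :
    (∑ k ∈ Finset.range m, if ctnAt U (k + 1) = x then 1 else 0) =
      (μ.cells.filter fun c => ctn c = x).card := by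
  rw [← Finset.card_filter]
  refine Finset.card_bij (fun k _ => U.pos (k + 1)) ?_ ?_ ?_
  · intro k hk
    obtain ⟨h1, h2⟩ := Finset.mem_filter.1 hk
    have h1 := Finset.mem_range.1 h1
    exact Finset.mem_filter.2 ⟨U.bij.mapsTo ⟨by omega, by omega⟩, h2⟩
  · intro k hk l hl h
    have h1 := Finset.mem_range.1 (Finset.mem_filter.1 hk).1
    have h2 := Finset.mem_range.1 (Finset.mem_filter.1 hl).1
    have := U.bij.injOn (Set.mem_Icc.2 ⟨by omega, by omega⟩) (Set.mem_Icc.2 ⟨by omega, by omega⟩) h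
    omega
  · intro c hc
    obtain ⟨h1, h2⟩ := Finset.mem_filter.1 hc
    obtain ⟨k, hk, rfl⟩ := U.bij.surjOn h1
    obtain ⟨h3, h4⟩ := Set.mem_Icc.1 hk
    obtain ⟨k, rfl⟩ : ∃ k', k = k' + 1 := ⟨k - 1, by omega⟩
    exact ⟨k, Finset.mem_filter.2 ⟨Finset.mem_range.2 (by omega), h2⟩, rfl⟩

end Diagonals

/-! ### Weights of the Jucys–Murphy idempotents -/

section IdempotentWeights

open scoped Matrix

variable {n m : ℕ} {q : ℂ}

theorem hecke_induction {p : Hecke q m → Prop} (hC : ∀ c, p (algebraMap ℂ _ c))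
    (hT : ∀ k < m - 1, p (Tn q m k)) (hmul : ∀ a b, p a → p b → p (a * b))
    (hadd : ∀ a b, p a → p b → p (a + b)) (h : Hecke q m) : p h := by
  obtain ⟨a, rfl⟩ := RingQuot.mkAlgHom_surjective ℂ (HeckeRel q m) h
  induction a using FreeAlgebra.induction with
  | grade0 c => rw [AlgHom.commutes]; exact hC c
  | grade1 i =>
    have := hT i i.2
    rwa [Tn, dif_pos i.2, Tgen] at this
  | mul a b ha hb => rw [map_mul]; exact hmul _ _ ha hb
  | add a b ha hb => rw [map_add]; exact hadd _ _ ha hb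

/-- The linear functional `s ↦ tr (Y s)`. -/
def trm (Y : Matrix (Fin m → Fin n) (Fin m → Fin n) ℂ) :
    Matrix (Fin m → Fin n) (Fin m → Fin n) ℂ →ₗ[ℂ] ℂ :=
  Matrix.traceLinearMap _ ℂ ℂ ∘ₗ LinearMap.mulLeft ℂ Y

theorem trm_apply (Y s : Matrix (Fin m → Fin n) (Fin m → Fin n) ℂ) :
    trm Y s = (Y * s).trace := rfl

variable {φ : Hecke q m →ₐ[ℂ] Matrix (Fin m → Fin n) (Fin m → Fin n) ℂ}

theorem commute_rep (hφ : ∀ k < m - 1, φ (Tn q m k) = Tw n m q ℂ k) (h : Hecke q m)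
    {s : Matrix (Fin m → Fin n) (Fin m → Fin n) ℂ} (hs : s ∈ cent n m q) :
    Commute (φ h) s := by
  induction h using hecke_induction with
  | hC c => rw [AlgHom.commutes]; exact Algebra.commute_algebraMap_left _ _
  | hT k hk => rw [hφ k hk]; exact mem_cent.1 hs k (by omega)
  | hmul a b ha hb => rw [map_mul]; exact ha.mul_left hb
  | hadd a b ha hb => rw [map_add]; exact ha.add_left hb

theorem trm_rep_comm (hφ : ∀ k < m - 1, φ (Tn q m k) = Tw n m q ℂ k) (h : Hecke q m)
    {s t : Matrix (Fin m → Fin n) (Fin m → Fin n) ℂ} (hs : s ∈ cent n m q) :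
    trm (φ h) (s * t) = trm (φ h) (t * s) := by
  rw [trm_apply, trm_apply, ← mul_assoc, (commute_rep hφ h hs).eq, mul_assoc, Matrix.trace_mul_comm,
    mul_assoc]

theorem trace_ne_zero_of_idempotent {ι : Type} [Fintype ι] {E : Matrix ι ι ℂ} (h : E * E = E)
    (h0 : E ≠ 0) : E.trace ≠ 0 := by
  intro ht
  rw [← Matrix.trace_toLin'_eq] at ht
  have hi : IsIdempotentElem (Matrix.toLin' E) := by
    rw [IsIdempotentElem, Module.End.mul_eq_comp, ← Matrix.toLin'_mul, h]
  rw [LinearMap.IsIdempotentElem.trace_eq_zero_iff hi] at ht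
  exact h0 (Matrix.toLin'.map_eq_zero_iff.1 ht)

theorem wp_mem_cent (hq : q ≠ 0) (ν : Fin n → ℕ) : wp m ν ∈ cent n m q :=
  opAlg_le_cent hq (wp_mem_opAlg ν)

theorem trm_wp_eq_zero_iff (hq : q ≠ 0) (hφ : ∀ k < m - 1, φ (Tn q m k) = Tw n m q ℂ k)
    {e : Hecke q m} (he : e * e = e) (ν : Fin n → ℕ) :
    trm (φ e) (wp m ν) = 0 ↔ φ e * wp m ν = 0 := by
  refine ⟨fun h => ?_, fun h => by rw [trm_apply, h, Matrix.trace_zero]⟩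
  by_contra h0
  refine trace_ne_zero_of_idempotent ?_ h0 h
  rw [mul_assoc, ← mul_assoc (wp m ν), ← (commute_rep hφ e (wp_mem_cent hq ν)).eq, mul_assoc,
    wp_mul_self, ← mul_assoc, ← map_mul, he]

theorem JMIdem_weights (hq : q ≠ 0) (hq' : NotRootOfUnity q)
    (hφ : ∀ k < m - 1, φ (Tn q m k) = Tw n m q ℂ k) {μ : YoungDiagram} {U : StdTab μ m}
    {e : Hecke q m} (he : IsJMIdem q m U e) (h0 : φ e ≠ 0) :
    trm (φ e) (wp m (rowW n μ)) ≠ 0 ∧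
      (∀ ν, trm (φ e) (wp m ν) ≠ 0 → toLex ν ≤ toLex (rowW n μ)) ∧ ∀ c ∈ μ.cells, c.1 < n := by
  obtain ⟨-, hee, hy⟩ := he
  have h1 : trm (φ e) 1 ≠ 0 := by
    rw [trm_apply, mul_one]
    exact trace_ne_zero_of_idempotent (by rw [← map_mul, hee]) h0
  obtain ⟨ν, hν, hν0, hmax⟩ := exists_antitone hq hq' (g := trm (φ e))
    (fun s hs t _ => trm_rep_comm hφ e (opAlg_le_cent hq hs)) (one_mem _) h1
  have hE : φ e * wp m ν ≠ 0 := fun h => hν0 ((trm_wp_eq_zero_iff hq hφ hee ν).2 h)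
  obtain ⟨J, hJ⟩ : ∃ J, (φ e * wp m ν) *ᵥ Pi.single J 1 ≠ 0 := by
    by_contra! h
    refine hE (Matrix.ext fun I J => ?_)
    have := congrFun (h J) I
    rwa [Matrix.mulVec_single_one] at this
  have hw : IsHW q ((φ e * wp m ν) *ᵥ Pi.single J 1) ν := by
    constructor
    · intro i j hij
      rw [Matrix.mulVec_mulVec, ← mul_assoc, ← (commute_rep hφ e (aK_mem_cent hq i j)).eq, mul_assoc]
      suffices h : φ e * (aK n m q ℂ i j * wp m ν) = 0 by rw [h, Matrix.zero_mulVec]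
      rcases Nat.eq_zero_or_pos (ν i) with hi | hi
      · suffices h : aK n m q ℂ i j * wp m ν = 0 by rw [h, mul_zero]
        ext I I'
        rw [mul_wp_apply, Matrix.zero_apply]
        by_contra h
        obtain ⟨h2, h3⟩ := ite_ne_right_iff.1 h
        have := congrFun (aK_weight i j I I' h3) i
        simp [h2, hi, hij.ne] at this
      · have hsum : ν + Pi.single j 1 - Pi.single i 1 + Pi.single i 1 = ν + Pi.single j 1 := by
          ext x
          by_cases hx : x = i
          · subst hx; simp [hij.ne']; omega
          · simp [hx]
        rw [(aK_weight i j).mul_wp hsum, ← mul_assoc]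
        suffices h : φ e * wp m (ν + Pi.single j 1 - Pi.single i 1) = 0 by rw [h, zero_mul]
        rw [← trm_wp_eq_zero_iff hq hφ hee]
        by_contra h
        refine absurd (hmax _ h) (not_le.2 ⟨j, fun x hx => ?_, ?_⟩)
        · simp [hx.ne, (hx.trans hij).ne]
        · simp [hij.ne]
    · intro I hI
      rw [(commute_rep hφ e (wp_mem_cent hq ν)).eq, Matrix.mulVec_single_one, Matrix.col_apply,
        wp_mul_apply] at hI
      exact (ite_ne_right_iff.1 hI).1
  have hc : ∀ k < m, (jmL n m q ℂ k * jmR n m q ℂ k) *ᵥ ((φ e * wp m ν) *ᵥ Pi.single J 1) =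
      q ^ (2 * ctnAt U (k + 1)) • ((φ e * wp m ν) *ᵥ Pi.single J 1) := by
    intro k hk
    rw [← rep_yJM φ le_rfl hφ hk, Matrix.mulVec_mulVec, ← mul_assoc, ← map_mul,
      (hy (k + 1) (by omega) (by omega)).1, map_smul, smul_mul_assoc, Matrix.smul_mulVec]
  obtain ⟨rfl, hrow⟩ := eq_rowW_of_card_diag hν fun x => by
    rw [← U.card_diag x]
    exact hw.content_count hq hq' hJ (c := fun k => ctnAt U (k + 1)) hc x
  exact ⟨hν0, hmax, hrow⟩

theorem cmp_rep {N : ℕ} (hq : q ≠ 0) {f : Fin n → Fin N} (hf : StrictMono f)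
    {ψ : Hecke q m →ₐ[ℂ] Matrix (Fin m → Fin N) (Fin m → Fin N) ℂ}
    (hφ : ∀ k < m - 1, φ (Tn q m k) = Tw n m q ℂ k)
    (hψ : ∀ k < m - 1, ψ (Tn q m k) = Tw N m q ℂ k) (h : Hecke q m) :
    cmp f (ψ h) = φ h := by
  have h1 : cmp (m := m) f 1 = 1 := by
    rw [cmp, Matrix.submatrix_one _ (comp_left_injective hf.injective)]
  induction h using hecke_induction with
  | hC c =>
    rw [AlgHom.commutes, AlgHom.commutes, Algebra.algebraMap_eq_smul_one,
      Algebra.algebraMap_eq_smul_one, ← h1]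
    rfl
  | hT k hk =>
    rw [hφ k hk, hψ k hk]
    have hk' : k + 1 < m := by omega
    ext I J
    rw [cmp, Matrix.submatrix_apply]
    generalize h1' : (1 : Matrix (Fin m → Fin n) (Fin m → Fin n) ℂ) = Z
    generalize h2' : (1 : Matrix (Fin m → Fin N) (Fin m → Fin N) ℂ) = Z'
    have e1 := Tw_mul_apply (q := q) hk' (1 : Matrix (Fin m → Fin N) (Fin m → Fin N) ℂ) (f ∘ I) (f ∘ J)
    have e2 := Tw_mul_apply (q := q) hk' (1 : Matrix (Fin m → Fin n) (Fin m → Fin n) ℂ) I J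
    have hinj : ∀ A B : Fin m → Fin n, (f ∘ A = f ∘ B) = (A = B) := fun A B =>
      propext (comp_left_injective hf.injective).eq_iff
    rw [mul_one] at e1 e2
    rw [e1, e2]
    simp only [Matrix.one_apply, Function.comp_apply, al_comp hf, be_comp hf, Function.comp_assoc, hinj]
  | hmul a b ha hb =>
    rw [map_mul, map_mul, cmp_mul_left hf.injective, ha, hb]
    intro I K hIK
    have h2 := congrFun (congrFun (commute_rep hψ a (wp_mem_cent hq (cnt K))).eq (f ∘ I)) K
    rw [mul_wp_apply, if_pos rfl, wp_mul_apply] at h2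
    rw [h2] at hIK
    obtain ⟨σ, hσ⟩ := cnt_eq_iff_exists_perm.1 (ite_ne_right_iff.1 hIK).1.symm
    exact ⟨I ∘ σ, hσ.symm⟩
  | hadd a b ha hb => rw [map_add, map_add, ← ha, ← hb]; rfl

theorem exists_comp_of_cnt {N : ℕ} {f : Fin n → Fin N} {I : Fin m → Fin N}
    (h : ∀ i ∉ Set.range f, cnt I i = 0) : ∃ J : Fin m → Fin n, f ∘ J = I := by
  have : ∀ k, ∃ j, f j = I k := by
    intro k
    by_contra hk
    have h1 := h (I k) hk
    rw [cnt_apply] at h1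
    have := Finset.sum_eq_zero_iff.1 h1 k (Finset.mem_univ _)
    simp at this
  choose J hJ using this
  exact ⟨J, funext hJ⟩

theorem rep_ne_zero (hq : q ≠ 0) (hq' : NotRootOfUnity q)
    (hφ : ∀ k < m - 1, φ (Tn q m k) = Tw n m q ℂ k) {μ : YoungDiagram} {U : StdTab μ m}
    {e : Hecke q m} (he : IsJMIdem q m U e) (hμ : ∀ c ∈ μ.cells, c.1 < n) : φ e ≠ 0 := by
  have hψ : ∀ k < m - 1, heckeRep m (n + m) hq (Tn q m k) = Tw (n + m) m q ℂ k := fun k hk =>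
    heckeRep_Tn hq hk
  have hψ0 : heckeRep m (n + m) hq e ≠ 0 := fun h => he.1
    (heckeRep_injective hq (Fin.natAdd_injective m n) (h.trans (map_zero _).symm))
  have h1 := (JMIdem_weights hq hq' hψ he hψ0).1
  rw [Ne, trm_wp_eq_zero_iff hq hψ he.2.1] at h1
  obtain ⟨I, J, hIJ⟩ : ∃ I J, (heckeRep m (n + m) hq e * wp m (rowW (n + m) μ)) I J ≠ 0 := by
    by_contra! h
    exact h1 (Matrix.ext h)
  have hr : ∀ i ∉ Set.range (Fin.castAdd m : Fin n → Fin (n + m)), rowW (n + m) μ i = 0 := by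
    intro i hi
    by_contra h
    have hmem : ((i : ℕ), 0) ∈ μ := YoungDiagram.mem_iff_lt_rowLen.2 (Nat.pos_of_ne_zero h)
    exact hi ⟨⟨i, hμ _ hmem⟩, rfl⟩
  have hJ := hIJ
  rw [mul_wp_apply] at hJ
  rw [(commute_rep hψ e (wp_mem_cent hq _)).eq, wp_mul_apply] at hIJ
  have hJ' := (ite_ne_right_iff.1 hJ).1
  obtain ⟨hI, hIJ⟩ := ite_ne_right_iff.1 hIJ
  obtain ⟨I, rfl⟩ := exists_comp_of_cnt (f := Fin.castAdd m) (I := I) (by rwa [hI])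
  obtain ⟨J, rfl⟩ := exists_comp_of_cnt (f := Fin.castAdd m) (I := J) (by rwa [hJ'])
  intro h
  have h2 := congrFun (congrFun (cmp_rep hq (Fin.strictMono_castAdd m) hφ hψ e) I) J
  rw [h] at h2
  exact hIJ h2

end IdempotentWeights

/-! ### The q-immanants are central -/

section Immanants

set_option linter.unusedSectionVars false

variable {n m : ℕ} {q : ℂ} {B : Type} [Ring B] [Algebra ℂ B] {X Y K : Matrix (Fin n) (Fin n) B}

theorem commute_trp_Dw_X (hq : q ≠ 0) {Z : Matrix (Fin m → Fin n) (Fin m → Fin n) B}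
    (hZ : Commute (Matrix.scalar (Fin n) Z) (bX n m q B * scal _ X)) (i j : Fin n) :
    Commute (X i j) (trp Z (Dw n m q)) := by
  rw [Commute, SemiconjBy, mul_trp_of_commute hq hZ]
  simp_rw [bXi, cross_X hq]
  rw [Finset.sum_eq_single i]
  · rw [if_pos rfl]
  · intro k _ hk; rw [if_neg hk.symm, map_zero, zero_mul]
  · simp

theorem commute_trp_Dw_K (hq : q ≠ 0) {Z : Matrix (Fin m → Fin n) (Fin m → Fin n) B}
    (hZ : Commute (Matrix.scalar (Fin n) Z) (scal _ K * aK n m q B)) (i j : Fin n) :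
    Commute (K i j) (trp Z (Dw n m q)) := by
  rw [Commute, SemiconjBy, trp_mul_of_commute hq hZ]
  simp_rw [cross_K hq]
  rw [Finset.sum_eq_single j]
  · rw [if_pos rfl]
  · intro k _ hk; rw [if_neg hk, map_zero, mul_zero]
  · simp

theorem commute_map_scalar (E : Matrix (Fin m → Fin n) (Fin m → Fin n) ℂ) (x : B) :
    Commute (E.map (algebraMap ℂ B)) (Matrix.scalar _ x) :=
  (scalar_commute_iff.2 fun _ _ => (Algebra.commutes _ x).symm).symm

theorem commute_map_map {E s : Matrix (Fin m → Fin n) (Fin m → Fin n) ℂ} (h : Commute E s) :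
    Commute (E.map (algebraMap ℂ B)) (s.map (algebraMap ℂ B)) :=
  Commute.map h (algebraMap ℂ B).mapMatrix

theorem scalar_map_commute_bX (hq : q ≠ 0) {E : Matrix (Fin m → Fin n) (Fin m → Fin n) ℂ}
    (hE : ∀ s ∈ cent n m q, Commute E s) :
    Commute (Matrix.scalar (Fin n) (E.map (algebraMap ℂ B))) (bX n m q B * scal _ X) :=
  scalar_commute_iff.2 fun i j => by
    rw [Matrix.mul_apply]
    refine Commute.sum_right _ _ _ fun k _ => Commute.mul_right ?_ (commute_map_scalar _ _)
    rw [bX_map]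
    exact commute_map_map (hE _ (bX_mem_cent hq _ _))

theorem scalar_map_commute_aK (hq : q ≠ 0) {E : Matrix (Fin m → Fin n) (Fin m → Fin n) ℂ}
    (hE : ∀ s ∈ cent n m q, Commute E s) :
    Commute (Matrix.scalar (Fin n) (E.map (algebraMap ℂ B))) (scal _ K * aK n m q B) :=
  scalar_commute_iff.2 fun i j => by
    rw [Matrix.mul_apply]
    refine Commute.sum_right _ _ _ fun k _ => Commute.mul_right (commute_map_scalar _ _) ?_
    rw [aK_map]
    exact commute_map_map (hE _ (aK_mem_cent hq _ _))

theorem scalar_add_smul_one {V W : Type} [Fintype V] [DecidableEq V] [Fintype W] [DecidableEq W]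
    {Z : Matrix W W B} {M : Matrix V V (Matrix W W B)} (h : Commute (Matrix.scalar V Z) M) (c : ℂ) :
    Commute (Matrix.scalar V (Z + c • 1)) M :=
  scalar_commute_iff.2 fun i j =>
    (scalar_commute_iff.1 h i j).add_left ((Commute.one_left _).smul_left c)

theorem prodU_eq {μ : YoungDiagram} (U : StdTab μ m) (E : Matrix (Fin m → Fin n) (Fin m → Fin n) ℂ)
    (L : Matrix (Fin n) (Fin n) B) (z : ℂ) :
    prodU q n m U E L z = asc (fun k => legBar q n m L k + (z * q ^ (-2 * ctnAt U (k + 1))) • 1) m *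
      E.map (algebraMap ℂ B) := by
  rw [prodU, prod_map_range]

theorem RLLK.prodU_comm (hq : q ≠ 0) (h : RLLK q X Y K) {μ : YoungDiagram} (U : StdTab μ m)
    {E : Matrix (Fin m → Fin n) (Fin m → Fin n) ℂ} (hE : ∀ s ∈ cent n m q, Commute E s) (z : ℂ) :
    Commute (Matrix.scalar (Fin n) (prodU q n m U E (X * K) z)) (bX n m q B * scal _ X) ∧
      Commute (Matrix.scalar (Fin n) (prodU q n m U E (X * K) z)) (scal _ K * aK n m q B) := by
  rw [prodU_eq, map_mul, map_asc]
  exact ⟨(commute_asc fun k hk => (scalar_add_smul_one (h.legBar_bX hq hk) _).symm).symm.mul_left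
      (scalar_map_commute_bX hq hE),
    (commute_asc fun k hk => (scalar_add_smul_one (h.legBar_aK hq hk) _).symm).symm.mul_left
      (scalar_map_commute_aK hq hE)⟩

theorem qTr_eq_trp (Z : Matrix (Fin m → Fin n) (Fin m → Fin n) B) :
    qTr q n m Z = trp Z (Dw n m q) := by
  rw [qTr, trp_apply]
  refine Finset.sum_congr rfl fun I _ => ?_
  rw [Finset.sum_eq_single I, Dw, Matrix.diagonal_apply_eq, Algebra.smul_def]
  · intro J _ hJ; rw [Dw, Matrix.diagonal_apply_ne _ hJ.symm, zero_smul]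
  · simp

theorem RLLK.SUpoly_comm (hq : q ≠ 0) (h : RLLK q X Y K) {μ : YoungDiagram} (U : StdTab μ m)
    {E : Matrix (Fin m → Fin n) (Fin m → Fin n) ℂ} (hE : ∀ s ∈ cent n m q, Commute E s) (z : ℂ)
    (i j : Fin n) : Commute ((X * K) i j) (SUpoly q n m U E (X * K) z) := by
  rw [SUpoly, qTr_eq_trp, Matrix.mul_apply]
  exact Commute.sum_left _ _ _ fun k _ =>
    (commute_trp_Dw_X hq (h.prodU_comm hq U hE z).1 i k).mul_left
      (commute_trp_Dw_K hq (h.prodU_comm hq U hE z).2 k j)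

theorem SUpoly_eq {μ : YoungDiagram} (U : StdTab μ m)
    (E : Matrix (Fin m → Fin n) (Fin m → Fin n) ℂ) (L : Matrix (Fin n) (Fin n) B) (z : ℂ) :
    SUpoly q n m U E L z =
      trp (asc (fun k => legBar q n m L k + (z * q ^ (-2 * ctnAt U (k + 1))) • 1) m)
        (E * Dw n m q) := by
  rw [SUpoly, qTr_eq_trp, prodU_eq, trp_map_right]

theorem RLLK.SUpoly_zero (hq : q ≠ 0) (h : RLLK q X Y K) {μ : YoungDiagram} (U : StdTab μ m)
    (E : Matrix (Fin m → Fin n) (Fin m → Fin n) ℂ) :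
    SUpoly q n m U E (X * K) 0 = trp (LLw m X K) (E * Dw n m q) := by
  rw [SUpoly_eq, ← h.asc_legBar hq]
  congr 2
  refine asc_congr fun k _ => ?_
  rw [zero_mul, zero_smul, add_zero]

/-- The span of the elements of degree less than `j`. -/
def Fil (X K : Matrix (Fin n) (Fin n) B) (j : ℕ) : Submodule ℂ B := ⨆ k < j, Msp k X K

theorem Msp_le_Fil {j k : ℕ} (h : k < j) : Msp k X K ≤ Fil X K j :=
  le_iSup₂_of_le k h le_rfl

theorem Fil_mono {j k : ℕ} (h : j ≤ k) : Fil X K j ≤ Fil X K k :=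
  iSup₂_le fun _ hi => Msp_le_Fil (hi.trans_le h)

theorem leg2_algebraMap (C : Matrix (Fin n × Fin n) (Fin n × Fin n) ℂ) (a b : ℕ)
    (I J : Fin m → Fin n) : ∃ c : ℂ, leg2 B n m C a b I J = algebraMap ℂ B c := by
  simp only [leg2]
  split_ifs
  · exact ⟨_, rfl⟩
  · exact ⟨0, (map_zero _).symm⟩
  · exact ⟨0, (map_zero _).symm⟩

theorem legBar_mem_span (L : Matrix (Fin n) (Fin n) B) (k : ℕ) (I J : Fin m → Fin n) :
    legBar q n m L k I J ∈ Submodule.span ℂ {x | ∃ i j, x = L i j} := by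
  induction k generalizing I J with
  | zero =>
    simp only [legBar, leg1]
    split_ifs
    · exact Submodule.subset_span ⟨_, _, rfl⟩
    · exact zero_mem _
    · exact zero_mem _
  | succ k ih =>
    rw [legBar, Matrix.mul_apply]
    refine Submodule.sum_mem _ fun I' _ => ?_
    rw [Matrix.mul_apply]
    obtain ⟨c, hc⟩ := leg2_algebraMap (B := B) (Rcheck q n)⁻¹ k (k + 1) I' J
    rw [RcLegInv, hc, ← Algebra.commutes, ← Algebra.smul_def]
    refine Submodule.smul_mem _ _ (Submodule.sum_mem _ fun J' _ => ?_)
    obtain ⟨c, hc⟩ := leg2_algebraMap (B := B) (Rcheck q n) k (k + 1) I J'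
    rw [RcLeg, hc, ← Algebra.smul_def]
    exact Submodule.smul_mem _ _ (ih _ _)

theorem RLLK.Fil_mul (hq : q ≠ 0) (h : RLLK q X Y K) {j : ℕ} {x y : B} (hx : x ∈ Fil X K j)
    (hy : y ∈ Submodule.span ℂ {x | ∃ i j, x = (X * K) i j}) : x * y ∈ Fil X K (j + 1) := by
  have h1 : ∀ x ∈ Fil X K j, ∀ a b, x * (X * K) a b ∈ Fil X K (j + 1) := by
    intro x hx a b
    have : Fil X K j ≤ (Fil X K (j + 1)).comap (LinearMap.mulRight ℂ ((X * K) a b)) :=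
      iSup₂_le fun k hk x hx => Msp_le_Fil (Nat.succ_lt_succ hk) (h.Msp_mul hq hx a b)
    exact this hx
  have : Submodule.span ℂ {x | ∃ i j, x = (X * K) i j} ≤
      (Fil X K (j + 1)).comap (LinearMap.mulLeft ℂ x) :=
    Submodule.span_le.2 (by rintro _ ⟨a, b, rfl⟩; exact h1 x hx a b)
  exact this hy

theorem mul_mem_Fil (hq : q ≠ 0) (h : RLLK q X Y K) {j : ℕ} {Z : Matrix (Fin m → Fin n) (Fin m → Fin n) B}
    (hZ : ∀ I J, Z I J ∈ Fil X K j) (k : ℕ) (I J : Fin m → Fin n) :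
    (Z * legBar q n m (X * K) k) I J ∈ Fil X K (j + 1) := by
  rw [Matrix.mul_apply]
  exact Submodule.sum_mem _ fun _ _ => h.Fil_mul hq (hZ _ _) (legBar_mem_span _ _ _ _)

theorem RLLK.asc_legBar_mem (hq : q ≠ 0) (h : RLLK q X Y K) (c : ℕ → ℂ) (j : ℕ) :
    (∀ I J, asc (legBar q n m (X * K)) j I J ∈ Fil X K (j + 1)) ∧
    ∀ I J, (asc (fun k => legBar q n m (X * K) k + c k • 1) j -
      asc (legBar q n m (X * K)) j) I J ∈ Fil X K j := by
  induction j with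
  | zero =>
    refine ⟨fun I J => ?_, fun I J => ?_⟩
    · rw [asc, Matrix.one_apply]
      split_ifs
      · exact Msp_le_Fil Nat.zero_lt_one RLLK.one_mem_Msp
      · exact zero_mem _
    · rw [asc, asc, sub_self]; exact zero_mem _
  | succ j ih =>
    obtain ⟨ih1, ih2⟩ := ih
    refine ⟨mul_mem_Fil hq h ih1 _, fun I J => ?_⟩
    have e : ∀ (P Q b : Matrix (Fin m → Fin n) (Fin m → Fin n) B) (c : ℂ),
        P * (b + c • 1) - Q * b = (P - Q) * b + c • (P - Q + Q) := by
      intro P Q b c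
      rw [mul_add, mul_smul_comm, mul_one, sub_add_cancel, sub_mul]
      abel
    rw [asc, asc, e, Matrix.add_apply, Matrix.smul_apply, Matrix.add_apply]
    exact add_mem (mul_mem_Fil hq h ih2 _ _ _)
      (Submodule.smul_mem _ _ (add_mem (Fil_mono (Nat.le_succ j) (ih2 I J)) (ih1 I J)))

theorem RLLK.SUpoly_sub_mem (hq : q ≠ 0) (h : RLLK q X Y K) {μ : YoungDiagram} (U : StdTab μ m)
    (E : Matrix (Fin m → Fin n) (Fin m → Fin n) ℂ) (z : ℂ) :
    SUpoly q n m U E (X * K) z - SUpoly q n m U E (X * K) 0 ∈ Fil X K m := by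
  have h1 := trp_mem (h.asc_legBar_mem hq (fun k => z * q ^ (-2 * ctnAt U (k + 1))) m).2
    (E * Dw n m q)
  rw [h.SUpoly_zero hq, SUpoly_eq, ← h.asc_legBar hq]
  convert h1 using 1
  rw [sub_eq_iff_eq_add, ← trp_add, sub_add_cancel]

theorem RLLK.SUpoly_zero_mem (hq : q ≠ 0) (h : RLLK q X Y K) {μ : YoungDiagram} (U : StdTab μ m)
    (E : Matrix (Fin m → Fin n) (Fin m → Fin n) ℂ) :
    SUpoly q n m U E (X * K) 0 ∈ Msp m X K := ⟨_, (h.SUpoly_zero hq U E).symm⟩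

theorem RLLK.Fil_le (hq : q ≠ 0) (h : RLLK q X Y K) (j : ℕ) :
    Fil X K j ≤ Subalgebra.toSubmodule (Lalg (X * K)) :=
  iSup₂_le fun _ _ => h.Msp_le hq

end Immanants

/-! ### Leading weights of central elements -/

section Leading

variable {n m : ℕ} {q : ℂ} {K : Matrix (Fin n) (Fin n) (Uq q n)}

/-- The element `x` of degree `m` pairs to a trace functional on the commutant whose leading
weight is `ν`. -/
def HasLead (m : ℕ) (K : Matrix (Fin n) (Fin n) (Uq q n)) (x : Uq q n) (ν : Fin n → ℕ) : Prop :=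
  ∃ Y : Matrix (Fin m → Fin n) (Fin m → Fin n) ℂ, x = trp (LLw m (Lp q n) K) (Y * Dw n m q) ∧
    trm Y (wp m ν) ≠ 0 ∧ ∀ κ, trm Y (wp m κ) ≠ 0 → toLex κ ≤ toLex ν

theorem trm_eq_zero_of_trp (hq : q ≠ 0) (hq' : NotRootOfUnity q)
    (hU : RLLK q (Lp q n) (Lm q n) K) {Y : Matrix (Fin m → Fin n) (Fin m → Fin n) ℂ}
    (h : trp (LLw m (Lp q n) K) (Y * Dw n m q) = 0) (ν : Fin n → ℕ) : trm Y (wp m ν) = 0 := by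
  have := (trp_LLw_eq_zero_iff hq hq' hU _).1 h _ (mul_mem Dwi_mem_cent (wp_mem_cent hq ν))
  rwa [mul_assoc, ← mul_assoc (Dw n m q), Dw_mul_Dwi hq, one_mul] at this

theorem HasLead.sub (hq : q ≠ 0) (hq' : NotRootOfUnity q) (hU : RLLK q (Lp q n) (Lm q n) K)
    {x y : Uq q n} {ν : Fin n → ℕ} (hx : HasLead m K x ν) (hy : HasLead m K y ν) :
    ∃ c : ℂ, ∀ κ, HasLead m K (x - c • y) κ → toLex κ < toLex ν := by
  obtain ⟨Y, rfl, hY, hYm⟩ := hx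
  obtain ⟨Y', rfl, hY', hYm'⟩ := hy
  refine ⟨trm Y (wp m ν) / trm Y' (wp m ν), ?_⟩
  rintro κ ⟨W, hW, hWκ, -⟩
  set c := trm Y (wp m ν) / trm Y' (wp m ν) with hc
  have e : ∀ κ, trm (Y - c • Y' - W) (wp m κ) =
      trm Y (wp m κ) - c * trm Y' (wp m κ) - trm W (wp m κ) := by
    intro κ
    simp only [trm_apply, sub_mul, smul_mul_assoc, Matrix.trace_sub, Matrix.trace_smul, smul_eq_mul]
  have h0 := trm_eq_zero_of_trp hq hq' hU (m := m) (Y := Y - c • Y' - W) (by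
    rw [sub_mul, sub_mul, map_sub, map_sub, smul_mul_assoc, map_smul, hW, sub_self])
  have h1 := fun κ => (e κ).symm.trans (h0 κ)
  have h2 := h1 κ
  refine lt_of_le_of_ne ?_ ?_
  · by_contra h3
    have a1 : trm Y (wp m κ) = 0 := by by_contra h4; exact h3 (hYm κ h4)
    have a2 : trm Y' (wp m κ) = 0 := by by_contra h4; exact h3 (hYm' κ h4)
    rw [a1, a2, mul_zero, sub_zero, zero_sub, neg_eq_zero] at h2
    exact hWκ h2
  · intro h3
    obtain rfl : κ = ν := toLex.injective h3
    rw [hc, div_mul_cancel₀ _ hY', sub_self, zero_sub, neg_eq_zero] at h2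
    exact hWκ h2

theorem zero_or_hasLead (hq : q ≠ 0) (hq' : NotRootOfUnity q) (hU : RLLK q (Lp q n) (Lm q n) K)
    {x : Uq q n} (hx : x ∈ Msp m (Lp q n) K) (h : ∀ i j, Commute ((Lp q n * K) i j) x) :
    x = 0 ∨ ∃ ν, Antitone ν ∧ ∑ i, ν i = m ∧ HasLead m K x ν := by
  have hc := commute_lp_K hq hq' hU hx h
  obtain ⟨Y, rfl⟩ := hx
  have hg : ∀ s ∈ opAlg n m q, ∀ t ∈ opAlg n m q,
      trm (Y * Dwi n m q) (s * t) = trm (Y * Dwi n m q) (t * s) := by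
    intro s hs t ht
    rw [opAlg_eq_cent hq hq'] at hs ht
    exact trace_property hq hq'
      (fun i k s hs => trace_bX_of_central hq hq' hU rfl (hU.LLw_comm_bX hq)
        (fun i j => (hc j i).1) i k hs)
      (fun j k s hs => trace_aK_of_central hq hq' hU rfl (hU.LLw_comm_aK hq)
        (fun i j => (hc i j).2) j k hs) hs ht
  by_cases h0 : ∀ s ∈ cent n m q, trm (Y * Dwi n m q) s = 0
  · left
    rw [trp_LLw_eq_zero_iff hq hq' hU]
    intro s hs
    have := h0 _ (mul_mem Dw_mem_cent hs)
    rwa [trm_apply, mul_assoc, ← mul_assoc (Dwi n m q), Dwi_mul_Dw hq, one_mul] at this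
  · right
    push Not at h0
    obtain ⟨s, hs, h0⟩ := h0
    rw [← opAlg_eq_cent hq hq'] at hs
    obtain ⟨ν, hν, hν0, hmax⟩ := exists_antitone hq hq' hg hs h0
    refine ⟨ν, hν, ?_, Y * Dwi n m q, ?_, hν0, hmax⟩
    · by_contra hs
      refine hν0 ?_
      rw [show wp m ν = 0 from ?_, map_zero]
      ext I J
      rw [wp_apply, Matrix.zero_apply, if_neg]
      rintro ⟨-, rfl⟩
      exact hs (sum_cnt I)
    · rw [mul_assoc, Dwi_mul_Dw hq, mul_one]

theorem eq_zero_of_hasLead (hq : q ≠ 0) (hq' : NotRootOfUnity q)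
    (hU : RLLK q (Lp q n) (Lm q n) K) {ι : Type} {s : Finset ι} {x : ι → Uq q n}
    {ν : ι → Fin n → ℕ} (hx : ∀ i ∈ s, HasLead m K (x i) (ν i)) (hν : Set.InjOn ν s) {c : ι → ℂ}
    (h : ∑ i ∈ s, c i • x i = 0) : ∀ i ∈ s, c i = 0 := by
  by_contra! h0
  obtain ⟨i, hi, hci⟩ := h0
  obtain ⟨i, hi, hmax⟩ := (s.filter fun i => c i ≠ 0).exists_max_image (fun i => toLex (ν i))
    ⟨i, Finset.mem_filter.2 ⟨hi, hci⟩⟩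
  obtain ⟨his, hci⟩ := Finset.mem_filter.1 hi
  choose! Y hY hY0 hYm using hx
  have h1 := trm_eq_zero_of_trp hq hq' hU (m := m) (Y := ∑ i ∈ s, c i • Y i) (by
    rw [Finset.sum_mul, map_sum, ← h]
    exact Finset.sum_congr rfl fun i hi => by rw [smul_mul_assoc, map_smul, ← hY i hi]) (ν i)
  rw [trm_apply, Finset.sum_mul, Matrix.trace_sum, Finset.sum_eq_single i] at h1
  · rw [smul_mul_assoc, Matrix.trace_smul, smul_eq_mul] at h1
    exact (mul_ne_zero hci (hY0 i his)) h1
  · intro j hj hji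
    rw [smul_mul_assoc, Matrix.trace_smul, smul_eq_mul]
    by_contra h2
    have h3 : c j ≠ 0 := left_ne_zero_of_mul h2
    have h4 := hYm j hj _ (right_ne_zero_of_mul h2)
    exact hji (hν hj his (toLex.injective
      (le_antisymm (hmax j (Finset.mem_filter.2 ⟨hj, h3⟩)) h4)))
  · exact fun h => (h his).elim

theorem rowW_injective : Function.Injective fun μ : ParIdx n => rowW n μ.1 := by
  intro μ μ' h
  refine Subtype.ext (YoungDiagram.ext (Finset.ext fun c => ?_))
  by_cases hc : c.1 < n
  · have := congrFun h ⟨c.1, hc⟩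
    simp only [rowW] at this
    exact (YoungDiagram.mem_iff_lt_rowLen (i := c.1) (j := c.2)).trans
      (this ▸ (YoungDiagram.mem_iff_lt_rowLen (i := c.1) (j := c.2)).symm)
  · exact iff_of_false (fun h => hc (μ.2 c h)) fun h => hc (μ'.2 c h)

theorem sum_rowW (μ : ParIdx n) : ∑ i, rowW n μ.1 i = μ.1.cells.card := by
  rw [Finset.card_eq_sum_card_fiberwise (f := Prod.fst) (t := Finset.range n)
    fun c hc => Finset.mem_coe.2 (Finset.mem_range.2 (μ.2 c hc)), Finset.sum_range]
  exact Finset.sum_congr rfl fun i _ => μ.1.rowLen_eq_card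

theorem exists_rowW {ν : Fin n → ℕ} (hν : Antitone ν) : ∃ μ : ParIdx n, rowW n μ.1 = ν := by
  have hs : (List.ofFn ν).SortedGE := List.sortedGE_ofFn_iff.2 hν
  refine ⟨⟨YoungDiagram.ofRowLens _ hs, fun c hc => ?_⟩, funext fun i => ?_⟩
  · obtain ⟨h, -⟩ := YoungDiagram.mem_ofRowLens.1 ((YoungDiagram.mem_cells _).1 hc)
    rwa [List.length_ofFn] at h
  · have := YoungDiagram.rowLen_ofRowLens (hw := hs) ⟨i, by rw [List.length_ofFn]; exact i.2⟩
    rw [rowW, this]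
    simp

variable {S : ParIdx n → Uq q n}

theorem mem_span_of_homogeneous (hq : q ≠ 0) (hq' : NotRootOfUnity q)
    (hU : RLLK q (Lp q n) (Lm q n) K) (hS : ∀ μ, S μ ∈ Msp μ.1.cells.card (Lp q n) K)
    (hSc : ∀ μ i j, Commute ((Lp q n * K) i j) (S μ))
    (hSl : ∀ μ, HasLead μ.1.cells.card K (S μ) (rowW n μ.1)) {x : Uq q n}
    (hx : x ∈ Msp m (Lp q n) K) (h : ∀ i j, Commute ((Lp q n * K) i j) x) :
    x ∈ Submodule.span ℂ (S '' {μ | μ.1.cells.card = m}) := by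
  have key : ∀ (N : Lex (Fin n → ℕ)) (x : Uq q n), x ∈ Msp m (Lp q n) K →
      (∀ i j, Commute ((Lp q n * K) i j) x) → ∀ ν, toLex ν = N → Antitone ν → ∑ i, ν i = m →
      HasLead m K x ν → x ∈ Submodule.span ℂ (S '' {μ | μ.1.cells.card = m}) := by
    intro N
    induction N using WellFoundedLT.induction with
    | ind N ih =>
      rintro x hx h ν rfl hν hm hl
      obtain ⟨μ, rfl⟩ := exists_rowW hν
      rw [sum_rowW] at hm
      subst hm
      obtain ⟨c, hc⟩ := hl.sub hq hq' hU (hSl μ)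
      rw [← sub_add_cancel x (c • S μ)]
      refine add_mem ?_ (Submodule.smul_mem _ _ (Submodule.subset_span ⟨μ, rfl, rfl⟩))
      have hx' := sub_mem hx (Submodule.smul_mem _ c (hS μ))
      have h' : ∀ i j, Commute ((Lp q n * K) i j) (x - c • S μ) := fun i j =>
        (h i j).sub_right ((hSc μ i j).smul_right c)
      rcases zero_or_hasLead hq hq' hU hx' h' with h0 | ⟨κ, hκ, hs, hl'⟩
      · rw [h0]; exact zero_mem _
      · exact ih _ (hc κ hl') _ hx' h' κ rfl hκ hs hl'
  rcases zero_or_hasLead hq hq' hU hx h with rfl | ⟨κ, hκ, hs, hl'⟩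
  · exact zero_mem _
  · exact key _ x hx h κ rfl hκ hs hl'

theorem four_pow_injective (k : ℕ) : Function.Injective fun m : ℕ => (4 : ℂ) ^ (m + k) := by
  intro a b h
  beta_reduce at h
  have h' : (4 : ℕ) ^ (a + k) = 4 ^ (b + k) := by exact_mod_cast h
  simpa using Nat.pow_right_injective (le_refl 2 |>.trans (by norm_num)) h'

theorem RLLK.iSupIndep_Msp (hq : q ≠ 0) (hU : RLLK q (Lp q n) (Lm q n) K) :
    iSupIndep fun m => Msp m (Lp q n) K := by
  obtain ⟨f, hf⟩ := exists_gamma hU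
  refine ((Module.End.eigenspaces_iSupIndep (f : Uq q n →ₗ[ℂ] Uq q n)).comp (four_pow_injective 0)).mono
    fun m x hx => Module.End.mem_eigenspace_iff.2 ?_
  exact hU.map_Msp hq hf hx

/-- The homogeneous components of a central element are central. -/
theorem exists_homogeneous (hq : q ≠ 0) (hU : RLLK q (Lp q n) (Lm q n) K)
    {P : ℕ → Submodule ℂ (Uq q n)} (hP : ∀ m, P m ≤ Msp m (Lp q n) K) {x : Uq q n}
    (hx : x ∈ ⨆ m, P m) (h : ∀ i j, Commute ((Lp q n * K) i j) x) :
    ∃ g : ℕ →₀ Uq q n, (∀ m, g m ∈ P m) ∧ (∀ m i j, Commute ((Lp q n * K) i j) (g m)) ∧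
      g.sum (fun _ y => y) = x := by
  obtain ⟨g, hg, rfl⟩ := (Submodule.mem_iSup_iff_exists_finsupp P x).1 hx
  refine ⟨g, hg, fun m i j => ?_, rfl⟩
  obtain ⟨f, hf⟩ := exists_gamma hU
  have hind := (Module.End.eigenspaces_iSupIndep (f : Uq q n →ₗ[ℂ] Uq q n)).comp (four_pow_injective 1)
  rw [iSupIndep_iff_finsetSum_eq_zero_imp_eq_zero] at hind
  by_cases hm : m ∈ g.support
  · refine sub_eq_zero.1 (hind g.support
      (fun m => (Lp q n * K) i j * g m - g m * (Lp q n * K) i j) (fun m _ => ?_) ?_ m hm)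
    · refine Module.End.mem_eigenspace_iff.2 ?_
      have e : f ((Lp q n * K) i j) = (4 : ℂ) • (Lp q n * K) i j := congrFun (congrFun hf i) j
      change f _ = _
      rw [map_sub, map_mul, map_mul, hU.map_Msp hq hf (hP m (hg m)), e, smul_mul_smul_comm,
        smul_mul_smul_comm, ← pow_succ, ← pow_succ', smul_sub]
    · rw [Finset.sum_sub_distrib, ← Finset.mul_sum, ← Finset.sum_mul]
      exact sub_eq_zero.2 (h i j)
  · rw [Finsupp.notMem_support_iff.1 hm]; exact Commute.zero_right _

theorem disjoint_Msp_Fil (hq : q ≠ 0) (hU : RLLK q (Lp q n) (Lm q n) K) (m : ℕ) :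
    Disjoint (Msp m (Lp q n) K) (Fil (Lp q n) K m) :=
  (hU.iSupIndep_Msp hq m).mono_right (iSup₂_le fun k hk => le_iSup₂_of_le k hk.ne le_rfl)

variable {S' : ParIdx n → Uq q n}

theorem linearIndependent_of_leading (hq : q ≠ 0) (hq' : NotRootOfUnity q)
    (hU : RLLK q (Lp q n) (Lm q n) K) (hS : ∀ μ, S μ ∈ Msp μ.1.cells.card (Lp q n) K)
    (hSl : ∀ μ, HasLead μ.1.cells.card K (S μ) (rowW n μ.1))
    (hS' : ∀ μ, S' μ - S μ ∈ Fil (Lp q n) K μ.1.cells.card) : LinearIndependent ℂ S' := by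
  rw [linearIndependent_iff']
  intro s c h
  by_contra! h0
  obtain ⟨μ, hμ, hcμ⟩ := h0
  obtain ⟨μ, hμ, hmax⟩ := (s.filter fun μ => c μ ≠ 0).exists_max_image (fun μ => μ.1.cells.card)
    ⟨μ, Finset.mem_filter.2 ⟨hμ, hcμ⟩⟩
  obtain ⟨hμs, hcμ⟩ := Finset.mem_filter.1 hμ
  set m := μ.1.cells.card
  set t := s.filter fun κ => κ.1.cells.card = m
  have h1 : ∑ κ ∈ t, c κ • S κ ∈ Msp m (Lp q n) K :=
    Submodule.sum_mem _ fun κ hκ => Submodule.smul_mem _ _ ((Finset.mem_filter.1 hκ).2 ▸ hS κ)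
  have h2 : ∑ κ ∈ t, c κ • S κ ∈ Fil (Lp q n) K m := by
    have e : ∑ κ ∈ s, (c κ • S' κ - if κ.1.cells.card = m then c κ • S κ else 0) =
        -∑ κ ∈ t, c κ • S κ := by
      rw [Finset.sum_sub_distrib, h, zero_sub, ← Finset.sum_filter]
    rw [← neg_mem_iff, ← e]
    refine Submodule.sum_mem _ fun κ hκ => ?_
    split_ifs with hκm
    · convert Submodule.smul_mem (Fil (Lp q n) K m) (c κ) (hκm ▸ hS' κ) using 1
      exact (smul_sub (c κ) (S' κ) (S κ)).symm
    · rw [sub_zero]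
      by_cases hcκ : c κ = 0
      · rw [hcκ, zero_smul]; exact zero_mem _
      · have hlt := lt_of_le_of_ne (hmax κ (Finset.mem_filter.2 ⟨hκ, hcκ⟩)) hκm
        rw [← sub_add_cancel (S' κ) (S κ)]
        exact Submodule.smul_mem _ _
          (add_mem (Fil_mono hlt.le (hS' κ)) (Msp_le_Fil hlt (hS κ)))
  have h3 := Submodule.disjoint_def.1 (disjoint_Msp_Fil hq hU m) _ h1 h2
  exact hcμ (eq_zero_of_hasLead hq hq' hU (m := m) (fun κ hκ => (Finset.mem_filter.1 hκ).2 ▸ hSl κ)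
    rowW_injective.injOn h3 μ (Finset.mem_filter.2 ⟨hμs, rfl⟩))

theorem mem_span_of_mem_Fil (hq : q ≠ 0) (hq' : NotRootOfUnity q)
    (hU : RLLK q (Lp q n) (Lm q n) K) (hS : ∀ μ, S μ ∈ Msp μ.1.cells.card (Lp q n) K)
    (hSc : ∀ μ i j, Commute ((Lp q n * K) i j) (S μ))
    (hSc' : ∀ μ i j, Commute ((Lp q n * K) i j) (S' μ))
    (hSl : ∀ μ, HasLead μ.1.cells.card K (S μ) (rowW n μ.1))
    (hS' : ∀ μ, S' μ - S μ ∈ Fil (Lp q n) K μ.1.cells.card) (N : ℕ) {x : Uq q n}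
    (hx : x ∈ Fil (Lp q n) K N) (h : ∀ i j, Commute ((Lp q n * K) i j) x) :
    x ∈ Submodule.span ℂ (Set.range S') := by
  induction N using Nat.strong_induction_on generalizing x with
  | _ N ih =>
    obtain ⟨g, hg, hgc, rfl⟩ := exists_homogeneous hq hU
      (P := fun k => ⨆ _ : k < N, Msp k (Lp q n) K) (fun k => iSup_le fun _ => le_rfl) hx h
    refine Submodule.sum_mem _ fun k _ => ?_
    by_cases hk : k < N
    · have hgk := hg k
      simp only [hk, iSup_pos] at hgk
      refine Submodule.span_le.2 ?_ (mem_span_of_homogeneous hq hq' hU hS hSc hSl hgk (hgc k))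
      rintro _ ⟨μ, rfl, rfl⟩
      rw [SetLike.mem_coe, ← sub_sub_cancel (S' μ) (S μ)]
      exact sub_mem (Submodule.subset_span ⟨μ, rfl⟩)
        (ih _ hk (hS' μ) fun i j => (hSc' μ i j).sub_right (hSc μ i j))
    · have hgk := hg k
      simp only [hk, iSup_neg, not_false_eq_true, Submodule.mem_bot] at hgk
      simp only [hgk]
      exact zero_mem _

theorem mem_center_iff {L : Matrix (Fin n) (Fin n) (Uq q n)} {x : Uq q n} :
    x ∈ Lalg L ⊓ Subalgebra.centralizer ℂ (Lalg L : Set (Uq q n)) ↔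
      x ∈ Lalg L ∧ ∀ i j, Commute (L i j) x := by
  refine and_congr_right fun _ => ⟨fun h i j => ?_, fun h => ?_⟩
  · exact Subalgebra.mem_centralizer_iff ℂ |>.1 h _ (mem_Lalg L i j)
  · refine (Subalgebra.mem_centralizer_iff ℂ).2 fun y hy => ?_
    have : Lalg L ≤ Subalgebra.centralizer ℂ {x} :=
      Algebra.adjoin_le (by
        rintro _ ⟨i, j, rfl⟩
        refine (Subalgebra.mem_centralizer_iff ℂ).2 ?_
        rintro _ rfl
        exact (h i j).symm)
    exact ((Subalgebra.mem_centralizer_iff ℂ).1 (this hy) x rfl).symm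

end Leading

/-- for each fixed `z ∈ ℂ`, the elements `S_μ(z)` (in particular the
q-immanants `S_μ = S_μ(0)`), with `μ` running over the Young diagrams with at most `n`
rows, form a basis of the center of the subalgebra `U°_q(gl_n)` generated by the entries
of `L`. -/
theorem qimmanants_basis_of_center (n : ℕ) (hn : 1 ≤ n) (q : ℂ) (hq : q ≠ 0)
    (hq' : NotRootOfUnity q)
    (K : Matrix (Fin n) (Fin n) (Uq q n)) (hK1 : Lm q n * K = 1) (hK2 : K * Lm q n = 1)
    (φ : ∀ m : ℕ, Hecke q m →ₐ[ℂ] Matrix (Fin m → Fin n) (Fin m → Fin n) ℂ)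
    (hφ : ∀ m : ℕ, IsHeckeRep q n m (φ m))
    (T : ∀ μ : ParIdx n, StdTab μ.1 μ.1.cells.card)
    (e : ∀ μ : ParIdx n, Hecke q μ.1.cells.card)
    (he : ∀ μ : ParIdx n, IsJMIdem q μ.1.cells.card (T μ) (e μ))
    (z : ℂ) :
    LinearIndependent ℂ (fun μ : ParIdx n =>
        SUpoly q n μ.1.cells.card (T μ) (φ μ.1.cells.card (e μ)) (Lmat q n K) z) ∧
    Submodule.span ℂ (Set.range fun μ : ParIdx n =>
        SUpoly q n μ.1.cells.card (T μ) (φ μ.1.cells.card (e μ)) (Lmat q n K) z) =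
      Subalgebra.toSubmodule
        (Algebra.adjoin ℂ {x : Uq q n | ∃ i j, x = Lmat q n K i j} ⊓
          Subalgebra.centralizer ℂ
            ((Algebra.adjoin ℂ {x : Uq q n | ∃ i j, x = Lmat q n K i j} : Subalgebra ℂ (Uq q n)) :
              Set (Uq q n))) := by
  have hU : RLLK q (Lp q n) (Lm q n) K := { RLL_U q n with inv := hK1, inv' := hK2 }
  have hφ' : ∀ m, ∀ k < m - 1, φ m (Tn q m k) = Tw n m q ℂ k := fun m k hk =>
    (hφ m k hk).trans (RcLeg_eq (by omega))
  have hE := fun μ : ParIdx n => fun s hs =>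
    commute_rep (n := n) (hφ' μ.1.cells.card) (e μ) (s := s) hs
  have hS := fun μ => hU.SUpoly_zero_mem hq (T μ) (φ _ (e μ))
  have hS' := fun μ => hU.SUpoly_sub_mem hq (T μ) (φ _ (e μ)) z
  have hSc := fun μ => hU.SUpoly_comm hq (T μ) (hE μ) 0
  have hSc' := fun μ => hU.SUpoly_comm hq (T μ) (hE μ) z
  have hSl : ∀ μ : ParIdx n, HasLead μ.1.cells.card K
      (SUpoly q n μ.1.cells.card (T μ) (φ _ (e μ)) (Lp q n * K) 0) (rowW n μ.1) := fun μ =>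
    have hw := JMIdem_weights hq hq' (hφ' _) (he μ) (rep_ne_zero hq hq' (hφ' _) (he μ) μ.2)
    ⟨φ _ (e μ), hU.SUpoly_zero hq (T μ) _, hw.1, hw.2.1⟩
  refine ⟨linearIndependent_of_leading hq hq' hU hS hSl hS', le_antisymm ?_ fun x hx => ?_⟩
  · rw [Submodule.span_le]
    rintro _ ⟨μ, rfl⟩
    refine mem_center_iff.2 ⟨?_, hSc' μ⟩
    have h := add_mem (hU.Fil_le hq _ (hS' μ))
      (hU.Fil_le hq _ (Msp_le_Fil (Nat.lt_succ_self _) (hS μ)))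
    rwa [sub_add_cancel] at h
  · obtain ⟨hxL, hxc⟩ := mem_center_iff.1 hx
    obtain ⟨g, hg, hgc, rfl⟩ := exists_homogeneous hq hU (fun m => le_rfl)
      ((hU.Lalg_eq_iSup hq).le hxL) hxc
    exact Submodule.sum_mem _ fun k _ => mem_span_of_mem_Fil hq hq' hU hS hSc hSc' hSl hS' (k + 1)
      (Msp_le_Fil k.lt_succ_self (hg k)) (hgc k)

end QImm
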